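/- For all integers n ≥ 1 and g ≥ 0, the Lusternik–Schnirelmann category of the n-th symmetric product of the closed orientable surface of genus g is cat(SP^n(M_g)) = 2n if n ≤ g, and cat(SP^n(M_g)) = n + g if n > g. -/

import Mathlib

open scoped unitInterval Topology
open MeasureTheory
noncomputable section

/-- The `n`-th symmetric product relation on `X^n`: two tuples are related iff they
differ by a permutation of coordinates. -/
def spRel (n : ℕ) (X : Type*) (s t : Fin n → X) : Prop :=
  ∃ e : Equiv.Perm (Fin n), s ∘ e = t

/-- The `n`-th symmetric product of a topological space `X`: the quotient of the
product space `X^n` by the permutation action of the symmetric group `S_n`,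
equipped with the quotient topology. -/
def SP (n : ℕ) (X : Type*) [TopologicalSpace X] : Type _ :=
  Quot (spRel n X)

instance (n : ℕ) (X : Type*) [TopologicalSpace X] : TopologicalSpace (SP n X) :=
  inferInstanceAs (TopologicalSpace (Quot (spRel n X)))

/-- The inclusion of a subset, as a continuous map. -/
def inclMap {X : Type*} [TopologicalSpace X] (U : Set X) : C(U, X) :=
  ⟨Subtype.val, continuous_subtype_val⟩

/-- `catLE X r` : `X` is covered by `r+1` open sets, each of whose inclusion maps
into `X` is null-homotopic. -/
def catLE (X : Type*) [TopologicalSpace X] (r : ℕ) : Prop :=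
  ∃ U : Fin (r + 1) → Set X, (∀ i, IsOpen (U i)) ∧ (⋃ i, U i) = Set.univ ∧
    ∀ i, (inclMap (U i)).Nullhomotopic

/-- The Lusternik–Schnirelmann category of `X`, valued in `ℕ∞`. -/
def LScat (X : Type*) [TopologicalSpace X] : ℕ∞ :=
  sInf {c : ℕ∞ | ∃ r : ℕ, catLE X r ∧ c = r}

/-- The closed unit disc (a topological model for a polygon). -/
abbrev Disc : Type := {z : ℂ // ‖z‖ ≤ 1}

/-- The point at parameter `t ∈ [0,1]` on the `k`-th of the `N` boundary edges of an
`N`-gon, realized as the closed unit disc whose boundary circle is divided into `N` arcs. -/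
def polyBP (N k : ℕ) (t : ℝ) : ℂ :=
  Complex.exp (2 * Real.pi * Complex.I * (((k : ℝ) + t) / (N : ℝ)))

/-- Boundary identifications of the `4g`-gon for the edge word
`[a₁,b₁]⋯[a_g,b_g] = a₁b₁a₁⁻¹b₁⁻¹⋯a_gb_ga_g⁻¹b_g⁻¹` : the point at parameter `t`
on edge `4j+r` (`r = 0,1`) is glued to the point at parameter `1-t` on edge `4j+r+2`. -/
def orientRel (g : ℕ) (z w : Disc) : Prop :=
  ∃ j : Fin g, ∃ r : Fin 2, ∃ t : ℝ, 0 ≤ t ∧ t ≤ 1 ∧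
    (z : ℂ) = polyBP (4 * g) (4 * (j : ℕ) + (r : ℕ)) t ∧
    (w : ℂ) = polyBP (4 * g) (4 * (j : ℕ) + (r : ℕ) + 2) (1 - t)

/-- The closed orientable surface of genus `g` : the `2`-sphere for `g = 0`, and for
`g ≥ 1` the quotient of the `4g`-gon by the boundary edge word `[a₁,b₁]⋯[a_g,b_g]`. -/
def Mg : ℕ → Type
  | 0 => Metric.sphere (0 : EuclideanSpace ℝ (Fin 3)) 1
  | (g + 1) => Quot (orientRel (g + 1))

instance (g : ℕ) : TopologicalSpace (Mg g) := by
  cases g with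
  | zero =>
      exact inferInstanceAs (TopologicalSpace (Metric.sphere (0 : EuclideanSpace ℝ (Fin 3)) 1))
  | succ g => exact inferInstanceAs (TopologicalSpace (Quot (orientRel (g + 1))))

open scoped unitInterval Topology
open MeasureTheory
noncomputable section
namespace SPcat

section cochains
variable {Y : Type*}

/-- face of a sequence: delete the `l`-th entry. -/
def fc (l : ℕ) (x : ℕ → Y) : ℕ → Y := fun i => if i < l then x i else x (i + 1)

/-- shift of a sequence -/
def sh (p : ℕ) (x : ℕ → Y) : ℕ → Y := fun i => x (i + p)

/-- coboundary of a degree `p` cochain. -/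
def dl (p : ℕ) (f : (ℕ → Y) → ℝ) : (ℕ → Y) → ℝ := fun x =>
  ∑ l ∈ Finset.range (p + 2), (-1 : ℝ) ^ l * f (fc l x)

/-- cup product, first factor of degree `p`. -/
def cup (p : ℕ) (f g : (ℕ → Y) → ℝ) : (ℕ → Y) → ℝ := fun x => f x * g (sh p x)

/-- `f` only depends on the first `p+1` entries. -/
def IsDeg (p : ℕ) (f : (ℕ → Y) → ℝ) : Prop :=
  ∀ x y : ℕ → Y, (∀ i, i ≤ p → x i = y i) → f x = f y

lemma sh_fc_le {l p : ℕ} (h : l ≤ p) (x : ℕ → Y) : sh p (fc l x) = sh (p + 1) x := by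
  funext i
  simp only [sh, fc]
  rw [if_neg (by omega)]
  congr 1

lemma sh_fc_ge {l p : ℕ} (x : ℕ → Y) : sh p (fc (p + l) x) = fc l (sh p x) := by
  funext i
  simp only [sh, fc]
  by_cases h : i < l
  · rw [if_pos (by omega), if_pos h]
  · rw [if_neg (by omega), if_neg h]; congr 1; omega

lemma IsDeg.fc_ge {p : ℕ} {f : (ℕ → Y) → ℝ} (hf : IsDeg p f) {l : ℕ} (h : p + 1 ≤ l)
    (x : ℕ → Y) : f (fc l x) = f x := by
  apply hf; intro i hi; simp only [fc]; rw [if_pos (by omega)]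

lemma fc_zero (x : ℕ → Y) : fc 0 x = sh 1 x := by
  funext i; simp [fc, sh]

lemma sh_sh (p q : ℕ) (x : ℕ → Y) : sh q (sh p x) = sh (p + q) x := by
  funext i; simp only [sh]; congr 1; omega

lemma leibniz {p q : ℕ} {f g : (ℕ → Y) → ℝ} (hf : IsDeg p f) (x : ℕ → Y) :
    dl (p + q) (cup p f g) x = cup (p + 1) (dl p f) g x + (-1) ^ p * cup p f (dl q g) x := by
  have h1 : dl (p + q) (cup p f g) x
      = ∑ l ∈ Finset.range (p + 1), (-1 : ℝ) ^ l * (f (fc l x) * g (sh (p + 1) x))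
        + ∑ l ∈ Finset.range (q + 1), (-1 : ℝ) ^ (p + 1 + l) * (f x * g (fc (l + 1) (sh p x))) := by
    unfold dl cup
    rw [show p + q + 2 = (p + 1) + (q + 1) by ring, Finset.sum_range_add]
    congr 1
    · apply Finset.sum_congr rfl
      intro l hl
      rw [sh_fc_le (by have := Finset.mem_range.1 hl; omega)]
    · apply Finset.sum_congr rfl
      intro l hl
      rw [hf.fc_ge (by omega), show p + 1 + l = p + (l + 1) by ring, sh_fc_ge]
  rw [h1]
  unfold cup dl
  rw [show p + 2 = (p + 1) + 1 by ring, Finset.sum_range_succ _ (p + 1), hf.fc_ge le_rfl,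
    show q + 2 = (q + 1) + 1 by ring, Finset.sum_range_succ' _ (q + 1), fc_zero, sh_sh]
  rw [add_mul, Finset.sum_mul, mul_add, mul_add, Finset.mul_sum, Finset.mul_sum]
  have e1 : ∑ l ∈ Finset.range (p + 1), (-1 : ℝ) ^ l * (f (fc l x) * g (sh (p + 1) x))
      = ∑ i ∈ Finset.range (p + 1), (-1 : ℝ) ^ i * f (fc i x) * g (sh (p + 1) x) :=
    Finset.sum_congr rfl fun l _ => by ring
  have e2 : ∑ l ∈ Finset.range (q + 1), (-1 : ℝ) ^ (p + 1 + l) * (f x * g (fc (l + 1) (sh p x)))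
      = ∑ i ∈ Finset.range (q + 1), (-1 : ℝ) ^ p * (f x * ((-1) ^ (i + 1) * g (fc (i + 1) (sh p x)))) :=
    Finset.sum_congr rfl fun l _ => by ring
  rw [e1, e2]
  ring

lemma cup_assoc (p q : ℕ) (f g h : (ℕ → Y) → ℝ) :
    cup p f (cup q g h) = cup (p + q) (cup p f g) h := by
  funext x; simp only [cup, sh_sh]; ring

lemma IsDeg.cup {p q : ℕ} {f g : (ℕ → Y) → ℝ} (hf : IsDeg p f) (hg : IsDeg q g) :
    IsDeg (p + q) (cup p f g) := by
  intro x y h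
  simp only [SPcat.cup]
  rw [hf x y fun i hi => h i (by omega), hg (sh p x) (sh p y) fun i hi => h (i + p) (by omega)]

lemma IsDeg.dl {p : ℕ} {f : (ℕ → Y) → ℝ} (hf : IsDeg p f) : IsDeg (p + 1) (dl p f) := by
  intro x y h
  simp only [SPcat.dl]
  apply Finset.sum_congr rfl
  intro l _
  congr 1
  apply hf
  intro i hi
  simp only [fc]
  split_ifs
  · exact h i (by omega)
  · exact h _ (by omega)

/-- a cohomology class with two representatives on small simplices -/
structure Cls (Y : Type*) where
  deg : ℕ
  x : (ℕ → Y) → ℝ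
  x' : (ℕ → Y) → ℝ
  b : (ℕ → Y) → ℝ

/-- validity of a class on a set of sequences -/
structure Cls.Valid (c : Cls Y) (S : Set (ℕ → Y)) : Prop where
  dx : IsDeg (c.deg + 1) c.x
  dx' : IsDeg (c.deg + 1) c.x'
  db : IsDeg c.deg c.b
  cx : ∀ s ∈ S, dl (c.deg + 1) c.x s = 0
  cx' : ∀ s ∈ S, dl (c.deg + 1) c.x' s = 0
  cob : ∀ s ∈ S, c.x s = c.x' s + dl c.deg c.b s

/-- product of the first representatives -/
def prodX : List (Cls Y) → (ℕ → Y) → ℝ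
  | [] => fun _ => 1
  | c :: l => cup (c.deg + 1) c.x (prodX l)

/-- product of the second representatives -/
def prodX' : List (Cls Y) → (ℕ → Y) → ℝ
  | [] => fun _ => 1
  | c :: l => cup (c.deg + 1) c.x' (prodX' l)

/-- total degree -/
def totDeg : List (Cls Y) → ℕ
  | [] => 0
  | c :: l => (c.deg + 1) + totDeg l

lemma dl_one (s : ℕ → Y) : dl 0 (fun _ : ℕ → Y => (1 : ℝ)) s = 0 := by
  simp [dl, Finset.sum_range_succ]

lemma prodX_deg {S : Set (ℕ → Y)} : ∀ l : List (Cls Y), (∀ c ∈ l, c.Valid S) →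
    IsDeg (totDeg l) (prodX l)
  | [], _ => fun _ _ _ => rfl
  | c :: l, h => by
      have h1 := (h c (by simp)).dx
      exact h1.cup (prodX_deg l fun c hc => h c (by simp [hc]))

lemma prodX_coc {S : Set (ℕ → Y)} (hS : ∀ s ∈ S, ∀ ρ : ℕ → ℕ, s ∘ ρ ∈ S) :
    ∀ l : List (Cls Y), (∀ c ∈ l, c.Valid S) → ∀ s ∈ S, dl (totDeg l) (prodX l) s = 0
  | [], _, s, _ => dl_one s
  | c :: l, h, s, hs => by
      have h1 := (h c (by simp))
      have ih := prodX_coc hS l fun c hc => h c (by simp [hc])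
      have := leibniz (q := totDeg l) (g := prodX l) h1.dx s
      simp only [totDeg, prodX]
      rw [this]
      simp only [cup]
      rw [h1.cx s hs, ih (sh _ s) (hS s hs fun i => i + _)]
      ring

theorem exchange {S : Set (ℕ → Y)} (hS : ∀ s ∈ S, ∀ ρ : ℕ → ℕ, s ∘ ρ ∈ S) (d : ℕ)
    (J : ((ℕ → Y) → ℝ) → ℝ) (Jc : ∀ f f', (∀ s ∈ S, f s = f' s) → J f = J f')
    (Jadd : ∀ f f', J (fun s => f s + f' s) = J f + J f')
    (Jsmul : ∀ (a : ℝ) f, J (fun s => a * f s) = a * J f)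
    (Jst : ∀ f, IsDeg d f → J (dl d f) = 0) :
    ∀ (l : List (Cls Y)) (p : ℕ) (R : (ℕ → Y) → ℝ), (∀ c ∈ l, c.Valid S) → IsDeg p R →
      (∀ s ∈ S, dl p R s = 0) → p + totDeg l = d + 1 →
      J (cup p R (prodX l)) = J (cup p R (prodX' l))
  | [], p, R, _, _, _, _ => rfl
  | c :: l, p, R, h, hR, cR, hd => by
      have hc := h c (by simp)
      have hl : ∀ c ∈ l, c.Valid S := fun c hc => h c (by simp [hc])
      have ih := exchange hS d J Jc Jadd Jsmul Jst l (p + (c.deg + 1)) (cup p R c.x') hl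
        (hR.cup hc.dx') (by
          intro s hs
          rw [leibniz hR]
          simp only [cup]
          rw [cR s hs, hc.cx' (sh _ s) (hS s hs fun i => i + _)]
          ring) (by simp only [totDeg] at hd; omega)
      have e2 : J (cup p R (prodX' (c :: l))) = J (cup (p + (c.deg + 1)) (cup p R c.x') (prodX' l)) := by
        simp only [prodX']; rw [cup_assoc]
      rw [e2, ← ih, ← cup_assoc]
      simp only [prodX]
      have key : ∀ s ∈ S, cup p R (cup (c.deg + 1) c.x (prodX l)) s =
          cup p R (cup (c.deg + 1) c.x' (prodX l)) s +
            (-1 : ℝ) ^ p * dl d (cup p R (cup c.deg c.b (prodX l))) s := by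
        intro s hs
        have hs1 : sh p s ∈ S := hS s hs fun i => i + _
        have hdd : d = p + (c.deg + totDeg l) := by simp only [totDeg] at hd; omega
        rw [hdd, leibniz hR]
        simp only [cup]
        rw [cR s hs]
        have h2 := leibniz (q := totDeg l) (g := prodX l) hc.db (sh p s)
        rw [h2]
        simp only [cup]
        rw [prodX_coc hS l hl (sh _ (sh p s)) (hS _ hs1 fun i => i + _), hc.cob _ hs1]
        have : ((-1 : ℝ) ^ p) * (-1) ^ p = 1 := by rw [← mul_pow]; simp
        linear_combination (-(R s * (dl c.deg c.b (sh p s) * prodX l (sh (c.deg + 1) (sh p s))))) * this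
      rw [Jc _ _ key, Jadd, Jsmul, Jst]
      · ring
      · have hdd : d = p + (c.deg + totDeg l) := by simp only [totDeg] at hd; omega
        rw [hdd]
        exact hR.cup (hc.db.cup (prodX_deg l hl))

theorem exchange_zero {S : Set (ℕ → Y)} (hS : ∀ s ∈ S, ∀ ρ : ℕ → ℕ, s ∘ ρ ∈ S) (d : ℕ)
    (J : ((ℕ → Y) → ℝ) → ℝ) (Jc : ∀ f f', (∀ s ∈ S, f s = f' s) → J f = J f')
    (Jadd : ∀ f f', J (fun s => f s + f' s) = J f + J f')
    (Jsmul : ∀ (a : ℝ) f, J (fun s => a * f s) = a * J f)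
    (Jst : ∀ f, IsDeg d f → J (dl d f) = 0)
    (l : List (Cls Y)) (hl : ∀ c ∈ l, c.Valid S) (hd : totDeg l = d + 1)
    (hv : ∀ s ∈ S, ∃ c ∈ l, ∀ ρ : ℕ → ℕ, c.x' (s ∘ ρ) = 0) : J (prodX l) = 0 := by
  have h := exchange hS d J Jc Jadd Jsmul Jst l 0 (fun _ => 1) hl (fun _ _ _ => rfl)
    (fun s _ => dl_one s) (by omega)
  have e : ∀ g : (ℕ → Y) → ℝ, cup 0 (fun _ => 1) g = g := by
    intro g; funext x; simp only [cup, one_mul]; rfl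
  rw [e, e] at h
  rw [h]
  have hz : ∀ (l : List (Cls Y)) (s : ℕ → Y), (∃ c ∈ l, ∀ ρ : ℕ → ℕ, c.x' (s ∘ ρ) = 0) →
      prodX' l s = 0 := by
    intro l
    induction l with
    | nil => rintro s ⟨c, hc, _⟩; simp at hc
    | cons a l ih =>
      rintro s ⟨c, hc, h⟩
      simp only [prodX', cup]
      rcases List.mem_cons.1 hc with rfl | hc
      · have := h id
        simp only [Function.comp_id] at this
        rw [this, zero_mul]
      · rw [ih (sh _ s) ⟨c, hc, fun ρ => h (fun i => ρ i + _)⟩, mul_zero]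
  rw [Jc _ (fun s => 0 * (0 : ℝ)) (fun s hs => by rw [hz l s (hv s hs)]; ring)]
  rw [Jsmul 0 (fun _ => (0 : ℝ))]
  ring

end cochains
end SPcat
end

open scoped unitInterval Topology
open MeasureTheory
noncomputable section
namespace SPcat

section kuhn
variable {Y : Type*} {d : ℕ}

lemma perm_inv_self (τ : Equiv.Perm (Fin d)) (q : Fin d) : τ⁻¹ (τ q) = q :=
  Equiv.symm_apply_apply τ q

/-- vertices of the Kuhn path -/
def kv (N : ℕ) (p : Fin d → ℕ) (τ : Equiv.Perm (Fin d)) (l : ℕ) : Fin d → ℝ :=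
  fun δ => ((p δ : ℝ) + (if ((τ⁻¹ δ : Fin d) : ℕ) < l then 1 else 0)) / (N : ℝ)

/-- evaluation of a cochain on one cube at grid point `p` -/
def kcell (N : ℕ) (G : (ℕ → (Fin d → ℝ)) → ℝ) (p : Fin d → ℕ) : ℝ :=
  ∑ τ : Equiv.Perm (Fin d), ((Equiv.Perm.sign τ : ℤ) : ℝ) * G (kv N p τ)

/-- evaluation of a cochain on the grid cycle. -/
def kJ {E : Type*} [Fintype E] (w : E → ℝ) (S : E → (Fin d → ℝ) → Y) (N : ℕ)
    (f : (ℕ → Y) → ℝ) : ℝ :=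
  ∑ e, w e * ∑ p : Fin d → Fin N, kcell N (fun x => f (fun l => S e (x l))) (fun i => (p i : ℕ))

lemma kv_swap (N : ℕ) {l : ℕ} (h1 : l + 1 < d) (p : Fin d → ℕ) (τ : Equiv.Perm (Fin d)) :
    fc (l + 1) (kv N p (τ * Equiv.swap ⟨l, by omega⟩ ⟨l + 1, h1⟩)) = fc (l + 1) (kv N p τ) := by
  have key : ∀ i : ℕ, i ≠ l + 1 →
      kv N p (τ * Equiv.swap ⟨l, by omega⟩ ⟨l + 1, h1⟩) i = kv N p τ i := by
    intro i hi
    funext δ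
    simp only [kv, mul_inv_rev, Equiv.swap_inv, Equiv.Perm.mul_apply]
    congr 3
    generalize τ⁻¹ δ = q
    apply propext
    by_cases hq1 : q = ⟨l, by omega⟩
    · subst hq1
      rw [Equiv.swap_apply_left]
      simp only
      omega
    · by_cases hq2 : q = ⟨l + 1, h1⟩
      · subst hq2
        rw [Equiv.swap_apply_right]
        simp only
        omega
      · rw [Equiv.swap_apply_of_ne_of_ne hq1 hq2]
  funext i
  simp only [fc]
  split_ifs with h
  · exact key i (by omega)
  · exact key (i + 1) (by omega)

lemma kcell_mid (N : ℕ) (G : (ℕ → (Fin d → ℝ)) → ℝ) (p : Fin d → ℕ) {l : ℕ} (h1 : l + 1 < d) :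
    ∑ τ : Equiv.Perm (Fin d), ((Equiv.Perm.sign τ : ℤ) : ℝ) * G (fc (l + 1) (kv N p τ)) = 0 := by
  have h := Equiv.sum_comp (Equiv.mulRight (Equiv.swap (⟨l, by omega⟩ : Fin d) ⟨l + 1, h1⟩))
    (fun τ => ((Equiv.Perm.sign τ : ℤ) : ℝ) * G (fc (l + 1) (kv N p τ)))
  simp only [Equiv.coe_mulRight] at h
  have h2 : ∀ τ : Equiv.Perm (Fin d),
      ((Equiv.Perm.sign (τ * Equiv.swap (⟨l, by omega⟩ : Fin d) ⟨l + 1, h1⟩) : ℤ) : ℝ)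
        * G (fc (l + 1) (kv N p (τ * Equiv.swap (⟨l, by omega⟩ : Fin d) ⟨l + 1, h1⟩)))
      = - (((Equiv.Perm.sign τ : ℤ) : ℝ) * G (fc (l + 1) (kv N p τ))) := by
    intro τ
    rw [kv_swap, Equiv.Perm.sign_mul, Equiv.Perm.sign_swap (by simp [Fin.ext_iff])]
    simp
  rw [Finset.sum_congr rfl (fun τ _ => h2 τ), Finset.sum_neg_distrib] at h
  linarith

lemma kv_rot (N d0 : ℕ) (p : Fin (d0 + 1) → ℕ) (τ : Equiv.Perm (Fin (d0 + 1))) (i : ℕ)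
    (hi : i ≤ d0) :
    kv N p τ (i + 1) = kv N (p + Pi.single (τ 0) 1) (τ * finRotate (d0 + 1)) i := by
  funext δ
  simp only [kv, mul_inv_rev, Equiv.Perm.mul_apply]
  congr 1
  obtain ⟨q, rfl⟩ := τ.surjective δ
  simp only [perm_inv_self]
  obtain ⟨r, rfl⟩ := (finRotate (d0 + 1)).surjective q
  simp only [perm_inv_self]
  by_cases hr : r = Fin.last d0
  · subst hr
    rw [finRotate_last]
    simp
    omega
  · have h2 : ((finRotate (d0 + 1) r : Fin (d0 + 1)) : ℕ) = r + 1 := by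
      apply coe_finRotate_of_ne_last hr
    have h3 : finRotate (d0 + 1) r ≠ 0 := by
      intro h; rw [h] at h2; simp at h2
    have h4 : τ (finRotate (d0 + 1) r) ≠ τ 0 := fun h => h3 (τ.injective h)
    rw [h2]
    simp only [Pi.add_apply, Pi.single_eq_of_ne h4, add_zero]
    congr 2
    simp

lemma kcell_stokes (N d0 : ℕ) (G : (ℕ → (Fin (d0 + 1) → ℝ)) → ℝ) (hG : IsDeg d0 G)
    (p : Fin (d0 + 1) → ℕ) :
    kcell N (dl d0 G) p = (-1 : ℝ) ^ d0 * ∑ τ : Equiv.Perm (Fin (d0 + 1)),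
      ((Equiv.Perm.sign τ : ℤ) : ℝ) *
        (G (kv N (p + Pi.single (τ (Fin.last d0)) 1) τ) - G (kv N p τ)) := by
  unfold kcell dl
  simp_rw [Finset.mul_sum]
  rw [Finset.sum_comm]
  rw [Finset.sum_range_succ, Finset.sum_range_succ']
  have hmid : ∑ k ∈ Finset.range d0, ∑ τ : Equiv.Perm (Fin (d0 + 1)),
      ((Equiv.Perm.sign τ : ℤ) : ℝ) * ((-1) ^ (k + 1) * G (fc (k + 1) (kv N p τ))) = 0 := by
    apply Finset.sum_eq_zero
    intro k hk
    have := kcell_mid N G p (l := k) (by have := Finset.mem_range.1 hk; omega)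
    calc _ = (-1 : ℝ) ^ (k + 1) * ∑ τ : Equiv.Perm (Fin (d0 + 1)),
      ((Equiv.Perm.sign τ : ℤ) : ℝ) * G (fc (k + 1) (kv N p τ)) := by
          rw [Finset.mul_sum]; exact Finset.sum_congr rfl fun _ _ => by ring
      _ = 0 := by rw [this, mul_zero]
  rw [hmid, zero_add]
  have h0 : ∑ τ : Equiv.Perm (Fin (d0 + 1)),
      ((Equiv.Perm.sign τ : ℤ) : ℝ) * ((-1) ^ 0 * G (fc 0 (kv N p τ))) =
      ∑ τ : Equiv.Perm (Fin (d0 + 1)), ((Equiv.Perm.sign τ : ℤ) : ℝ) *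
        ((-1) ^ d0 * G (kv N (p + Pi.single (τ (Fin.last d0)) 1) τ)) := by
    refine Eq.trans ?_ (Equiv.sum_comp (Equiv.mulRight (finRotate (d0 + 1)))
      (fun τ => ((Equiv.Perm.sign τ : ℤ) : ℝ) *
        ((-1) ^ d0 * G (kv N (p + Pi.single (τ (Fin.last d0)) 1) τ))))
    apply Finset.sum_congr rfl
    intro τ _
    simp only [Equiv.coe_mulRight, Equiv.Perm.mul_apply, finRotate_last, Equiv.Perm.sign_mul,
      sign_finRotate]
    have e : G (fc 0 (kv N p τ)) = G (kv N (p + Pi.single (τ 0) 1) (τ * finRotate (d0 + 1))) := by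
      apply hG
      intro i hi
      rw [fc_zero]
      exact kv_rot N d0 p τ i hi
    rw [e]
    have : ((-1 : ℝ) ^ d0) * (-1) ^ d0 = 1 := by rw [← mul_pow]; simp
    push_cast
    linear_combination (-((((Equiv.Perm.sign τ : ℤ) : ℝ)) * G (kv N (p + Pi.single (τ 0) 1) (τ * finRotate (d0 + 1))))) * this
  rw [h0, ← Finset.sum_add_distrib]
  apply Finset.sum_congr rfl
  intro τ _
  rw [hG.fc_ge le_rfl]
  ring

lemma sum_tele (N d : ℕ) (δ : Fin d) (g : (Fin d → ℕ) → ℝ) :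
    ∑ p : Fin d → Fin N, (g ((fun i => (p i : ℕ)) + Pi.single δ 1) - g (fun i => (p i : ℕ))) =
    ∑ q : {j : Fin d // j ≠ δ} → Fin N,
      (g (fun j => if h : j = δ then N else (q ⟨j, h⟩ : ℕ))
        - g (fun j => if h : j = δ then 0 else (q ⟨j, h⟩ : ℕ))) := by
  rw [← Equiv.sum_comp (Equiv.funSplitAt δ (Fin N)).symm, Fintype.sum_prod_type_right]
  apply Finset.sum_congr rfl
  intro q _
  have hs := Finset.sum_range_sub (fun a : ℕ => g (fun j => if h : j = δ then a else (q ⟨j, h⟩ : ℕ))) N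
  rw [← hs, Finset.sum_range]
  apply Finset.sum_congr rfl
  intro a _
  congr 2
  · funext j
    by_cases h : j = δ
    · subst h; simp [Equiv.funSplitAt, Equiv.piSplitAt]
    · simp [Equiv.funSplitAt, Equiv.piSplitAt, h]
  · funext j
    by_cases h : j = δ
    · subst h; simp [Equiv.funSplitAt, Equiv.piSplitAt]
    · simp [Equiv.funSplitAt, Equiv.piSplitAt, h]

theorem kJ_stokes {E : Type*} [Fintype E] {d0 : ℕ} (w : E → ℝ) (S : E → (Fin (d0 + 1) → ℝ) → Y)
    (N : ℕ) (hN : 0 < N)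
    (HB : ∀ (δ : Fin (d0 + 1)) (Φ : ((Fin (d0 + 1) → ℝ) → Y) → ℝ),
      ∑ e, w e * (Φ (fun z => S e (Function.update z δ 1))
        - Φ (fun z => S e (Function.update z δ 0))) = 0)
    (f : (ℕ → Y) → ℝ) (hf : IsDeg d0 f) : kJ w S N (dl d0 f) = 0 := by
  have hGd : ∀ e, (fun x : ℕ → (Fin (d0 + 1) → ℝ) => dl d0 f (fun l => S e (x l))) =
      dl d0 (fun x => f (fun l => S e (x l))) := by
    intro e; funext x
    simp only [dl]
    apply Finset.sum_congr rfl
    intro l _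
    congr 2
    funext i; simp only [fc]; split_ifs <;> rfl
  have hG : ∀ e, IsDeg d0 (fun x : ℕ → (Fin (d0 + 1) → ℝ) => f (fun l => S e (x l))) := by
    intro e x y h
    exact hf _ _ fun i hi => by rw [h i hi]
  have hcell : ∀ e, ∑ p : Fin (d0 + 1) → Fin N,
      kcell N (fun x => dl d0 f (fun l => S e (x l))) (fun i => (p i : ℕ)) =
      ∑ τ : Equiv.Perm (Fin (d0 + 1)), ∑ q : {j : Fin (d0 + 1) // j ≠ τ (Fin.last d0)} → Fin N,
        ((-1 : ℝ) ^ d0 * ((Equiv.Perm.sign τ : ℤ) : ℝ)) *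
        (f (fun i => S e (Function.update (kv N (fun j => if h : j = τ (Fin.last d0) then 0 else
            (q ⟨j, h⟩ : ℕ)) τ i) (τ (Fin.last d0)) 1)) -
         f (fun i => S e (Function.update (kv N (fun j => if h : j = τ (Fin.last d0) then 0 else
            (q ⟨j, h⟩ : ℕ)) τ i) (τ (Fin.last d0)) 0))) := by
    intro e
    rw [hGd]
    simp_rw [kcell_stokes N d0 _ (hG e), Finset.mul_sum]
    rw [Finset.sum_comm]
    apply Finset.sum_congr rfl
    intro τ _
    simp_rw [← mul_assoc]
    rw [← Finset.mul_sum, ← Finset.mul_sum]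
    congr 1
    rw [sum_tele N (d0 + 1) (τ (Fin.last d0))
      (fun p => f (fun l => S e (kv N p τ l)))]
    apply Finset.sum_congr rfl
    intro q _
    congr 1
    · apply hf
      intro i hi
      congr 1
      funext j
      by_cases h : j = τ (Fin.last d0)
      · subst h
        simp only [Function.update_self, kv, dif_pos, perm_inv_self, Fin.val_last]
        rw [if_neg (by omega), add_zero, div_self (by positivity)]
      · simp [Function.update_of_ne h, kv, h]
    · apply hf
      intro i hi
      congr 1
      funext j
      by_cases h : j = τ (Fin.last d0)
      · subst h
        simp only [Function.update_self, kv, dif_pos, perm_inv_self, Fin.val_last]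
        rw [if_neg (by omega)]; simp
      · simp [Function.update_of_ne h, kv, h]
  unfold kJ
  simp_rw [hcell, Finset.mul_sum]
  rw [Finset.sum_comm]
  apply Finset.sum_eq_zero
  intro τ _
  rw [Finset.sum_comm]
  apply Finset.sum_eq_zero
  intro q _
  have := HB (τ (Fin.last d0)) (fun W => f (fun i => W (kv N (fun j => if h : j = τ (Fin.last d0)
    then 0 else (q ⟨j, h⟩ : ℕ)) τ i)))
  calc _ = ((-1 : ℝ) ^ d0 * ((Equiv.Perm.sign τ : ℤ) : ℝ)) * _ := by
        rw [Finset.mul_sum]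
        apply Finset.sum_congr rfl
        intro e _
        rw [mul_left_comm]
    _ = 0 := by rw [this, mul_zero]

lemma kJ_add {E : Type*} [Fintype E] (w : E → ℝ) (S : E → (Fin d → ℝ) → Y) (N : ℕ)
    (f f' : (ℕ → Y) → ℝ) : kJ w S N (fun s => f s + f' s) = kJ w S N f + kJ w S N f' := by
  simp only [kJ, kcell, mul_add, Finset.sum_add_distrib]

lemma kJ_smul {E : Type*} [Fintype E] (w : E → ℝ) (S : E → (Fin d → ℝ) → Y) (N : ℕ)
    (a : ℝ) (f : (ℕ → Y) → ℝ) : kJ w S N (fun s => a * f s) = a * kJ w S N f := by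
  simp only [kJ, kcell, Finset.mul_sum]
  refine Finset.sum_congr rfl fun e _ => Finset.sum_congr rfl fun p _ =>
    Finset.sum_congr rfl fun τ _ => ?_
  ring

/-- sequences in the image of one grid cell -/
def cellSeq {E : Type*} (S : E → (Fin d → ℝ) → Y) (N : ℕ) : Set (ℕ → Y) :=
  {s | ∃ (e : E) (p : Fin d → Fin N) (ζ : ℕ → Fin d → ℝ),
    (∀ l δ, ((p δ : ℕ) : ℝ) / N ≤ ζ l δ ∧ ζ l δ ≤ (((p δ : ℕ) : ℝ) + 1) / N) ∧ s = fun l => S e (ζ l)}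

lemma cellSeq_reindex {E : Type*} (S : E → (Fin d → ℝ) → Y) (N : ℕ) (s : ℕ → Y)
    (hs : s ∈ cellSeq S N) (ρ : ℕ → ℕ) : s ∘ ρ ∈ cellSeq S N := by
  obtain ⟨e, p, ζ, h, rfl⟩ := hs
  exact ⟨e, p, ζ ∘ ρ, fun l δ => h (ρ l) δ, rfl⟩

lemma kv_mem (N : ℕ) (p : Fin d → ℕ) (τ : Equiv.Perm (Fin d)) (l : ℕ) (δ : Fin d) :
    (p δ : ℝ) / N ≤ kv N p τ l δ ∧ kv N p τ l δ ≤ ((p δ : ℝ) + 1) / N := by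
  simp only [kv]
  constructor
  · gcongr; split_ifs <;> simp
  · gcongr; split_ifs <;> simp

lemma kJ_congr {E : Type*} [Fintype E] (w : E → ℝ) (S : E → (Fin d → ℝ) → Y) (N : ℕ)
    (f f' : (ℕ → Y) → ℝ) (h : ∀ s ∈ cellSeq S N, f s = f' s) : kJ w S N f = kJ w S N f' := by
  simp only [kJ, kcell]
  refine Finset.sum_congr rfl fun e _ => ?_
  congr 1
  refine Finset.sum_congr rfl fun p _ => Finset.sum_congr rfl fun τ _ => ?_
  rw [h _ ⟨e, p, kv N (fun i => (p i : ℕ)) τ, fun l δ => kv_mem N (fun i => (p i : ℕ)) τ l δ, rfl⟩]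

end kuhn
end SPcat
end

open scoped unitInterval Topology
open MeasureTheory
noncomputable section
namespace SPcat

section evl
variable {M E : Type*} {n : ℕ}

/-- product parametrization -/
def pS (s : E → ℝ → ℝ → M) (e : Fin n → E) (z : Fin (n * 2) → ℝ) : Fin n → M :=
  fun j => s (e j) (z (finProdFinEquiv (j, 0))) (z (finProdFinEquiv (j, 1)))

/-- two dimensional path -/
def P2 (N : ℕ) (s : E → ℝ → ℝ → M) (e : E) (q : Fin 2 → ℕ) (φ : Equiv.Perm (Fin 2)) (i : ℕ) : M :=
  s e (((q 0 : ℝ) + if ((φ⁻¹ 0 : Fin 2) : ℕ) < i then 1 else 0) / N)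
    (((q 1 : ℝ) + if ((φ⁻¹ 1 : Fin 2) : ℕ) < i then 1 else 0) / N)

/-- two dimensional evaluation -/
def I2 [Fintype E] (N : ℕ) (ε : E → ℝ) (s : E → ℝ → ℝ → M) (Yk : M → M → M → ℝ) : ℝ :=
  ∑ e, ∑ q : Fin 2 → Fin N, ∑ φ : Equiv.Perm (Fin 2), ε e * (((Equiv.Perm.sign φ : ℤ) : ℝ) *
    Yk (P2 N s e (fun i => (q i : ℕ)) φ 0) (P2 N s e (fun i => (q i : ℕ)) φ 1)
      (P2 N s e (fun i => (q i : ℕ)) φ 2))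

/-- one-point factor -/
def yk (t : Fin n → Bool) (a b : Fin n → M → M → ℝ) (A : M → M → M → ℝ) (k : Fin n) :
    M → M → M → ℝ := fun x y z => if t k then a k x y * b k y z else A x y z

/-- n-point factor -/
def yv (t : Fin n → Bool) (a b : Fin n → M → M → ℝ) (A : M → M → M → ℝ) (k : Fin n)
    (x y z : Fin n → M) : ℝ :=
  if t k then (∑ j, a k (x j) (y j)) * (∑ j, b k (y j) (z j)) else ∑ j, A (x j) (y j) (z j)

/-- total product -/
def yprod (t : Fin n → Bool) (a b : Fin n → M → M → ℝ) (A : M → M → M → ℝ)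
    (x : ℕ → Fin n → M) : ℝ :=
  ∏ k : Fin n, yv t a b A k (x (2 * k)) (x (2 * k + 1)) (x (2 * k + 2))

/-- the vertices for a permutation of `Fin n × Fin 2` -/
def vtx (N : ℕ) (s : E → ℝ → ℝ → M) (e : Fin n → E) (p : Fin n → Fin 2 → ℕ)
    (ς : Equiv.Perm (Fin n × Fin 2)) (l : ℕ) (j : Fin n) : M :=
  s (e j) (((p j 0 : ℝ) + if ((ς.symm (j, 0)).2 : ℕ) + 2 * (ς.symm (j, 0)).1 < l then 1 else 0) / N)
    (((p j 1 : ℝ) + if ((ς.symm (j, 1)).2 : ℕ) + 2 * (ς.symm (j, 1)).1 < l then 1 else 0) / N)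

lemma vtx_step (N : ℕ) (s : E → ℝ → ℝ → M) (e : Fin n → E) (p : Fin n → Fin 2 → ℕ)
    (ς : Equiv.Perm (Fin n × Fin 2)) (k : Fin n) (b : Fin 2) (j : Fin n) (h : (ς (k, b)).1 ≠ j) :
    vtx N s e p ς (b + 2 * k) j = vtx N s e p ς (b + 2 * k + 1) j := by
  have key : ∀ c : Fin 2, (((ς.symm (j, c)).2 : ℕ) + 2 * (ς.symm (j, c)).1 < b + 2 * k) ↔
      (((ς.symm (j, c)).2 : ℕ) + 2 * (ς.symm (j, c)).1 < b + 2 * k + 1) := by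
    intro c
    have : ς.symm (j, c) ≠ (k, b) := by
      intro h2; apply h; rw [← h2]; simp
    generalize ς.symm (j, c) = q at this
    obtain ⟨q1, q2⟩ := q
    have h3 : ¬ (((q2 : Fin 2) : ℕ) + 2 * (q1 : ℕ) = b + 2 * k) := by
      intro h4
      apply this
      have := q2.2
      have := b.2
      ext
      · simp only; omega
      · simp only; omega
    simp only
    omega
  simp only [vtx]
  simp only [key]

/-- block permutation -/
def blkP (τ : Equiv.Perm (Fin n)) (φ : Fin n → Equiv.Perm (Fin 2)) : Equiv.Perm (Fin n × Fin 2) :=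
  (Equiv.prodCongrLeft fun _ => τ) * Equiv.prodCongrRight φ

lemma blkP_apply (τ : Equiv.Perm (Fin n)) (φ : Fin n → Equiv.Perm (Fin 2)) (k : Fin n) (b : Fin 2) :
    blkP τ φ (k, b) = (τ k, φ k b) := rfl

lemma blkP_symm (τ : Equiv.Perm (Fin n)) (φ : Fin n → Equiv.Perm (Fin 2)) (k : Fin n) (b : Fin 2) :
    (blkP τ φ).symm (τ k, b) = (k, (φ k)⁻¹ b) := by
  rw [Equiv.symm_apply_eq, blkP_apply]
  congr 1
  exact (Equiv.apply_symm_apply (φ k) b).symm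

lemma blkP_sign (τ : Equiv.Perm (Fin n)) (φ : Fin n → Equiv.Perm (Fin 2)) :
    ((Equiv.Perm.sign (blkP τ φ) : ℤ) : ℝ) = ∏ k, ((Equiv.Perm.sign (φ k) : ℤ) : ℝ) := by
  unfold blkP
  rw [Equiv.Perm.sign_mul, Equiv.Perm.sign_prodCongrLeft, Equiv.Perm.sign_prodCongrRight]
  simp only [Finset.prod_const, Finset.card_univ, Fintype.card_fin]
  rw [show (Equiv.Perm.sign τ) ^ 2 = 1 from Int.units_sq _, one_mul]
  push_cast
  rfl

lemma blkP_inj : Function.Injective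
    (fun x : Equiv.Perm (Fin n) × (Fin n → Equiv.Perm (Fin 2)) => blkP x.1 x.2) := by
  rintro ⟨τ, φ⟩ ⟨τ', φ'⟩ h
  have h' : ∀ k b, (τ k, φ k b) = (τ' k, φ' k b) := fun k b => by
    rw [← blkP_apply, ← blkP_apply]; exact congrArg (fun q : Equiv.Perm _ => q (k, b)) h
  ext
  · simpa using congrArg (fun q : Fin n × Fin 2 => (q.1 : ℕ)) (h' _ 0)
  · simpa using congrArg (fun q : Fin n × Fin 2 => (q.2 : ℕ)) (h' _ _)

lemma fin2_three {a b c : Fin 2} (h1 : a ≠ b) (h2 : c ≠ a) (h3 : c ≠ b) : False := by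
  omega

lemma three_in_block (ς : Equiv.Perm (Fin n × Fin 2)) {x y z : Fin n × Fin 2} (hxy : x ≠ y)
    (h1 : (ς x).1 = (ς y).1) (h2 : (ς z).1 = (ς y).1) : z = x ∨ z = y := by
  by_contra hc
  push Not at hc
  have e1 : (ς x).2 ≠ (ς y).2 := fun h => hxy (ς.injective (Prod.ext h1 h))
  have e2 : (ς z).2 ≠ (ς x).2 := fun h => hc.1 (ς.injective (Prod.ext (h2.trans h1.symm) h))
  have e3 : (ς z).2 ≠ (ς y).2 := fun h => hc.2 (ς.injective (Prod.ext h2 h))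
  exact fin2_three e1 e2 e3

lemma blkP_surj (ς : Equiv.Perm (Fin n × Fin 2)) (h : ∀ k, (ς (k, 0)).1 = (ς (k, 1)).1) :
    ∃ τ φ, ς = blkP τ φ := by
  have hτ : Function.Injective (fun k => (ς (k, 0)).1) := by
    intro k k' hk
    have := three_in_block ς (x := (k, 0)) (y := (k, 1)) (z := (k', 0)) (by simp) (h k)
      (hk.symm.trans (h k))
    rcases this with h | h
    · exact (congrArg Prod.fst h).symm
    · simp at h
  have hb : ∀ k b, (ς (k, b)).1 = (ς (k, 0)).1 := by
    intro k b
    fin_cases b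
    · rfl
    · exact (h k).symm
  have hφ : ∀ k, Function.Injective (fun b => (ς (k, b)).2) := by
    intro k b b' hbb
    have : ς (k, b) = ς (k, b') := Prod.ext ((hb k b).trans (hb k b').symm) hbb
    exact congrArg Prod.snd (ς.injective this)
  refine ⟨Equiv.ofBijective _ (Finite.injective_iff_bijective.1 hτ),
    fun k => Equiv.ofBijective _ (Finite.injective_iff_bijective.1 (hφ k)), ?_⟩
  ext1 ⟨k, b⟩
  rw [blkP_apply]
  simp only [Equiv.ofBijective_apply]
  exact Prod.ext (hb k b) rfl

variable (t : Fin n → Bool) (a b : Fin n → M → M → ℝ) (A : M → M → M → ℝ)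

lemma yv_block (ha : ∀ k x, a k x x = 0) (hb : ∀ k x, b k x x = 0)
    (hA1 : ∀ x z, A x x z = 0)
    (k j : Fin n) (x y z : Fin n → M)
    (h1 : ∀ i, j ≠ i → x i = y i) (h2 : ∀ i, j ≠ i → y i = z i) :
    yv t a b A k x y z = yk t a b A k (x j) (y j) (z j) := by
  unfold yv yk
  split_ifs
  · rw [Finset.sum_eq_single j, Finset.sum_eq_single j]
    · intro i _ hi; rw [h2 i (Ne.symm hi)]; exact hb _ _
    · simp
    · intro i _ hi; rw [h1 i (Ne.symm hi)]; exact ha _ _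
    · simp
  · rw [Finset.sum_eq_single j]
    · intro i _ hi; rw [h1 i (Ne.symm hi)]; exact hA1 _ _
    · simp

lemma yv_nonblock (sec : E → Fin n → Prop) (ha : ∀ k x, a k x x = 0) (hb : ∀ k x, b k x x = 0)
    (hA1 : ∀ x z, A x x z = 0) (hA2 : ∀ x z, A x z z = 0)
    (s : E → ℝ → ℝ → M)
    (hsa : ∀ k e r u r' u', ¬ sec e k → a k (s e r u) (s e r' u') = 0)
    (hsb : ∀ k e r u r' u', ¬ sec e k → b k (s e r u) (s e r' u') = 0)
    (N : ℕ) (e : Fin n → E) (p : Fin n → Fin 2 → ℕ) (ς : Equiv.Perm (Fin n × Fin 2)) (k : Fin n)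
    (h : yv t a b A k (vtx N s e p ς (2 * k)) (vtx N s e p ς (2 * k + 1))
      (vtx N s e p ς (2 * k + 2)) ≠ 0) :
    (t k = true ∧ sec (e (ς (k, 0)).1) k ∧ sec (e (ς (k, 1)).1) k) ∨
      (t k = false ∧ (ς (k, 0)).1 = (ς (k, 1)).1) := by
  have s0 : ∀ i, (ς (k, 0)).1 ≠ i → vtx N s e p ς (2 * k) i = vtx N s e p ς (2 * k + 1) i := by
    intro i hi
    have := vtx_step N s e p ς k 0 i hi
    simpa using this
  have s1 : ∀ i, (ς (k, 1)).1 ≠ i → vtx N s e p ς (2 * k + 1) i = vtx N s e p ς (2 * k + 2) i := by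
    intro i hi
    have := vtx_step N s e p ς k 1 i hi
    have e1 : ((1 : Fin 2) : ℕ) + 2 * (k : ℕ) = 2 * k + 1 := by simp [add_comm]
    rw [e1] at this
    exact this
  unfold yv at h
  cases ht : t k
  · right
    refine ⟨rfl, ?_⟩
    rw [ht] at h
    simp only [Bool.false_eq_true, if_false] at h
    by_contra hne
    apply h
    apply Finset.sum_eq_zero
    intro j _
    by_cases hj : (ς (k, 0)).1 = j
    · rw [s1 j (fun h => hne (hj.trans h.symm))]; exact hA2 _ _
    · rw [s0 j hj]; exact hA1 _ _
  · left
    rw [ht] at h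
    simp only [if_true] at h
    refine ⟨rfl, ?_, ?_⟩
    · by_contra hs
      apply h
      rw [Finset.sum_eq_zero, zero_mul]
      intro j _
      by_cases hj : (ς (k, 0)).1 = j
      · subst hj; exact hsa _ _ _ _ _ _ hs
      · rw [s0 j hj]; exact ha _ _
    · by_contra hs
      apply h
      rw [Finset.sum_eq_zero (f := fun j => b k _ _), mul_zero]
      intro j _
      by_cases hj : (ς (k, 1)).1 = j
      · subst hj; exact hsb _ _ _ _ _ _ hs
      · rw [s1 j hj]; exact hb _ _

lemma block_of_ne (sec : E → Fin n → Prop) (hsec : ∀ e k k', sec e k → sec e k' → k = k')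
    (e : Fin n → E) (ς : Equiv.Perm (Fin n × Fin 2))
    (h : ∀ k, (t k = true ∧ sec (e (ς (k, 0)).1) k ∧ sec (e (ς (k, 1)).1) k) ∨
      (t k = false ∧ (ς (k, 0)).1 = (ς (k, 1)).1)) (k : Fin n) : (ς (k, 0)).1 = (ς (k, 1)).1 := by
  by_contra hne
  rcases h k with ⟨htk, hs0, hs1⟩ | ⟨_, h2⟩
  swap
  · exact hne h2
  -- the other coordinate of the block of `ς (k,0)`
  obtain ⟨c, hc⟩ : ∃ c : Fin 2, c ≠ (ς (k, 0)).2 :=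
    ⟨(ς (k, 0)).2 + 1, by generalize (ς (k, 0)).2 = q; revert q; decide⟩
  obtain ⟨⟨k2, b2⟩, hk2⟩ := ς.surjective ((ς (k, 0)).1, c)
  have hk2' : (ς (k2, b2)).1 = (ς (k, 0)).1 := by rw [hk2]
  have hkk : k2 ≠ k := by
    intro hkk
    subst hkk
    fin_cases b2
    · apply hc; exact (congrArg Prod.snd hk2).symm
    · exact hne hk2'.symm
  rcases h k2 with ⟨_, hs0', hs1'⟩ | ⟨_, h2⟩
  · apply hkk
    have : sec (e (ς (k2, b2)).1) k2 := by
      fin_cases b2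
      · exact hs0'
      · exact hs1'
    rw [hk2'] at this
    exact hsec _ _ _ this hs0
  · have hb1 : (ς (k2, 1)).1 = (ς (k, 0)).1 := by
      fin_cases b2
      · exact h2.symm.trans hk2'
      · exact hk2'
    have := three_in_block ς (x := (k2, 0)) (y := (k2, 1)) (z := (k, 0)) (by simp) h2 hb1.symm
    rcases this with h | h
    · exact hkk (congrArg Prod.fst h).symm
    · exact hkk (congrArg Prod.fst h).symm

lemma vtx_block (N : ℕ) (s : E → ℝ → ℝ → M) (e : Fin n → E) (p : Fin n → Fin 2 → ℕ)
    (τ : Equiv.Perm (Fin n)) (φ : Fin n → Equiv.Perm (Fin 2)) (k : Fin n) (i : ℕ) :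
    vtx N s e p (blkP τ φ) (2 * k + i) (τ k) = P2 N s (e (τ k)) (p (τ k)) (φ k) i := by
  simp only [vtx, P2, blkP_symm]
  have : ∀ q : ℕ, (q + 2 * (k : ℕ) < 2 * k + i) ↔ q < i := by intro q; omega
  simp only [this]

theorem kJ_value [Fintype E] (sec : E → Fin n → Prop)
    (hsec : ∀ e k k', sec e k → sec e k' → k = k')
    (ha : ∀ k x, a k x x = 0) (hb : ∀ k x, b k x x = 0)
    (hA1 : ∀ x z, A x x z = 0) (hA2 : ∀ x z, A x z z = 0)
    (s : E → ℝ → ℝ → M)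
    (hsa : ∀ k e r u r' u', ¬ sec e k → a k (s e r u) (s e r' u') = 0)
    (hsb : ∀ k e r u r' u', ¬ sec e k → b k (s e r u) (s e r' u') = 0)
    (N : ℕ) (ε : E → ℝ) :
    kJ (fun e : Fin n → E => ∏ j, ε (e j)) (pS s) N (yprod t a b A) =
      (n.factorial : ℝ) * ∏ k, I2 N ε s (yk t a b A k) := by
  -- rewrite permutations
  have step1 : ∀ (e : Fin n → E) (p : Fin (n * 2) → ℕ),
      kcell N (fun x => yprod t a b A (fun l => pS s e (x l))) p =
      ∑ τ : Equiv.Perm (Fin n), ∑ φ : Fin n → Equiv.Perm (Fin 2),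
        ∏ k, (((Equiv.Perm.sign (φ k) : ℤ) : ℝ) *
          yk t a b A k (P2 N s (e (τ k)) (fun c => p (finProdFinEquiv (τ k, c))) (φ k) 0)
            (P2 N s (e (τ k)) (fun c => p (finProdFinEquiv (τ k, c))) (φ k) 1)
            (P2 N s (e (τ k)) (fun c => p (finProdFinEquiv (τ k, c))) (φ k) 2)) := by
    intro e p
    unfold kcell
    rw [← Equiv.sum_comp (Equiv.permCongr (finProdFinEquiv (m := n) (n := 2)))]
    have hv : ∀ (ς : Equiv.Perm (Fin n × Fin 2)) (l : ℕ),
        pS s e (kv N p (Equiv.permCongr finProdFinEquiv ς) l) =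
          vtx N s e (fun j c => p (finProdFinEquiv (j, c))) ς l := by
      intro ς l
      funext j
      simp only [pS, vtx, kv]
      have : ∀ c : Fin 2, (((Equiv.permCongr finProdFinEquiv ς)⁻¹ (finProdFinEquiv (j, c)) :
          Fin (n * 2)) : ℕ) = ((ς.symm (j, c)).2 : ℕ) + 2 * (ς.symm (j, c)).1 := by
        intro c
        have : (Equiv.permCongr finProdFinEquiv ς)⁻¹ (finProdFinEquiv (j, c)) =
            finProdFinEquiv (ς.symm (j, c)) := by
          change (Equiv.permCongr finProdFinEquiv ς).symm (finProdFinEquiv (j, c)) = _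
          rw [Equiv.symm_apply_eq, Equiv.permCongr_apply]
          simp
        rw [this, finProdFinEquiv_apply_val]
      simp only [this]
    simp only [Equiv.Perm.sign_permCongr, hv]
    rw [← Finset.sum_product', Finset.univ_product_univ]
    symm
    apply Finset.sum_of_injOn (fun x => blkP x.1 x.2)
    · exact blkP_inj.injOn
    · intro x _; simp
    · intro ς _ hς
      by_contra hne
      apply hς
      have hy := right_ne_zero_of_mul hne
      unfold yprod at hy
      rw [Finset.prod_ne_zero_iff] at hy
      have h3 := block_of_ne t sec hsec e ς (fun k => yv_nonblock t a b A sec ha hb hA1 hA2 s hsa hsb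
        N e _ ς k (hy k (Finset.mem_univ _)))
      obtain ⟨τ, φ, rfl⟩ := blkP_surj ς h3
      exact ⟨(τ, φ), by simp, rfl⟩
    · rintro ⟨τ, φ⟩ _
      rw [blkP_sign, Finset.prod_mul_distrib]
      congr 1
      unfold yprod
      apply Finset.prod_congr rfl
      intro k _
      rw [yv_block t a b A ha hb hA1 k (τ k)]
      · congr 1
        · exact (vtx_block N s e (fun j c => p (finProdFinEquiv (j, c))) τ φ k 0).symm
        · exact (vtx_block N s e (fun j c => p (finProdFinEquiv (j, c))) τ φ k 1).symm
        · exact (vtx_block N s e (fun j c => p (finProdFinEquiv (j, c))) τ φ k 2).symm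
      · intro i hi
        have := vtx_step N s e (fun j c => p (finProdFinEquiv (j, c))) (blkP τ φ) k 0 i (by rw [blkP_apply]; exact hi)
        simpa using this
      · intro i hi
        have := vtx_step N s e (fun j c => p (finProdFinEquiv (j, c))) (blkP τ φ) k 1 i (by rw [blkP_apply]; exact hi)
        have e1 : ((1 : Fin 2) : ℕ) + 2 * (k : ℕ) = 2 * k + 1 := by simp [add_comm]
        rw [e1] at this
        exact this
  -- fix τ
  let F : Fin n → E → (Fin 2 → Fin N) → Equiv.Perm (Fin 2) → ℝ := fun k e q φ =>
    ε e * (((Equiv.Perm.sign φ : ℤ) : ℝ) *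
    yk t a b A k (P2 N s e (fun i => (q i : ℕ)) φ 0) (P2 N s e (fun i => (q i : ℕ)) φ 1)
      (P2 N s e (fun i => (q i : ℕ)) φ 2))
  have step2 : ∏ k, I2 N ε s (yk t a b A k) = ∑ e : Fin n → E, ∑ q : Fin n → Fin 2 → Fin N,
      ∑ φ : Fin n → Equiv.Perm (Fin 2), ∏ k, F k (e k) (q k) (φ k) := by
    unfold I2
    rw [Finset.prod_univ_sum, Fintype.piFinset_univ]
    refine Finset.sum_congr rfl fun e _ => ?_
    rw [Finset.prod_univ_sum, Fintype.piFinset_univ]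
    refine Finset.sum_congr rfl fun q _ => ?_
    rw [Finset.prod_univ_sum, Fintype.piFinset_univ]
  have step3 : ∀ τ : Equiv.Perm (Fin n), ∑ e : Fin n → E, ∑ q : Fin n → Fin 2 → Fin N,
      ∑ φ : Fin n → Equiv.Perm (Fin 2), ∏ k, F k (e (τ k)) (q (τ k)) (φ k)
      = ∏ k, I2 N ε s (yk t a b A k) := by
    intro τ
    rw [step2]
    rw [← Equiv.sum_comp (Equiv.arrowCongr τ.symm (Equiv.refl E))
      (fun e => ∑ q : Fin n → Fin 2 → Fin N,
      ∑ φ : Fin n → Equiv.Perm (Fin 2), ∏ k, F k (e k) (q k) (φ k))]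
    refine Finset.sum_congr rfl fun e _ => ?_
    rw [← Equiv.sum_comp (Equiv.arrowCongr τ.symm (Equiv.refl (Fin 2 → Fin N)))
      (fun q => 
      ∑ φ : Fin n → Equiv.Perm (Fin 2), ∏ k, F k _ (q k) (φ k))]
    rfl
  have hp : ∀ G : (Fin n → Fin 2 → Fin N) → ℝ, ∑ p : Fin (n * 2) → Fin N,
      G (fun j c => p (finProdFinEquiv (j, c))) = ∑ q, G q := by
    intro G
    exact Equiv.sum_comp ((Equiv.arrowCongr finProdFinEquiv.symm (Equiv.refl (Fin N))).trans
      (Equiv.curry (Fin n) (Fin 2) (Fin N))) G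
  unfold kJ
  simp_rw [step1]
  have step4 : ∀ e : Fin n → E, (∏ j, ε (e j)) * ∑ p : Fin (n * 2) → Fin N,
      ∑ τ : Equiv.Perm (Fin n), ∑ φ : Fin n → Equiv.Perm (Fin 2),
        ∏ k, (((Equiv.Perm.sign (φ k) : ℤ) : ℝ) *
          yk t a b A k (P2 N s (e (τ k)) (fun c => (p (finProdFinEquiv (τ k, c)) : ℕ)) (φ k) 0)
            (P2 N s (e (τ k)) (fun c => (p (finProdFinEquiv (τ k, c)) : ℕ)) (φ k) 1)
            (P2 N s (e (τ k)) (fun c => (p (finProdFinEquiv (τ k, c)) : ℕ)) (φ k) 2)) =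
      ∑ τ : Equiv.Perm (Fin n), ∑ q : Fin n → Fin 2 → Fin N,
      ∑ φ : Fin n → Equiv.Perm (Fin 2), ∏ k, F k (e (τ k)) (q (τ k)) (φ k) := by
    intro e
    rw [Finset.sum_comm, Finset.mul_sum]
    refine Finset.sum_congr rfl fun τ _ => ?_
    rw [← hp, Finset.mul_sum]
    refine Finset.sum_congr rfl fun p _ => ?_
    rw [Finset.mul_sum]
    refine Finset.sum_congr rfl fun φ _ => ?_
    rw [← Equiv.prod_comp τ, ← Finset.prod_mul_distrib]
  simp_rw [step4]
  rw [Finset.sum_comm]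
  simp_rw [step3]
  rw [Finset.sum_const, Finset.card_univ, Fintype.card_perm, Fintype.card_fin, nsmul_eq_mul]

end evl
end SPcat
end

open scoped unitInterval Topology
open MeasureTheory
noncomputable section
namespace SPcat

section argtools

lemma eq_zero_of_angle {x : ℝ} (h : (x : Real.Angle) = 0) (hx : |x| < 2 * Real.pi) : x = 0 := by
  rw [← Real.Angle.coe_zero, Real.Angle.angle_eq_iff_two_pi_dvd_sub] at h
  obtain ⟨k, hk⟩ := h
  rw [sub_zero] at hk
  have hp := Real.pi_pos
  rw [hk, abs_mul, abs_of_pos (by positivity : 0 < 2 * Real.pi)] at hx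
  have : |(k : ℝ)| < 1 := by
    by_contra hc
    push Not at hc
    nlinarith
  have h2 : |k| < 1 := by exact_mod_cast this
  have h3 : k = 0 := Int.abs_lt_one_iff.1 h2
  rw [hk, h3]; simp

variable {X : Type*} [TopologicalSpace X]

lemma arg_near {W : Type*} [TopologicalSpace W] {g : W → ℂ} {w : W} (hg : ContinuousAt g w)
    {c : ℝ} (hc : 0 < c) (hw : g w = c) {ε : ℝ} (hε : 0 < ε) :
    ∀ᶠ x in 𝓝 w, |Complex.arg (g x)| < ε ∧ g x ≠ 0 := by
  have h1 : ContinuousAt (fun x => Complex.arg (g x)) w := by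
    have h0 : ContinuousAt Complex.arg (g w) := by
      apply Complex.continuousAt_arg
      rw [hw]
      exact Or.inl (by simpa using hc)
    exact ContinuousAt.comp (g := Complex.arg) h0 hg
  have h2 : Complex.arg (g w) = 0 := by rw [hw]; exact Complex.arg_ofReal_of_nonneg hc.le
  have h3 : ∀ᶠ x in 𝓝 w, |Complex.arg (g x)| < ε := by
    have h4 : ContinuousAt (fun x => |Complex.arg (g x)|) w := h1.abs
    apply h4.eventually_lt continuousAt_const
    rw [h2]; simpa using hε
  have h4 : ∀ᶠ x in 𝓝 w, g x ≠ 0 := by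
    apply hg.eventually_ne
    rw [hw]; exact_mod_cast hc.ne'
  exact h3.and h4

lemma small3 {x0 : X} {P : X → X → X → Prop}
    (h : ∀ᶠ q in 𝓝 (x0, x0, x0), P q.1 q.2.1 q.2.2) :
    ∀ᶠ V in (𝓝 x0).smallSets, ∀ x ∈ V, ∀ y ∈ V, ∀ z ∈ V, P x y z := by
  rw [nhds_prod_eq, nhds_prod_eq] at h
  obtain ⟨t1, ht1, t2, ht2, h12⟩ := Filter.mem_prod_iff.1 h
  obtain ⟨t3, ht3, t4, ht4, h34⟩ := Filter.mem_prod_iff.1 ht2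
  rw [Filter.eventually_smallSets]
  refine ⟨t1 ∩ (t3 ∩ t4), Filter.inter_mem ht1 (Filter.inter_mem ht3 ht4), ?_⟩
  intro V hV x hx y hy z hz
  have : (x, y, z) ∈ t1 ×ˢ t2 := ⟨(hV hx).1, h34 ⟨(hV hy).2.1, (hV hz).2.2⟩⟩
  exact h12 this

lemma small_comap {W : Type*} [TopologicalSpace W] {f : W → X} {w : W} (hf : ContinuousAt f w)
    {P : X → X → X → X → Prop}
    (h : ∀ᶠ V in (𝓝 (f w)).smallSets, ∀ x ∈ V, ∀ y ∈ V, ∀ z ∈ V, ∀ u ∈ V, P x y z u) :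
    ∀ᶠ V in (𝓝 w).smallSets, ∀ x ∈ V, ∀ y ∈ V, ∀ z ∈ V, ∀ u ∈ V, P (f x) (f y) (f z) (f u) := by
  rw [Filter.eventually_smallSets] at h ⊢
  obtain ⟨s, hs, h⟩ := h
  refine ⟨f ⁻¹' s, hf hs, ?_⟩
  intro V hV x hx y hy z hz u hu
  exact h s le_rfl _ (hV hx) _ (hV hy) _ (hV hz) _ (hV hu)

/-- hermitian pairing -/
def hh {ι : Type*} [Fintype ι] (v w : ι → ℂ) : ℂ := ∑ i, (starRingEnd ℂ) (v i) * w i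

lemma hh_conj {ι : Type*} [Fintype ι] (v w : ι → ℂ) : (starRingEnd ℂ) (hh v w) = hh w v := by
  simp only [hh, map_sum, map_mul, Complex.conj_conj]
  exact Finset.sum_congr rfl fun i _ => mul_comm _ _

lemma hh_self {ι : Type*} [Fintype ι] (v : ι → ℂ) : hh v v = ((∑ i, ‖v i‖ ^ 2 : ℝ) : ℂ) := by
  simp only [hh]
  push_cast
  refine Finset.sum_congr rfl fun i _ => ?_
  rw [mul_comm, Complex.mul_conj, Complex.normSq_eq_norm_sq]
  push_cast; rfl

lemma hh_self_pos {ι : Type*} [Fintype ι] {v : ι → ℂ} (hv : v ≠ 0) : 0 < ∑ i, ‖v i‖ ^ 2 := by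
  obtain ⟨i, hi⟩ := Function.ne_iff.1 hv
  refine Finset.sum_pos' (fun _ _ => by positivity) ⟨i, Finset.mem_univ _, ?_⟩
  have : v i ≠ 0 := hi
  positivity

/-- trace of a triple product -/
def tr3 {ι : Type*} [Fintype ι] (P Q R : ι → ι → ℂ) : ℂ := ∑ i, ∑ j, ∑ k, P i j * Q j k * R k i

lemma tr3_eq {ι : Type*} [Fintype ι] (u v w : ι → ℂ) :
    tr3 (fun i j => u i * (starRingEnd ℂ) (u j)) (fun i j => v i * (starRingEnd ℂ) (v j))
      (fun i j => w i * (starRingEnd ℂ) (w j)) = hh u v * hh v w * hh w u := by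
  simp only [tr3, hh, Finset.sum_mul, Finset.mul_sum]
  refine Finset.sum_congr rfl fun i _ => ?_
  rw [Finset.sum_comm]
  refine Finset.sum_congr rfl fun j _ => Finset.sum_congr rfl fun k _ => ?_
  ring

/-- the two-cocycle of a rank one projection-valued function -/
def A3 {ι : Type*} [Fintype ι] (P : X → ι → ι → ℂ) (x y z : X) : ℝ :=
  Complex.arg (tr3 (P x) (P y) (P z))

/-- rank one property -/
def Rk1 {ι : Type*} [Fintype ι] (P : X → ι → ι → ℂ) : Prop :=
  Continuous P ∧ ∀ x, ∃ v : ι → ℂ, v ≠ 0 ∧ P x = fun i j => v i * (starRingEnd ℂ) (v j)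

lemma tr3_diag_pos {ι : Type*} [Fintype ι] {v : ι → ℂ} (hv : v ≠ 0) :
    ∃ c : ℝ, 0 < c ∧ hh v v * hh v v * hh v v = c := by
  refine ⟨(∑ i, ‖v i‖ ^ 2) ^ 3, by have := hh_self_pos hv; positivity, ?_⟩
  rw [hh_self]; push_cast; ring

lemma A3_small {ι : Type*} [Fintype ι] {P : X → ι → ι → ℂ} (hP : Rk1 P) (x0 : X) {ε : ℝ}
    (hε : 0 < ε) : ∀ᶠ V in (𝓝 x0).smallSets, ∀ x ∈ V, ∀ y ∈ V, ∀ z ∈ V,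
      |A3 P x y z| < ε ∧ tr3 (P x) (P y) (P z) ≠ 0 := by
  apply small3 (P := fun x y z => |A3 P x y z| < ε ∧ tr3 (P x) (P y) (P z) ≠ 0)
  obtain ⟨v, hv, hPv⟩ := hP.2 x0
  obtain ⟨c, hc, hcv⟩ := tr3_diag_pos hv
  have hcont : Continuous (fun q : X × X × X => tr3 (P q.1) (P q.2.1) (P q.2.2)) := by
    have h := hP.1
    have hij : ∀ i j, Continuous fun x => P x i j := fun i j =>
      (continuous_apply j).comp ((continuous_apply i).comp h)
    unfold tr3
    refine continuous_finsetSum _ fun i _ => continuous_finsetSum _ fun j _ =>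
      continuous_finsetSum _ fun k _ => ?_
    exact (((hij i j).comp continuous_fst).mul ((hij j k).comp (continuous_fst.comp continuous_snd))).mul
      ((hij k i).comp (continuous_snd.comp continuous_snd))
  refine arg_near hcont.continuousAt hc ?_ hε
  simp only [hPv]
  rw [tr3_eq, hcv]

lemma ang_tr3 {ι : Type*} [Fintype ι] {u v w : ι → ℂ} (h1 : hh u v ≠ 0) (h2 : hh v w ≠ 0)
    (h3 : hh w u ≠ 0) : ((Complex.arg (hh u v * hh v w * hh w u) : ℝ) : Real.Angle) =
      (Complex.arg (hh u v) : Real.Angle) + (Complex.arg (hh v w) : Real.Angle)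
        - (Complex.arg (hh u w) : Real.Angle) := by
  rw [Complex.arg_mul_coe_angle (mul_ne_zero h1 h2) h3, Complex.arg_mul_coe_angle h1 h2,
    ← hh_conj u w, Complex.arg_conj_coe_angle]
  abel

lemma A3_cocycle {ι : Type*} [Fintype ι] {P : X → ι → ι → ℂ} (hP : Rk1 P) (x0 : X) :
    ∀ᶠ V in (𝓝 x0).smallSets, ∀ x ∈ V, ∀ y ∈ V, ∀ z ∈ V, ∀ w ∈ V,
      A3 P y z w - A3 P x z w + A3 P x y w - A3 P x y z = 0 := by
  filter_upwards [A3_small hP x0 (ε := Real.pi / 2) (by positivity)] with V hV x hx y hy z hz w hw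
  obtain ⟨vx, _, hvx⟩ := hP.2 x
  obtain ⟨vy, _, hvy⟩ := hP.2 y
  obtain ⟨vz, _, hvz⟩ := hP.2 z
  obtain ⟨vw, _, hvw⟩ := hP.2 w
  obtain ⟨b1, n1⟩ := hV y hy z hz w hw
  obtain ⟨b2, n2⟩ := hV x hx z hz w hw
  obtain ⟨b3, n3⟩ := hV x hx y hy w hw
  obtain ⟨b4, n4⟩ := hV x hx y hy z hz
  simp only [A3] at *
  rw [hvx, hvy, hvz, hvw] at *
  rw [tr3_eq] at *
  have m : ∀ {a b c : ℂ}, a * b * c ≠ 0 → a ≠ 0 ∧ b ≠ 0 ∧ c ≠ 0 := fun h =>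
    ⟨left_ne_zero_of_mul (left_ne_zero_of_mul h), right_ne_zero_of_mul (left_ne_zero_of_mul h),
      right_ne_zero_of_mul h⟩
  obtain ⟨p1, p2, p3⟩ := m n1
  obtain ⟨q1, q2, q3⟩ := m n2
  obtain ⟨r1, r2, r3⟩ := m n3
  obtain ⟨s1, s2, s3⟩ := m n4
  apply eq_zero_of_angle
  · rw [tr3_eq, tr3_eq, tr3_eq, Real.Angle.coe_sub, Real.Angle.coe_add, Real.Angle.coe_sub,
      ang_tr3 p1 p2 p3, ang_tr3 q1 q2 q3, ang_tr3 r1 r2 r3, ang_tr3 s1 s2 s3]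
    abel
  · rw [tr3_eq, tr3_eq, tr3_eq]
    rw [abs_lt] at *
    constructor <;> linarith

lemma A3_deg1 {ι : Type*} [Fintype ι] {P : X → ι → ι → ℂ} (hP : Rk1 P) (x z : X) :
    A3 P x x z = 0 ∧ A3 P x z z = 0 := by
  obtain ⟨v, _, hv⟩ := hP.2 x
  obtain ⟨w, _, hw⟩ := hP.2 z
  simp only [A3, hv, hw]
  rw [tr3_eq, tr3_eq]
  have key : hh v w * hh w v = ((‖hh v w‖ ^ 2 : ℝ) : ℂ) := by
    rw [← hh_conj v w, Complex.mul_conj, Complex.normSq_eq_norm_sq]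
  constructor
  · rw [mul_assoc, key, hh_self, ← Complex.ofReal_mul]
    exact Complex.arg_ofReal_of_nonneg (by positivity)
  · rw [mul_right_comm, key, hh_self, ← Complex.ofReal_mul]
    exact Complex.arg_ofReal_of_nonneg (by positivity)

/-- the one-cocycle of a circle valued function -/
def A2 (F : X → ℂ) (x y : X) : ℝ := Complex.arg ((starRingEnd ℂ) (F x) * F y)

/-- circle valued -/
def Cv (F : X → ℂ) : Prop := Continuous F ∧ ∀ x, ‖F x‖ = 1

lemma Cv.ne {F : X → ℂ} (hF : Cv F) (x : X) : F x ≠ 0 := by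
  have := hF.2 x
  intro h; rw [h] at this; simp at this

lemma A2_self {F : X → ℂ} (hF : Cv F) (x : X) : A2 F x x = 0 := by
  unfold A2
  rw [mul_comm, Complex.mul_conj, Complex.normSq_eq_norm_sq, hF.2]; simp

lemma A2_ang {F : X → ℂ} (hF : Cv F) (x y : X) : ((A2 F x y : ℝ) : Real.Angle) =
    (Complex.arg (F y) : Real.Angle) - (Complex.arg (F x) : Real.Angle) := by
  unfold A2
  rw [Complex.arg_mul_coe_angle (by simpa using hF.ne x) (hF.ne y), Complex.arg_conj_coe_angle]
  abel

lemma A2_small {F : X → ℂ} (hF : Cv F) (x0 : X) {ε : ℝ} (hε : 0 < ε) :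
    ∀ᶠ V in (𝓝 x0).smallSets, ∀ x ∈ V, ∀ y ∈ V, |A2 F x y| < ε := by
  have := small3 (x0 := x0) (P := fun x y _ => |A2 F x y| < ε) (by
    have hc : Continuous (fun q : X × X × X => (starRingEnd ℂ) (F q.1) * F q.2.1) :=
      (Complex.continuous_conj.comp (hF.1.comp continuous_fst)).mul
        (hF.1.comp (continuous_fst.comp continuous_snd))
    refine (arg_near hc.continuousAt one_pos ?_ hε).mono fun q hq => hq.1
    simp only
    rw [mul_comm, Complex.mul_conj, Complex.normSq_eq_norm_sq, hF.2]; simp)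
  filter_upwards [this] with V hV x hx y hy
  exact hV x hx y hy y hy

lemma A2_cocycle {F : X → ℂ} (hF : Cv F) (x0 : X) :
    ∀ᶠ V in (𝓝 x0).smallSets, ∀ x ∈ V, ∀ y ∈ V, ∀ z ∈ V,
      A2 F y z - A2 F x z + A2 F x y = 0 := by
  filter_upwards [A2_small hF x0 (ε := Real.pi / 2) (by positivity)] with V hV x hx y hy z hz
  have b1 := hV y hy z hz
  have b2 := hV x hx z hz
  have b3 := hV x hx y hy
  apply eq_zero_of_angle
  · rw [Real.Angle.coe_add, Real.Angle.coe_sub, A2_ang hF, A2_ang hF, A2_ang hF]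
    abel
  · rw [abs_lt] at *
    constructor <;> linarith [Real.pi_pos]

end argtools

section prism
variable {X : Type*} [TopologicalSpace X]

/-- uniform time step -/
lemma time_step {h : ℝ → X → X} {U : Set X} (hU : IsOpen U)
    (hc : ∀ x ∈ U, ∀ t ∈ Set.Icc (0 : ℝ) 1, ContinuousWithinAt (fun q : ℝ × X => h q.1 q.2) (Set.Icc 0 1 ×ˢ Set.univ) (t, x))
    {G : Set X → Prop} (hG : ∀ s t, s ⊆ t → G t → G s)
    (hloc : ∀ x, ∀ᶠ V in (𝓝 x).smallSets, G V) {K : Set X} (hK : IsCompact K) (hKU : K ⊆ U) :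
    ∃ T0 : ℕ, ∀ T : ℕ, T0 ≤ T → 0 < T → ∀ x ∈ K, ∃ O ∈ 𝓝 x, ∀ i < T,
      G ((fun q : ℝ × X => h q.1 q.2) '' (Set.Icc ((i : ℝ) / T) ((i + 1 : ℝ) / T) ×ˢ O)) := by
  refine hK.induction_on (p := fun K => ∃ T0 : ℕ, ∀ T : ℕ, T0 ≤ T → 0 < T → ∀ x ∈ K, ∃ O ∈ 𝓝 x,
    ∀ i < T, G ((fun q : ℝ × X => h q.1 q.2) '' (Set.Icc ((i : ℝ) / T) ((i + 1 : ℝ) / T) ×ˢ O))) ?_ ?_ ?_ ?_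
  · exact ⟨0, fun T _ _ x hx => hx.elim⟩
  · rintro s t hst ⟨T0, h0⟩
    exact ⟨T0, fun T hT hp x hx => h0 T hT hp x (hst hx)⟩
  · rintro s t ⟨T0, h0⟩ ⟨T1, h1⟩
    refine ⟨max T0 T1, fun T hT hp x hx => ?_⟩
    rcases hx with hx | hx
    · exact h0 T (le_trans (le_max_left _ _) hT) hp x hx
    · exact h1 T (le_trans (le_max_right _ _) hT) hp x hx
  · intro x hx
    have hxU := hKU hx
    -- local boxes
    have hbox : ∀ t ∈ Set.Icc (0 : ℝ) 1, ∃ A O, IsOpen A ∧ t ∈ A ∧ IsOpen O ∧ x ∈ O ∧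
        G ((fun q : ℝ × X => h q.1 q.2) '' ((A ∩ Set.Icc 0 1) ×ˢ O)) := by
      intro t ht
      obtain ⟨V, hV, hGV⟩ := Filter.eventually_smallSets.1 (hloc (h t x))
      have := hc x hxU t ht hV
      rw [Filter.mem_map, mem_nhdsWithin] at this
      obtain ⟨B, hBo, hBm, hB⟩ := this
      obtain ⟨A, O, hA, hO, htA, hxO, hAO⟩ := isOpen_prod_iff.1 hBo t x hBm
      refine ⟨A, O, hA, htA, hO, hxO, hG _ V ?_ (hGV V le_rfl)⟩
      rintro _ ⟨⟨t', y⟩, ⟨⟨h1, h2⟩, h3⟩, rfl⟩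
      exact hB ⟨hAO ⟨h1, h3⟩, ⟨h2, Set.mem_univ _⟩⟩
    choose! A O hA htA hO hxO hGb using hbox
    obtain ⟨b, hb1, hb2, hb3⟩ := isCompact_Icc (a := (0 : ℝ)) (b := 1).elim_finite_subcover_image
      (b := Set.Icc (0 : ℝ) 1) (c := A) (fun t ht => hA t ht)
      (fun t ht => Set.mem_biUnion ht (htA t ht))
    obtain ⟨δ, hδ, hleb⟩ := lebesgue_number_lemma_of_metric (s := Set.Icc (0 : ℝ) 1)
      (c := fun t : b => A t) isCompact_Icc (fun t => hA t (hb1 t.2)) (by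
        intro t ht
        obtain ⟨i, hi, hti⟩ := Set.mem_iUnion₂.1 (hb3 ht)
        exact Set.mem_iUnion.2 ⟨⟨i, hi⟩, hti⟩)
    have hOb : IsOpen (⋂ t ∈ b, O t) := hb2.isOpen_biInter fun t ht => hO t (hb1 ht)
    refine ⟨⋂ t ∈ b, O t, mem_nhdsWithin_of_mem_nhds (hOb.mem_nhds ?_), ?_⟩
    · exact Set.mem_iInter₂.2 fun t ht => hxO t (hb1 ht)
    obtain ⟨T0, hT0⟩ := exists_nat_gt (1 / δ)
    refine ⟨T0, fun T hT hp y hy => ⟨⋂ t ∈ b, O t, hOb.mem_nhds hy, fun i hi => ?_⟩⟩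
    have hTp : (0 : ℝ) < T := by exact_mod_cast hp
    have hi' : ((i : ℝ) + 1) ≤ T := by exact_mod_cast hi
    have hiI : (i : ℝ) / T ∈ Set.Icc (0 : ℝ) 1 :=
      ⟨by positivity, by rw [div_le_one hTp]; linarith⟩
    obtain ⟨t, ht⟩ := hleb _ hiI
    refine hG _ _ (Set.image_mono ?_) (hGb t (hb1 t.2))
    rintro ⟨t', z⟩ ⟨⟨h1, h2⟩, h3⟩
    simp only at h1 h2 h3
    have hle1 : ((i : ℝ) + 1) / T ≤ 1 := by rw [div_le_one hTp]; linarith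
    refine ⟨⟨ht ?_, ⟨hiI.1.trans h1, h2.trans hle1⟩⟩, Set.mem_iInter₂.1 h3 t t.2⟩
    rw [Metric.mem_ball, Real.dist_eq, abs_of_nonneg (by linarith)]
    have : ((i : ℝ) + 1) / T - i / T = 1 / T := by ring
    have h4 : (1 : ℝ) / T < δ := by
      rw [div_lt_iff₀ hTp]
      have : (1 / δ) < T := lt_of_lt_of_le hT0 (by exact_mod_cast hT)
      rw [div_lt_iff₀ hδ] at this
      linarith
    linarith

/-- primitive for one-cocycles -/
def pr1 (f : X → X → ℝ) (h : ℝ → X → X) (T : ℕ) (x : X) : ℝ :=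
  ∑ i ∈ Finset.range T, f (h (i / T) x) (h ((i + 1 : ℕ) / T) x)

/-- primitive for two-cocycles -/
def pr2 (f : X → X → X → ℝ) (h : ℝ → X → X) (T : ℕ) (x y : X) : ℝ :=
  ∑ i ∈ Finset.range T, (f (h (i / T) x) (h ((i + 1 : ℕ) / T) x) (h ((i + 1 : ℕ) / T) y)
    - f (h (i / T) x) (h (i / T) y) (h ((i + 1 : ℕ) / T) y))

lemma pr1_spec {f : X → X → ℝ} {h : ℝ → X → X} {T : ℕ} (hT : 0 < T) {x y c : X}
    (h0x : h 0 x = x) (h0y : h 0 y = y) (h1x : h 1 x = c) (h1y : h 1 y = c) (hcc : f c c = 0)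
    (hco : ∀ i < T, ∃ V : Set X, (∀ x ∈ V, ∀ y ∈ V, ∀ z ∈ V, f y z - f x z + f x y = 0) ∧
      h ((i : ℝ) / T) x ∈ V ∧ h ((i : ℝ) / T) y ∈ V ∧ h (((i + 1 : ℕ) : ℝ) / T) x ∈ V ∧
      h (((i + 1 : ℕ) : ℝ) / T) y ∈ V) :
    f x y = pr1 f h T x - pr1 f h T y := by
  have key := Finset.sum_range_sub (fun i : ℕ => f (h ((i : ℝ) / T) x) (h ((i : ℝ) / T) y)) T
  have hTT : ((T : ℝ)) / T = 1 := div_self (by exact_mod_cast hT.ne')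
  simp only [hTT, h1x, h1y, hcc] at key
  rw [Nat.cast_zero, zero_div, h0x, h0y] at key
  unfold pr1
  rw [← Finset.sum_sub_distrib]
  have : ∑ i ∈ Finset.range T, (f (h (i / T) x) (h ((i + 1 : ℕ) / T) x) -
      f (h (i / T) y) (h ((i + 1 : ℕ) / T) y)) = - ∑ i ∈ Finset.range T,
      (f (h (((i + 1 : ℕ) : ℝ) / T) x) (h (((i + 1 : ℕ) : ℝ) / T) y) - f (h ((i : ℝ) / T) x) (h ((i : ℝ) / T) y)) := by
    rw [← Finset.sum_neg_distrib]
    apply Finset.sum_congr rfl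
    intro i hi
    obtain ⟨V, hV, a1, a2, a3, a4⟩ := hco i (Finset.mem_range.1 hi)
    have e1 := hV _ a1 _ a3 _ a4
    have e2 := hV _ a1 _ a2 _ a4
    linarith
  rw [this, key]; ring

lemma pr2_spec {f : X → X → X → ℝ} {h : ℝ → X → X} {T : ℕ} (hT : 0 < T) {x y z c : X}
    (h0x : h 0 x = x) (h0y : h 0 y = y) (h0z : h 0 z = z)
    (h1x : h 1 x = c) (h1y : h 1 y = c) (h1z : h 1 z = c) (hcc : f c c c = 0)
    (hco : ∀ i < T, ∃ V : Set X, (∀ x ∈ V, ∀ y ∈ V, ∀ z ∈ V, ∀ w ∈ V,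
        f y z w - f x z w + f x y w - f x y z = 0) ∧
      h ((i : ℝ) / T) x ∈ V ∧ h ((i : ℝ) / T) y ∈ V ∧ h ((i : ℝ) / T) z ∈ V ∧
      h (((i + 1 : ℕ) : ℝ) / T) x ∈ V ∧
      h (((i + 1 : ℕ) : ℝ) / T) y ∈ V ∧ h (((i + 1 : ℕ) : ℝ) / T) z ∈ V) :
    f x y z = - (pr2 f h T y z - pr2 f h T x z + pr2 f h T x y) := by
  have key := Finset.sum_range_sub
    (fun i : ℕ => f (h ((i : ℝ) / T) x) (h ((i : ℝ) / T) y) (h ((i : ℝ) / T) z)) T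
  have hTT : ((T : ℝ)) / T = 1 := div_self (by exact_mod_cast hT.ne')
  simp only [hTT, h1x, h1y, h1z, hcc] at key
  rw [Nat.cast_zero, zero_div, h0x, h0y, h0z] at key
  unfold pr2
  rw [← Finset.sum_sub_distrib, ← Finset.sum_add_distrib]
  rw [eq_neg_iff_add_eq_zero, add_comm, ← eq_neg_iff_add_eq_zero, ← zero_sub (f x y z), ← key]
  apply Finset.sum_congr rfl
  intro i hi
  obtain ⟨V, hV, a1, a2, a3, a4, a5, a6⟩ := hco i (Finset.mem_range.1 hi)
  have e1 := hV _ a1 _ a4 _ a5 _ a6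
  have e2 := hV _ a1 _ a2 _ a5 _ a6
  have e3 := hV _ a1 _ a2 _ a3 _ a6
  linarith

end prism
end SPcat
end

open scoped unitInterval Topology
open MeasureTheory
noncomputable section
namespace SPcat

section assembly

lemma fc_fc {Y : Type*} {m l : ℕ} (h : m ≤ l) (s : ℕ → Y) :
    fc m (fc (l + 1) s) = fc l (fc m s) := by
  funext i
  simp only [fc]
  split_ifs <;> first | rfl | omega

lemma dl_dl0 {Y : Type*} (b : (ℕ → Y) → ℝ) (s : ℕ → Y) : dl 1 (dl 0 b) s = 0 := by
  simp only [dl, Finset.sum_range_succ, Finset.sum_range_zero]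
  rw [fc_fc (le_refl 0), fc_fc (show 0 ≤ 1 by omega), fc_fc (show 1 ≤ 1 by omega)]
  ring

lemma dl_dl1 {Y : Type*} (b : (ℕ → Y) → ℝ) (s : ℕ → Y) : dl 2 (dl 1 b) s = 0 := by
  simp only [dl, Finset.sum_range_succ, Finset.sum_range_zero]
  rw [fc_fc (le_refl 0), fc_fc (show 0 ≤ 1 by omega), fc_fc (show 1 ≤ 1 by omega),
    fc_fc (show 0 ≤ 2 by omega), fc_fc (show 1 ≤ 2 by omega), fc_fc (show 2 ≤ 2 by omega)]
  ring

/-- property of sequences close to a point -/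
def Loc {Y : Type*} [TopologicalSpace Y] (y : Y) (Q : (ℕ → Y) → Prop) : Prop :=
  ∃ V ∈ 𝓝 y, ∀ s : ℕ → Y, (∀ i, s i ∈ V) → Q s

lemma Loc.and {Y : Type*} [TopologicalSpace Y] {y : Y} {Q Q' : (ℕ → Y) → Prop} (h : Loc y Q)
    (h' : Loc y Q') : Loc y (fun s => Q s ∧ Q' s) := by
  obtain ⟨V, hV, h⟩ := h
  obtain ⟨V', hV', h'⟩ := h'
  exact ⟨V ∩ V', Filter.inter_mem hV hV', fun s hs => ⟨h s fun i => (hs i).1, h' s fun i => (hs i).2⟩⟩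

lemma Loc.mono {Y : Type*} [TopologicalSpace Y] {y : Y} {Q Q' : (ℕ → Y) → Prop} (h : Loc y Q)
    (hQ : ∀ s, Q s → Q' s) : Loc y Q' := by
  obtain ⟨V, hV, h⟩ := h
  exact ⟨V, hV, fun s hs => hQ _ (h s hs)⟩

lemma Loc.all {Y : Type*} [TopologicalSpace Y] {y : Y} {ι : Type*} [Finite ι]
    {Q : ι → (ℕ → Y) → Prop} (h : ∀ i, Loc y (Q i)) : Loc y (fun s => ∀ i, Q i s) := by
  choose V hV h using h
  exact ⟨⋂ i, V i, Filter.iInter_mem.2 hV, fun s hs i => h i s fun k => Set.mem_iInter.1 (hs k) i⟩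

lemma Loc.reindex {Y : Type*} [TopologicalSpace Y] {y : Y} {Q : (ℕ → Y) → Prop} (h : Loc y Q) :
    Loc y (fun s => ∀ ρ : ℕ → ℕ, Q (s ∘ ρ)) := by
  obtain ⟨V, hV, h⟩ := h
  exact ⟨V, hV, fun s hs ρ => h _ fun i => hs (ρ i)⟩

lemma Loc.comap {Y X : Type*} [TopologicalSpace Y] [TopologicalSpace X] {f : Y → X}
    (hf : Continuous f) {y : Y} {Q : (ℕ → X) → Prop} (h : Loc (f y) Q) :
    Loc y (fun s => Q (fun i => f (s i))) := by
  obtain ⟨V, hV, h⟩ := h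
  exact ⟨f ⁻¹' V, hf.continuousAt hV, fun s hs => h _ hs⟩

lemma Loc.grid {Y : Type*} [TopologicalSpace Y] {d : ℕ} {E : Type*} [Finite E]
    {S : E → (Fin d → ℝ) → Y} (hS : ∀ e, Continuous (S e)) {Q : (ℕ → Y) → Prop}
    (h : ∀ e, ∀ z ∈ Set.Icc (0 : Fin d → ℝ) 1, Loc (S e z) Q) :
    ∃ N0 : ℕ, ∀ N ≥ N0, 0 < N → ∀ s ∈ cellSeq S N, Q s := by
  have h1 : ∀ e, ∃ N0 : ℕ, ∀ N ≥ N0, 0 < N → ∀ (p : Fin d → Fin N) (ζ : ℕ → Fin d → ℝ),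
    (∀ l δ, ((p δ : ℕ) : ℝ) / N ≤ ζ l δ ∧ ζ l δ ≤ (((p δ : ℕ) : ℝ) + 1) / N) →
      Q fun l => S e (ζ l) := by
    intro e
    have h2 : ∀ z : Set.Icc (0 : Fin d → ℝ) 1, ∃ O : Set (Fin d → ℝ), IsOpen O ∧ z.1 ∈ O ∧
        ∀ ζ : ℕ → Fin d → ℝ, (∀ l, ζ l ∈ O) → Q fun l => S e (ζ l) := by
      rintro ⟨z, hz⟩
      obtain ⟨V, hV, hQ⟩ := (h e z hz).comap (hS e)
      obtain ⟨O, hO, h3, h4⟩ := mem_nhds_iff.1 hV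
      exact ⟨O, h3, h4, fun ζ hζ => hQ ζ fun i => hO (hζ i)⟩
    choose O hO hzO hQ using h2
    obtain ⟨δ, hδ, hleb⟩ := lebesgue_number_lemma_of_metric (s := Set.Icc (0 : Fin d → ℝ) 1)
      (c := O) isCompact_Icc hO (fun z hz => Set.mem_iUnion.2 ⟨⟨z, hz⟩, hzO ⟨z, hz⟩⟩)
    obtain ⟨N0, hN0⟩ := exists_nat_gt (1 / δ)
    refine ⟨N0, fun N hN hp p ζ hζ => ?_⟩
    have hNp : (0 : ℝ) < N := by exact_mod_cast hp
    have hz0 : ζ 0 ∈ Set.Icc (0 : Fin d → ℝ) 1 := by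
      constructor <;> intro i
      · exact le_trans (by positivity) (hζ 0 i).1
      · refine (hζ 0 i).2.trans ?_
        rw [div_le_iff₀ hNp]
        have : ((p i : ℕ) : ℝ) + 1 ≤ N := by exact_mod_cast (p i).2
        simpa using this
    obtain ⟨z, hz⟩ := hleb _ hz0
    refine hQ z ζ fun l => hz ?_
    rw [Metric.mem_ball, dist_pi_lt_iff hδ]
    intro i
    have h4 : (1 : ℝ) / N < δ := by
      rw [div_lt_iff₀ hNp]
      have : (1 / δ) < N := lt_of_lt_of_le hN0 (by exact_mod_cast hN)
      rw [div_lt_iff₀ hδ] at this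
      linarith
    have e1 : (((p i : ℕ) : ℝ) + 1) / N = ((p i : ℕ) : ℝ) / N + 1 / N := by ring
    rw [Real.dist_eq, abs_lt]
    constructor <;> linarith [(hζ 0 i).1, (hζ 0 i).2, (hζ l i).1, (hζ l i).2]
  choose N0 hN0 using h1
  obtain ⟨N1, hN1⟩ := Finite.exists_le (fun e => N0 e)
  refine ⟨N1, fun N hN hp s hs => ?_⟩
  obtain ⟨e, p, ζ, hζ, rfl⟩ := hs
  exact hN0 e N ((hN1 e).trans hN) hp p ζ hζ

/-- good classes -/
structure GCls {X Y : Type*} [TopologicalSpace X] [TopologicalSpace Y] (π : Y → X)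
    (deg : ℕ) (x : (ℕ → Y) → ℝ) : Prop where
  dle : deg ≤ 1
  dx : IsDeg (deg + 1) x
  cx : ∀ y, Loc y (fun s => dl (deg + 1) x s = 0)
  null : ∀ U, IsOpen U → (inclMap U).Nullhomotopic → ∀ K, IsCompact K → K ⊆ U →
    ∃ b, IsDeg deg b ∧ ∀ y, π y ∈ K → Loc y (fun s => x s = dl deg b s)

lemma dl_sub {Y : Type*} (p : ℕ) (f g : (ℕ → Y) → ℝ) (s : ℕ → Y) :
    dl p (fun s => f s - g s) s = dl p f s - dl p g s := by
  simp only [dl, mul_sub, Finset.sum_sub_distrib]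

lemma IsDeg.sub {Y : Type*} {p : ℕ} {f g : (ℕ → Y) → ℝ} (hf : IsDeg p f) (hg : IsDeg p g) :
    IsDeg p (fun s => f s - g s) := by
  intro x y h
  show f x - g x = f y - g y
  rw [hf x y h, hg x y h]

theorem lower_main {X Y : Type*} [TopologicalSpace X] [TopologicalSpace Y] {π : Y → X}
    (hπ : Continuous π) {E : Type*} [Fintype E] {d0 : ℕ} (w : E → ℝ)
    (S : E → (Fin (d0 + 1) → ℝ) → Y) (hS : ∀ e, Continuous (S e))
    (HB : ∀ (δ : Fin (d0 + 1)) (Φ : ((Fin (d0 + 1) → ℝ) → Y) → ℝ),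
      ∑ e, w e * (Φ (fun z => S e (Function.update z δ 1))
        - Φ (fun z => S e (Function.update z δ 0))) = 0)
    (l : List (ℕ × ((ℕ → Y) → ℝ))) (hl : ∀ c ∈ l, GCls π c.1 c.2)
    (pr : (ℕ → Y) → ℝ)
    (hpr : ∀ L : List (Cls Y), L.map (fun c => (c.deg, c.x)) = l → prodX L = pr)
    (hd : (l.map (fun c => c.1 + 1)).sum = d0 + 1)
    (hJ : ∃ N0 : ℕ, ∀ N ≥ N0, kJ w S N pr ≠ 0)
    {r : ℕ} (hcat : catLE X r) : l.length ≤ r := by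
  by_contra hr
  push Not at hr
  obtain ⟨U, hUo, hUc, hUn⟩ := hcat
  -- compact sets
  have hcov : ∀ e, ∃ K : Fin (r + 1) → Set (Fin (d0 + 1) → ℝ), (∀ i, IsCompact (K i)) ∧
      (∀ i, K i ⊆ (fun z => π (S e z)) ⁻¹' U i) ∧ Set.Icc (0 : Fin (d0 + 1) → ℝ) 1 = ⋃ i, K i := by
    intro e
    obtain ⟨K, h1, h2, h3⟩ := (isCompact_Icc (a := (0 : Fin (d0 + 1) → ℝ)) (b := 1)).finite_compact_cover
      Finset.univ (fun i => (fun z => π (S e z)) ⁻¹' U i)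
      (fun i _ => (hUo i).preimage (hπ.comp (hS e))) (by
        intro z _
        have : π (S e z) ∈ ⋃ i, U i := by rw [hUc]; trivial
        simpa using this)
    exact ⟨K, h1, h2, by simpa using h3⟩
  choose K hK1 hK2 hK3 using hcov
  let KX : Fin (r + 1) → Set X := fun i => ⋃ e, (fun z => π (S e z)) '' K e i
  have hKXc : ∀ i, IsCompact (KX i) := fun i =>
    isCompact_iUnion fun e => (hK1 e i).image (hπ.comp (hS e))
  have hKXU : ∀ i, KX i ⊆ U i := by
    intro i x hx
    obtain ⟨e, z, hz, rfl⟩ := Set.mem_iUnion.1 hx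
    exact hK2 e i hz
  have hKX : ∀ e, ∀ z ∈ Set.Icc (0 : Fin (d0 + 1) → ℝ) 1, ∃ i, π (S e z) ∈ KX i := by
    intro e z hz
    rw [hK3 e] at hz
    obtain ⟨i, hi⟩ := Set.mem_iUnion.1 hz
    exact ⟨i, Set.mem_iUnion.2 ⟨e, z, hi, rfl⟩⟩
  -- index of the class
  let ix : Fin l.length → Fin (r + 1) := fun i => ⟨min i r, by omega⟩
  have hb : ∀ i : Fin l.length, ∃ b, IsDeg (l.get i).1 b ∧
      ∀ y, π y ∈ KX (ix i) → Loc y (fun s => (l.get i).2 s = dl (l.get i).1 b s) := fun i =>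
    (hl _ (List.get_mem _ _)).null _ (hUo _) (hUn _) _ (hKXc _) (hKXU _)
  choose b hbd hbl using hb
  let cl : Fin l.length → Cls Y := fun i =>
    ⟨(l.get i).1, (l.get i).2, fun s => (l.get i).2 s - dl (l.get i).1 (b i) s, b i⟩
  let L : List (Cls Y) := List.ofFn cl
  have hL : L.map (fun c => (c.deg, c.x)) = l := by
    rw [List.map_ofFn]
    exact List.ofFn_get l
  have htot : totDeg L = d0 + 1 := by
    have h1 : ∀ L : List (Cls Y), totDeg L = (L.map (fun c => c.deg + 1)).sum := by
      intro L
      induction L with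
      | nil => rfl
      | cons a L ih => simp [totDeg, ih]
    rw [h1, ← hd]
    conv_rhs => rw [← hL]
    rw [List.map_map]
    rfl
  -- localization
  have hloc : ∀ e, ∀ z ∈ Set.Icc (0 : Fin (d0 + 1) → ℝ) 1, Loc (S e z) (fun s =>
      (∀ i, dl ((l.get i).1 + 1) (l.get i).2 s = 0) ∧
        ∃ i, ∀ ρ : ℕ → ℕ, (l.get i).2 (s ∘ ρ) = dl (l.get i).1 (b i) (s ∘ ρ)) := by
    intro e z hz
    obtain ⟨i, hi⟩ := hKX e z hz
    refine (Loc.all fun i => (hl _ (List.get_mem l i)).cx _).and ?_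
    have h1 : ix ⟨i, by omega⟩ = i := by
      apply Fin.ext
      have := i.2
      simp only [ix]; omega
    refine (hbl ⟨i, by omega⟩ _ (by rw [h1]; exact hi)).reindex.mono fun s hs => ⟨_, hs⟩
  obtain ⟨N0, hN0⟩ := Loc.grid hS hloc
  obtain ⟨N1, hN1⟩ := hJ
  have hN := hN0 (max (max N0 N1) 1) (by simp) (by simp)
  refine hN1 (max (max N0 N1) 1) (by simp) ?_
  rw [← hpr L hL]
  refine exchange_zero (S := cellSeq S (max (max N0 N1) 1)) (cellSeq_reindex _ _) d0 _
    (kJ_congr w S _) (kJ_add w S _) (kJ_smul w S _)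
    (fun f hf => kJ_stokes w S _ (by simp) HB f hf) L ?_ htot ?_
  · intro c hc
    obtain ⟨i, rfl⟩ := (List.mem_ofFn' _ _).1 hc
    have hg := hl _ (List.get_mem l i)
    refine ⟨hg.dx, hg.dx.sub (hbd i).dl, hbd i, fun s hs => (hN s hs).1 i, fun s hs => ?_, fun s hs => ?_⟩
    · show dl _ (fun s => (l.get i).2 s - dl (l.get i).1 (b i) s) s = 0
      rw [dl_sub]
      have h1 := (hN s hs).1 i
      show dl ((l.get i).1 + 1) _ s - dl ((l.get i).1 + 1) _ s = 0
      rw [h1, zero_sub, neg_eq_zero]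
      have h2 := hg.dle
      generalize (l.get i).1 = q at *
      interval_cases q
      · exact dl_dl0 _ _
      · exact dl_dl1 _ _
    · show (l.get i).2 s = (l.get i).2 s - dl (l.get i).1 (b i) s + dl (l.get i).1 (b i) s
      ring
  · intro s hs
    obtain ⟨i, hi⟩ := (hN s hs).2
    refine ⟨cl i, (List.mem_ofFn' _ _).2 ⟨i, rfl⟩, fun ρ => ?_⟩
    show (l.get i).2 (s ∘ ρ) - dl (l.get i).1 (b i) (s ∘ ρ) = 0
    rw [hi ρ, sub_self]

end assembly
end SPcat
end

open scoped unitInterval Topology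
open MeasureTheory
noncomputable section
namespace SPcat

section prims
variable {X : Type*} [TopologicalSpace X]

lemma null_h {U : Set X} (hU : IsOpen U) (hn : (inclMap U).Nullhomotopic) :
    ∃ (h : ℝ → X → X) (c : X), (∀ x ∈ U, h 0 x = x) ∧ (∀ x ∈ U, h 1 x = c) ∧
      ∀ x ∈ U, ∀ t ∈ Set.Icc (0 : ℝ) 1, ContinuousWithinAt (fun q : ℝ × X => h q.1 q.2)
        (Set.Icc 0 1 ×ˢ Set.univ) (t, x) := by
  classical
  obtain ⟨c, ⟨H⟩⟩ := hn
  refine ⟨fun τ y => if hy : y ∈ U then H (Set.projIcc 0 1 zero_le_one τ, ⟨y, hy⟩) else y, c,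
    ?_, ?_, ?_⟩
  · intro x hx
    simp only [hx, dif_pos]
    rw [Set.projIcc_left]
    exact H.apply_zero _
  · intro x hx
    simp only [hx, dif_pos]
    rw [Set.projIcc_right]
    exact H.apply_one _
  · intro x hx t _
    apply ContinuousAt.continuousWithinAt
    have hO : IsOpen (Set.univ ×ˢ U : Set (ℝ × X)) := isOpen_univ.prod hU
    apply ContinuousOn.continuousAt _ (hO.mem_nhds ⟨trivial, hx⟩)
    rw [continuousOn_iff_continuous_domRestrict]
    have : Set.domRestrict (Set.univ ×ˢ U : Set (ℝ × X)) (fun q : ℝ × X =>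
        if hy : q.2 ∈ U then H (Set.projIcc 0 1 zero_le_one q.1, ⟨q.2, hy⟩) else q.2) =
        fun q => H (Set.projIcc 0 1 zero_le_one q.1.1, ⟨q.1.2, (Set.mem_prod.1 q.2).2⟩) := by
      funext q
      exact dif_pos (Set.mem_prod.1 q.2).2
    rw [this]
    fun_prop

lemma step_mem {T i : ℕ} (hT : 0 < T) : ((i : ℝ) / T ∈ Set.Icc ((i : ℝ) / T) ((i + 1 : ℝ) / T)) ∧
    ((((i + 1 : ℕ) : ℝ)) / T ∈ Set.Icc ((i : ℝ) / T) ((i + 1 : ℝ) / T)) := by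
  push_cast
  refine ⟨⟨le_rfl, ?_⟩, ?_, le_rfl⟩ <;> gcongr <;> linarith

lemma prim1 {f : X → X → ℝ} (hcc : ∀ x, f x x = 0)
    (hf : ∀ x0 : X, ∀ᶠ V in (𝓝 x0).smallSets, ∀ x ∈ V, ∀ y ∈ V, ∀ z ∈ V,
      f y z - f x z + f x y = 0)
    {U : Set X} (hU : IsOpen U) (hn : (inclMap U).Nullhomotopic) {K : Set X} (hK : IsCompact K)
    (hKU : K ⊆ U) : ∃ β : X → ℝ, ∀ x0 ∈ K, ∃ O ∈ 𝓝 x0, ∀ x ∈ O, ∀ y ∈ O, f x y = β y - β x := by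
  obtain ⟨h, c, h0, h1, hc⟩ := null_h hU hn
  obtain ⟨T0, hT⟩ := time_step hU hc (G := fun V => ∀ x ∈ V, ∀ y ∈ V, ∀ z ∈ V,
      f y z - f x z + f x y = 0) (fun s t hst ht x hx y hy z hz => ht x (hst hx) y (hst hy) z (hst hz))
      hf hK hKU
  have hT1 : 0 < max T0 1 := by simp
  have hT := hT (max T0 1) (by simp) hT1
  generalize max T0 1 = T at *
  refine ⟨fun x => - pr1 f h T x, fun x0 hx0 => ?_⟩
  obtain ⟨O, hO, hT⟩ := hT x0 hx0
  refine ⟨O ∩ U, Filter.inter_mem hO (hU.mem_nhds (hKU hx0)), fun x hx y hy => ?_⟩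
  rw [pr1_spec hT1 (h0 x hx.2) (h0 y hy.2) (h1 x hx.2) (h1 y hy.2) (hcc c)]
  · ring
  · intro i hi
    obtain ⟨m1, m2⟩ := step_mem (i := i) hT1
    exact ⟨_, hT i hi, ⟨(_, x), ⟨m1, hx.1⟩, rfl⟩, ⟨(_, y), ⟨m1, hy.1⟩, rfl⟩,
      ⟨(_, x), ⟨m2, hx.1⟩, rfl⟩, ⟨(_, y), ⟨m2, hy.1⟩, rfl⟩⟩

lemma prim2 {f : X → X → X → ℝ} (hcc : ∀ x, f x x x = 0)
    (hf : ∀ x0 : X, ∀ᶠ V in (𝓝 x0).smallSets, ∀ x ∈ V, ∀ y ∈ V, ∀ z ∈ V, ∀ w ∈ V,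
      f y z w - f x z w + f x y w - f x y z = 0)
    {U : Set X} (hU : IsOpen U) (hn : (inclMap U).Nullhomotopic) {K : Set X} (hK : IsCompact K)
    (hKU : K ⊆ U) : ∃ β : X → X → ℝ, ∀ x0 ∈ K, ∃ O ∈ 𝓝 x0, ∀ x ∈ O, ∀ y ∈ O, ∀ z ∈ O,
      f x y z = β y z - β x z + β x y := by
  obtain ⟨h, c, h0, h1, hc⟩ := null_h hU hn
  obtain ⟨T0, hT⟩ := time_step hU hc (G := fun V => ∀ x ∈ V, ∀ y ∈ V, ∀ z ∈ V, ∀ w ∈ V,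
      f y z w - f x z w + f x y w - f x y z = 0)
      (fun s t hst ht x hx y hy z hz w hw => ht x (hst hx) y (hst hy) z (hst hz) w (hst hw))
      hf hK hKU
  have hT1 : 0 < max T0 1 := by simp
  have hT := hT (max T0 1) (by simp) hT1
  generalize max T0 1 = T at *
  refine ⟨fun x y => - pr2 f h T x y, fun x0 hx0 => ?_⟩
  obtain ⟨O, hO, hT⟩ := hT x0 hx0
  refine ⟨O ∩ U, Filter.inter_mem hO (hU.mem_nhds (hKU hx0)), fun x hx y hy z hz => ?_⟩
  rw [pr2_spec hT1 (h0 x hx.2) (h0 y hy.2) (h0 z hz.2) (h1 x hx.2) (h1 y hy.2) (h1 z hz.2) (hcc c)]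
  · ring
  · intro i hi
    obtain ⟨m1, m2⟩ := step_mem (i := i) hT1
    exact ⟨_, hT i hi, ⟨(_, x), ⟨m1, hx.1⟩, rfl⟩, ⟨(_, y), ⟨m1, hy.1⟩, rfl⟩, ⟨(_, z), ⟨m1, hz.1⟩, rfl⟩,
      ⟨(_, x), ⟨m2, hx.1⟩, rfl⟩, ⟨(_, y), ⟨m2, hy.1⟩, rfl⟩, ⟨(_, z), ⟨m2, hz.1⟩, rfl⟩⟩

end prims

section spclasses
variable {M : Type*} [TopologicalSpace M] {n : ℕ}

/-- the projection -/
def spm (n : ℕ) (M : Type*) [TopologicalSpace M] (x : Fin n → M) : SP n M := Quot.mk _ x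

lemma continuous_spm : Continuous (spm n M) := continuous_quot_mk

lemma spm_surj (D : SP n M) : ∃ x, spm n M x = D := Quot.exists_rep D

/-- product of a function -/
def prodF (n : ℕ) (F : M → ℂ) : SP n M → ℂ := Quot.lift (fun x => ∏ j, F (x j)) (by
  rintro x y ⟨e, rfl⟩
  exact (Equiv.prod_comp e (fun j => F (x j))).symm)

lemma prodF_spm (F : M → ℂ) (x : Fin n → M) : prodF n F (spm n M x) = ∏ j, F (x j) := rfl

lemma prodF_cv {F : M → ℂ} (hF : Cv F) : Cv (prodF n F) := by
  constructor
  · apply continuous_quot_lift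
    exact continuous_finsetProd _ fun j _ => hF.1.comp (continuous_apply j)
  · intro D
    obtain ⟨x, rfl⟩ := spm_surj D
    rw [prodF_spm, norm_prod]
    exact Finset.prod_eq_one fun j _ => hF.2 _

lemma coe_sum_angle {ι : Type*} (s : Finset ι) (f : ι → ℝ) :
    ((∑ i ∈ s, f i : ℝ) : Real.Angle) = ∑ i ∈ s, (f i : Real.Angle) :=
  map_sum Real.Angle.coeHom f s

lemma arg_prod_angle {ι : Type*} (s : Finset ι) (f : ι → ℂ) (h : ∀ i ∈ s, f i ≠ 0) :
    ((Complex.arg (∏ i ∈ s, f i) : ℝ) : Real.Angle) = ∑ i ∈ s, (Complex.arg (f i) : Real.Angle) := by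
  classical
  induction s using Finset.induction_on with
  | empty => simp
  | insert a s ha ih =>
    rw [Finset.prod_insert ha, Finset.sum_insert ha, Complex.arg_mul_coe_angle (h a (by simp)),
      ih fun i hi => h i (by simp [hi])]
    exact Finset.prod_ne_zero_iff.2 fun i hi => h i (by simp [hi])

lemma sum_lt_pi {f : Fin n → ℝ} (h : ∀ j, |f j| < Real.pi / (n + 1)) : |∑ j, f j| < Real.pi := by
  have h1 : |∑ j, f j| ≤ ∑ j : Fin n, Real.pi / (n + 1) :=
    (Finset.abs_sum_le_sum_abs _ _).trans (Finset.sum_le_sum fun j _ => (h j).le)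
  refine h1.trans_lt ?_
  rw [Finset.sum_const, Finset.card_univ, Fintype.card_fin, nsmul_eq_mul, ← mul_div_assoc,
    div_lt_iff₀ (by positivity)]
  nlinarith [Real.pi_pos]

/-- evaluation of smallness coordinatewise -/
lemma loc_coord {Q : Fin n → Set M → Prop} (hQ : ∀ j (s t : Set M), s ⊆ t → Q j t → Q j s)
    (y : Fin n → M) (h : ∀ j, ∀ᶠ V in (𝓝 (y j)).smallSets, Q j V) :
    ∃ V ∈ 𝓝 y, ∀ j, Q j ((fun x : Fin n → M => x j) '' V) := by
  have : ∀ j, ∃ V ∈ 𝓝 (y j), Q j V := fun j => by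
    obtain ⟨V, hV, h⟩ := Filter.eventually_smallSets.1 (h j)
    exact ⟨V, hV, h V le_rfl⟩
  choose V hV hQV using this
  refine ⟨⋂ j, (fun x : Fin n → M => x j) ⁻¹' V j,
    Filter.iInter_mem.2 fun j => (continuous_apply j).continuousAt (hV j), fun j => ?_⟩
  refine hQ j _ _ ?_ (hQV j)
  rintro _ ⟨x, hx, rfl⟩
  exact Set.mem_iInter.1 hx j

lemma smallSets_loc {X : Type*} [TopologicalSpace X] {x : X} {Q : Set X → Prop}
    (h : ∀ᶠ V in (𝓝 x).smallSets, Q V) : ∃ V ∈ 𝓝 x, Q V := by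
  obtain ⟨V, hV, h⟩ := Filter.eventually_smallSets.1 h
  exact ⟨V, hV, h V le_rfl⟩

/-- degree one class -/
def cl1 (F : M → ℂ) (s : ℕ → Fin n → M) : ℝ := ∑ j, A2 F (s 0 j) (s 1 j)

theorem cl1_good {F : M → ℂ} (hF : Cv F) : GCls (spm n M) 0 (cl1 F) := by
  have hsum : ∀ y : Fin n → M, ∃ V ∈ 𝓝 y, ∀ u ∈ V, ∀ v ∈ V,
      ∑ j, A2 F (u j) (v j) = A2 (prodF n F) (spm n M u) (spm n M v) := by
    intro y
    obtain ⟨V, hV, h⟩ := loc_coord (Q := fun j V => ∀ x ∈ V, ∀ y ∈ V, |A2 F x y| < Real.pi / (n + 1))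
      (fun j s t hst ht x hx y hy => ht x (hst hx) y (hst hy)) y
      (fun j => A2_small hF (y j) (by positivity))
    refine ⟨V, hV, fun u hu v hv => ?_⟩
    rw [← sub_eq_zero]
    apply eq_zero_of_angle
    · rw [Real.Angle.coe_sub, A2_ang (prodF_cv hF), coe_sum_angle, prodF_spm, prodF_spm,
        arg_prod_angle _ _ (fun i _ => hF.ne _), arg_prod_angle _ _ (fun i _ => hF.ne _),
        ← Finset.sum_sub_distrib, ← Finset.sum_sub_distrib]
      refine Finset.sum_eq_zero fun j _ => ?_
      rw [A2_ang hF, sub_self]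
    · have h1 := sum_lt_pi (f := fun j => A2 F (u j) (v j))
        (fun j => h j _ ⟨u, hu, rfl⟩ _ ⟨v, hv, rfl⟩)
      have h2 : |A2 (prodF n F) (spm n M u) (spm n M v)| ≤ Real.pi := Complex.abs_arg_le_pi _
      rw [abs_lt] at *
      rw [abs_le] at h2
      constructor <;> linarith
  refine ⟨by omega, ?_, ?_, ?_⟩
  · intro x y h
    simp only [cl1]
    rw [h 0 (by omega), h 1 (by omega)]
  · intro y
    obtain ⟨V, hV, h⟩ := loc_coord (Q := fun j V => ∀ x ∈ V, ∀ y ∈ V, ∀ z ∈ V,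
        A2 F y z - A2 F x z + A2 F x y = 0)
      (fun j s t hst ht x hx y hy z hz => ht x (hst hx) y (hst hy) z (hst hz)) y
      (fun j => A2_cocycle hF (y j))
    refine ⟨V, hV, fun s hs => ?_⟩
    simp only [dl, Finset.sum_range_succ, Finset.sum_range_zero, cl1, fc]
    simp only [zero_add, pow_zero, one_mul, pow_one]
    norm_num
    rw [← sub_eq_add_neg, ← Finset.sum_sub_distrib, ← Finset.sum_add_distrib]
    exact Finset.sum_eq_zero fun j _ => h j _ ⟨_, hs 0, rfl⟩ _ ⟨_, hs 1, rfl⟩ _ ⟨_, hs 2, rfl⟩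
  · intro U hU hn K hK hKU
    obtain ⟨β, hβ⟩ := prim1 (A2_self (prodF_cv (n := n) hF)) (A2_cocycle (prodF_cv hF)) hU hn hK hKU
    refine ⟨fun s => β (spm n M (s 0)), ?_, ?_⟩
    · intro x y h
      simp only [h 0 le_rfl]
    · intro y hy
      obtain ⟨O, hO, h⟩ := hβ _ hy
      obtain ⟨V, hV, h'⟩ := hsum y
      refine ⟨V ∩ spm n M ⁻¹' O, Filter.inter_mem hV (continuous_spm.continuousAt hO), fun s hs => ?_⟩
      simp only [dl, Finset.sum_range_succ, Finset.sum_range_zero, cl1, fc]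
      rw [h' _ (hs 0).1 _ (hs 1).1, h _ (hs 0).2 _ (hs 1).2]
      norm_num
      ring

/-- linear form -/
def lv (a : ℕ) (u : Fin 2 → ℂ) : ℂ := u 0 + a * u 1

lemma lv_ne {u : Fin 2 → ℂ} (hu : u ≠ 0) {a b : ℕ} (ha : lv a u = 0) (hb : lv b u = 0) : a = b := by
  simp only [lv] at ha hb
  have h : ((a : ℂ) - b) * u 1 = 0 := by linear_combination ha - hb
  rcases mul_eq_zero.1 h with h | h
  · have : (a : ℂ) = b := sub_eq_zero.1 h
    exact_mod_cast this
  · exfalso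
    apply hu
    rw [h] at ha
    funext i
    fin_cases i
    · simpa using ha
    · exact h

/-- the product vector -/
def Psi (n : ℕ) (u : Fin n → Fin 2 → ℂ) (a : Fin (n + 1)) : ℂ := ∏ j, lv a (u j)

lemma Psi_ne {u : Fin n → Fin 2 → ℂ} (hu : ∀ j, u j ≠ 0) : Psi n u ≠ 0 := by
  intro h
  have h1 : ∀ a : Fin (n + 1), ∃ j, lv a (u j) = 0 := by
    intro a
    have := congrFun h a
    obtain ⟨j, _, hj⟩ := Finset.prod_eq_zero_iff.1 this
    exact ⟨j, hj⟩
  choose f hf using h1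
  obtain ⟨a, b, hab, hfab⟩ := Fintype.exists_ne_map_eq_of_card_lt f (by simp)
  have := lv_ne (hu (f a)) (hf a) (by rw [hfab]; exact hf b)
  exact hab (Fin.ext this)

/-- evaluated matrix -/
def mv (a b : ℕ) (p : Fin 2 → Fin 2 → ℂ) : ℂ := p 0 0 + b * p 0 1 + a * p 1 0 + a * b * p 1 1

lemma mv_eq (a b : ℕ) (u v : Fin 2 → ℂ) : mv a b (fun i j => u i * (starRingEnd ℂ) (v j)) =
    lv a u * (starRingEnd ℂ) (lv b v) := by
  simp only [mv, lv, map_add, map_mul, Complex.conj_natCast]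
  ring

/-- product of two matrices -/
def mm (p q : Fin 2 → Fin 2 → ℂ) (i j : Fin 2) : ℂ := p i 0 * q 0 j + p i 1 * q 1 j

/-- the projection on the symmetric product -/
def prodP (n : ℕ) (p : M → Fin 2 → Fin 2 → ℂ) : SP n M → Fin (n + 1) → Fin (n + 1) → ℂ :=
  Quot.lift (fun x a b => ∏ j, mv a b (p (x j))) (by
    rintro x y ⟨e, rfl⟩
    funext a b
    exact (Equiv.prod_comp e (fun j => mv a b (p (x j)))).symm)

lemma prodP_spm (p : M → Fin 2 → Fin 2 → ℂ) (x : Fin n → M) :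
    prodP n p (spm n M x) = fun (a b : Fin (n + 1)) => ∏ j, mv a b (p (x j)) := rfl

lemma continuous_entry {p : M → Fin 2 → Fin 2 → ℂ} (hp : Continuous p) (i j : Fin 2) :
    Continuous fun x => p x i j := (continuous_apply j).comp ((continuous_apply i).comp hp)

lemma prodP_vec {p : M → Fin 2 → Fin 2 → ℂ} {x : Fin n → M} {u : Fin n → Fin 2 → ℂ}
    (hu : ∀ j, p (x j) = fun i k => u j i * (starRingEnd ℂ) (u j k)) :
    prodP n p (spm n M x) = fun a b => Psi n u a * (starRingEnd ℂ) (Psi n u b) := by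
  rw [prodP_spm]
  funext a b
  simp only [hu, mv_eq, Psi, map_prod, Finset.prod_mul_distrib]

lemma prodP_rk {p : M → Fin 2 → Fin 2 → ℂ} (hp : Rk1 p) : Rk1 (prodP n p) := by
  constructor
  · apply continuous_quot_lift
    refine continuous_pi fun a => continuous_pi fun b => continuous_finsetProd _ fun j _ => ?_
    have h0 : Continuous fun z : Fin 2 → Fin 2 → ℂ => mv a b z := by
      simp only [mv]
      fun_prop
    exact h0.comp (hp.1.comp (continuous_apply j))
  · intro D
    obtain ⟨x, rfl⟩ := spm_surj D
    choose u hu hpu using fun j => hp.2 (x j)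
    exact ⟨Psi n u, Psi_ne hu, prodP_vec hpu⟩

/-- the comparison kernel -/
def kap (p : M → Fin 2 → Fin 2 → ℂ) (x y : Fin n → M) : ℂ :=
  ∑ a : Fin (n + 1), ∏ j, mv a a (mm (p (y j)) (p (x j)))

lemma mm_vec (u v : Fin 2 → ℂ) : mm (fun i k => v i * (starRingEnd ℂ) (v k))
    (fun i k => u i * (starRingEnd ℂ) (u k)) = fun i k => (hh v u * v i) * (starRingEnd ℂ) (u k) := by
  funext i k
  simp only [mm, hh, Fin.sum_univ_two]
  ring

lemma lv_smul (a : ℕ) (c : ℂ) (u : Fin 2 → ℂ) : lv a (fun i => c * u i) = c * lv a u := by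
  simp only [lv]; ring

lemma kap_eq {p : M → Fin 2 → Fin 2 → ℂ} {x y : Fin n → M} {u v : Fin n → Fin 2 → ℂ}
    (hu : ∀ j, p (x j) = fun i k => u j i * (starRingEnd ℂ) (u j k))
    (hv : ∀ j, p (y j) = fun i k => v j i * (starRingEnd ℂ) (v j k)) :
    kap p x y = hh (Psi n u) (Psi n v) * ∏ j, hh (v j) (u j) := by
  simp only [kap, hu, hv, mm_vec]
  rw [hh, Finset.sum_mul]
  refine Finset.sum_congr rfl fun a _ => ?_
  have h1 : ∀ j, (mv a a fun i k => hh (v j) (u j) * v j i * (starRingEnd ℂ) (u j k)) =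
      hh (v j) (u j) * (lv a (v j) * (starRingEnd ℂ) (lv a (u j))) := fun j => by
    rw [mv_eq a a (fun i => hh (v j) (u j) * v j i) (u j), lv_smul, mul_assoc]
  simp only [h1, Psi, map_prod]
  rw [← Finset.prod_mul_distrib, ← Finset.prod_mul_distrib]
  refine Finset.prod_congr rfl fun j _ => ?_
  ring

lemma kap_cont0 (a : ℕ) : Continuous fun z : (Fin 2 → Fin 2 → ℂ) × (Fin 2 → Fin 2 → ℂ) =>
    mv a a (mm z.1 z.2) := by
  simp only [mv, mm]
  fun_prop

lemma kap_cont {p : M → Fin 2 → Fin 2 → ℂ} (hp : Continuous p) :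
    Continuous fun q : (Fin n → M) × (Fin n → M) => kap p q.1 q.2 := by
  unfold kap
  apply continuous_finsetSum
  intro a _
  apply continuous_finsetProd
  intro j _
  have h1 : Continuous fun q : (Fin n → M) × (Fin n → M) => p (q.1 j) := by fun_prop
  have h2 : Continuous fun q : (Fin n → M) × (Fin n → M) => p (q.2 j) := by fun_prop
  exact (kap_cont0 a).comp (h2.prodMk h1)

lemma kap_small {p : M → Fin 2 → Fin 2 → ℂ} (hp : Rk1 p) (y : Fin n → M) {ε : ℝ} (hε : 0 < ε) :
    ∃ V ∈ 𝓝 y, ∀ u ∈ V, ∀ v ∈ V, |Complex.arg (kap p u v)| < ε ∧ kap p u v ≠ 0 := by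
  choose u hu hpu using fun j => hp.2 (y j)
  obtain ⟨c, hc, hcv⟩ : ∃ c : ℝ, 0 < c ∧ kap p y y = (c : ℂ) := by
    refine ⟨(∑ i, ‖Psi n u i‖ ^ 2) * ∏ j, ∑ i, ‖u j i‖ ^ 2,
      mul_pos (hh_self_pos (Psi_ne hu)) (Finset.prod_pos fun j _ => hh_self_pos (hu j)), ?_⟩
    rw [kap_eq hpu hpu, hh_self, Complex.ofReal_mul, Complex.ofReal_prod]
    congr 1
    exact Finset.prod_congr rfl fun j _ => hh_self (u j)
  have h := arg_near (g := fun q : (Fin n → M) × (Fin n → M) => kap p q.1 q.2) (w := (y, y))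
    (kap_cont hp.1).continuousAt hc hcv hε
  rw [nhds_prod_eq] at h
  obtain ⟨t1, ht1, t2, ht2, h12⟩ := Filter.mem_prod_iff.1 h
  refine ⟨t1 ∩ t2, Filter.inter_mem ht1 ht2, fun u' hu' v' hv' => ?_⟩
  have h5 := h12 (Set.mk_mem_prod hu'.1 hv'.2)
  rw [Set.mem_setOf_eq] at h5
  exact h5

/-- degree two class -/
def cl2 (p : M → Fin 2 → Fin 2 → ℂ) (s : ℕ → Fin n → M) : ℝ := ∑ j, A3 p (s 0 j) (s 1 j) (s 2 j)

lemma ang_kap {p : M → Fin 2 → Fin 2 → ℂ} {x y : Fin n → M} {u v : Fin n → Fin 2 → ℂ}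
    (hu : ∀ j, p (x j) = fun i k => u j i * (starRingEnd ℂ) (u j k))
    (hv : ∀ j, p (y j) = fun i k => v j i * (starRingEnd ℂ) (v j k)) (hk : kap p x y ≠ 0) :
    hh (Psi n u) (Psi n v) ≠ 0 ∧ (∀ j, hh (u j) (v j) ≠ 0) ∧
    ((Complex.arg (kap p x y) : ℝ) : Real.Angle) = (Complex.arg (hh (Psi n u) (Psi n v)) : Real.Angle)
      - ∑ j, (Complex.arg (hh (u j) (v j)) : Real.Angle) := by
  rw [kap_eq hu hv] at *
  have h1 := left_ne_zero_of_mul hk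
  have h2 := Finset.prod_ne_zero_iff.1 (right_ne_zero_of_mul hk)
  have h3 : ∀ j, hh (u j) (v j) ≠ 0 := fun j => by
    rw [← hh_conj (v j) (u j)]
    simpa using h2 j (Finset.mem_univ _)
  refine ⟨h1, h3, ?_⟩
  rw [Complex.arg_mul_coe_angle h1 (right_ne_zero_of_mul hk), arg_prod_angle _ _ h2, sub_eq_add_neg,
    ← Finset.sum_neg_distrib]
  congr 1
  refine Finset.sum_congr rfl fun j _ => ?_
  rw [← hh_conj (u j) (v j), Complex.arg_conj_coe_angle]

theorem cl2_good {p : M → Fin 2 → Fin 2 → ℂ} (hp : Rk1 p) : GCls (spm n M) 1 (cl2 p) := by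
  have hsum : ∀ y : Fin n → M, ∃ V ∈ 𝓝 y, ∀ u ∈ V, ∀ v ∈ V, ∀ w ∈ V,
      ∑ j, A3 p (u j) (v j) (w j) = A3 (prodP n p) (spm n M u) (spm n M v) (spm n M w)
        - (Complex.arg (kap p v w) - Complex.arg (kap p u w) + Complex.arg (kap p u v)) := by
    intro y
    obtain ⟨V, hV, h⟩ := loc_coord (Q := fun j V => ∀ x ∈ V, ∀ y ∈ V, ∀ z ∈ V,
        |A3 p x y z| < Real.pi / (n + 1) ∧ tr3 (p x) (p y) (p z) ≠ 0)
      (fun j s t hst ht x hx y hy z hz => ht x (hst hx) y (hst hy) z (hst hz)) y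
      (fun j => A3_small hp (y j) (by positivity))
    obtain ⟨V1, hV1, h1⟩ := smallSets_loc (A3_small (prodP_rk (n := n) hp) (spm n M y)
      (ε := Real.pi / 4) (by positivity))
    obtain ⟨V2, hV2, h2⟩ := kap_small hp y (ε := Real.pi / 4) (by positivity)
    refine ⟨V ∩ (spm n M ⁻¹' V1 ∩ V2), Filter.inter_mem hV (Filter.inter_mem
      (continuous_spm.continuousAt hV1) hV2), fun u hu v hv w hw => ?_⟩
    have s1 := sum_lt_pi (f := fun j => A3 p (u j) (v j) (w j))
        (fun j => (h j _ ⟨u, hu.1, rfl⟩ _ ⟨v, hv.1, rfl⟩ _ ⟨w, hw.1, rfl⟩).1)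
    have s2 := (h1 _ hu.2.1 _ hv.2.1 _ hw.2.1).1
    obtain ⟨s3, k3⟩ := h2 _ hv.2.2 _ hw.2.2
    obtain ⟨s4, k4⟩ := h2 _ hu.2.2 _ hw.2.2
    obtain ⟨s5, k5⟩ := h2 _ hu.2.2 _ hv.2.2
    rw [← sub_eq_zero]
    apply eq_zero_of_angle
    · choose xu _ hxu using fun j => hp.2 (u j)
      choose xv _ hxv using fun j => hp.2 (v j)
      choose xw _ hxw using fun j => hp.2 (w j)
      obtain ⟨a1, b1, c1⟩ := ang_kap hxv hxw k3
      obtain ⟨a2, b2, c2⟩ := ang_kap hxu hxw k4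
      obtain ⟨a3, b3, c3⟩ := ang_kap hxu hxv k5
      have b2' : ∀ j, hh (xw j) (xu j) ≠ 0 := fun j => by
        rw [← hh_conj]; simpa using b2 j
      have a2' : hh (Psi n xw) (Psi n xu) ≠ 0 := by
        rw [← hh_conj]; simpa using a2
      simp only [Real.Angle.coe_sub, Real.Angle.coe_add, c1, c2, c3, coe_sum_angle]
      simp only [A3, prodP_vec hxu, prodP_vec hxv, prodP_vec hxw, hxu, hxv, hxw, tr3_eq]
      rw [ang_tr3 a3 a1 a2']
      simp only [fun j => ang_tr3 (b3 j) (b1 j) (b2' j), Finset.sum_sub_distrib, Finset.sum_add_distrib]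
      abel
    · rw [abs_lt] at *
      constructor <;> linarith
  refine ⟨by omega, ?_, ?_, ?_⟩
  · intro x y h
    simp only [cl2]
    rw [h 0 (by omega), h 1 (by omega), h 2 (by omega)]
  · intro y
    obtain ⟨V, hV, h⟩ := loc_coord (Q := fun j V => ∀ x ∈ V, ∀ y ∈ V, ∀ z ∈ V, ∀ w ∈ V,
        A3 p y z w - A3 p x z w + A3 p x y w - A3 p x y z = 0)
      (fun j s t hst ht x hx y hy z hz w hw => ht x (hst hx) y (hst hy) z (hst hz) w (hst hw)) y
      (fun j => A3_cocycle hp (y j))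
    refine ⟨V, hV, fun s hs => ?_⟩
    simp only [dl, Finset.sum_range_succ, Finset.sum_range_zero, cl2, fc]
    norm_num
    rw [← sub_eq_add_neg, ← sub_eq_add_neg, ← Finset.sum_sub_distrib, ← Finset.sum_add_distrib, ← Finset.sum_sub_distrib]
    exact Finset.sum_eq_zero fun j _ => h j _ ⟨_, hs 0, rfl⟩ _ ⟨_, hs 1, rfl⟩ _ ⟨_, hs 2, rfl⟩ _ ⟨_, hs 3, rfl⟩
  · intro U hU hn K hK hKU
    obtain ⟨β, hβ⟩ := prim2 (fun x => (A3_deg1 (prodP_rk (n := n) hp) x x).1)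
      (A3_cocycle (prodP_rk hp)) hU hn hK hKU
    refine ⟨fun s => β (spm n M (s 0)) (spm n M (s 1)) - Complex.arg (kap p (s 0) (s 1)), ?_, ?_⟩
    · intro x y h
      simp only [h 0 (by omega), h 1 le_rfl]
    · intro y hy
      obtain ⟨O, hO, h⟩ := hβ _ hy
      obtain ⟨V, hV, h'⟩ := hsum y
      refine ⟨V ∩ spm n M ⁻¹' O, Filter.inter_mem hV (continuous_spm.continuousAt hO), fun s hs => ?_⟩
      simp only [dl, Finset.sum_range_succ, Finset.sum_range_zero, cl2, fc]
      rw [h' _ (hs 0).1 _ (hs 1).1 _ (hs 2).1, h _ (hs 0).2 _ (hs 1).2 _ (hs 2).2]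
      norm_num
      ring

end spclasses
end SPcat
end

open scoped unitInterval Topology
open MeasureTheory
noncomputable section
namespace SPcat

section spmain
variable {M : Type*} [TopologicalSpace M] {n : ℕ}

/-- product of data -/
def prodD {Y : Type*} : List (ℕ × ((ℕ → Y) → ℝ)) → (ℕ → Y) → ℝ
  | [] => fun _ => 1
  | c :: l => cup (c.1 + 1) c.2 (prodD l)

lemma prodX_eq {Y : Type*} (L : List (Cls Y)) : prodX L = prodD (L.map (fun c => (c.deg, c.x))) := by
  induction L with
  | nil => rfl
  | cons a L ih => simp only [prodX, List.map_cons, prodD, ih]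

/-- block of classes for a factor -/
def blk (t : Fin n → Bool) (Fa Fb : Fin n → M → ℂ) (p : M → Fin 2 → Fin 2 → ℂ) (k : Fin n) :
    List (ℕ × ((ℕ → Fin n → M) → ℝ)) :=
  if t k then [(0, cl1 (Fa k)), (0, cl1 (Fb k))] else [(1, cl2 p)]

lemma prodD_blk (t : Fin n → Bool) (Fa Fb : Fin n → M → ℂ) (p : M → Fin 2 → Fin 2 → ℂ) (k : Fin n)
    (l : List (ℕ × ((ℕ → Fin n → M) → ℝ))) (s : ℕ → Fin n → M) :
    prodD (blk t Fa Fb p k ++ l) s =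
      yv t (fun k => A2 (Fa k)) (fun k => A2 (Fb k)) (A3 p) k (s 0) (s 1) (s 2) * prodD l (sh 2 s) := by
  unfold blk yv
  split_ifs
  · simp only [List.cons_append, List.nil_append, prodD, cup, cl1, sh]
    rw [mul_assoc]
    rfl
  · simp only [List.cons_append, List.nil_append, prodD, cup, cl2]
    try rfl

lemma prodD_blks (t : Fin n → Bool) (Fa Fb : Fin n → M → ℂ) (p : M → Fin 2 → Fin 2 → ℂ) :
    ∀ (q : ℕ) (f : Fin q → Fin n) (s : ℕ → Fin n → M),
    prodD ((List.ofFn f).flatMap (blk t Fa Fb p)) s = ∏ i : Fin q,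
      yv t (fun k => A2 (Fa k)) (fun k => A2 (Fb k)) (A3 p) (f i) (s (2 * i)) (s (2 * i + 1)) (s (2 * i + 2))
  | 0, f, s => by simp [prodD]
  | q + 1, f, s => by
    rw [List.ofFn_succ, List.flatMap_cons, prodD_blk, Fin.prod_univ_succ, prodD_blks t Fa Fb p q]
    rfl

lemma blks_len (t : Fin n → Bool) (Fa Fb : Fin n → M → ℂ) (p : M → Fin 2 → Fin 2 → ℂ) :
    ((List.ofFn (id : Fin n → Fin n)).flatMap (blk t Fa Fb p)).length =
      n + (Finset.univ.filter (fun k => t k = true)).card := by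
  rw [List.length_flatMap, List.map_ofFn, List.sum_ofFn]
  have : ∀ i : Fin n, ((fun k => (blk t Fa Fb p k).length) ∘ id) i = 1 + if t i = true then 1 else 0 := by
    intro i
    simp only [Function.comp, id, blk]
    split_ifs <;> rfl
  simp only [this, Finset.sum_add_distrib, Finset.card_filter]
  simp

lemma blks_deg (t : Fin n → Bool) (Fa Fb : Fin n → M → ℂ) (p : M → Fin 2 → Fin 2 → ℂ) :
    (((List.ofFn (id : Fin n → Fin n)).flatMap (blk t Fa Fb p)).map (fun c => c.1 + 1)).sum = n * 2 := by
  have h2 : ∀ i : Fin n, ((blk t Fa Fb p i).map (fun c => c.1 + 1)).sum = 2 := by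
    intro i
    simp only [blk]
    split_ifs <;> rfl
  have : ∀ K : List (Fin n), ((K.flatMap (blk t Fa Fb p)).map (fun c => c.1 + 1)).sum = K.length * 2 := by
    intro K
    induction K with
    | nil => rfl
    | cons a K ih => rw [List.flatMap_cons, List.map_append, List.sum_append, ih, h2, List.length_cons]; ring
  rw [this, List.length_ofFn]

lemma pS_HB {E : Type*} [Fintype E] [DecidableEq E] {M : Type*} {n : ℕ} (ε : E → ℝ) (s : E → ℝ → ℝ → M)
    (H1 : ∀ Φ : (ℝ → M) → ℝ, ∑ e, ε e * (Φ (fun u => s e 1 u) - Φ (fun u => s e 0 u)) = 0)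
    (H2 : ∀ Φ : (ℝ → M) → ℝ, ∑ e, ε e * (Φ (fun r => s e r 1) - Φ (fun r => s e r 0)) = 0)
    (δ : Fin (n * 2)) (Φ : ((Fin (n * 2) → ℝ) → Fin n → M) → ℝ) :
    ∑ e : Fin n → E, (∏ j, ε (e j)) * (Φ (fun z => pS s e (Function.update z δ 1))
        - Φ (fun z => pS s e (Function.update z δ 0))) = 0 := by
  obtain ⟨⟨j, b⟩, rfl⟩ := finProdFinEquiv.surjective δ
  rw [← Equiv.sum_comp (Equiv.funSplitAt j E).symm, Fintype.sum_prod_type, Finset.sum_comm]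
  refine Finset.sum_eq_zero fun e' _ => ?_
  have hj : ∀ x, (Equiv.funSplitAt j E).symm (x, e') j = x := fun x => by simp [Equiv.funSplitAt]
  have hi : ∀ x (i) (h : i ≠ j), (Equiv.funSplitAt j E).symm (x, e') i = e' ⟨i, h⟩ := fun x i h => by
    simp [Equiv.funSplitAt, h]
  have hp : ∀ x, ∏ i, ε ((Equiv.funSplitAt j E).symm (x, e') i) =
      (∏ i : {i // i ≠ j}, ε (e' i)) * ε x := by
    intro x
    rw [Fintype.prod_eq_mul_prod_subtype_ne _ j, hj, mul_comm]
    congr 1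
    refine Finset.prod_congr rfl fun i _ => ?_
    rw [hi x i.1 i.2]
  simp only [hp, mul_assoc, ← Finset.mul_sum]
  apply mul_eq_zero_of_right
  have key : ∀ (x : E) (v : ℝ), (fun z => pS s ((Equiv.funSplitAt j E).symm (x, e'))
      (Function.update z (finProdFinEquiv (j, b)) v)) = fun z i => if h : i = j then
        (if b = 0 then s x v (z (finProdFinEquiv (j, 1))) else s x (z (finProdFinEquiv (j, 0))) v)
        else s (e' ⟨i, h⟩) (z (finProdFinEquiv (i, 0))) (z (finProdFinEquiv (i, 1))) := by
    intro x v
    funext z i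
    simp only [pS]
    by_cases h : i = j
    · subst h
      rw [hj, dif_pos rfl]
      obtain rfl | rfl : b = 0 ∨ b = 1 := by fin_cases b <;> simp
      · rw [Function.update_apply, Function.update_apply, if_pos rfl, if_neg, if_pos rfl]
        simp
      · rw [Function.update_apply, Function.update_apply, if_neg, if_pos rfl, if_neg]
        · simp
        · simp
    · rw [dif_neg h, hi x i h, Function.update_of_ne, Function.update_of_ne]
      · intro hc
        exact h (congrArg Prod.fst (finProdFinEquiv.injective hc))
      · intro hc
        exact h (congrArg Prod.fst (finProdFinEquiv.injective hc))
  simp only [key]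
  obtain rfl | rfl : b = 0 ∨ b = 1 := by fin_cases b <;> simp
  · exact H1 (fun c => Φ fun z i => if h : i = j then c (z (finProdFinEquiv (j, 1)))
      else s (e' ⟨i, h⟩) (z (finProdFinEquiv (i, 0))) (z (finProdFinEquiv (i, 1))))
  · exact H2 (fun c => Φ fun z i => if h : i = j then c (z (finProdFinEquiv (j, 0)))
      else s (e' ⟨i, h⟩) (z (finProdFinEquiv (i, 0))) (z (finProdFinEquiv (i, 1))))

theorem lower_SP (hn : 1 ≤ n) {E : Type*} [Fintype E] [DecidableEq E] (ε : E → ℝ) (s : E → ℝ → ℝ → M)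
    (hs : ∀ e, Continuous fun q : ℝ × ℝ => s e q.1 q.2)
    (H1 : ∀ Φ : (ℝ → M) → ℝ, ∑ e, ε e * (Φ (fun u => s e 1 u) - Φ (fun u => s e 0 u)) = 0)
    (H2 : ∀ Φ : (ℝ → M) → ℝ, ∑ e, ε e * (Φ (fun r => s e r 1) - Φ (fun r => s e r 0)) = 0)
    (t : Fin n → Bool) (Fa Fb : Fin n → M → ℂ) (hFa : ∀ k, Cv (Fa k)) (hFb : ∀ k, Cv (Fb k))
    (p : M → Fin 2 → Fin 2 → ℂ) (hp : Rk1 p)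
    (sec : E → Fin n → Prop) (hsec : ∀ e k k', sec e k → sec e k' → k = k')
    (hsa : ∀ k e r u r' u', ¬ sec e k → A2 (Fa k) (s e r u) (s e r' u') = 0)
    (hsb : ∀ k e r u r' u', ¬ sec e k → A2 (Fb k) (s e r u) (s e r' u') = 0)
    (hI1 : ∀ k, t k = true → ∃ N0, ∀ N ≥ N0,
      I2 N ε s (fun x y z => A2 (Fa k) x y * A2 (Fb k) y z) ≠ 0)
    (hI2 : ∃ N0, ∀ N ≥ N0, I2 N ε s (A3 p) ≠ 0)
    {r : ℕ} (hcat : catLE (SP n M) r) :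
    n + (Finset.univ.filter (fun k => t k = true)).card ≤ r := by
  obtain ⟨d0, hd0⟩ : ∃ d0, n * 2 = d0 + 1 := ⟨n * 2 - 1, by omega⟩
  have main : ∀ (d : ℕ) (S : (Fin n → E) → (Fin d → ℝ) → Fin n → M), d = d0 + 1 →
      (∀ e, Continuous (S e)) →
      (∀ (δ : Fin d) (Φ : ((Fin d → ℝ) → Fin n → M) → ℝ),
        ∑ e : Fin n → E, (∏ j, ε (e j)) * (Φ (fun z => S e (Function.update z δ 1))
          - Φ (fun z => S e (Function.update z δ 0))) = 0) →
      (∃ N0 : ℕ, ∀ N ≥ N0, kJ (fun e : Fin n → E => ∏ j, ε (e j)) S N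
        (yprod t (fun k => A2 (Fa k)) (fun k => A2 (Fb k)) (A3 p)) ≠ 0) →
      n + (Finset.univ.filter (fun k => t k = true)).card ≤ r := by
    rintro d S rfl hS HB hJ
    rw [← blks_len t Fa Fb p]
    refine lower_main continuous_spm (fun e : Fin n → E => ∏ j, ε (e j)) S hS HB _ ?_
      _ ?_ ?_ hJ hcat
    · intro c hc
      obtain ⟨k, _, hk⟩ := List.mem_flatMap.1 hc
      unfold blk at hk
      split_ifs at hk
      · simp only [List.mem_cons, List.not_mem_nil, or_false] at hk
        rcases hk with rfl | rfl
        · exact cl1_good (hFa k)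
        · exact cl1_good (hFb k)
      · simp only [List.mem_cons, List.not_mem_nil, or_false] at hk
        subst hk
        exact cl2_good hp
    · intro L hL
      rw [prodX_eq, hL]
      funext x
      rw [prodD_blks]
      rfl
    · rw [blks_deg]; exact hd0
  refine main (n * 2) (pS s) hd0 ?_ (pS_HB ε s H1 H2) ?_
  · intro e
    refine continuous_pi fun j => ?_
    have : Continuous fun z : Fin (n*2) → ℝ => (z (finProdFinEquiv (j,0)), z (finProdFinEquiv (j,1))) := by
      fun_prop
    exact (hs (e j)).comp this
  · obtain ⟨N2, hN2⟩ := hI2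
    have : ∀ k, ∃ N0, ∀ N ≥ N0, I2 N ε s
        (yk t (fun k => A2 (Fa k)) (fun k => A2 (Fb k)) (A3 p) k) ≠ 0 := by
      intro k
      unfold yk
      by_cases h : t k = true
      · simp only [h, if_true]; exact hI1 k h
      · simp only [h]; exact ⟨N2, hN2⟩
    choose N0 hN0 using this
    obtain ⟨N1, hN1⟩ := Finite.exists_le (fun e => N0 e)
    refine ⟨N1, fun N hN => ?_⟩
    rw [kJ_value t (fun k => A2 (Fa k)) (fun k => A2 (Fb k)) (A3 p) sec hsec (fun k => A2_self (hFa k)) (fun k => A2_self (hFb k))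
      (fun x z => (A3_deg1 hp x z).1) (fun x z => (A3_deg1 hp x z).2) s hsa hsb]
    refine mul_ne_zero (by exact_mod_cast n.factorial_ne_zero) (Finset.prod_ne_zero_iff.2 fun k _ => ?_)
    exact hN0 k N ((hN1 k).trans hN)

end spmain
end SPcat
end

open scoped unitInterval Topology
open MeasureTheory
noncomputable section
namespace SPcat

lemma perm2_univ : (Finset.univ : Finset (Equiv.Perm (Fin 2))) = {1, Equiv.swap 0 1} := by decide

lemma sum_q2 {N : ℕ} (f : Fin N → Fin N → ℝ) :
    ∑ q : Fin 2 → Fin N, f (q 0) (q 1) = ∑ i : Fin N, ∑ j : Fin N, f i j := by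
  rw [← Fintype.sum_prod_type']
  exact Fintype.sum_equiv (finTwoArrowEquiv (Fin N)) _ _ (fun q => rfl)

/-- The I2 sum, made explicit. -/
lemma I2_explicit {E M : Type*} [Fintype E] (N : ℕ) (ε : E → ℝ) (s : E → ℝ → ℝ → M)
    (Y : M → M → M → ℝ) :
    I2 N ε s Y = ∑ e, ε e * ∑ i : Fin N, ∑ j : Fin N,
      (Y (s e ((i:ℕ) / N) ((j:ℕ) / N)) (s e (((i:ℕ) + 1 : ℝ) / N) ((j:ℕ) / N))
          (s e (((i:ℕ) + 1 : ℝ) / N) (((j:ℕ) + 1 : ℝ) / N))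
        - Y (s e ((i:ℕ) / N) ((j:ℕ) / N)) (s e ((i:ℕ) / N) (((j:ℕ) + 1 : ℝ) / N))
          (s e (((i:ℕ) + 1 : ℝ) / N) (((j:ℕ) + 1 : ℝ) / N))) := by
  unfold I2
  refine Finset.sum_congr rfl fun e _ => ?_
  rw [← sum_q2 (fun i j => (Y (s e ((i:ℕ) / N) ((j:ℕ) / N)) (s e (((i:ℕ) + 1 : ℝ) / N) ((j:ℕ) / N))
          (s e (((i:ℕ) + 1 : ℝ) / N) (((j:ℕ) + 1 : ℝ) / N))
        - Y (s e ((i:ℕ) / N) ((j:ℕ) / N)) (s e ((i:ℕ) / N) (((j:ℕ) + 1 : ℝ) / N))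
          (s e (((i:ℕ) + 1 : ℝ) / N) (((j:ℕ) + 1 : ℝ) / N)))), Finset.mul_sum]
  refine Finset.sum_congr rfl fun q _ => ?_
  rw [perm2_univ, Finset.sum_pair (by decide), ← mul_add]
  congr 1
  simp [P2, Equiv.swap_apply_left, Equiv.swap_apply_right]
  ring

/-- angle bound -/
lemma arg_cd {c d δ : ℝ} (hc : 0 ≤ c) (hd : 0 ≤ d) (hcd : 0 < c + d) (hδ : |δ| < Real.pi / 3) :
    |Complex.arg (c + d * Complex.exp (δ * Complex.I))| < Real.pi / 3 ∧
      (c + d * Complex.exp (δ * Complex.I) : ℂ) ≠ 0 := by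
  have hp := Real.pi_pos
  have hcos : 0 < Real.cos δ := Real.cos_pos_of_mem_Ioo ⟨by linarith [abs_lt.1 hδ], by linarith [abs_lt.1 hδ]⟩
  set z : ℂ := c + d * Complex.exp (δ * Complex.I) with hz
  have hre : z.re = c + d * Real.cos δ := by
    rw [hz]; simp [Complex.exp_ofReal_mul_I_re, Complex.exp_ofReal_mul_I_im]
  have him : z.im = d * Real.sin δ := by
    rw [hz]; simp [Complex.exp_ofReal_mul_I_re, Complex.exp_ofReal_mul_I_im]
  have hrepos : 0 < z.re := by
    rw [hre]
    rcases hd.eq_or_lt with h | h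
    · rw [← h] at hcd ⊢; simpa using hcd
    · positivity
  have hz0 : z ≠ 0 := by intro h; rw [h] at hrepos; simp at hrepos
  refine ⟨?_, hz0⟩
  rw [Complex.arg_of_re_nonneg hrepos.le]
  have hn : 0 < ‖z‖ := norm_pos_iff.2 hz0
  have hnd : d ≤ ‖z‖ := by
    rw [← abs_of_nonneg hd, ← abs_of_nonneg hn.le]
    apply sq_le_sq.1
    rw [← Complex.normSq_eq_norm_sq, Complex.normSq_apply, hre, him]
    nlinarith [Real.sin_sq_add_cos_sq δ, mul_nonneg hc (mul_nonneg hd hcos.le), sq_nonneg c]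
  have hle : |z.im / ‖z‖| ≤ |Real.sin δ| := by
    rw [abs_div, abs_of_pos hn, div_le_iff₀ hn, him, abs_mul, abs_of_nonneg hd, mul_comm]
    exact mul_le_mul_of_nonneg_left hnd (abs_nonneg _)
  have h3 : |Real.sin δ| = Real.sin |δ| := by
    rw [Real.abs_sin_eq_sin_abs_of_abs_le_pi (by linarith)]
  rw [h3] at hle
  have h4 : Real.arcsin (Real.sin |δ|) = |δ| :=
    Real.arcsin_sin (by linarith [abs_nonneg δ]) (by linarith)
  rw [abs_le] at hle
  rw [abs_lt]
  constructor
  · have := Real.monotone_arcsin hle.1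
    rw [Real.arcsin_neg, h4] at this; linarith
  · have := Real.monotone_arcsin hle.2
    rw [h4] at this; linarith

/-- the polar vector -/
def psiv (C S w : ℝ) : Fin 2 → ℂ := ![(C : ℂ), S * Complex.exp (w * Complex.I)]

lemma hh_psiv (C S w C' S' w' : ℝ) : hh (psiv C S w) (psiv C' S' w') =
    ((C * C' : ℝ) : ℂ) + ((S * S' : ℝ) : ℂ) * Complex.exp (((w' - w : ℝ) : ℂ) * Complex.I) := by
  simp only [hh, psiv, Fin.sum_univ_two, Matrix.cons_val_zero, Matrix.cons_val_one, map_mul,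
    Complex.conj_ofReal, ← Complex.exp_conj, Complex.conj_I]
  push_cast
  rw [sub_mul, Complex.exp_sub, mul_neg, Complex.exp_neg]
  field_simp

lemma A3_psiv {M : Type*} {p : M → Fin 2 → Fin 2 → ℂ} {x y z : M} {C1 S1 w1 C2 S2 w2 C3 S3 w3 : ℝ}
    (hx : p x = fun i j => psiv C1 S1 w1 i * (starRingEnd ℂ) (psiv C1 S1 w1 j))
    (hy : p y = fun i j => psiv C2 S2 w2 i * (starRingEnd ℂ) (psiv C2 S2 w2 j))
    (hz : p z = fun i j => psiv C3 S3 w3 i * (starRingEnd ℂ) (psiv C3 S3 w3 j))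
    (h1 : 0 ≤ C1) (h2 : 0 ≤ C2) (h3 : 0 ≤ C3) (k1 : 0 ≤ S1) (k2 : 0 ≤ S2) (k3 : 0 ≤ S3)
    (m12 : 0 < C1 * C2 + S1 * S2) (m23 : 0 < C2 * C3 + S2 * S3) (m13 : 0 < C1 * C3 + S1 * S3)
    (d12 : |w2 - w1| < Real.pi / 3) (d23 : |w3 - w2| < Real.pi / 3) (d13 : |w3 - w1| < Real.pi / 3) :
    A3 p x y z = Complex.arg (hh (psiv C1 S1 w1) (psiv C2 S2 w2)) +
      Complex.arg (hh (psiv C2 S2 w2) (psiv C3 S3 w3)) -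
      Complex.arg (hh (psiv C1 S1 w1) (psiv C3 S3 w3)) := by
  have a12 := arg_cd (mul_nonneg h1 h2) (mul_nonneg k1 k2) m12 d12
  have a23 := arg_cd (mul_nonneg h2 h3) (mul_nonneg k2 k3) m23 d23
  have a13 := arg_cd (mul_nonneg h1 h3) (mul_nonneg k1 k3) m13 d13
  rw [← hh_psiv] at a12 a23 a13
  have e31 : hh (psiv C3 S3 w3) (psiv C1 S1 w1) ≠ 0 := by
    rw [← hh_conj]; simpa using a13.2
  rw [← sub_eq_zero]
  apply eq_zero_of_angle
  · unfold A3
    rw [hx, hy, hz, tr3_eq, Real.Angle.coe_sub, ang_tr3 a12.2 a23.2 e31]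
    simp
  · have b := Complex.abs_arg_le_pi (tr3 (p x) (p y) (p z))
    have c1 := abs_lt.1 a12.1
    have c2 := abs_lt.1 a23.1
    have c3 := abs_lt.1 a13.1
    have b' := abs_le.1 b
    unfold A3
    rw [abs_lt]; constructor <;> linarith

lemma arg_psiv_same {C S w C' S' : ℝ} (h : 0 ≤ C * C' + S * S') :
    Complex.arg (hh (psiv C S w) (psiv C' S' w)) = 0 := by
  rw [hh_psiv, sub_self]
  simp only [Complex.ofReal_zero, zero_mul, Complex.exp_zero, mul_one]
  rw [← Complex.ofReal_add]
  exact Complex.arg_ofReal_of_nonneg h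

/-- integral of the degree two class over a polar chart -/
lemma A3_chart {M : Type*} (p : M → Fin 2 → Fin 2 → ℂ) (s : ℝ → ℝ → M) (C S : ℝ → ℝ) (w0 w1 : ℝ)
    (hp : ∀ r u, 0 ≤ r → r ≤ 1 → 0 ≤ u → u ≤ 1 → p (s r u) =
      fun i j => psiv (C r) (S r) (w0 + w1 * u) i * (starRingEnd ℂ) (psiv (C r) (S r) (w0 + w1 * u) j))
    (hC : ∀ r, 0 ≤ r → r ≤ 1 → 0 ≤ C r) (hS : ∀ r, 0 ≤ r → r ≤ 1 → 0 ≤ S r)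
    (hC0 : ∀ r, 0 ≤ r → r < 1 → 0 < C r) (hS0 : ∀ r, 0 < r → r ≤ 1 → 0 < S r)
    (c1 : C 1 = 0) (s0 : S 0 = 0) (N : ℕ) (hN : 2 ≤ N) (hwN : |w1| / N < Real.pi / 3) :
    ∑ i : Fin N, ∑ j : Fin N,
      (A3 p (s ((i:ℕ) / N) ((j:ℕ) / N)) (s (((i:ℕ) + 1 : ℝ) / N) ((j:ℕ) / N))
          (s (((i:ℕ) + 1 : ℝ) / N) (((j:ℕ) + 1 : ℝ) / N))
        - A3 p (s ((i:ℕ) / N) ((j:ℕ) / N)) (s ((i:ℕ) / N) (((j:ℕ) + 1 : ℝ) / N))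
          (s (((i:ℕ) + 1 : ℝ) / N) (((j:ℕ) + 1 : ℝ) / N))) = w1 := by
  have hNpos : (0:ℝ) < N := by positivity
  let a : ℕ → ℕ → ℝ := fun i j => Complex.arg (hh (psiv (C (i / N)) (S (i / N)) (w0 + w1 * (j / N)))
    (psiv (C (i / N)) (S (i / N)) (w0 + w1 * ((j + 1) / N))))
  have key : ∀ i j : Fin N, (A3 p (s ((i:ℕ) / N) ((j:ℕ) / N)) (s (((i:ℕ) + 1 : ℝ) / N) ((j:ℕ) / N))
          (s (((i:ℕ) + 1 : ℝ) / N) (((j:ℕ) + 1 : ℝ) / N))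
        - A3 p (s ((i:ℕ) / N) ((j:ℕ) / N)) (s ((i:ℕ) / N) (((j:ℕ) + 1 : ℝ) / N))
          (s (((i:ℕ) + 1 : ℝ) / N) (((j:ℕ) + 1 : ℝ) / N))) = a ((i:ℕ) + 1) j - a i j := by
    intro i j
    have hi : ((i:ℕ):ℝ) + 1 ≤ N := by exact_mod_cast i.2
    have hj : ((j:ℕ):ℝ) + 1 ≤ N := by exact_mod_cast j.2
    have i0 : (0:ℝ) ≤ (i:ℕ) / N := by positivity
    have i0' : (0:ℝ) < ((i:ℕ) + 1) / N := by positivity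
    have j0 : (0:ℝ) ≤ (j:ℕ) / N := by positivity
    have j0' : (0:ℝ) < ((j:ℕ) + 1) / N := by positivity
    have i1 : (((i:ℕ):ℝ) + 1) / N ≤ 1 := (div_le_one hNpos).2 hi
    have j1 : (((j:ℕ):ℝ) + 1) / N ≤ 1 := (div_le_one hNpos).2 hj
    have i2 : ((i:ℕ):ℝ) / N < 1 := (div_lt_one hNpos).2 (by linarith)
    have j2 : ((j:ℕ):ℝ) / N ≤ 1 := (div_le_one hNpos).2 (by linarith)
    have q00 := hp _ _ i0 i2.le j0 j2
    have q10 := hp _ _ i0'.le i1 j0 j2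
    have q01 := hp _ _ i0 i2.le j0'.le j1
    have q11 := hp _ _ i0'.le i1 j0'.le j1
    have dz : ∀ w : ℝ, |w - w| < Real.pi / 3 := fun w => by simp; positivity
    have dw : |(w0 + w1 * ((((j:ℕ):ℝ) + 1) / N)) - (w0 + w1 * ((j:ℕ) / N))| < Real.pi / 3 := by
      have : (w0 + w1 * ((((j:ℕ):ℝ) + 1) / N)) - (w0 + w1 * ((j:ℕ) / N)) = w1 / N := by field_simp; ring
      rw [this, abs_div, abs_of_pos hNpos]; exact hwN
    have C0 := hC0 _ i0 i2
    have S0 := hS _ i0 i2.le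
    have C1 := hC _ i0'.le i1
    have S1 := hS0 _ i0' i1
    have m01 : 0 < C ((i:ℕ) / N) * C (((i:ℕ) + 1) / N) + S ((i:ℕ) / N) * S (((i:ℕ) + 1) / N) := by
      rcases i0.eq_or_lt with h | h
      · have : (((i:ℕ):ℝ) + 1) / N < 1 := by
          have hi0 : ((i:ℕ):ℝ) = 0 := by
            rcases div_eq_zero_iff.1 h.symm with h | h
            · exact h
            · linarith
          rw [hi0, div_lt_one hNpos]
          have : (2:ℝ) ≤ N := by exact_mod_cast hN
          linarith
        have := hC0 _ i0'.le this
        positivity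
      · have := hS0 _ h i2.le
        positivity
    have m00 : 0 < C ((i:ℕ) / N) * C ((i:ℕ) / N) + S ((i:ℕ) / N) * S ((i:ℕ) / N) := by positivity
    have m11 : 0 < C (((i:ℕ) + 1) / N) * C (((i:ℕ) + 1) / N) + S (((i:ℕ) + 1) / N) * S (((i:ℕ) + 1) / N) := by
      positivity
    rw [A3_psiv q00 q10 q11 C0.le C1 C1 S0 S1.le S1.le m01 m11 m01 (dz _) dw dw,
      A3_psiv q00 q01 q11 C0.le C0.le C1 S0 S0 S1.le m00 m01 m01 dw (dz _) dw,
      arg_psiv_same m01.le, arg_psiv_same m01.le]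
    simp only [a]
    push_cast
    ring
  simp only [key]
  rw [Finset.sum_comm]
  have tel : ∀ j : Fin N, ∑ i : Fin N, (a ((i:ℕ) + 1) j - a i j) = w1 / N := by
    intro j
    rw [Fin.sum_univ_eq_sum_range (fun i => a (i + 1) j - a i j), Finset.sum_range_sub (fun i => a i j)]
    have e1 : a 0 j = 0 := by
      simp only [a, hh_psiv]
      simp [s0]
      rw [← Complex.ofReal_mul]
      exact Complex.arg_ofReal_of_nonneg (mul_self_nonneg _)
    have e2 : a N j = w1 / N := by
      simp only [a, hh_psiv]
      rw [div_self hNpos.ne', c1]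
      have : (w0 + w1 * ((((j:ℕ):ℝ) + 1) / N)) - (w0 + w1 * ((j:ℕ) / N)) = w1 / N := by field_simp; ring
      rw [this]
      have hs1 := hS0 1 one_pos le_rfl
      have hpi := Real.pi_pos
      have hb : |w1 / N| < Real.pi / 3 := by rw [abs_div, abs_of_pos hNpos]; exact hwN
      have hb := abs_lt.1 hb
      rw [mul_zero, Complex.ofReal_zero, zero_add, Complex.arg_real_mul _ (by positivity),
        Complex.arg_exp_mul_I, toIocMod_eq_self]
      constructor <;> linarith
    rw [e1, e2, sub_zero]
  rw [Finset.sum_congr rfl fun j _ => tel j]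
  simp
  field_simp

end SPcat
end

open scoped unitInterval Topology
open MeasureTheory
noncomputable section
namespace SPcat

/-- the polygon quotient -/
abbrev MG (g : ℕ) : Type := Quot (orientRel g)

/-- clamping to the unit interval -/
def cl (x : ℝ) : ℝ := max 0 (min 1 x)

lemma cl_nonneg (x : ℝ) : 0 ≤ cl x := le_max_left _ _
lemma cl_le_one (x : ℝ) : cl x ≤ 1 := max_le zero_le_one (min_le_left _ _)
lemma cl_of_mem {x : ℝ} (h0 : 0 ≤ x) (h1 : x ≤ 1) : cl x = x := by
  rw [cl, min_eq_right h1, max_eq_right h0]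
lemma cl_of_nonpos {x : ℝ} (h : x ≤ 0) : cl x = 0 := max_eq_left ((min_le_right _ _).trans h)
lemma cl_of_one_le {x : ℝ} (h : 1 ≤ x) : cl x = 1 := by rw [cl, min_eq_left h]; simp
@[fun_prop] lemma continuous_cl : Continuous cl := by unfold cl; fun_prop
@[simp] lemma cl_zero : cl 0 = 0 := cl_of_mem le_rfl zero_le_one
@[simp] lemma cl_one : cl 1 = 1 := cl_of_mem zero_le_one le_rfl
lemma cl_cl (x : ℝ) : cl (cl x) = cl x := cl_of_mem (cl_nonneg x) (cl_le_one x)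

lemma abs_cl_sub (x y : ℝ) : |cl x - cl y| ≤ |x - y| := by
  unfold cl
  have h1 : |max 0 (min 1 x) - max 0 (min 1 y)| ≤ |min 1 x - min 1 y| := by
    rw [max_comm 0, max_comm 0]; exact abs_max_sub_max_le_abs _ _ 0
  refine h1.trans ?_
  rw [min_comm 1, min_comm 1]
  exact (abs_min_sub_min_le_max _ _ _ _).trans (by simp)

/-- polar coordinates on the disc, angle measured in edges. -/
def polD (N : ℕ) (r θ : ℝ) : Disc :=
  ⟨(cl r : ℂ) * Complex.exp (2 * Real.pi * Complex.I * ((θ : ℂ) / (N : ℝ))), by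
    have : (2 * Real.pi * Complex.I * ((θ : ℂ) / (N : ℝ)) : ℂ) = ((2 * Real.pi * (θ / N) : ℝ) : ℂ) * Complex.I := by
      push_cast; ring
    rw [norm_mul, this, Complex.norm_exp_ofReal_mul_I, mul_one, Complex.norm_real, Real.norm_eq_abs,
      abs_of_nonneg (cl_nonneg r)]
    exact cl_le_one r⟩

lemma polD_val (N : ℕ) (r θ : ℝ) : (polD N r θ : ℂ) = (cl r : ℂ) * Complex.exp (((2 * Real.pi * (θ / N) : ℝ) : ℂ) * Complex.I) := by
  have : (2 * Real.pi * Complex.I * ((θ : ℂ) / (N : ℝ)) : ℂ) = ((2 * Real.pi * (θ / N) : ℝ) : ℂ) * Complex.I := by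
    push_cast; ring
  simp only [polD]
  rw [this]

lemma continuous_polD (N : ℕ) : Continuous fun q : ℝ × ℝ => polD N q.1 q.2 := by
  unfold polD
  refine Continuous.subtype_mk ?_ _
  fun_prop

/-- polar coordinates on the surface -/
def pol (g : ℕ) (r θ : ℝ) : MG g := Quot.mk _ (polD (4 * g) r θ)

lemma continuous_pol (g : ℕ) : Continuous fun q : ℝ × ℝ => pol g q.1 q.2 :=
  continuous_quot_mk.comp (continuous_polD _)

lemma polD_zero (N : ℕ) (θ θ' : ℝ) : polD N 0 θ = polD N 0 θ' := by
  apply Subtype.ext; simp [polD_val]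

lemma polD_add (N : ℕ) (hN : 0 < N) (r θ : ℝ) (k : ℤ) : polD N r (θ + k * N) = polD N r θ := by
  apply Subtype.ext
  have hN' : (N : ℝ) ≠ 0 := by positivity
  rw [polD_val, polD_val]
  congr 1
  have : (((2 * Real.pi * ((θ + k * N) / N) : ℝ) : ℂ) * Complex.I) =
      ((2 * Real.pi * (θ / N) : ℝ) : ℂ) * Complex.I + k * (2 * Real.pi * Complex.I) := by
    rw [add_div, mul_div_assoc, div_self hN', mul_one]
    push_cast; ring
  rw [this, Complex.exp_add, Complex.exp_int_mul_two_pi_mul_I, mul_one]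

lemma polD_cl (N : ℕ) (r θ : ℝ) : polD N (cl r) θ = polD N r θ := by
  apply Subtype.ext; simp [polD_val, cl_cl]

lemma polD_surj (N : ℕ) (hN : 0 < N) (z : Disc) :
    ∃ r θ : ℝ, 0 ≤ r ∧ r ≤ 1 ∧ 0 ≤ θ ∧ θ < N ∧ polD N r θ = z := by
  have hN' : (0:ℝ) < N := by positivity
  have hpi := Real.pi_pos
  have h2 : ∀ θ, polD N ‖z.1‖ (θ) = polD N ‖z.1‖ (θ + ((-⌊θ / N⌋ : ℤ)) * N) := fun θ => (polD_add N hN _ _ _).symm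
  refine ⟨‖z.1‖, Complex.arg z.1 / (2 * Real.pi) * N + ((-⌊(Complex.arg z.1 / (2 * Real.pi) * N) / N⌋ : ℤ)) * N,
    norm_nonneg _, z.2, ?_, ?_, ?_⟩
  · have := Int.floor_le ((Complex.arg z.1 / (2 * Real.pi) * N) / N)
    rw [le_div_iff₀ hN'] at this
    push_cast; linarith
  · have := Int.lt_floor_add_one ((Complex.arg z.1 / (2 * Real.pi) * N) / N)
    rw [div_lt_iff₀ hN'] at this
    push_cast; linarith
  · rw [← h2]
    apply Subtype.ext
    rw [polD_val, cl_of_mem (norm_nonneg _) z.2]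
    have : 2 * Real.pi * (Complex.arg z.1 / (2 * Real.pi) * N / N) = Complex.arg z.1 := by
      field_simp
    rw [this, Complex.norm_mul_exp_arg_mul_I]

lemma polD_inj (N : ℕ) (hN : 0 < N) {r θ r' θ' : ℝ} (hr : 0 ≤ r) (hr1 : r ≤ 1) (hr' : 0 ≤ r') (hr1' : r' ≤ 1)
    (h : polD N r θ = polD N r' θ') : r = r' ∧ (r = 0 ∨ ∃ k : ℤ, θ = θ' + k * N) := by
  have hN' : (0:ℝ) < N := by positivity
  have hpi := Real.pi_pos
  have h := congrArg Subtype.val h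
  rw [polD_val, polD_val, cl_of_mem hr hr1, cl_of_mem hr' hr1'] at h
  have h1 : r = r' := by
    have := congrArg norm h
    rw [norm_mul, norm_mul, Complex.norm_exp_ofReal_mul_I, Complex.norm_exp_ofReal_mul_I, mul_one, mul_one,
      Complex.norm_real, Complex.norm_real, Real.norm_eq_abs, Real.norm_eq_abs, abs_of_nonneg hr, abs_of_nonneg hr'] at this
    exact this
  refine ⟨h1, ?_⟩
  by_cases h0 : r = 0
  · exact Or.inl h0
  right
  rw [← h1] at h
  have h2 := mul_left_cancel₀ (by exact_mod_cast h0) h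
  rw [Complex.exp_eq_exp_iff_exists_int] at h2
  obtain ⟨k, hk⟩ := h2
  refine ⟨k, ?_⟩
  have : ((2 * Real.pi * (θ / N) : ℝ) : ℂ) = ((2 * Real.pi * (θ' / N) + k * (2 * Real.pi) : ℝ) : ℂ) := by
    have hI := Complex.I_ne_zero
    apply mul_right_cancel₀ hI
    rw [hk]; push_cast; ring
  have := Complex.ofReal_injective this
  field_simp at this
  linarith

lemma pol_surj {g : ℕ} (hg : 0 < g) (x : MG g) :
    ∃ r θ : ℝ, 0 ≤ r ∧ r ≤ 1 ∧ 0 ≤ θ ∧ θ < 4 * g ∧ pol g r θ = x := by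
  obtain ⟨z, rfl⟩ := Quot.mk_surjective x
  obtain ⟨r, θ, h1, h2, h3, h4, h5⟩ := polD_surj (4 * g) (by omega) z
  exact ⟨r, θ, h1, h2, h3, by push_cast at h4; exact h4, by rw [pol, h5]⟩

lemma pol_zero (g : ℕ) (θ θ' : ℝ) : pol g 0 θ = pol g 0 θ' := by rw [pol, polD_zero _ θ θ', pol]
lemma pol_cl (g : ℕ) (r θ : ℝ) : pol g (cl r) θ = pol g r θ := by rw [pol, polD_cl, pol]
lemma pol_per {g : ℕ} (hg : 0 < g) (r : ℝ) : pol g r (4 * g) = pol g r 0 := by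
  have := polD_add (4 * g) (by omega) r 0 1
  rw [pol, pol, ← this]; congr 2; push_cast; ring

lemma polyBP_eq (N k : ℕ) (t : ℝ) : polyBP N k t = (polD N 1 (k + t) : ℂ) := by
  simp [polyBP, polD]

lemma pol_glue {g j ρ : ℕ} (hj : j < g) (hρ : ρ < 2) {t : ℝ} (h0 : 0 ≤ t) (h1 : t ≤ 1) :
    pol g 1 (4 * j + ρ + t) = pol g 1 (4 * j + ρ + 3 - t) := by
  apply Quot.sound
  refine ⟨⟨j, hj⟩, ⟨ρ, hρ⟩, t, h0, h1, ?_, ?_⟩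
  · rw [polyBP_eq]; congr 2; push_cast; ring
  · rw [polyBP_eq]; congr 2; push_cast; ring

/-- compatibility of a map in polar coordinates with the gluing -/
structure Compat {Y : Type*} (g : ℕ) (f : ℝ → ℝ → Y) : Prop where
  zero : ∀ θ : ℝ, 0 ≤ θ → θ ≤ 4 * g → f 0 θ = f 0 0
  per : ∀ r, 0 ≤ r → r ≤ 1 → f r (4 * g) = f r 0
  glue : ∀ j : ℕ, j < g → ∀ ρ : ℕ, ρ < 2 → ∀ t : ℝ, 0 ≤ t → t ≤ 1 →
    f 1 (4 * j + ρ + t) = f 1 (4 * j + ρ + 3 - t)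

lemma exists_lift {Y : Type*} {g : ℕ} (hg : 0 < g) {f : ℝ → ℝ → Y} (hf : Compat g f) :
    ∃ F : MG g → Y, ∀ r θ : ℝ, 0 ≤ r → r ≤ 1 → 0 ≤ θ → θ ≤ 4 * g → F (pol g r θ) = f r θ := by
  have hN : 0 < 4 * g := by omega
  choose R T h1 h2 h3 h4 h5 using polD_surj (4 * g) hN
  have hc : ((4 * g : ℕ) : ℝ) = 4 * g := by push_cast; ring
  rw [hc] at h4
  have key : ∀ r θ : ℝ, 0 ≤ r → r ≤ 1 → 0 ≤ θ → θ ≤ 4 * g →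
      f (R (polD (4 * g) r θ)) (T (polD (4 * g) r θ)) = f r θ := by
    intro r θ a1 a2 a3 a4
    set z := polD (4 * g) r θ with hz
    obtain ⟨e1, e2⟩ := polD_inj (4 * g) hN (h1 z) (h2 z) a1 a2 (h5 z)
    rw [e1]
    rcases e2 with e2 | ⟨k, e2⟩
    · rw [e1] at e2
      rw [e2, hf.zero _ (h3 z) (h4 z).le, hf.zero _ a3 a4]
    · rw [hc] at e2
      have gp : (0:ℝ) < 4 * g := by positivity
      have k1 : (k:ℝ) < 1 := by
        by_contra! h
        have := h4 z
        nlinarith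
      have k2 : (-2:ℝ) < k := by
        by_contra! h
        have := h3 z
        nlinarith
      have k1' : k < 1 := by exact_mod_cast k1
      have k2' : -2 < k := by exact_mod_cast k2
      obtain rfl | rfl : k = 0 ∨ k = -1 := by omega
      · rw [e2]; simp
      · have : θ = 4 * g := by
          have := h3 z
          push_cast at e2
          linarith
        have t0 : T z = 0 := by push_cast at e2; linarith
        rw [this, t0, hf.per r a1 a2]
  refine ⟨Quot.lift (fun z => f (R z) (T z)) ?_, fun r θ a1 a2 a3 a4 => key r θ a1 a2 a3 a4⟩
  rintro z w ⟨j, ρ, t, t0, t1, hz, hw⟩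
  have hj : ((j:ℕ):ℝ) + 1 ≤ g := by exact_mod_cast j.2
  have hρ : ((ρ:ℕ):ℝ) ≤ 1 := by exact_mod_cast Nat.lt_succ_iff.1 ρ.2
  have hj0 : (0:ℝ) ≤ (j:ℕ) := by positivity
  have hρ0 : (0:ℝ) ≤ (ρ:ℕ) := by positivity
  rw [polyBP_eq] at hz hw
  have hz := Subtype.ext hz
  have hw := Subtype.ext hw
  have ez : ((4 * (j:ℕ) + (ρ:ℕ) : ℕ) : ℝ) + t = 4 * (j:ℕ) + (ρ:ℕ) + t := by push_cast; ring
  have ew : ((4 * (j:ℕ) + (ρ:ℕ) + 2: ℕ) : ℝ) + (1 - t) = 4 * (j:ℕ) + (ρ:ℕ) + 3 - t := by push_cast; ring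
  rw [ez] at hz
  rw [ew] at hw
  rw [hz, hw, key _ _ zero_le_one le_rfl (by linarith) (by linarith),
    key _ _ zero_le_one le_rfl (by linarith) (by linarith)]
  exact hf.glue j j.2 ρ ρ.2 t t0 t1

/-- compact coordinate domain -/
abbrev PK (g : ℕ) : Type := Set.Icc (0:ℝ) 1 × Set.Icc (0:ℝ) (4 * g)

def polK (g : ℕ) (q : PK g) : MG g := pol g q.1 q.2

lemma isQuotientMap_polK {g : ℕ} (hg : 0 < g) : Topology.IsQuotientMap (polK g) := by
  have h1 : Topology.IsQuotientMap (fun q : PK g => polD (4 * g) q.1 q.2) := by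
    have hc : Continuous (fun q : PK g => polD (4 * g) q.1 q.2) :=
      (continuous_polD (4 * g)).comp (by fun_prop : Continuous fun q : PK g => ((q.1 : ℝ), (q.2 : ℝ)))
    refine hc.isClosedMap.isQuotientMap hc ?_
    intro z
    obtain ⟨r, θ, h1, h2, h3, h4, h5⟩ := polD_surj (4 * g) (by omega) z
    push_cast at h4
    exact ⟨(⟨r, h1, h2⟩, ⟨θ, h3, h4.le⟩), h5⟩
  exact isQuotientMap_quot_mk.comp h1

lemma continuous_of_pol {Y : Type*} [TopologicalSpace Y] {g : ℕ} (hg : 0 < g) {F : MG g → Y}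
    (h : Continuous fun q : PK g => F (pol g q.1 q.2)) : Continuous F :=
  (isQuotientMap_polK hg).continuous_iff.2 h

lemma continuous_of_pol2 {Y T : Type*} [TopologicalSpace Y] [TopologicalSpace T] [LocallyCompactSpace T]
    {g : ℕ} (hg : 0 < g) {F : MG g × T → Y}
    (h : Continuous fun q : PK g × T => F (pol g q.1.1 q.1.2, q.2)) : Continuous F := by
  exact (isQuotientMap_polK hg).continuous_lift_prod_left h

end SPcat
end

open scoped unitInterval Topology
open MeasureTheory
noncomputable section
namespace SPcat

/-- trapezoid function -/
def tz (c θ : ℝ) : ℝ := cl (min (θ - c) (c + 3 - θ))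

@[fun_prop] lemma continuous_tz (c : ℝ) : Continuous (tz c) := by
  unfold tz
  exact continuous_cl.comp (by fun_prop)

lemma tz_nonneg (c θ : ℝ) : 0 ≤ tz c θ := cl_nonneg _
lemma tz_le_one (c θ : ℝ) : tz c θ ≤ 1 := cl_le_one _
lemma tz_left {c θ : ℝ} (h : θ ≤ c) : tz c θ = 0 := cl_of_nonpos ((min_le_left _ _).trans (by linarith))
lemma tz_right {c θ : ℝ} (h : c + 3 ≤ θ) : tz c θ = 0 := cl_of_nonpos ((min_le_right _ _).trans (by linarith))
lemma tz_mid {c θ : ℝ} (h : c + 1 ≤ θ) (h' : θ ≤ c + 2) : tz c θ = 1 :=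
  cl_of_one_le (le_min (by linarith) (by linarith))
lemma tz_up {c θ : ℝ} (h : c ≤ θ) (h' : θ ≤ c + 1) : tz c θ = θ - c := by
  rw [tz, min_eq_left (by linarith), cl_of_mem (by linarith) (by linarith)]
lemma tz_down {c θ : ℝ} (h : c + 2 ≤ θ) (h' : θ ≤ c + 3) : tz c θ = c + 3 - θ := by
  rw [tz, min_eq_right (by linarith), cl_of_mem (by linarith) (by linarith)]
lemma tz_symm (c θ : ℝ) : tz c (2 * c + 3 - θ) = tz c θ := by
  unfold tz; rw [min_comm]; congr 2 <;> ring

/-- values glue: trapezoids agree modulo one -/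
lemma tz_glue {k j ρ ς : ℕ} (hρ : ρ < 2) (hς : ς < 2) {t : ℝ} (t0 : 0 ≤ t) (t1 : t ≤ 1) :
    (tz (4 * k + ς) (4 * j + ρ + t) = tz (4 * k + ς) (4 * j + ρ + 3 - t)) ∨
    (j = k ∧ ((tz (4 * k + ς) (4 * j + ρ + t) = 1 ∧ tz (4 * k + ς) (4 * j + ρ + 3 - t) = 0) ∨
    (tz (4 * k + ς) (4 * j + ρ + t) = 0 ∧ tz (4 * k + ς) (4 * j + ρ + 3 - t) = 1))) := by
  have r0 : (0:ℝ) ≤ ρ := by positivity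
  have r1 : (ρ:ℝ) ≤ 1 := by exact_mod_cast Nat.lt_succ_iff.1 hρ
  have q0 : (0:ℝ) ≤ ς := by positivity
  have q1 : (ς:ℝ) ≤ 1 := by exact_mod_cast Nat.lt_succ_iff.1 hς
  rcases lt_trichotomy j k with h | h | h
  · left
    have : (j:ℝ) + 1 ≤ k := by exact_mod_cast h
    rw [tz_left (by linarith), tz_left (by linarith)]
  · subst h
    obtain rfl | rfl : ρ = 0 ∨ ρ = 1 := by omega
    · obtain rfl | rfl : ς = 0 ∨ ς = 1 := by omega
      · left; rw [← tz_symm]; congr 1; push_cast; ring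
      · right; refine ⟨rfl, Or.inr ⟨tz_left ?_, tz_mid ?_ ?_⟩⟩ <;> push_cast <;> linarith
    · obtain rfl | rfl : ς = 0 ∨ ς = 1 := by omega
      · right; refine ⟨rfl, Or.inl ⟨tz_mid ?_ ?_, tz_right ?_⟩⟩ <;> push_cast <;> linarith
      · left; rw [← tz_symm]; congr 1; push_cast; ring
  · left
    have : (k:ℝ) + 1 ≤ j := by exact_mod_cast h
    rw [tz_right (by linarith), tz_right (by linarith)]

lemma exists_F {g k ς : ℕ} (hk : k < g) (hς : ς < 2) : ∃ F : MG g → ℂ, Cv F ∧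
    ∀ r θ : ℝ, 0 ≤ r → r ≤ 1 → 0 ≤ θ → θ ≤ 4 * g →
      F (pol g r θ) = Complex.exp (((2 * Real.pi * (r * tz (4 * k + ς) θ) : ℝ) : ℂ) * Complex.I) := by
  have hg : 0 < g := by omega
  have hk1 : (k:ℝ) + 1 ≤ g := by exact_mod_cast hk
  have q0 : (0:ℝ) ≤ ς := by positivity
  have q1 : (ς:ℝ) ≤ 1 := by exact_mod_cast Nat.lt_succ_iff.1 hς
  have k0 : (0:ℝ) ≤ k := by positivity
  obtain ⟨F, hF⟩ := exists_lift (Y := ℂ) hg (f := fun r θ =>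
      Complex.exp (((2 * Real.pi * (r * tz (4 * k + ς) θ) : ℝ) : ℂ) * Complex.I)) ⟨by intros; simp, by
        intro r _ _
        rw [tz_left (θ := 0) (by positivity), tz_right (by linarith)], by
        intro j hj ρ hρ t t0 t1
        have e1 : Complex.exp (((2 * Real.pi * (1 * 1) : ℝ) : ℂ) * Complex.I) =
          Complex.exp (((2 * Real.pi * (1 * 0) : ℝ) : ℂ) * Complex.I) := by
          rw [mul_one, mul_one, mul_zero, mul_zero]
          push_cast
          rw [Complex.exp_two_pi_mul_I]; simp
        rcases tz_glue (k := k) (j := j) hρ hς t0 t1 with h | ⟨_, ⟨h, h'⟩ | ⟨h, h'⟩⟩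
        · rw [h]
        · rw [h, h', e1]
        · rw [h, h', e1]⟩
  refine ⟨F, ⟨continuous_of_pol hg ?_, fun x => ?_⟩, hF⟩
  · have : (fun q : PK g => F (pol g q.1 q.2)) = fun q : PK g =>
      Complex.exp (((2 * Real.pi * ((q.1 : ℝ) * tz (4 * k + ς) q.2) : ℝ) : ℂ) * Complex.I) := by
      funext q; exact hF _ _ q.1.2.1 q.1.2.2 q.2.2.1 q.2.2.2
    rw [this]
    fun_prop
  · obtain ⟨r, θ, h1, h2, h3, h4, rfl⟩ := pol_surj hg x
    rw [hF _ _ h1 h2 h3 h4.le, Complex.norm_exp_ofReal_mul_I]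

lemma A2_of_exp {M : Type*} {F : M → ℂ} {x y : M} {a b : ℝ}
    (hx : F x = Complex.exp (((2 * Real.pi * a : ℝ) : ℂ) * Complex.I))
    (hy : F y = Complex.exp (((2 * Real.pi * b : ℝ) : ℂ) * Complex.I)) (hab : |b - a| < 1 / 2) :
    A2 F x y = 2 * Real.pi * (b - a) := by
  unfold A2
  rw [hx, hy, ← Complex.exp_conj, map_mul, Complex.conj_ofReal, Complex.conj_I, ← Complex.exp_add]
  have : ((2 * Real.pi * a : ℝ) : ℂ) * -Complex.I + ((2 * Real.pi * b : ℝ) : ℂ) * Complex.I =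
    ((2 * Real.pi * (b - a) : ℝ) : ℂ) * Complex.I := by push_cast; ring
  rw [this, Complex.arg_exp_mul_I, toIocMod_eq_self]
  have hp := Real.pi_pos
  have := abs_lt.1 hab
  constructor <;> nlinarith

/-- angular coordinate in the four sectors -/
def ag (ρ : Fin 4) (u : ℝ) : ℝ := ![u, 1 + u, 3 - u, 4 - u] ρ

def eps4 (ρ : Fin 4) : ℝ := ![1, 1, -1, -1] ρ

def sg (g : ℕ) (e : Fin g × Fin 4) (r u : ℝ) : MG g := pol g r (4 * (e.1 : ℕ) + ag e.2 (cl u))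

lemma ag_bd (ρ : Fin 4) {u : ℝ} (h0 : 0 ≤ u) (h1 : u ≤ 1) : 0 ≤ ag ρ u ∧ ag ρ u ≤ 4 := by
  fin_cases ρ <;> simp [ag] <;> constructor <;> linarith

lemma continuous_sg (g : ℕ) (e : Fin g × Fin 4) : Continuous fun q : ℝ × ℝ => sg g e q.1 q.2 := by
  unfold sg
  have h : Continuous fun q : ℝ × ℝ => (q.1, 4 * ((e.1 : ℕ) : ℝ) + ag e.2 (cl q.2)) := by
    obtain ⟨j, ρ⟩ := e
    fin_cases ρ <;> simp only [ag] <;> simp <;> refine ⟨by fun_prop, by fun_prop⟩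
  exact (continuous_pol g).comp h

lemma sg_H1 (g : ℕ) (Φ : (ℝ → MG g) → ℝ) :
    ∑ e : Fin g × Fin 4, eps4 e.2 * (Φ (fun u => sg g e 1 u) - Φ (fun u => sg g e 0 u)) = 0 := by
  rw [Fintype.sum_prod_type]
  refine Finset.sum_eq_zero fun j _ => ?_
  have z : ∀ ρ : Fin 4, (fun u => sg g (j, ρ) 0 u) = fun _ => pol g 0 0 := by
    intro ρ; funext u; exact pol_zero _ _ _
  have e1 : (fun u => sg g (j, 0) 1 u) = fun u => sg g (j, 2) 1 u := by
    funext u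
    have := pol_glue (ρ := 0) j.2 (by norm_num) (cl_nonneg u) (cl_le_one u)
    simp only [sg, ag]
    simp at this ⊢
    rw [this]; congr 1; ring
  have e2 : (fun u => sg g (j, 1) 1 u) = fun u => sg g (j, 3) 1 u := by
    funext u
    have := pol_glue (ρ := 1) j.2 (by norm_num) (cl_nonneg u) (cl_le_one u)
    simp only [sg, ag]
    simp at this ⊢
    rw [← add_assoc, this]; congr 1; ring
  rw [Fin.sum_univ_four]
  simp only [z, e1, e2]
  simp [eps4]
  ring

lemma sg_H2 {g : ℕ} (hg : 0 < g) (Φ : (ℝ → MG g) → ℝ) :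
    ∑ e : Fin g × Fin 4, eps4 e.2 * (Φ (fun r => sg g e r 1) - Φ (fun r => sg g e r 0)) = 0 := by
  rw [Fintype.sum_prod_type]
  let R : ℝ → ℝ := fun x => Φ (fun r => pol g r x)
  have key : ∀ j : Fin g, ∑ ρ : Fin 4, eps4 ρ * (Φ (fun r => sg g (j, ρ) r 1) - Φ (fun r => sg g (j, ρ) r 0)) =
      (fun j : ℕ => R (4 * (j + 1 : ℕ)) - R (4 * (j:ℕ))) j := by
    intro j
    rw [Fin.sum_univ_four]
    simp only [sg, ag, eps4, R]
    simp
    have h1 : (4 * ((j:ℕ):ℝ) + (1 + 1)) = 4 * ((j:ℕ):ℝ) + 2 := by ring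
    have h2 : (4 * ((j:ℕ):ℝ) + (3 - 1)) = 4 * ((j:ℕ):ℝ) + 2 := by ring
    have h3 : (4 * ((j:ℕ):ℝ) + (4 - 1)) = 4 * ((j:ℕ):ℝ) + 3 := by ring
    have h4 : (4 * (((j:ℕ):ℝ) + 1)) = 4 * ((j:ℕ):ℝ) + 4 := by ring
    rw [h1, h2, h3, h4]; ring
  rw [Finset.sum_congr rfl fun j _ => key j, Fin.sum_univ_eq_sum_range
    (fun j : ℕ => R (4 * (j + 1 : ℕ)) - R (4 * (j:ℕ))), Finset.sum_range_sub (fun j : ℕ => R (4 * (j:ℕ)))]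
  have : R (4 * (g:ℕ)) = R (4 * ((0:ℕ):ℝ)) := by
    simp only [R]; congr 1; funext r; rw [pol_per hg]; simp
  rw [this, sub_self]

/-- tautological line of the surface -/
lemma exists_p {g : ℕ} (hg : 0 < g) : ∃ p : MG g → Fin 2 → Fin 2 → ℂ, Rk1 p ∧
    ∀ r θ : ℝ, 0 ≤ r → r ≤ 1 → 0 ≤ θ → θ ≤ 4 * g → p (pol g r θ) = fun i j =>
      psiv (1 - r) r (2 * Real.pi / (4 * g) * θ) i *
        (starRingEnd ℂ) (psiv (1 - r) r (2 * Real.pi / (4 * g) * θ) j) := by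
  have hg' : (0:ℝ) < g := by positivity
  have nrm : ∀ w : ℝ, Complex.exp (w * Complex.I) * (starRingEnd ℂ) (Complex.exp (w * Complex.I)) = 1 := by
    intro w
    rw [Complex.mul_conj, Complex.normSq_eq_norm_sq, Complex.norm_exp_ofReal_mul_I]; simp
  obtain ⟨F, hF⟩ := exists_lift (Y := Fin 2 → Fin 2 → ℂ) hg (f := fun r θ => fun i j =>
      psiv (1 - r) r (2 * Real.pi / (4 * g) * θ) i *
        (starRingEnd ℂ) (psiv (1 - r) r (2 * Real.pi / (4 * g) * θ) j)) ⟨by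
        intro θ _ _; funext i j; fin_cases i <;> fin_cases j <;> simp [psiv], by
        intro r _ _
        have : psiv (1 - r) r (2 * Real.pi / (4 * g) * (4 * g)) = psiv (1 - r) r (2 * Real.pi / (4 * g) * 0) := by
          unfold psiv
          rw [div_mul_cancel₀ _ (by positivity), mul_zero]
          simp [Complex.exp_two_pi_mul_I]
        rw [this], by
        intro j hj ρ hρ t t0 t1
        funext a b
        fin_cases a <;> fin_cases b <;> simp only [psiv] <;> simp [-map_mul, nrm]
        have h1 := nrm (2 * Real.pi / (4 * g) * (4 * j + ρ + t))
        have h2 := nrm (2 * Real.pi / (4 * g) * (4 * j + ρ + 3 - t))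
        push_cast at h1 h2
        rw [h1, h2]⟩
  refine ⟨F, ⟨continuous_of_pol hg ?_, fun x => ?_⟩, hF⟩
  · have : (fun q : PK g => F (pol g q.1 q.2)) = fun q : PK g => fun i j =>
      psiv (1 - q.1) q.1 (2 * Real.pi / (4 * g) * q.2) i *
        (starRingEnd ℂ) (psiv (1 - q.1) q.1 (2 * Real.pi / (4 * g) * q.2) j) := by
      funext q; exact hF _ _ q.1.2.1 q.1.2.2 q.2.2.1 q.2.2.2
    rw [this]
    refine continuous_pi fun i => continuous_pi fun j => ?_
    have hc : ∀ i : Fin 2, Continuous fun q : PK g => psiv (1 - q.1) q.1 (2 * Real.pi / (4 * g) * q.2) i := by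
      intro i; fin_cases i <;> simp only [psiv] <;> simp <;> fun_prop
    exact (hc i).mul (Complex.continuous_conj.comp (hc j))
  · obtain ⟨r, θ, h1, h2, h3, h4, rfl⟩ := pol_surj hg x
    refine ⟨_, ?_, hF _ _ h1 h2 h3 h4.le⟩
    intro h
    have h1 := congrFun h 0
    have h2 := congrFun h 1
    simp [psiv] at h1 h2
    rw [h2] at h1; simp at h1

end SPcat
end

open scoped unitInterval Topology
open MeasureTheory
noncomputable section
namespace SPcat

lemma tz_ag {j k : ℕ} {u : ℝ} (h0 : 0 ≤ u) (h1 : u ≤ 1) :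
    (j ≠ k → ∀ ρ, ∀ ς : ℕ, ς < 2 → tz (4 * k + ς) (4 * j + ag ρ u) = 0) ∧
    (∀ ρ, tz (4 * k + (0:ℕ)) (4 * k + ag ρ u) = ![u, 1, u, 0] ρ) ∧
    (∀ ρ, tz (4 * k + (1:ℕ)) (4 * k + ag ρ u) = ![0, u, 1, u] ρ) := by
  refine ⟨fun hjk ρ ς hς => ?_, fun ρ => ?_, fun ρ => ?_⟩
  · have q0 : (0:ℝ) ≤ ς := by positivity
    have q1 : (ς:ℝ) ≤ 1 := by exact_mod_cast Nat.lt_succ_iff.1 hς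
    obtain ⟨b0, b1⟩ := ag_bd ρ h0 h1
    rcases lt_or_gt_of_ne hjk with h | h
    · have : (j:ℝ) + 1 ≤ k := by exact_mod_cast h
      exact tz_left (by linarith)
    · have : (k:ℝ) + 1 ≤ j := by exact_mod_cast h
      exact tz_right (by linarith)
  · fin_cases ρ <;> simp [ag]
    · rw [tz_up] <;> linarith
    · rw [tz_mid] <;> linarith
    · rw [tz_down] <;> linarith
    · rw [tz_right]; linarith
  · fin_cases ρ <;> simp [ag]
    · rw [tz_left]; linarith
    · rw [tz_up] <;> linarith
    · rw [tz_mid] <;> linarith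
    · rw [tz_down] <;> linarith

lemma sum_odd (N : ℕ) : ∑ i ∈ Finset.range N, (2 * (i:ℝ) + 1) = (N:ℝ) ^ 2 := by
  induction N with
  | zero => simp
  | succ N ih => rw [Finset.sum_range_succ, ih]; push_cast; ring

lemma I2_ab {g k : ℕ} (hk : k < g) {Fa Fb : MG g → ℂ}
    (ha : ∀ r θ : ℝ, 0 ≤ r → r ≤ 1 → 0 ≤ θ → θ ≤ 4 * g →
      Fa (pol g r θ) = Complex.exp (((2 * Real.pi * (r * tz (4 * k + (0:ℕ)) θ) : ℝ) : ℂ) * Complex.I))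
    (hb : ∀ r θ : ℝ, 0 ≤ r → r ≤ 1 → 0 ≤ θ → θ ≤ 4 * g →
      Fb (pol g r θ) = Complex.exp (((2 * Real.pi * (r * tz (4 * k + (1:ℕ)) θ) : ℝ) : ℂ) * Complex.I))
    (N : ℕ) (hN : 3 ≤ N) :
    I2 N (fun e : Fin g × Fin 4 => eps4 e.2) (sg g) (fun x y z => A2 Fa x y * A2 Fb y z) ≠ 0 := by
  have hNp : (0:ℝ) < N := by positivity
  have hN3 : (3:ℝ) ≤ N := by exact_mod_cast hN
  have fa : ∀ (e : Fin g × Fin 4) (r u : ℝ), 0 ≤ r → r ≤ 1 → 0 ≤ u → u ≤ 1 → Fa (sg g e r u) =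
      Complex.exp (((2 * Real.pi * (if (e.1:ℕ) = k then r * ![u, 1, u, 0] e.2 else 0) : ℝ) : ℂ) * Complex.I) := by
    intro e r u r0 r1 u0 u1
    have hj : ((e.1:ℕ):ℝ) + 1 ≤ g := by exact_mod_cast e.1.2
    obtain ⟨b0, b1⟩ := ag_bd e.2 u0 u1
    rw [sg, cl_of_mem u0 u1, ha _ _ r0 r1 (by positivity) (by linarith)]
    split_ifs with h
    · rw [h, (tz_ag u0 u1 (j := k)).2.1]
    · rw [(tz_ag u0 u1).1 h _ _ (by norm_num), mul_zero]
  have fb : ∀ (e : Fin g × Fin 4) (r u : ℝ), 0 ≤ r → r ≤ 1 → 0 ≤ u → u ≤ 1 → Fb (sg g e r u) =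
      Complex.exp (((2 * Real.pi * (if (e.1:ℕ) = k then r * ![0, u, 1, u] e.2 else 0) : ℝ) : ℂ) * Complex.I) := by
    intro e r u r0 r1 u0 u1
    have hj : ((e.1:ℕ):ℝ) + 1 ≤ g := by exact_mod_cast e.1.2
    obtain ⟨b0, b1⟩ := ag_bd e.2 u0 u1
    rw [sg, cl_of_mem u0 u1, hb _ _ r0 r1 (by positivity) (by linarith)]
    split_ifs with h
    · rw [h, (tz_ag u0 u1 (j := k)).2.2]
    · rw [(tz_ag u0 u1).1 h _ _ (by norm_num), mul_zero]
  rw [I2_explicit]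
  have bnd : ∀ i : Fin N, (0:ℝ) ≤ (i:ℕ) / N ∧ ((i:ℕ):ℝ) / N ≤ 1 ∧ (0:ℝ) ≤ ((i:ℕ) + 1) / N ∧ (((i:ℕ):ℝ) + 1) / N ≤ 1 := by
    intro i
    have hi : ((i:ℕ):ℝ) + 1 ≤ N := by exact_mod_cast i.2
    refine ⟨by positivity, (div_le_one hNp).2 (by linarith), by positivity, (div_le_one hNp).2 hi⟩
  have cell : ∀ (e : Fin g × Fin 4) (i j : Fin N),
      (A2 Fa (sg g e ((i:ℕ) / N) ((j:ℕ) / N)) (sg g e (((i:ℕ) + 1 : ℝ) / N) ((j:ℕ) / N)) *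
          A2 Fb (sg g e (((i:ℕ) + 1 : ℝ) / N) ((j:ℕ) / N)) (sg g e (((i:ℕ) + 1 : ℝ) / N) (((j:ℕ) + 1 : ℝ) / N))
        - A2 Fa (sg g e ((i:ℕ) / N) ((j:ℕ) / N)) (sg g e ((i:ℕ) / N) (((j:ℕ) + 1 : ℝ) / N)) *
          A2 Fb (sg g e ((i:ℕ) / N) (((j:ℕ) + 1 : ℝ) / N)) (sg g e (((i:ℕ) + 1 : ℝ) / N) (((j:ℕ) + 1 : ℝ) / N))) =
      if (e.1:ℕ) = k then (2 * Real.pi) ^ 2 / N ^ 3 * ![0, ((i:ℕ):ℝ) + 1, - (i:ℕ), 0] e.2 else 0 := by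
    rintro ⟨m, ρ⟩ i j
    obtain ⟨i0, i1, i2, i3⟩ := bnd i
    obtain ⟨j0, j1, j2, j3⟩ := bnd j
    have d1 : (((i:ℕ):ℝ) + 1) / N - (i:ℕ) / N = 1 / N := by ring
    have d2 : (((j:ℕ):ℝ) + 1) / N - (j:ℕ) / N = 1 / N := by ring
    have hN1 : (1:ℝ) / N < 1 / 2 := by
      rw [div_lt_div_iff₀ hNp (by norm_num)]; linarith
    have hN0 : (0:ℝ) < 1 / N := by positivity
    set x := ((i:ℕ):ℝ) / N with hx
    set x' := (((i:ℕ):ℝ) + 1) / N with hx'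
    set y := ((j:ℕ):ℝ) / N with hy
    set y' := (((j:ℕ):ℝ) + 1) / N with hy'
    have b1 : ∀ w : ℝ, 0 ≤ w → w ≤ 1 → |w * (1 / N)| < 1 / 2 := by
      intro w w0 w1
      rw [abs_of_nonneg (by positivity)]
      nlinarith
    have a1 := A2_of_exp (fa (m, ρ) x y i0 i1 j0 j1) (fa (m, ρ) x' y i2 i3 j0 j1)
    have a2 := A2_of_exp (fa (m, ρ) x y i0 i1 j0 j1) (fa (m, ρ) x y' i0 i1 j2 j3)
    have c1 := A2_of_exp (fb (m, ρ) x' y i2 i3 j0 j1) (fb (m, ρ) x' y' i2 i3 j2 j3)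
    have c2 := A2_of_exp (fb (m, ρ) x y' i0 i1 j2 j3) (fb (m, ρ) x' y' i2 i3 j2 j3)
    have dx' : x' = x + 1 / N := by linarith
    have dy' : y' = y + 1 / N := by linarith
    have hxi : ((i:ℕ):ℝ) = x * N := by rw [hx]; field_simp
    by_cases h : (m:ℕ) = k
    · have e1 : ∀ w : ℝ, x' * w - x * w = w * (1 / N) := by intro w; rw [dx']; ring
      have e2 : ∀ w : ℝ, w * y' - w * y = w * (1 / N) := by intro w; rw [dy']; ring
      simp only [h, if_true] at a1 a2 c1 c2 ⊢
      fin_cases ρ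
      · simp at a1 a2 c1 c2 ⊢
        rw [c1, c2]; simp
      · simp [e2] at a1 a2 c1 c2 ⊢
        have := b1 x' i2 i3
        have h3 := b1 1 zero_le_one le_rfl
        simp at this h3
        rw [a1 (by rw [d1]; simpa using h3), a2, c1 (by simpa using this), d1, hxi, dx']
        field_simp
        ring
      · simp [e2] at a1 a2 c1 c2 ⊢
        have := b1 x i0 i1
        have h3 := b1 1 zero_le_one le_rfl
        simp at this h3
        rw [c1, a2 (by simpa using this), c2 (by rw [d1]; simpa using h3), d1, hxi]
        field_simp
        ring
      · simp at a1 a2 c1 c2 ⊢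
        rw [a1, a2]; simp
    · simp [h] at a1 a2 ⊢
      rw [a1, a2]; simp
  simp only [cell]
  have tot : ∑ e : Fin g × Fin 4, eps4 e.2 * ∑ i : Fin N, ∑ j : Fin N,
      (if (e.1:ℕ) = k then (2 * Real.pi) ^ 2 / N ^ 3 * ![0, ((i:ℕ):ℝ) + 1, - (i:ℕ), 0] e.2 else 0) = (2 * Real.pi) ^ 2 := by
    rw [Fintype.sum_prod_type, Finset.sum_eq_single (⟨k, hk⟩ : Fin g)]
    · rw [Fin.sum_univ_four]
      simp [eps4]
      rw [← Finset.sum_add_distrib]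
      have : ∀ i : Fin N, (N:ℝ) * ((2 * Real.pi) ^ 2 / N ^ 3 * (((i:ℕ):ℝ) + 1)) +
          ((N:ℝ) * ((2 * Real.pi) ^ 2 / N ^ 3 * (i:ℕ))) = (2 * Real.pi) ^ 2 / N ^ 2 * (2 * ((i:ℕ):ℝ) + 1) := by
        intro i; field_simp; ring
      have key : ∑ i : Fin N, (2 * Real.pi) ^ 2 / N ^ 2 * (2 * ((i:ℕ):ℝ) + 1) = (2 * Real.pi) ^ 2 := by
        rw [← Finset.mul_sum, Fin.sum_univ_eq_sum_range (fun i : ℕ => 2 * (i:ℝ) + 1), sum_odd]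
        field_simp
      exact (Finset.sum_congr rfl fun i _ => this i).trans key
    · intro b _ hb
      refine Finset.sum_eq_zero fun ρ _ => ?_
      have : ¬ (b:ℕ) = k := fun h => hb (Fin.ext h)
      simp [this]
    · simp
  rw [tot]
  have := Real.pi_pos
  positivity

lemma I2_p {g : ℕ} (hg : 0 < g) {p : MG g → Fin 2 → Fin 2 → ℂ}
    (hp : ∀ r θ : ℝ, 0 ≤ r → r ≤ 1 → 0 ≤ θ → θ ≤ 4 * g → p (pol g r θ) = fun i j =>
      psiv (1 - r) r (2 * Real.pi / (4 * g) * θ) i *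
        (starRingEnd ℂ) (psiv (1 - r) r (2 * Real.pi / (4 * g) * θ) j)) (N : ℕ) (hN : 3 ≤ N) :
    I2 N (fun e : Fin g × Fin 4 => eps4 e.2) (sg g) (A3 p) ≠ 0 := by
  have hg' : (1:ℝ) ≤ g := by exact_mod_cast hg
  have hNp : (0:ℝ) < N := by positivity
  have hN3 : (3:ℝ) ≤ N := by exact_mod_cast hN
  have hpi := Real.pi_pos
  rw [I2_explicit]
  have ch : ∀ e : Fin g × Fin 4, ∑ i : Fin N, ∑ j : Fin N,
      (A3 p (sg g e ((i:ℕ) / N) ((j:ℕ) / N)) (sg g e (((i:ℕ) + 1 : ℝ) / N) ((j:ℕ) / N))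
          (sg g e (((i:ℕ) + 1 : ℝ) / N) (((j:ℕ) + 1 : ℝ) / N))
        - A3 p (sg g e ((i:ℕ) / N) ((j:ℕ) / N)) (sg g e ((i:ℕ) / N) (((j:ℕ) + 1 : ℝ) / N))
          (sg g e (((i:ℕ) + 1 : ℝ) / N) (((j:ℕ) + 1 : ℝ) / N))) = 2 * Real.pi / (4 * g) * eps4 e.2 := by
    intro e
    refine A3_chart p (sg g e) (fun r => 1 - r) (fun r => r) (2 * Real.pi / (4 * g) * (4 * (e.1:ℕ) + ![0, 1, 3, 4] e.2))
      (2 * Real.pi / (4 * g) * eps4 e.2) ?_ ?_ ?_ ?_ ?_ ?_ ?_ N (by omega) ?_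
    · intro r u r0 r1 u0 u1
      have hj : ((e.1:ℕ):ℝ) + 1 ≤ g := by exact_mod_cast e.1.2
      obtain ⟨b0, b1⟩ := ag_bd e.2 u0 u1
      have e3 : 2 * Real.pi / (4 * g) * (4 * ((e.1:ℕ):ℝ) + ag e.2 u) =
          2 * Real.pi / (4 * g) * (4 * (e.1:ℕ) + ![0, 1, 3, 4] e.2) + 2 * Real.pi / (4 * g) * eps4 e.2 * u := by
        obtain ⟨j, ρ⟩ := e
        rw [mul_assoc, ← mul_add]; congr 1
        fin_cases ρ <;> simp [ag, eps4] <;> ring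
      rw [sg, cl_of_mem u0 u1, hp _ _ r0 r1 (by positivity) (by linarith), e3]
    · intro r _ _; linarith
    · intro r _ _; linarith
    · intro r _ _; linarith
    · intro r _ _; linarith
    · norm_num
    · rfl
    · have : |eps4 e.2| = 1 := by
        obtain ⟨j, ρ⟩ := e
        fin_cases ρ <;> simp [eps4]
      rw [abs_mul, this, mul_one, abs_of_pos (by positivity), div_div, div_lt_div_iff₀ (by positivity) (by norm_num)]
      have h12 : (12:ℝ) ≤ 4 * g * N := by nlinarith
      nlinarith
  simp only [ch]
  have : ∑ e : Fin g × Fin 4, eps4 e.2 * (2 * Real.pi / (4 * g) * eps4 e.2) = 2 * Real.pi := by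
    have : ∀ e : Fin g × Fin 4, eps4 e.2 * (2 * Real.pi / (4 * g) * eps4 e.2) = 2 * Real.pi / (4 * g) := by
      rintro ⟨j, ρ⟩
      fin_cases ρ <;> simp [eps4]
    simp only [this]
    simp
    field_simp
  rw [this]; positivity

theorem lower_MG {n g : ℕ} (hn : 1 ≤ n) (hg : 0 < g) {r : ℕ} (h : catLE (SP n (MG g)) r) :
    n + min n g ≤ r := by
  have : ∀ (k : Fin n), ∃ Fa Fb : MG g → ℂ, Cv Fa ∧ Cv Fb ∧
    ((hk : (k:ℕ) < g) → (∀ r θ : ℝ, 0 ≤ r → r ≤ 1 → 0 ≤ θ → θ ≤ 4 * g →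
      Fa (pol g r θ) = Complex.exp (((2 * Real.pi * (r * tz (4 * (k:ℕ) + (0:ℕ)) θ) : ℝ) : ℂ) * Complex.I)) ∧
      (∀ r θ : ℝ, 0 ≤ r → r ≤ 1 → 0 ≤ θ → θ ≤ 4 * g →
      Fb (pol g r θ) = Complex.exp (((2 * Real.pi * (r * tz (4 * (k:ℕ) + (1:ℕ)) θ) : ℝ) : ℂ) * Complex.I))) ∧
    (¬ (k:ℕ) < g → Fa = (fun _ => 1) ∧ Fb = fun _ => 1) := by
    intro k
    by_cases hk : (k:ℕ) < g
    · obtain ⟨Fa, h1, h2⟩ := exists_F hk (ς := 0) (by norm_num)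
      obtain ⟨Fb, h3, h4⟩ := exists_F hk (ς := 1) (by norm_num)
      exact ⟨Fa, Fb, h1, h3, fun _ => ⟨h2, h4⟩, fun h => absurd hk h⟩
    · exact ⟨fun _ => 1, fun _ => 1, ⟨continuous_const, by simp⟩, ⟨continuous_const, by simp⟩,
        fun h => absurd h hk, fun _ => ⟨rfl, rfl⟩⟩
  choose Fa Fb hFa hFb hF hF' using this
  obtain ⟨p, hp, hp'⟩ := exists_p hg
  have van : ∀ (F : MG g → ℂ) (k ς : ℕ), ς < 2 → (∀ r θ : ℝ, 0 ≤ r → r ≤ 1 → 0 ≤ θ → θ ≤ 4 * g →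
      F (pol g r θ) = Complex.exp (((2 * Real.pi * (r * tz (4 * k + ς) θ) : ℝ) : ℂ) * Complex.I)) →
      ∀ (e : Fin g × Fin 4) (r u : ℝ), (e.1:ℕ) ≠ k → F (sg g e r u) = 1 := by
    intro F k ς hς hF e r u hek
    have hj : ((e.1:ℕ):ℝ) + 1 ≤ g := by exact_mod_cast e.1.2
    obtain ⟨b0, b1⟩ := ag_bd e.2 (cl_nonneg u) (cl_le_one u)
    rw [sg, ← pol_cl, hF _ _ (cl_nonneg _) (cl_le_one _) (by positivity) (by linarith),
      (tz_ag (cl_nonneg u) (cl_le_one u)).1 hek _ _ hς]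
    simp
  have A2one : ∀ (F : MG g → ℂ) x y, F x = 1 → F y = 1 → A2 F x y = 0 := by
    intro F x y hx hy
    simp [A2, hx, hy]
  have := lower_SP hn (fun e : Fin g × Fin 4 => eps4 e.2) (sg g) (continuous_sg g) (sg_H1 g) (sg_H2 hg)
    (fun k : Fin n => decide ((k:ℕ) < g)) Fa Fb hFa hFb p hp (fun e k => (e.1:ℕ) = k)
    (fun e k k' h h' => Fin.ext (h.symm.trans h')) ?_ ?_ ?_ ⟨3, fun N hN => I2_p hg hp' N hN⟩ h
  · refine le_trans (Nat.add_le_add_left ?_ n) this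
    have e : (Finset.univ.filter (fun k : Fin n => decide ((k:ℕ) < g) = true)).card = min n g := by
      simp only [decide_eq_true_eq]
      rw [Fin.card_filter_val_lt]
    rw [e]
  · intro k e r u r' u' hs
    by_cases hk : (k:ℕ) < g
    · exact A2one _ _ _ (van _ _ 0 (by norm_num) (hF k hk).1 _ _ _ hs) (van _ _ 0 (by norm_num) (hF k hk).1 _ _ _ hs)
    · apply A2one <;> rw [(hF' k hk).1]
  · intro k e r u r' u' hs
    by_cases hk : (k:ℕ) < g
    · exact A2one _ _ _ (van _ _ 1 (by norm_num) (hF k hk).2 _ _ _ hs) (van _ _ 1 (by norm_num) (hF k hk).2 _ _ _ hs)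
    · apply A2one <;> rw [(hF' k hk).2]
  · intro k hk
    rw [decide_eq_true_eq] at hk
    exact ⟨3, fun N hN => I2_ab hk (hF k hk).1 (hF k hk).2 N hN⟩

end SPcat
end

open scoped unitInterval Topology
open MeasureTheory
noncomputable section
namespace SPcat

/-- the two-sphere -/
abbrev S2 : Type := Metric.sphere (0 : EuclideanSpace ℝ (Fin 3)) 1

lemma S2_mk_mem {x y z : ℝ} (h : x ^ 2 + y ^ 2 + z ^ 2 = 1) :
    !₂[x, y, z] ∈ Metric.sphere (0 : EuclideanSpace ℝ (Fin 3)) 1 := by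
  rw [mem_sphere_zero_iff_norm, EuclideanSpace.norm_eq, Fin.sum_univ_three]
  simp [h]

lemma S2_eq (x : S2) : x.1 0 ^ 2 + x.1 1 ^ 2 + x.1 2 ^ 2 = 1 := by
  have h := x.2
  rw [mem_sphere_zero_iff_norm, EuclideanSpace.norm_eq, Fin.sum_univ_three] at h
  simpa [Real.sqrt_eq_one] using h

/-- spherical coordinates -/
def sph (b r u : ℝ) : S2 :=
  ⟨!₂[Real.sin (Real.pi * r) * Real.cos (2 * Real.pi * (b * u)), Real.sin (Real.pi * r) * Real.sin (2 * Real.pi * (b * u)),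
    Real.cos (Real.pi * r)], S2_mk_mem (by
      have h1 := Real.sin_sq_add_cos_sq (2 * Real.pi * (b * u))
      have h2 := Real.sin_sq_add_cos_sq (Real.pi * r)
      linear_combination h2 + Real.sin (Real.pi * r) ^ 2 * h1)⟩

lemma continuous_sph (b : ℝ) : Continuous fun q : ℝ × ℝ => sph b q.1 q.2 := by
  unfold sph
  refine Continuous.subtype_mk ?_ _
  refine (PiLp.continuous_toLp 2 _).comp (continuous_pi fun i => ?_)
  fin_cases i <;> simp <;> fun_prop

def pS2 (x : S2) : Fin 2 → Fin 2 → ℂ :=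
  ![![(1 + x.1 2) / 2, (x.1 0 - x.1 1 * Complex.I) / 2], ![(x.1 0 + x.1 1 * Complex.I) / 2, (1 - x.1 2) / 2]]

lemma continuous_pS2 : Continuous pS2 := by
  unfold pS2
  refine continuous_pi fun i => continuous_pi fun j => ?_
  have h : ∀ i : Fin 3, Continuous fun x : S2 => x.1 i := fun i => by fun_prop
  have h0 := h 0
  have h1 := h 1
  have h2 := h 2
  fin_cases i <;> fin_cases j <;> simp <;> fun_prop

lemma pS2_sph (b r u : ℝ) : pS2 (sph b r u) = fun i j =>
    psiv (Real.cos (Real.pi / 2 * r)) (Real.sin (Real.pi / 2 * r)) (0 + 2 * Real.pi * b * u) i *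
      (starRingEnd ℂ) (psiv (Real.cos (Real.pi / 2 * r)) (Real.sin (Real.pi / 2 * r)) (0 + 2 * Real.pi * b * u) j) := by
  have hw : 0 + 2 * Real.pi * b * u = 2 * Real.pi * (b * u) := by ring
  rw [hw]
  set w := 2 * Real.pi * (b * u) with hwd
  have hr : Real.pi * r = 2 * (Real.pi / 2 * r) := by ring
  set q := Real.pi / 2 * r with hq
  have hc : (starRingEnd ℂ) (Complex.exp (w * Complex.I)) = Real.cos w - Real.sin w * Complex.I := by
    rw [← Complex.exp_conj, map_mul, Complex.conj_ofReal, Complex.conj_I, mul_neg, ← neg_mul,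
      Complex.exp_mul_I]
    simp; ring
  have he : Complex.exp (w * Complex.I) = Real.cos w + Real.sin w * Complex.I := by
    rw [Complex.exp_mul_I]; simp
  have h1 : ((Real.cos q : ℂ)) ^ 2 + (Real.sin q : ℂ) ^ 2 = 1 := by
    exact_mod_cast Real.cos_sq_add_sin_sq q
  have h2 : ((Real.cos w : ℂ)) ^ 2 + (Real.sin w : ℂ) ^ 2 = 1 := by
    exact_mod_cast Real.cos_sq_add_sin_sq w
  funext i j
  fin_cases i <;> fin_cases j <;>
    simp only [pS2, sph, psiv] <;>
    simp [-Complex.ofReal_sin, -Complex.ofReal_cos, hc, he, hr, Real.cos_two_mul, Real.sin_two_mul, ← hwd]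
  · ring
  · ring
  · ring
  · linear_combination (-1 : ℂ) * h1 + 0 * h2 - (Real.sin q : ℂ) ^ 2 * (h2) + (Real.sin q : ℂ) ^ 2 * (Real.sin w : ℂ) ^ 2 * Complex.I_sq

lemma sph_surj (x : S2) : ∃ r u, x = sph 1 r u := by
  have hx := S2_eq x
  have hpi := Real.pi_pos
  refine ⟨Real.arccos (x.1 2) / Real.pi, Complex.arg (⟨x.1 0, x.1 1⟩ : ℂ) / (2 * Real.pi), ?_⟩
  apply Subtype.ext
  have e1 : Real.pi * (Real.arccos (x.1 2) / Real.pi) = Real.arccos (x.1 2) := by field_simp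
  have e2 : 2 * Real.pi * (1 * (Complex.arg (⟨x.1 0, x.1 1⟩ : ℂ) / (2 * Real.pi))) = Complex.arg (⟨x.1 0, x.1 1⟩ : ℂ) := by
    field_simp
  have n1 : ‖(⟨x.1 0, x.1 1⟩ : ℂ)‖ = Real.sin (Real.arccos (x.1 2)) := by
    rw [Real.sin_arccos, Complex.norm_def, Complex.normSq_apply]
    congr 1
    simp only
    linarith
  have c1 := Complex.norm_mul_cos_arg (⟨x.1 0, x.1 1⟩ : ℂ)
  have c2 := Complex.norm_mul_sin_arg (⟨x.1 0, x.1 1⟩ : ℂ)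
  rw [n1] at c1 c2
  ext i
  fin_cases i <;> simp only [sph, e1, e2] <;> simp
  · exact c1.symm
  · exact c2.symm
  · rw [Real.cos_arccos] <;> nlinarith [sq_nonneg (x.1 0), sq_nonneg (x.1 1)]

lemma Rk1_pS2 : Rk1 pS2 := by
  refine ⟨continuous_pS2, fun x => ?_⟩
  obtain ⟨r, u, rfl⟩ := sph_surj x
  refine ⟨_, ?_, pS2_sph 1 r u⟩
  intro h
  have h0 := congrFun h 0
  have h1 := congrFun h 1
  simp only [psiv, Pi.zero_apply, Matrix.cons_val_zero, Matrix.cons_val_one, Complex.ofReal_eq_zero, mul_eq_zero,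
    Complex.exp_ne_zero, or_false] at h0 h1
  have := Real.cos_sq_add_sin_sq (Real.pi / 2 * r)
  rw [h0, h1] at this; norm_num at this

theorem lower_S2 {n : ℕ} (hn : 1 ≤ n) {r : ℕ} (h : catLE (SP n S2) r) : n ≤ r := by
  have hpi := Real.pi_pos
  have := lower_SP (M := S2) hn (fun b : Bool => if b then (1:ℝ) else -1)
    (fun b => sph (if b then 1 else 0)) (fun b => continuous_sph _) ?_ ?_
    (fun _ => false) (fun _ _ => 1) (fun _ _ => 1) (fun _ => ⟨continuous_const, by simp⟩)
    (fun _ => ⟨continuous_const, by simp⟩) pS2 Rk1_pS2 (fun _ _ => False) (by simp) (by simp [A2]) (by simp [A2])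
    (by simp) ⟨7, fun N hN => ?_⟩ h
  · omega
  · intro Φ
    simp [sph]
  · intro Φ
    simp [sph]
  · rw [I2_explicit]
    have hN7 : (7:ℝ) ≤ N := by exact_mod_cast hN
    have hNp : (0:ℝ) < N := by linarith
    have ch : ∀ b : Bool, ∑ i : Fin N, ∑ j : Fin N,
      (A3 pS2 (sph (if b then 1 else 0) ((i:ℕ) / N) ((j:ℕ) / N)) (sph (if b then 1 else 0) (((i:ℕ) + 1 : ℝ) / N) ((j:ℕ) / N))
          (sph (if b then 1 else 0) (((i:ℕ) + 1 : ℝ) / N) (((j:ℕ) + 1 : ℝ) / N))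
        - A3 pS2 (sph (if b then 1 else 0) ((i:ℕ) / N) ((j:ℕ) / N)) (sph (if b then 1 else 0) ((i:ℕ) / N) (((j:ℕ) + 1 : ℝ) / N))
          (sph (if b then 1 else 0) (((i:ℕ) + 1 : ℝ) / N) (((j:ℕ) + 1 : ℝ) / N))) = 2 * Real.pi * (if b then 1 else 0) := by
      intro b
      refine A3_chart pS2 _ (fun r => Real.cos (Real.pi / 2 * r)) (fun r => Real.sin (Real.pi / 2 * r)) 0 _
        (fun r u _ _ _ _ => pS2_sph _ r u) ?_ ?_ ?_ ?_ ?_ ?_ N (by omega) ?_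
      · intro r r0 r1; exact Real.cos_nonneg_of_mem_Icc ⟨by nlinarith, by nlinarith⟩
      · intro r r0 r1; exact Real.sin_nonneg_of_nonneg_of_le_pi (by positivity) (by nlinarith)
      · intro r r0 r1; exact Real.cos_pos_of_mem_Ioo ⟨by nlinarith, by nlinarith⟩
      · intro r r0 r1; exact Real.sin_pos_of_pos_of_lt_pi (by positivity) (by nlinarith)
      · simp
      · simp
      · have : |2 * Real.pi * (if b then (1:ℝ) else 0)| ≤ 2 * Real.pi := by
          rw [abs_mul, abs_of_pos (by positivity)]
          cases b <;> simp; positivity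
        rw [div_lt_div_iff₀ hNp (by norm_num)]
        nlinarith
    simp only [ch]
    simp

end SPcat
end

open scoped unitInterval Topology
open MeasureTheory
noncomputable section
namespace SPcat

/-! ## Finite multisets of points as a topological space -/

section MS
variable {X Y Z T : Type*} [TopologicalSpace X] [TopologicalSpace Y] [TopologicalSpace Z]
  [TopologicalSpace T]

/-- The multiset of values of a tuple. -/
def tmn {Y : Type*} (n : ℕ) (f : Fin n → Y) : Multiset Y := (Finset.univ : Finset (Fin n)).val.map f

instance topMS : TopologicalSpace (Multiset Y) :=
  ⨆ n, TopologicalSpace.coinduced (tmn (Y := Y) n) inferInstance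

@[simp] lemma card_tmn {Y : Type*} {n : ℕ} (f : Fin n → Y) : Multiset.card (tmn n f) = n := by simp [tmn]

lemma tmn_surj {Y : Type*} (D : Multiset Y) : ∃ f, tmn (Multiset.card D) f = D := by
  induction D using Quotient.inductionOn with
  | _ l =>
    refine ⟨l.get, ?_⟩
    change tmn l.length l.get = _
    simp [tmn]

lemma tmn_surj' {Y : Type*} {n : ℕ} (D : Multiset Y) (h : Multiset.card D = n) : ∃ f, tmn n f = D := by
  subst h; exact tmn_surj D

lemma mem_tmn {Y : Type*} {n : ℕ} {f : Fin n → Y} {y : Y} : y ∈ tmn n f ↔ ∃ i, f i = y := by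
  simp [tmn]

lemma map_tmn {Y Z : Type*} {n : ℕ} (f : Fin n → Y) (h : Y → Z) : (tmn n f).map h = tmn n (h ∘ f) := by
  unfold tmn; rw [Multiset.map_map]

lemma sum_map_tmn {Y Z : Type*} [AddCommMonoid Z] {n : ℕ} (f : Fin n → Y) (h : Y → Z) :
    ((tmn n f).map h).sum = ∑ i, h (f i) := by
  rw [map_tmn]; rfl

lemma tmn_perm {Y : Type*} {n : ℕ} (f : Fin n → Y) (e : Equiv.Perm (Fin n)) : tmn n (f ∘ e) = tmn n f := by
  unfold tmn
  rw [← Multiset.map_map, Multiset.map_univ_val_equiv]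

lemma tmn_eq {Y : Type*} {n : ℕ} {f f' : Fin n → Y} (h : tmn n f = tmn n f') :
    ∃ e : Equiv.Perm (Fin n), f ∘ e = f' := by
  classical
  have key : ∀ y, Fintype.card {i // f' i = y} = Fintype.card {i // f i = y} := by
    intro y
    have h1 := congrArg (Multiset.count y) h
    unfold tmn at h1
    rw [Multiset.count_map, Multiset.count_map] at h1
    rw [Fintype.card_subtype, Fintype.card_subtype, Finset.card_def, Finset.card_def,
      Finset.filter_val, Finset.filter_val]
    simp only [eq_comm (a := y)] at h1
    exact h1.symm
  refine ⟨Equiv.ofFiberEquiv (f := f') (g := f) fun y => Fintype.equivOfCardEq (key y), ?_⟩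
  funext i
  exact Equiv.ofFiberEquiv_map _ i

lemma continuous_tmn (n : ℕ) : Continuous (tmn (Y := Y) n) := by
  rw [continuous_iff_coinduced_le]
  exact le_iSup (fun n => TopologicalSpace.coinduced (tmn (Y := Y) n) inferInstance) n

lemma isOpen_ms {W : Set (Multiset Y)} : IsOpen W ↔ ∀ n, IsOpen (tmn n ⁻¹' W) := by
  rw [isOpen_iSup_iff]
  rfl

lemma isOpenMap_tmn (n : ℕ) : IsOpenMap (tmn (Y := Y) n) := by
  intro W hW
  rw [isOpen_ms]
  intro m
  by_cases hm : m = n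
  · subst hm
    have : tmn m ⁻¹' (tmn m '' W) = ⋃ e : Equiv.Perm (Fin m), (fun f : Fin m → Y => f ∘ e) ⁻¹' W := by
      ext f
      simp only [Set.mem_preimage, Set.mem_image, Set.mem_iUnion]
      constructor
      · rintro ⟨f', hf', h⟩
        obtain ⟨e, he⟩ := tmn_eq h.symm
        exact ⟨e, he ▸ hf'⟩
      · rintro ⟨e, he⟩
        exact ⟨_, he, tmn_perm f e⟩
    rw [this]
    exact isOpen_iUnion fun e => hW.preimage (by fun_prop)
  · have : tmn m ⁻¹' (tmn n '' W) = ∅ := by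
      ext f
      simp only [Set.mem_preimage, Set.mem_image, Set.mem_empty_iff_false, iff_false]
      rintro ⟨f', -, h⟩
      have := congrArg Multiset.card h
      simp at this; omega
    rw [this]; exact isOpen_empty

lemma continuousAt_of_open {A B C : Type*} [TopologicalSpace A] [TopologicalSpace B] [TopologicalSpace C]
    {q : A → B} (hq : IsOpenMap q) {F : B → C} {a : A} (h : ContinuousAt (fun a => F (q a)) a) :
    ContinuousAt F (q a) := by
  intro W hW
  exact hq.nhds_le a (h hW)

lemma continuousAt_ms {F : Multiset Y → Z} {n : ℕ} {f : Fin n → Y}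
    (h : ContinuousAt (fun f => F (tmn n f)) f) : ContinuousAt F (tmn n f) :=
  continuousAt_of_open (isOpenMap_tmn n) h

lemma continuousAt_ms_prod {F : Multiset Y × T → Z} {n : ℕ} {f : Fin n → Y} {t : T}
    (h : ContinuousAt (fun p : (Fin n → Y) × T => F (tmn n p.1, p.2)) (f, t)) :
    ContinuousAt F (tmn n f, t) :=
  continuousAt_of_open (q := Prod.map (tmn n) id) ((isOpenMap_tmn n).prodMap IsOpenMap.id) h

lemma tmn_append {Y : Type*} {n m : ℕ} (f : Fin n → Y) (f' : Fin m → Y) :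
    tmn (n + m) (Fin.append f f') = tmn n f + tmn m f' := by
  have h : ∀ {n : ℕ} (f : Fin n → Y), tmn n f = (List.ofFn f : Multiset Y) := by
    intro n f; unfold tmn; simp
  rw [h, h, h, List.ofFn_fin_append]; rfl

instance : ContinuousAdd (Multiset Y) := by
  constructor
  rw [continuous_iff_continuousAt]
  rintro ⟨D, E⟩
  obtain ⟨f, hf⟩ := tmn_surj D
  obtain ⟨f', hf'⟩ := tmn_surj E
  rw [← hf, ← hf']
  refine continuousAt_of_open (q := Prod.map (tmn _) (tmn _))
    ((isOpenMap_tmn _).prodMap (isOpenMap_tmn _)) (a := (f, f')) ?_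
  apply Continuous.continuousAt
  have : Continuous fun p : (Fin (Multiset.card D) → Y) × (Fin (Multiset.card E) → Y) =>
      tmn _ (Fin.append p.1 p.2) := by
    refine (continuous_tmn _).comp ?_
    refine continuous_pi fun i => ?_
    induction i using Fin.addCases with
    | left i => simp only [Fin.append_left]; fun_prop
    | right i => simp only [Fin.append_right]; fun_prop
  simp only [tmn_append] at this
  exact this

lemma continuous_single : Continuous fun y : Y => ({y} : Multiset Y) := by
  have : (fun y : Y => ({y} : Multiset Y)) = fun y => tmn 1 (fun _ => y) := by
    funext y; simp [tmn]
  rw [this]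
  exact (continuous_tmn 1).comp (by fun_prop)

/-- The sum over a multiset of a parametrised function is continuous where the function is. -/
lemma continuousAt_msum {M : Type*} [AddCommMonoid M] [TopologicalSpace M] [ContinuousAdd M]
    {e : Y × T → M} {D : Multiset Y} {t : T} (h : ∀ y ∈ D, ContinuousAt e (y, t)) :
    ContinuousAt (fun p : Multiset Y × T => (p.1.map fun y => e (y, p.2)).sum) (D, t) := by
  obtain ⟨f, hf⟩ := tmn_surj D
  rw [← hf] at h ⊢
  apply continuousAt_ms_prod
  simp only [sum_map_tmn]
  refine tendsto_finsetSum _ fun i _ => ?_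
  have h1 := h (f i) (mem_tmn.2 ⟨i, rfl⟩)
  exact ContinuousAt.comp (f := fun p : (Fin _ → Y) × T => (p.1 i, p.2)) (x := (f, t)) h1 (by fun_prop)

/-- composed version. -/
lemma ContinuousAt.msum {M : Type*} [AddCommMonoid M] [TopologicalSpace M] [ContinuousAdd M]
    {e : Y × T → M} {q : X → Multiset Y} {s : X → T} {x : X} (hq : ContinuousAt q x)
    (hs : ContinuousAt s x) (h : ∀ y ∈ q x, ContinuousAt e (y, s x)) :
    ContinuousAt (fun x => ((q x).map fun y => e (y, s x)).sum) x :=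
  ContinuousAt.comp (f := fun x => (q x, s x)) (x := x) (continuousAt_msum h) (hq.prodMk hs)

lemma sum_map_single {Y Z : Type*} (D : Multiset Y) (h : Y → Z) :
    (D.map fun y => ({h y} : Multiset Z)).sum = D.map h := by
  have := Multiset.map_map (fun z => ({z} : Multiset Z)) h D
  simp only [Function.comp_def] at this
  rw [← this, Multiset.sum_map_singleton]

lemma ContinuousAt.mmap {e : Y × T → Z} {q : X → Multiset Y} {s : X → T} {x : X}
    (hq : ContinuousAt q x) (hs : ContinuousAt s x) (h : ∀ y ∈ q x, ContinuousAt e (y, s x)) :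
    ContinuousAt (fun x => (q x).map fun y => e (y, s x)) x := by
  have := ContinuousAt.msum (e := fun p => ({e p} : Multiset Z)) hq hs
    fun y hy => continuous_single.continuousAt.comp (h y hy)
  simpa only [sum_map_single] using this

lemma continuous_msum {M : Type*} [AddCommMonoid M] [TopologicalSpace M] [ContinuousAdd M]
    {e : Y → M} (he : Continuous e) {q : X → Multiset Y} (hq : Continuous q) :
    Continuous fun x => ((q x).map e).sum := by
  rw [continuous_iff_continuousAt]
  intro x
  exact ContinuousAt.msum (T := Unit) (e := fun p => e p.1) (s := fun _ => ()) hq.continuousAt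
    continuousAt_const fun y _ => (he.comp continuous_fst).continuousAt

lemma continuous_mmap {e : Y → Z} (he : Continuous e) {q : X → Multiset Y} (hq : Continuous q) :
    Continuous fun x => (q x).map e := by
  have := continuous_msum (continuous_single.comp he) hq
  simpa only [Function.comp_def, sum_map_single] using this

lemma continuous_card : Continuous (Multiset.card : Multiset Y → ℕ) := by
  have := continuous_msum (e := fun _ : Y => (1 : ℕ)) continuous_const (q := id) continuous_id
  simpa using this

lemma isOpen_card (n : ℕ) : IsOpen {D : Multiset Y | Multiset.card D = n} :=
  (isOpen_discrete {n}).preimage continuous_card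

lemma isCompact_card [CompactSpace Y] (n : ℕ) : IsCompact {D : Multiset Y | Multiset.card D = n} := by
  have : {D : Multiset Y | Multiset.card D = n} = Set.range (tmn n) := by
    ext D
    constructor
    · rintro rfl
      exact tmn_surj D
    · rintro ⟨f, rfl⟩; simp
  rw [this]
  exact isCompact_range (continuous_tmn n)

instance [T2Space Y] : T2Space (Multiset Y) := by
  constructor
  intro D E hDE
  by_cases hc : Multiset.card D = Multiset.card E
  · obtain ⟨f, hf⟩ := tmn_surj D
    obtain ⟨f', hf'⟩ := tmn_surj' E hc.symm
    have hcl : IsClosed (⋃ e : Equiv.Perm (Fin (Multiset.card D)),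
        {p : (Fin (Multiset.card D) → Y) × (Fin (Multiset.card D) → Y) | p.1 ∘ e = p.2}) := by
      refine isClosed_iUnion_of_finite fun e => isClosed_eq ?_ continuous_snd
      exact continuous_pi fun i => (continuous_apply (e i)).comp continuous_fst
    have hmem : (f, f') ∈ (⋃ e : Equiv.Perm (Fin (Multiset.card D)),
        {p : (Fin (Multiset.card D) → Y) × (Fin (Multiset.card D) → Y) | p.1 ∘ e = p.2})ᶜ := by
      simp only [Set.mem_compl_iff, Set.mem_iUnion, Set.mem_ofPred_eq, not_exists]
      intro e he
      apply hDE
      rw [← hf, ← hf', ← he, tmn_perm]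
    obtain ⟨U, V, hU, hV, hfU, hfV, hUV⟩ := isOpen_prod_iff.1 hcl.isOpen_compl _ _ hmem
    refine ⟨tmn _ '' U, tmn _ '' V, isOpenMap_tmn _ _ hU, isOpenMap_tmn _ _ hV, ⟨f, hfU, hf⟩,
      ⟨f', hfV, hf'⟩, ?_⟩
    rw [Set.disjoint_left]
    rintro _ ⟨a, ha, rfl⟩ ⟨b, hb, hab⟩
    obtain ⟨e, he⟩ := tmn_eq hab.symm
    exact hUV (show (a, b) ∈ U ×ˢ V from ⟨ha, hb⟩) (Set.mem_iUnion.2 ⟨e, he⟩)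
  · exact ⟨_, _, isOpen_card _, isOpen_card _, rfl, rfl, by
      rw [Set.disjoint_left]; intro A hA hA'; exact hc (hA.symm.trans hA')⟩

/-- Number of points in a set -/
def cnt {Y : Type*} (V : Set Y) (D : Multiset Y) : ℕ := by
  classical exact D.countP (· ∈ V)

lemma cnt_tmn {Y : Type*} (V : Set Y) {n : ℕ} (f : Fin n → Y) : cnt V (tmn n f) = Nat.card {i // f i ∈ V} := by
  classical
  unfold cnt tmn
  rw [Multiset.countP_map, Nat.card_eq_fintype_card, Fintype.card_subtype, Finset.card_def, Finset.filter_val]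

lemma cnt_open {V : Set Y} (hV : IsOpen V) (m : ℕ) : IsOpen {D | m ≤ cnt V D} := by
  rw [isOpen_ms]
  intro n
  rw [isOpen_iff_mem_nhds]
  intro f hf
  have : {f' : Fin n → Y | ∀ i, f i ∈ V → f' i ∈ V} ∈ 𝓝 f := by
    have : {f' : Fin n → Y | ∀ i, f i ∈ V → f' i ∈ V} = ⋂ i : {i // f i ∈ V}, {f' | f' i.1 ∈ V} := by
      ext f'; simp
    rw [this]
    refine IsOpen.mem_nhds (isOpen_iInter_of_finite fun i => hV.preimage (by fun_prop)) ?_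
    simp
  filter_upwards [this] with f' hf'
  simp only [Set.mem_preimage, Set.mem_ofPred_eq, cnt_tmn] at hf ⊢
  exact hf.trans (Nat.card_le_card_of_injective (fun i => ⟨i.1, hf' i.1 i.2⟩)
    fun a b h => Subtype.ext (by simpa using h))

lemma cnt_compl {Y : Type*} (V : Set Y) (D : Multiset Y) : cnt V D + cnt Vᶜ D = Multiset.card D := by
  classical
  unfold cnt
  rw [Multiset.card_eq_countP_add_countP (fun y => y ∈ V)]
  congr!

lemma cnt_closed {V : Set Y} (hV : IsClosed V) (m : ℕ) : IsOpen {D | cnt V D ≤ m} := by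
  have : {D | cnt V D ≤ m} = ⋃ n, {D : Multiset Y | Multiset.card D = n} ∩ {D | n - m ≤ cnt Vᶜ D} := by
    ext D
    have := cnt_compl V D
    simp only [Set.mem_ofPred_eq, Set.mem_iUnion, Set.mem_inter_iff]
    constructor
    · intro h; exact ⟨_, rfl, by omega⟩
    · rintro ⟨n, h1, h2⟩; omega
  rw [this]
  exact isOpen_iUnion fun n => (isOpen_card n).inter (cnt_open hV.isOpen_compl _)

lemma cnt_mono {Y : Type*} {V W : Set Y} (h : V ⊆ W) (D : Multiset Y) : cnt V D ≤ cnt W D := by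
  classical
  unfold cnt
  rw [Multiset.countP_eq_card_filter, Multiset.countP_eq_card_filter]
  exact Multiset.card_le_card (Multiset.monotone_filter_right D fun _ hx => h hx)

lemma cnt_add {Y : Type*} (V : Set Y) (D E : Multiset Y) : cnt V (D + E) = cnt V D + cnt V E := by
  classical
  unfold cnt; exact Multiset.countP_add ..

lemma cnt_eq_zero {Y : Type*} {V : Set Y} {D : Multiset Y} : cnt V D = 0 ↔ ∀ y ∈ D, y ∉ V := by
  classical
  unfold cnt; exact Multiset.countP_eq_zero

lemma cnt_pos {Y : Type*} {V : Set Y} {D : Multiset Y} : 0 < cnt V D ↔ ∃ y ∈ D, y ∈ V := by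
  classical
  unfold cnt; exact Multiset.countP_pos

/-- Cancellation -/
lemma continuous_cancel [CompactSpace Y] [T2Space Y] {n : ℕ} {E : Multiset Y} {f : X → Multiset Y}
    (hn : ∀ x, Multiset.card (f x) = n) (h : Continuous fun x => f x + E) : Continuous f := by
  rw [continuous_iff_isClosed]
  intro C hC
  have hK : IsCompact (C ∩ {D : Multiset Y | Multiset.card D = n}) := (isCompact_card n).inter_left hC
  have hK' := (hK.image (f := fun D => D + E) (by fun_prop)).isClosed
  have : f ⁻¹' C = (fun x => f x + E) ⁻¹' ((fun D => D + E) '' (C ∩ {D : Multiset Y | Multiset.card D = n})) := by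
    ext x
    constructor
    · intro hx; exact ⟨f x, ⟨hx, hn x⟩, rfl⟩
    · rintro ⟨D, ⟨hD, -⟩, h⟩
      have : D = f x := add_right_cancel h
      exact Set.mem_preimage.2 (this ▸ hD)
  rw [this]
  exact hK'.preimage h

/-! relation with `SP` -/

/-- a point of the symmetric product as a multiset. -/
def spMS {Y : Type*} [TopologicalSpace Y] (n : ℕ) : SP n Y → Multiset Y :=
  Quot.lift (tmn n) (by rintro a b ⟨e, rfl⟩; exact (tmn_perm a e).symm)

lemma spMS_spm {n : ℕ} (f : Fin n → Y) : spMS n (spm n Y f) = tmn n f := rfl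

lemma card_spMS {n : ℕ} (D : SP n Y) : Multiset.card (spMS n D) = n := by
  obtain ⟨f, rfl⟩ := spm_surj D; simp [spMS_spm]

lemma continuous_spMS (n : ℕ) : Continuous (spMS (Y := Y) n) :=
  continuous_quot_lift _ (continuous_tmn n)

lemma spMS_inj (n : ℕ) : Function.Injective (spMS (Y := Y) n) := by
  intro D E h
  obtain ⟨f, rfl⟩ := spm_surj D
  obtain ⟨f', rfl⟩ := spm_surj E
  exact Quot.sound (tmn_eq h)

lemma isOpenMap_spMS (n : ℕ) : IsOpenMap (spMS (Y := Y) n) := by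
  intro W hW
  have : spMS n '' W = tmn n '' (spm n Y ⁻¹' W) := by
    ext D
    constructor
    · rintro ⟨E, hE, rfl⟩
      obtain ⟨f, rfl⟩ := spm_surj E
      exact ⟨f, hE, rfl⟩
    · rintro ⟨f, hf, rfl⟩; exact ⟨_, hf, rfl⟩
  rw [this]
  exact isOpenMap_tmn n _ (hW.preimage continuous_spm)

lemma spMS_emb (n : ℕ) : Topology.IsOpenEmbedding (spMS (Y := Y) n) :=
  .of_continuous_injective_isOpenMap (continuous_spMS n) (spMS_inj n) (isOpenMap_spMS n)

end MS
end SPcat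
end

open scoped unitInterval Topology
open MeasureTheory
noncomputable section
namespace SPcat

/-! ## Homotopies of multiset valued maps with control on the base point multiplicity -/

section HC
variable {X X' Y Z T : Type*} [TopologicalSpace X] [TopologicalSpace X'] [TopologicalSpace Y]
  [TopologicalSpace Z] [TopologicalSpace T]

/-- Homotopy `f0 ≃ f1` through maps which contain `v` at least `b x` times at `x`. -/
def HomC (v : Y) (b : X → ℕ) (f0 f1 : X → Multiset Y) : Prop :=
  ∃ H : X → ℝ → Multiset Y, Continuous (fun p : X × ℝ => H p.1 p.2) ∧ (∀ x, H x 0 = f0 x) ∧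
    (∀ x, H x 1 = f1 x) ∧ ∀ x t, 0 ≤ t → t ≤ 1 → b x ≤ cnt {v} (H x t)

variable {v : Y} {b b' : X → ℕ} {f0 f1 f2 f0' f1' : X → Multiset Y}

lemma HomC.mk' (H : X → ℝ → Multiset Y)
    (hc : ∀ x t, 0 ≤ t → t ≤ 1 → ContinuousAt (fun p : X × ℝ => H p.1 p.2) (x, t))
    (h0 : ∀ x, H x 0 = f0 x) (h1 : ∀ x, H x 1 = f1 x)
    (hb : ∀ x t, 0 ≤ t → t ≤ 1 → b x ≤ cnt {v} (H x t)) : HomC v b f0 f1 := by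
  refine ⟨fun x t => H x (cl t), ?_, by simpa using h0, by simpa using h1, fun x t _ _ =>
    hb x _ (cl_nonneg _) (cl_le_one _)⟩
  rw [continuous_iff_continuousAt]
  rintro ⟨x, t⟩
  refine ContinuousAt.comp (f := fun p : X × ℝ => (p.1, cl p.2)) (x := (x, t))
    (hc x (cl t) (cl_nonneg _) (cl_le_one _)) ?_
  fun_prop

lemma HomC.refl {f : X → Multiset Y} (hf : Continuous f) (hb : ∀ x, b x ≤ cnt {v} (f x)) : HomC v b f f :=
  ⟨fun x _ => f x, hf.comp continuous_fst, fun _ => rfl, fun _ => rfl, fun x _ _ _ => hb x⟩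

lemma HomC.cont0 (h : HomC v b f0 f1) : Continuous f0 := by
  obtain ⟨H, hc, h0, -, -⟩ := h
  have : Continuous fun x => H x 0 := hc.comp (by fun_prop : Continuous fun x : X => (x, (0 : ℝ)))
  simpa only [h0] using this

lemma HomC.cont1 (h : HomC v b f0 f1) : Continuous f1 := by
  obtain ⟨H, hc, -, h0, -⟩ := h
  have : Continuous fun x => H x 1 := hc.comp (by fun_prop : Continuous fun x : X => (x, (1 : ℝ)))
  simpa only [h0] using this

lemma HomC.mono (h : HomC v b f0 f1) (hb : ∀ x, b' x ≤ b x) : HomC v b' f0 f1 := by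
  obtain ⟨H, hc, h0, h1, h2⟩ := h
  exact ⟨H, hc, h0, h1, fun x t ht ht' => (hb x).trans (h2 x t ht ht')⟩

lemma HomC.congr (h : HomC v b f0 f1) (e0 : ∀ x, f0 x = f0' x) (e1 : ∀ x, f1 x = f1' x) :
    HomC v b f0' f1' := by
  obtain rfl : f0 = f0' := funext e0
  obtain rfl : f1 = f1' := funext e1
  exact h

lemma HomC.symm (h : HomC v b f0 f1) : HomC v b f1 f0 := by
  obtain ⟨H, hc, h0, h1, h2⟩ := h
  refine ⟨fun x t => H x (1 - t), ?_, by simpa using h1, by simpa using h0, fun x t ht ht' =>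
    h2 x _ (by linarith) (by linarith)⟩
  exact hc.comp (by fun_prop : Continuous fun p : X × ℝ => (p.1, 1 - p.2))

lemma HomC.trans (h : HomC v b f0 f1) (h' : HomC v b f1 f2) : HomC v b f0 f2 := by
  obtain ⟨H, hc, h0, h1, h2⟩ := h
  obtain ⟨K, kc, k0, k1, k2⟩ := h'
  refine ⟨fun x t => if t ≤ 1 / 2 then H x (2 * t) else K x (2 * t - 1), ?_, ?_, ?_, ?_⟩
  · refine Continuous.if_le (f' := fun p : X × ℝ => H p.1 (2 * p.2))
      (g' := fun p : X × ℝ => K p.1 (2 * p.2 - 1)) (f := fun p : X × ℝ => p.2)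
      (g := fun _ => (1 / 2 : ℝ)) ?_ ?_ continuous_snd continuous_const ?_
    · exact hc.comp (by fun_prop : Continuous fun p : X × ℝ => (p.1, 2 * p.2))
    · exact kc.comp (by fun_prop : Continuous fun p : X × ℝ => (p.1, 2 * p.2 - 1))
    · rintro ⟨x, t⟩ ht
      simp only at ht
      subst ht
      norm_num [h1, k0]
  · intro x
    norm_num [h0]
  · intro x
    norm_num [k1]
  · intro x t ht ht'
    simp only
    split_ifs with h
    · exact h2 x _ (by linarith) (by linarith)
    · exact k2 x _ (by linarith) (by linarith)

lemma HomC.add (h : HomC v b f0 f1) (h' : HomC v b' f0' f1') :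
    HomC v (fun x => b x + b' x) (fun x => f0 x + f0' x) (fun x => f1 x + f1' x) := by
  obtain ⟨H, hc, h0, h1, h2⟩ := h
  obtain ⟨K, kc, k0, k1, k2⟩ := h'
  refine ⟨fun x t => H x t + K x t, hc.add kc, by simp [h0, k0], by simp [h1, k1], fun x t ht ht' => ?_⟩
  rw [cnt_add]
  exact Nat.add_le_add (h2 x t ht ht') (k2 x t ht ht')

lemma HomC.add_const (h : HomC v b f0 f1) {E : X → Multiset Y} (hE : Continuous E) :
    HomC v (fun x => b x + cnt {v} (E x)) (fun x => f0 x + E x) (fun x => f1 x + E x) :=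
  h.add (HomC.refl (b := fun x => cnt {v} (E x)) hE fun _ => le_rfl)

lemma HomC.sum {ι : Type*} (s : Finset ι) {B : ι → X → ℕ} {F0 F1 : ι → X → Multiset Y}
    (h : ∀ i ∈ s, HomC v (B i) (F0 i) (F1 i)) :
    HomC v (fun x => ∑ i ∈ s, B i x) (fun x => ∑ i ∈ s, F0 i x) (fun x => ∑ i ∈ s, F1 i x) := by
  classical
  induction s using Finset.induction_on with
  | empty => simpa using HomC.refl continuous_const (by simp)
  | insert i s hi ih =>
    simp only [Finset.sum_insert hi]
    exact (h i (by simp)).add (ih fun j hj => h j (by simp [hj]))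

lemma cnt_single_le_map {Y Z : Type*} {v : Y} (h : Y → Z) (D : Multiset Y) : cnt {v} D ≤ cnt {h v} (D.map h) := by
  classical
  unfold cnt
  rw [Multiset.countP_map, Multiset.countP_eq_card_filter]
  refine Multiset.card_le_card (Multiset.monotone_filter_right D fun a ha => ?_)
  simp only [Set.mem_singleton_iff] at ha ⊢
  rw [ha]

lemma HomC.map (h : HomC v b f0 f1) {m : Y → Z} (hm : Continuous m) :
    HomC (m v) b (fun x => (f0 x).map m) (fun x => (f1 x).map m) := by
  obtain ⟨H, hc, h0, h1, h2⟩ := h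
  exact ⟨fun x t => (H x t).map m, continuous_mmap hm hc, by simp [h0], by simp [h1],
    fun x t ht ht' => (h2 x t ht ht').trans (cnt_single_le_map m _)⟩

lemma HomC.comp (h : HomC v b f0 f1) {q : X' → X} (hq : Continuous q) :
    HomC v (fun x => b (q x)) (fun x => f0 (q x)) (fun x => f1 (q x)) := by
  obtain ⟨H, hc, h0, h1, h2⟩ := h
  refine ⟨fun x t => H (q x) t, ?_, by simp [h0], by simp [h1], fun x t ht ht' => h2 _ t ht ht'⟩
  exact hc.comp (by fun_prop : Continuous fun p : X' × ℝ => (q p.1, p.2))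

lemma cnt_nsmul {Y : Type*} (v : Y) (m : ℕ) : cnt {v} (m • ({v} : Multiset Y)) = m := by
  classical
  unfold cnt
  rw [Multiset.nsmul_singleton]
  refine (Multiset.countP_eq_card.2 fun a ha => Multiset.eq_of_mem_replicate ha).trans ?_
  simp

lemma le_of_cnt {Y : Type*} {v : Y} {m : ℕ} {D : Multiset Y} (h : m ≤ cnt {v} D) :
    ∃ E, D = E + m • ({v} : Multiset Y) := by
  classical
  have h1 : Multiset.replicate m v ≤ D := by
    rw [← Multiset.le_count_iff_replicate_le]
    refine h.trans (le_of_eq ?_)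
    unfold cnt Multiset.count
    refine Multiset.countP_congr rfl fun x _ => ?_
    simp [eq_comm]
  obtain ⟨E, hE⟩ := Multiset.le_iff_exists_add.1 h1
  exact ⟨E, by rw [hE, Multiset.nsmul_singleton, add_comm]⟩

lemma HomC.card_eq (H : X → ℝ → Multiset Y) (hH : Continuous (fun p : X × ℝ => H p.1 p.2)) (x : X) (t : ℝ) :
    Multiset.card (H x t) = Multiset.card (H x 0) := by
  have : Continuous fun t => Multiset.card (H x t) :=
    continuous_card.comp (hH.comp (by fun_prop : Continuous fun t : ℝ => (x, t)))
  exact PreconnectedSpace.constant inferInstance this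

lemma HomC.cancel [CompactSpace Y] [T2Space Y] {n m : ℕ} (hn : ∀ x, Multiset.card (f0 x) = n)
    (hb : ∀ x, m ≤ b x) (h : HomC v b (fun x => f0 x + m • {v}) (fun x => f1 x + m • {v})) :
    HomC v (fun _ => 0) f0 f1 := by
  obtain ⟨H, hc, h0, h1, h2⟩ := h
  have hex : ∀ x t, ∃ E, H x (cl t) = E + m • ({v} : Multiset Y) := fun x t =>
    le_of_cnt ((hb x).trans (h2 x _ (cl_nonneg _) (cl_le_one _)))
  choose E hE using hex
  refine ⟨E, ?_, ?_, ?_, fun _ _ _ _ => Nat.zero_le _⟩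
  · refine continuous_cancel (n := n) (E := m • ({v} : Multiset Y)) (f := fun p : X × ℝ => E p.1 p.2) ?_ ?_
    · rintro ⟨x, t⟩
      have e1 := HomC.card_eq H hc x (cl t)
      rw [hE, h0] at e1
      simp only [Multiset.card_add, hn] at e1
      exact Nat.add_right_cancel e1
    · simp only [← hE]
      exact hc.comp (by fun_prop : Continuous fun p : X × ℝ => (p.1, cl p.2))
  · intro x
    have := hE x 0
    rw [cl_zero, h0] at this
    exact (add_right_cancel this).symm
  · intro x
    have := hE x 1
    rw [cl_one, h1] at this
    exact (add_right_cancel this).symm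

/-- homotopy by a pointwise homotopy which is continuous where needed -/
lemma HomC.pointwise {h : Y × ℝ → Z} {w : Z} {q : X → Multiset Y} (hq : Continuous q)
    (hc : ∀ x, ∀ y ∈ q x, ∀ t, 0 ≤ t → t ≤ 1 → ContinuousAt h (y, t)) :
    HomC w (fun _ => 0) (fun x => (q x).map fun y => h (y, 0)) (fun x => (q x).map fun y => h (y, 1)) := by
  refine HomC.mk' (fun x t => (q x).map fun y => h (y, t)) ?_ (fun _ => rfl) (fun _ => rfl)
    fun _ _ _ _ => Nat.zero_le _
  intro x t h0 h1
  exact ContinuousAt.mmap (s := fun p : X × ℝ => p.2) (q := fun p : X × ℝ => q p.1)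
    (hq.comp continuous_fst).continuousAt continuousAt_snd fun y hy => hc x y hy t h0 h1

/-- Main reduction of the upper bound on the category. -/
theorem catLE_of {n r : ℕ} {ι : Type*} (v : Y) (W : Fin (r + 1) → ι → Set (Multiset Y))
    (hW : ∀ j τ, IsOpen (W j τ))
    (hdis : ∀ j τ τ', ∀ D ∈ W j τ, D ∈ W j τ' → τ = τ')
    (hcov : ∀ D : Multiset Y, Multiset.card D = n → ∃ j τ, D ∈ W j τ)
    (hom : ∀ j τ, HomC v (fun _ => 0) (fun D : W j τ => D.1) (fun _ => n • {v})) :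
    catLE (SP n Y) r := by
  refine ⟨fun j => ⋃ τ, spMS n ⁻¹' W j τ, fun j => isOpen_iUnion fun τ =>
    (hW j τ).preimage (continuous_spMS n), ?_, ?_⟩
  · rw [Set.eq_univ_iff_forall]
    intro D
    obtain ⟨j, τ, h⟩ := hcov (spMS n D) (card_spMS D)
    exact Set.mem_iUnion.2 ⟨j, Set.mem_iUnion.2 ⟨τ, h⟩⟩
  · intro j
    choose H hc h0 h1 _ using hom j
    have hτ : ∀ D : ↥(⋃ τ, spMS n ⁻¹' W j τ), ∃ τ, spMS n D.1 ∈ W j τ := fun D => by simpa using Set.mem_iUnion.1 D.2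
    choose τ hτ using hτ
    have hlift : ∀ (D : ↥(⋃ τ, spMS n ⁻¹' W j τ)) (t : ℝ), ∃ E : SP n Y, spMS n E = H (τ D) ⟨_, hτ D⟩ t := by
      intro D t
      obtain ⟨f, hf⟩ := tmn_surj' (n := n) (H (τ D) ⟨_, hτ D⟩ t) (by
        rw [HomC.card_eq _ (hc _), h0, card_spMS])
      exact ⟨spm n Y f, hf⟩
    choose K hK using hlift
    have hKc : Continuous fun p : ↥(⋃ τ, spMS n ⁻¹' W j τ) × ℝ => K p.1 p.2 := by
      rw [(spMS_emb n).isInducing.continuous_iff, continuous_iff_continuousAt]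
      rintro ⟨D, t⟩
      have hO : IsOpen {E : ↥(⋃ τ, spMS n ⁻¹' W j τ) | spMS n E.1 ∈ W j (τ D)} :=
        (hW j (τ D)).preimage ((continuous_spMS n).comp continuous_subtype_val)
      refine continuousAt_of_open
        (q := Prod.map (Subtype.val : {E : ↥(⋃ τ, spMS n ⁻¹' W j τ) | spMS n E.1 ∈ W j (τ D)} → _) (id : ℝ → ℝ))
        (hO.isOpenMap_subtype_val.prodMap IsOpenMap.id) (a := (⟨D, hτ D⟩, t)) ?_
      have e : (fun a : {E : ↥(⋃ τ, spMS n ⁻¹' W j τ) | spMS n E.1 ∈ W j (τ D)} × ℝ =>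
          (spMS n ∘ fun p : ↥(⋃ τ, spMS n ⁻¹' W j τ) × ℝ => K p.1 p.2) (Prod.map Subtype.val id a)) =
          fun a => H (τ D) ⟨spMS n a.1.1.1, a.1.2⟩ a.2 := by
        funext a
        simp only [Function.comp_apply, Prod.map_fst, Prod.map_snd, id, hK]
        have : τ a.1.1 = τ D := hdis j _ _ _ (hτ _) a.1.2
        have key : ∀ τ' (h : spMS n a.1.1.1 ∈ W j τ'), τ' = τ D →
          H τ' ⟨spMS n a.1.1.1, h⟩ a.2 = H (τ D) ⟨spMS n a.1.1.1, a.1.2⟩ a.2 := by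
          rintro _ h rfl; rfl
        exact key _ _ this
      rw [e]
      apply Continuous.continuousAt
      refine (hc (τ D)).comp (f := fun a : {E : ↥(⋃ τ, spMS n ⁻¹' W j τ) | spMS n E.1 ∈ W j (τ D)} × ℝ =>
        ((⟨spMS n a.1.1.1, a.1.2⟩ : W j (τ D)), a.2)) ?_
      refine Continuous.prodMk ?_ continuous_snd
      exact Continuous.subtype_mk ((continuous_spMS n).comp (continuous_subtype_val.comp
        (continuous_subtype_val.comp continuous_fst))) _
    refine ⟨spm n Y fun _ => v, ⟨⟨⟨fun p => K p.2 p.1, ?_⟩, ?_, ?_⟩⟩⟩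
    · exact hKc.comp (by fun_prop : Continuous fun p : I × ↥(⋃ τ, spMS n ⁻¹' W j τ) => (p.2, (p.1 : ℝ)))
    · intro D
      apply spMS_inj n
      change spMS n (K D ((0 : I) : ℝ)) = spMS n D.1
      rw [hK, Set.Icc.coe_zero, h0]
    · intro D
      apply spMS_inj n
      change spMS n (K D ((1 : I) : ℝ)) = spMS n (spm n Y fun _ => v)
      rw [hK, Set.Icc.coe_one, h1, spMS_spm, Multiset.nsmul_singleton]
      unfold tmn
      rw [Multiset.map_const']
      simp

/-- Pointwise contraction criterion. -/
theorem catLE_pointwise {n d : ℕ} (v : Y) (A : Fin (n * d + 1) → Set Y) (hA : ∀ j, IsOpen (A j))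
    (hbad : ∀ y, Nat.card {j // y ∉ A j} ≤ d) (h : Fin (n * d + 1) → Y × ℝ → Y)
    (hc : ∀ j, ∀ y ∈ A j, ∀ t, 0 ≤ t → t ≤ 1 → ContinuousAt (h j) (y, t))
    (h0 : ∀ j, ∀ y ∈ A j, h j (y, 0) = y) (h1 : ∀ j, ∀ y ∈ A j, h j (y, 1) = v) :
    catLE (SP n Y) (n * d) := by
  classical
  refine catLE_of v (fun j (_ : Unit) => {D | Multiset.card D = n} ∩ {D | cnt (A j)ᶜ D ≤ 0}) ?_ ?_ ?_ ?_
  · intro j _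
    exact (isOpen_card n).inter (cnt_closed (hA j).isClosed_compl 0)
  · intros; rfl
  · intro D hD
    obtain ⟨f, rfl⟩ := tmn_surj' D hD
    by_contra hcon
    push Not at hcon
    have hb : ∀ j, ∃ i, f i ∉ A j := by
      intro j
      by_contra hj
      push Not at hj
      refine hcon j () ⟨hD, ?_⟩
      change _ ≤ 0
      rw [Nat.le_zero, cnt_eq_zero]
      intro y hy
      obtain ⟨i, rfl⟩ := mem_tmn.1 hy
      simpa using hj i
    choose i hi using hb
    have h1 : Fintype.card (Fin (n * d + 1)) ≤ Fintype.card (Σ i : Fin n, {j // f i ∉ A j}) :=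
      Fintype.card_le_of_injective (fun j => ⟨i j, j, hi j⟩) (by
        intro a b hab
        exact congrArg (fun s : Σ i : Fin n, {j // f i ∉ A j} => s.2.1) hab)
    rw [Fintype.card_fin, Fintype.card_sigma] at h1
    have h2 : ∑ i : Fin n, Fintype.card {j // f i ∉ A j} ≤ ∑ i : Fin n, d :=
      Finset.sum_le_sum fun i _ => by
        have := hbad (f i)
        rwa [Nat.card_eq_fintype_card] at this
    rw [Finset.sum_const, Finset.card_univ, Fintype.card_fin, smul_eq_mul] at h2
    omega
  · intro j _
    have hmem : ∀ D : ↥({D : Multiset Y | Multiset.card D = n} ∩ {D | cnt (A j)ᶜ D ≤ 0}), ∀ y ∈ D.1, y ∈ A j := by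
      rintro ⟨D, hD⟩ y hy
      have := cnt_eq_zero.1 (Nat.le_zero.1 hD.2) y hy
      simpa using this
    refine (HomC.pointwise (h := h j) (w := v) (q := fun D : ↥({D : Multiset Y | Multiset.card D = n} ∩
      {D | cnt (A j)ᶜ D ≤ 0}) => D.1) continuous_subtype_val fun D y hy t ht ht' =>
        hc j y (hmem D y hy) t ht ht').congr ?_ ?_
    · intro D
      conv_rhs => rw [← Multiset.map_id D.1]
      exact Multiset.map_congr rfl fun y hy => h0 j y (hmem D y hy)
    · intro D
      rw [Multiset.map_congr rfl fun y hy => h1 j y (hmem D y hy), Multiset.map_const',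
        Multiset.nsmul_singleton]
      rw [show Multiset.card D.1 = n from D.2.1]

end HC
end SPcat
end

open scoped unitInterval Topology
open MeasureTheory
noncomputable section
namespace SPcat

abbrev E3 := EuclideanSpace ℝ (Fin 3)

/-- radial projection to the sphere -/
def nrm (w : E3) : S2 := by
  classical
  exact if h : w ≠ 0 then ⟨‖w‖⁻¹ • w, by
    rw [mem_sphere_zero_iff_norm, norm_smul, norm_inv, norm_norm, inv_mul_cancel₀ (norm_ne_zero_iff.2 h)]⟩
  else ⟨!₂[1, 0, 0], S2_mk_mem (by norm_num)⟩

lemma nrm_val {w : E3} (h : w ≠ 0) : (nrm w).1 = ‖w‖⁻¹ • w := by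
  unfold nrm; rw [dif_pos h]

lemma continuousAt_nrm {w : E3} (h : w ≠ 0) : ContinuousAt nrm w := by
  rw [Topology.IsInducing.subtypeVal.continuousAt_iff]
  have h1 : ContinuousAt (fun w : E3 => ‖w‖⁻¹ • w) w :=
    (continuous_norm.continuousAt.inv₀ (norm_ne_zero_iff.2 h)).smul continuousAt_id
  refine h1.congr ?_
  filter_upwards [isOpen_ne.mem_nhds h] with w' hw'
  exact (nrm_val hw').symm

def S2h (ς : ℝ) (p : S2 × ℝ) : E3 :=
  max (1 - 2 * p.2) 0 • p.1.1 + (min (2 * p.2) (2 - 2 * p.2) * ς) • (!₂[0, 0, 1] : E3) +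
    max (2 * p.2 - 1) 0 • (!₂[1, 0, 0] : E3)

lemma continuous_S2h (ς : ℝ) : Continuous (S2h ς) := by unfold S2h; fun_prop

lemma S2h_ne {ς : ℝ} {y : S2} {t : ℝ} (h0 : 0 ≤ t) (h1 : t ≤ 1)
    (h : (ς = 1 ∧ -1 < y.1 2) ∨ (ς = -1 ∧ y.1 2 < 1)) : S2h ς (y, t) ≠ 0 := by
  intro he
  have e0 := congrArg (fun w : E3 => w 0) he
  have e1 := congrArg (fun w : E3 => w 1) he
  have e2 := congrArg (fun w : E3 => w 2) he
  have hy := S2_eq y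
  simp [S2h] at e0 e1 e2
  rcases le_total t (1 / 2) with ht | ht
  · rw [max_eq_left (by linarith : 0 ≤ 1 - 2 * t)] at e0 e2
    rw [max_eq_right (by linarith)] at e0
    rw [min_eq_left (by linarith)] at e2
    have hς : ς ^ 2 = 1 := by rcases h with h | h <;> rw [h.1] <;> norm_num
    by_cases ha : 1 - 2 * t = 0
    · rw [ha] at e2
      have : 2 * t = 1 := by linarith
      rw [this] at e2
      rcases h with h | h <;> rw [h.1] at e2 <;> norm_num at e2
    · have hx : y.1 0 = 0 := by
        have := mul_eq_zero.1 (by linarith : (1 - 2 * t) * y.1 0 = 0); tauto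
      have hx' : y.1 1 = 0 := by
        have : 1 - 2 * t = 0 ∨ y.1 1 = 0 := by
          rcases e1 with h | h
          · left; linarith
          · exact Or.inr h
        tauto
      rw [hx, hx'] at hy
      have ha' : 0 < 1 - 2 * t := lt_of_le_of_ne (by linarith) (Ne.symm ha)
      have hz : (y.1 2 - 1) * (y.1 2 + 1) = 0 := by linear_combination hy
      rcases h with ⟨rfl, h⟩ | ⟨rfl, h⟩
      · have : y.1 2 = 1 := by
          rcases mul_eq_zero.1 hz with h' | h' <;> linarith
        rw [this] at e2; linarith
      · have : y.1 2 = -1 := by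
          rcases mul_eq_zero.1 hz with h' | h' <;> linarith
        rw [this] at e2; linarith
  · rw [max_eq_right (by linarith : 1 - 2 * t ≤ 0)] at e0 e2
    rw [max_eq_left (by linarith)] at e0
    rw [min_eq_right (by linarith)] at e2
    have : t = 1 / 2 := by linarith
    subst this
    rcases h with h | h <;> rw [h.1] at e2 <;> norm_num at e2

theorem upper_S2 {n : ℕ} : catLE (SP n S2) n := by
  have hs : ∀ j : Fin (n * 1 + 1), 0 ≤ ((j : ℕ) : ℝ) / (n + 1) ∧ ((j : ℕ) : ℝ) / (n + 1) < 1 := by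
    intro j
    have hj := j.2
    have hj' : ((j : ℕ) : ℝ) < n + 1 := by exact_mod_cast (by omega : (j : ℕ) < n + 1)
    exact ⟨by positivity, by rw [div_lt_one (by positivity)]; exact hj'⟩
  have hz : Continuous fun y : S2 => y.1 2 := by fun_prop
  have key := catLE_pointwise (Y := S2) (n := n) (d := 1) ⟨!₂[1, 0, 0], S2_mk_mem (by norm_num)⟩
    (fun j => {y | y.1 2 ≠ ((j : ℕ) : ℝ) / (n + 1)}) (fun j => isOpen_ne.preimage hz) ?_
    (fun j p => nrm (S2h (if ((j : ℕ) : ℝ) / (n + 1) < p.1.1 2 then 1 else -1) p)) ?_ ?_ ?_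
  · simpa using key
  · intro y
    rw [Finite.card_le_one_iff_subsingleton]
    constructor
    rintro ⟨a, ha⟩ ⟨b, hb⟩
    simp only [Set.mem_ofPred_eq, not_not] at ha hb
    have := ha.symm.trans hb
    rw [div_left_inj' (by positivity)] at this
    exact Subtype.ext (Fin.ext (by exact_mod_cast this))
  · intro j y hy t h0 h1
    rcases lt_or_gt_of_ne hy with h | h
    · have hne := S2h_ne (ς := -1) (y := y) h0 h1 (Or.inr ⟨rfl, h.trans (hs j).2⟩)
      have : ContinuousAt (fun p => nrm (S2h (-1) p)) (y, t) :=
        ContinuousAt.comp (continuousAt_nrm hne) (continuous_S2h _).continuousAt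
      refine this.congr ?_
      have ho : IsOpen {p : S2 × ℝ | p.1.1 2 < ((j : ℕ) : ℝ) / (n + 1)} := isOpen_lt (by fun_prop) (by fun_prop)
      filter_upwards [ho.mem_nhds h] with p hp
      rw [if_neg (not_lt.2 (le_of_lt hp))]
    · have hne := S2h_ne (ς := 1) (y := y) h0 h1 (Or.inl ⟨rfl, by linarith [(hs j).1, show ((j : ℕ) : ℝ) / (n + 1) < y.1 2 from h]⟩)
      have : ContinuousAt (fun p => nrm (S2h 1 p)) (y, t) :=
        ContinuousAt.comp (continuousAt_nrm hne) (continuous_S2h _).continuousAt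
      refine this.congr ?_
      have ho : IsOpen {p : S2 × ℝ | ((j : ℕ) : ℝ) / (n + 1) < p.1.1 2} := isOpen_lt (by fun_prop) (by fun_prop)
      filter_upwards [ho.mem_nhds h] with p hp
      rw [if_pos hp]
  · intro j y _
    have : ∀ ς, S2h ς (y, 0) = y.1 := by intro ς; simp [S2h]
    have hy : ‖y.1‖ = 1 := mem_sphere_zero_iff_norm.1 y.2
    simp only [this]
    apply Subtype.ext
    rw [nrm_val (by intro h; rw [h] at hy; simp at hy), hy]; simp
  · intro j y _
    have : ∀ ς, S2h ς (y, 1) = !₂[1, 0, 0] := by intro ς; norm_num [S2h]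
    simp only [this]
    have hy : ‖(!₂[1, 0, 0] : E3)‖ = 1 := mem_sphere_zero_iff_norm.1 (S2_mk_mem (by norm_num))
    apply Subtype.ext
    rw [nrm_val (by intro h; rw [h] at hy; simp at hy), hy]; simp

end SPcat
end

open scoped unitInterval Topology
open MeasureTheory
noncomputable section
namespace SPcat

/-! ## More on the polar coordinates of the surface -/

/-- the vertex -/
def vx (g : ℕ) : MG g := pol g 1 0

lemma pol_per' {g : ℕ} (hg : 0 < g) (r θ : ℝ) (k : ℤ) : pol g r (θ + k * (4 * g)) = pol g r θ := by
  have := polD_add (4 * g) (by omega) r θ k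
  rw [pol, pol, ← this]; congr 2; push_cast; ring

lemma pol_vert4 {g : ℕ} (j : ℕ) (hj : j < g) : pol g 1 (4 * j + 1) = pol g 1 (4 * j) ∧
    pol g 1 (4 * j + 2) = pol g 1 (4 * j) ∧ pol g 1 (4 * j + 3) = pol g 1 (4 * j) ∧
    pol g 1 (4 * j + 4) = pol g 1 (4 * j) := by
  have a1 := pol_glue (ρ := 0) hj (by norm_num) (t := 0) le_rfl zero_le_one
  have a2 := pol_glue (ρ := 0) hj (by norm_num) (t := 1) zero_le_one le_rfl
  have a3 := pol_glue (ρ := 1) hj (by norm_num) (t := 0) le_rfl zero_le_one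
  have a4 := pol_glue (ρ := 1) hj (by norm_num) (t := 1) zero_le_one le_rfl
  have e1 : (4 * (j:ℝ) + (0:ℕ) + 0) = 4 * j := by push_cast; ring
  have e2 : (4 * (j:ℝ) + (0:ℕ) + 3 - 0) = 4 * j + 3 := by push_cast; ring
  have e3 : (4 * (j:ℝ) + (0:ℕ) + 1) = 4 * j + 1 := by push_cast; ring
  have e4 : (4 * (j:ℝ) + (0:ℕ) + 3 - 1) = 4 * j + 2 := by push_cast; ring
  have e5 : (4 * (j:ℝ) + (1:ℕ) + 0) = 4 * j + 1 := by push_cast; ring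
  have e6 : (4 * (j:ℝ) + (1:ℕ) + 3 - 0) = 4 * j + 4 := by push_cast; ring
  have e7 : (4 * (j:ℝ) + (1:ℕ) + 1) = 4 * j + 2 := by push_cast; ring
  have e8 : (4 * (j:ℝ) + (1:ℕ) + 3 - 1) = 4 * j + 3 := by push_cast; ring
  rw [e1, e2] at a1
  rw [e3, e4] at a2
  rw [e5, e6] at a3
  rw [e7, e8] at a4
  exact ⟨by rw [a2, a4, a1], by rw [a4, a1], a1.symm, by rw [← a3, a2, a4, a1]⟩

lemma pol_vert {g : ℕ} (j : ℕ) (hj : j ≤ g) : pol g 1 (4 * j) = vx g := by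
  induction j with
  | zero => simp [vx]
  | succ j ih =>
    have h1 : pol g 1 (4 * (j:ℝ) + 4) = pol g 1 (4 * (j:ℝ)) := (pol_vert4 j (by omega)).2.2.2
    have h2 : pol g 1 (4 * (j:ℝ)) = vx g := ih (by omega)
    rw [← h2, ← h1]; congr 1; push_cast; ring

lemma pol_nat {g m : ℕ} (hg : 0 < g) (hm : m ≤ 4 * g) : pol g 1 (m : ℝ) = vx g := by
  have e : (m : ℝ) = 4 * (m / 4 : ℕ) + (m % 4 : ℕ) := by exact_mod_cast (Nat.div_add_mod m 4).symm
  by_cases h : m / 4 < g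
  · have := pol_vert4 (m / 4) h
    have hv := pol_vert (g := g) (m / 4) h.le
    have h4 : m % 4 < 4 := Nat.mod_lt _ (by norm_num)
    rw [e]
    obtain h' | h' | h' | h' : m % 4 = 0 ∨ m % 4 = 1 ∨ m % 4 = 2 ∨ m % 4 = 3 := by omega
    · rw [h']; simpa using hv
    · rw [h', ← hv, ← this.1]; norm_num
    · rw [h', ← hv, ← this.2.1]; norm_num
    · rw [h', ← hv, ← this.2.2.1]; norm_num
  · have : m = 4 * g := by omega
    subst this
    have := pol_vert (g := g) g le_rfl
    rw [← this]; push_cast; rfl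

lemma pol_int {g : ℕ} (hg : 0 < g) (m : ℤ) : pol g 1 (m : ℝ) = vx g := by
  have hg' : (4 * g : ℤ) ≠ 0 := by positivity
  have h0 := Int.emod_nonneg m hg'
  have h1 := Int.emod_lt_of_pos m (by positivity : (0:ℤ) < 4 * g)
  have h2 := Int.emod_add_mul_ediv m (4 * g)
  obtain ⟨a, ha⟩ := Int.eq_ofNat_of_zero_le h0
  have e : (m : ℝ) = (a : ℝ) + ((m / (4 * g) : ℤ) : ℝ) * (4 * g) := by
    rw [ha] at h2
    have : (m : ℝ) = ((a + 4 * g * (m / (4 * g)) : ℤ) : ℝ) := by rw [h2]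
    rw [this]; push_cast; ring
  rw [e, pol_per' hg, pol_nat hg]
  omega

/-- normal form of boundary points -/
lemma pol_bdry {g : ℕ} {θ : ℝ} (h0 : 0 ≤ θ) (h1 : θ < 4 * g) :
    ∃ j : ℕ, j < g ∧ ∃ ρ : ℕ, ρ < 2 ∧ ∃ t : ℝ, 0 ≤ t ∧ t ≤ 1 ∧
      pol g 1 θ = pol g 1 (4 * (j:ℝ) + (ρ:ℝ) + t) ∧
      (θ = 4 * (j:ℝ) + (ρ:ℝ) + t ∨ θ = 4 * (j:ℝ) + (ρ:ℝ) + 3 - t) := by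
  set m := ⌊θ⌋₊ with hm
  have m0 : (m:ℝ) ≤ θ := Nat.floor_le h0
  have m1 : θ < m + 1 := Nat.lt_floor_add_one θ
  have mg : m < 4 * g := by
    have : (m:ℝ) < (4 * g : ℕ) := by push_cast; linarith
    exact_mod_cast this
  have e : (m : ℝ) = 4 * (m / 4 : ℕ) + (m % 4 : ℕ) := by exact_mod_cast (Nat.div_add_mod m 4).symm
  have hj : m / 4 < g := by omega
  have h4 : m % 4 < 4 := Nat.mod_lt _ (by norm_num)
  by_cases h : m % 4 < 2
  · exact ⟨m / 4, hj, m % 4, h, θ - m, by linarith, by linarith, by congr 1; linarith, Or.inl (by linarith)⟩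
  · have e' : ((m % 4 : ℕ) : ℝ) = (m % 4 - 2 : ℕ) + 2 := by
      exact_mod_cast (by omega : m % 4 = m % 4 - 2 + 2)
    have e3 : θ = 4 * (m / 4 : ℕ) + (m % 4 - 2 : ℕ) + 3 - (m + 1 - θ) := by linarith
    refine ⟨m / 4, hj, m % 4 - 2, by omega, m + 1 - θ, by linarith, by linarith, ?_, Or.inr e3⟩
    rw [pol_glue hj (by omega) (by linarith) (by linarith)]
    congr 1

lemma exists_clift {Z : Type*} [TopologicalSpace Z] {g : ℕ} (hg : 0 < g) {f : ℝ → ℝ → Z} (hf : Compat g f)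
    (hc : Continuous fun p : ℝ × ℝ => f p.1 p.2) : ∃ F : MG g → Z, Continuous F ∧
      ∀ r θ : ℝ, 0 ≤ r → r ≤ 1 → 0 ≤ θ → θ ≤ 4 * g → F (pol g r θ) = f r θ := by
  obtain ⟨F, hF⟩ := exists_lift hg hf
  refine ⟨F, continuous_of_pol hg ?_, hF⟩
  have : (fun q : PK g => F (pol g q.1 q.2)) = fun q : PK g => f q.1 q.2 := by
    funext q; exact hF _ _ q.1.2.1 q.1.2.2 q.2.2.1 q.2.2.2
  rw [this]
  exact hc.comp (by fun_prop : Continuous fun q : PK g => ((q.1:ℝ), (q.2:ℝ)))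

lemma exists_rad {g : ℕ} (hg : 0 < g) : ∃ F : MG g → ℝ, Continuous F ∧
      ∀ r θ : ℝ, 0 ≤ r → r ≤ 1 → 0 ≤ θ → θ ≤ 4 * g → F (pol g r θ) = r :=
  exists_clift hg (f := fun r _ => r) ⟨fun _ _ _ => rfl, fun _ _ _ => rfl, fun _ _ _ _ _ _ _ => rfl⟩ (by fun_prop)

lemma exp_tz_other {j k ρ ς : ℕ} (hρ : ρ < 2) (hς : ς < 2) {t : ℝ} (t0 : 0 ≤ t) (t1 : t ≤ 1)
    (h : ¬(j = k ∧ ρ = ς)) : tz (4 * k + ς) (4 * j + ρ + t) = 0 ∨ tz (4 * k + ς) (4 * j + ρ + t) = 1 := by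
  have r0 : (0:ℝ) ≤ ρ := by positivity
  have r1 : (ρ:ℝ) ≤ 1 := by exact_mod_cast Nat.lt_succ_iff.1 hρ
  have q0 : (0:ℝ) ≤ ς := by positivity
  have q1 : (ς:ℝ) ≤ 1 := by exact_mod_cast Nat.lt_succ_iff.1 hς
  rcases lt_trichotomy j k with h' | h' | h'
  · left
    have : (j:ℝ) + 1 ≤ k := by exact_mod_cast h'
    exact tz_left (by linarith)
  · subst h'
    obtain rfl | rfl : ρ = 0 ∨ ρ = 1 := by omega
    · obtain rfl : ς = 1 := by omega
      left; refine tz_left ?_; push_cast; linarith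
    · obtain rfl : ς = 0 := by omega
      right; refine tz_mid ?_ ?_ <;> push_cast <;> linarith
  · left
    have : (k:ℝ) + 1 ≤ j := by exact_mod_cast h'
    exact tz_right (by linarith)

lemma tz_self {k ς : ℕ} {t : ℝ} (t0 : 0 ≤ t) (t1 : t ≤ 1) : tz (4 * k + ς) (4 * k + ς + t) = t := by
  rw [tz_up (by linarith) (by linarith)]; ring

lemma exp_two_pi_inj {a b : ℝ} (h : Complex.exp (((2 * Real.pi * a : ℝ) : ℂ) * Complex.I) =
    Complex.exp (((2 * Real.pi * b : ℝ) : ℂ) * Complex.I)) : ∃ k : ℤ, a = b + k := by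
  rw [Complex.exp_eq_exp_iff_exists_int] at h
  obtain ⟨k, hk⟩ := h
  refine ⟨k, ?_⟩
  have : ((2 * Real.pi * a : ℝ) : ℂ) = ((2 * Real.pi * (b + k) : ℝ) : ℂ) := by
    apply mul_right_cancel₀ Complex.I_ne_zero
    rw [hk]; push_cast; ring
  have := Complex.ofReal_injective this
  exact mul_left_cancel₀ (by positivity) this

lemma pol_eq_of_F {g : ℕ} (hg : 0 < g) {j k ρ ς : ℕ} (hj : j < g) (hk : k < g) (hρ : ρ < 2) (hς : ς < 2)
    {t u : ℝ} (t0 : 0 ≤ t) (t1 : t ≤ 1) (u0 : 0 ≤ u) (u1 : u ≤ 1)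
    (h : ∀ k' : ℕ, k' < g → ∀ ς' : ℕ, ς' < 2 → ∃ a : ℤ,
      tz (4 * k' + ς') (4 * j + ρ + t) = tz (4 * k' + ς') (4 * k + ς + u) + a) :
    pol g 1 (4 * j + ρ + t) = pol g 1 (4 * k + ς + u) := by
  have hend : ∀ (j ρ : ℕ) (t : ℝ) (a : ℤ), t = a → pol g 1 (4 * j + ρ + t) = vx g := by
    rintro j ρ _ a rfl
    rw [← pol_int hg (4 * j + ρ + a)]; congr 1; push_cast; ring
  by_cases he : j = k ∧ ρ = ς
  · obtain ⟨rfl, rfl⟩ := he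
    obtain ⟨a, ha⟩ := h j hj ρ hρ
    rw [tz_self t0 t1, tz_self u0 u1] at ha
    by_cases h0 : a = 0
    · rw [h0] at ha; rw [ha]; simp
    · have : a = 1 ∨ a = -1 := by
        have h1 : (a : ℝ) < 2 := by linarith
        have h2 : (-2 : ℝ) < a := by linarith
        have h1' : a < 2 := by exact_mod_cast h1
        have h2' : -2 < a := by exact_mod_cast h2
        omega
      rcases this with rfl | rfl
      · push_cast at ha
        rw [hend j ρ t 1 (by push_cast; linarith), hend j ρ u 0 (by push_cast; linarith)]
      · push_cast at ha
        rw [hend j ρ t 0 (by push_cast; linarith), hend j ρ u 1 (by push_cast; linarith)]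
  · have h1 : ∃ a : ℤ, t = a := by
      obtain ⟨a, ha⟩ := h j hj ρ hρ
      rw [tz_self t0 t1] at ha
      rcases exp_tz_other hς hρ u0 u1 (fun h => he ⟨h.1.symm, h.2.symm⟩) with h | h
      · exact ⟨a, by rw [ha, h]; simp⟩
      · exact ⟨1 + a, by rw [ha, h]; simp⟩
    have h2 : ∃ a : ℤ, u = a := by
      obtain ⟨a, ha⟩ := h k hk ς hς
      rw [tz_self u0 u1] at ha
      rcases exp_tz_other hρ hς t0 t1 he with h | h
      · exact ⟨-a, by push_cast; linarith⟩
      · exact ⟨1 - a, by push_cast; linarith⟩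
    obtain ⟨a, ha⟩ := h1
    obtain ⟨b, hb⟩ := h2
    rw [hend _ _ _ _ ha, hend _ _ _ _ hb]

lemma compactMG {g : ℕ} (hg : 0 < g) : CompactSpace (MG g) :=
  ⟨by
    rw [← (isQuotientMap_polK hg).surjective.range_eq]
    exact isCompact_range (isQuotientMap_polK hg).continuous⟩

lemma t2MG {g : ℕ} (hg : 0 < g) : T2Space (MG g) := by
  obtain ⟨R, hRc, hR⟩ := exists_rad hg
  obtain ⟨J, hJc, hJ⟩ := exists_clift (Z := ℂ) hg (f := fun r θ => ((1 - r : ℝ) : ℂ) * ((r : ℝ) : ℂ) *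
      Complex.exp (((2 * Real.pi * (θ / (4 * g)) : ℝ) : ℂ) * Complex.I)) ⟨by intros; simp, by
        intro r _ _
        have : ((4 * g : ℝ) / (4 * g)) = 1 := by field_simp
        rw [this]; simp [Complex.exp_two_pi_mul_I], by intros; simp⟩ (by fun_prop)
  have hF : ∀ e : Fin g × Fin 2, _ := fun e => exists_F e.1.2 e.2.2
  choose F hFc hF using hF
  refine T2Space.of_injective_continuous (f := fun x : MG g => (R x, J x, fun e => F e x)) ?_ (by
    have : ∀ e, Continuous (F e) := fun e => (hFc e).1
    fun_prop)
  intro x x' h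
  obtain ⟨r, θ, r0, r1, θ0, θ1, rfl⟩ := pol_surj hg x
  obtain ⟨r', θ', r0', r1', θ0', θ1', rfl⟩ := pol_surj hg x'
  simp only [Prod.mk.injEq] at h
  obtain ⟨hr, hj, hf⟩ := h
  rw [hR _ _ r0 r1 θ0 θ1.le, hR _ _ r0' r1' θ0' θ1'.le] at hr
  subst hr
  by_cases h0 : r = 0
  · rw [h0]; exact pol_zero _ _ _
  by_cases h1 : r = 1
  · subst h1
    obtain ⟨j, hj, ρ, hρ, t, t0, t1, e, -⟩ := pol_bdry θ0 θ1
    obtain ⟨k, hk, ς, hς, u, u0, u1, e', -⟩ := pol_bdry θ0' θ1'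
    rw [e, e'] at hf ⊢
    refine pol_eq_of_F hg hj hk hρ hς t0 t1 u0 u1 ?_
    intro k' hk' ς' hς'
    have := congrFun hf (⟨k', hk'⟩, ⟨ς', hς'⟩)
    have hb : ∀ (j ρ : ℕ) (t : ℝ), j < g → ρ < 2 → 0 ≤ t → t ≤ 1 → 0 ≤ 4 * (j:ℝ) + ρ + t ∧ 4 * (j:ℝ) + ρ + t ≤ 4 * g := by
      intro j ρ t hj hρ t0 t1
      have a : (j:ℝ) + 1 ≤ g := by exact_mod_cast hj
      have b : (ρ:ℝ) ≤ 1 := by exact_mod_cast Nat.lt_succ_iff.1 hρ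
      exact ⟨by positivity, by linarith⟩
    have b1 := hb j ρ t hj hρ t0 t1
    have b2 := hb k ς u hk hς u0 u1
    rw [hF _ _ _ zero_le_one le_rfl b1.1 b1.2, hF _ _ _ zero_le_one le_rfl b2.1 b2.2] at this
    have := exp_two_pi_inj this
    simpa only [one_mul] using this
  · rw [hJ _ _ r0 r1 θ0 θ1.le, hJ _ _ r0' r1' θ0' θ1'.le] at hj
    have hne : ((1 - r : ℝ) : ℂ) ≠ 0 := by
      rw [Ne, Complex.ofReal_eq_zero]; intro h; apply h1; linarith
    have hj := mul_left_cancel₀ hne ((mul_assoc _ _ _).symm.trans (hj.trans (mul_assoc _ _ _)))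
    unfold pol
    congr 1
    apply Subtype.ext
    rw [polD_val, polD_val, cl_of_mem r0 r1]
    push_cast at hj ⊢
    exact hj

/-- pointwise criterion of continuity -/
lemma contAt_pol {Z T : Type*} [TopologicalSpace Z] [TopologicalSpace T] {g : ℕ} (hg : 0 < g)
    {F : MG g × T → Z} {y : MG g} {t : T}
    (h : ∀ r θ : ℝ, 0 ≤ r → r ≤ 1 → 0 ≤ θ → θ ≤ 4 * g → pol g r θ = y →
      ∃ f : ℝ × ℝ × T → Z, ContinuousAt f (r, θ, t) ∧ ∀ᶠ q : ℝ × ℝ × T in 𝓝 (r, θ, t),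
        0 ≤ q.1 → q.1 ≤ 1 → 0 ≤ q.2.1 → q.2.1 ≤ 4 * (g:ℝ) → F (pol g q.1 q.2.1, q.2.2) = f q) :
    ContinuousAt F (y, t) := by
  have := compactMG hg
  have := t2MG hg
  have hp : IsProperMap (polK g) := (isQuotientMap_polK hg).continuous.isProperMap
  have hp2 : IsClosedMap (Prod.map (polK g) (id : T → T)) := (hp.prodMap isProperMap_id).isClosedMap
  intro W hW
  rw [Filter.mem_map]
  obtain ⟨W', hW'W, hW'o, hW'm⟩ := mem_nhds_iff.1 hW
  -- open neighbourhood of the fibre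
  have key : ∀ q : PK g × T, Prod.map (polK g) id q = (y, t) → Prod.map (polK g) id ⁻¹' (F ⁻¹' W') ∈ 𝓝 q := by
    rintro ⟨⟨r, θ⟩, t'⟩ hq
    simp only [Prod.map_apply, id, Prod.mk.injEq] at hq
    obtain ⟨hq, rfl⟩ := hq
    obtain ⟨f, hf, hev⟩ := h r θ r.2.1 r.2.2 θ.2.1 θ.2.2 hq
    have hval : F (y, t') = f (r, θ, t') := by
      rw [← hq]; exact hev.self_of_nhds r.2.1 r.2.2 θ.2.1 θ.2.2
    have hcont : Continuous fun q : PK g × T => ((q.1.1 : ℝ), (q.1.2 : ℝ), q.2) := by fun_prop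
    have h1 : ∀ᶠ q in 𝓝 ((r:ℝ), (θ:ℝ), t'), f q ∈ W' := hf.eventually_mem (by rw [← hval]; exact hW'o.mem_nhds hW'm)
    have h2 := hcont.continuousAt.tendsto (x := ((r, θ), t')) |>.eventually (hev.and h1)
    filter_upwards [h2] with q hq
    have := hq.1 q.1.1.2.1 q.1.1.2.2 q.1.2.2.1 q.1.2.2.2
    change F (pol g q.1.1 q.1.2, q.2) ∈ W'
    rw [this]; exact hq.2
  have hcl := hp2 _ (isOpen_interior (s := Prod.map (polK g) (id : T → T) ⁻¹' (F ⁻¹' W'))).isClosed_compl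
  have : (Prod.map (polK g) (id : T → T) '' (interior (Prod.map (polK g) (id : T → T) ⁻¹' (F ⁻¹' W')))ᶜ)ᶜ ∈ 𝓝 (y, t) := by
    refine hcl.isOpen_compl.mem_nhds ?_
    rintro ⟨q, hq, he⟩
    exact hq (mem_interior_iff_mem_nhds.2 (key q he))
  filter_upwards [this] with p hp
  obtain ⟨q0, hq0⟩ := (isQuotientMap_polK hg).surjective p.1
  by_contra hcon
  apply hp
  refine ⟨(q0, p.2), fun hin => hcon ?_, by simp [hq0]⟩
  have := interior_subset hin
  simp only [Set.mem_preimage, Prod.map_apply, hq0, id] at this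
  exact hW'W this

end SPcat
end

open scoped unitInterval Topology
open MeasureTheory
noncomputable section
namespace SPcat

/-! ## Upper bound `2n` -/

/-- straight line in the disc -/
def lin (z w : Disc) (t : ℝ) : Disc := ⟨((1 - cl t : ℝ) : ℂ) * z.1 + ((cl t : ℝ) : ℂ) * w.1, by
  have h0 := cl_nonneg t
  have h1 := cl_le_one t
  have hz := z.2
  have hw := w.2
  refine (norm_add_le _ _).trans ?_
  rw [norm_mul, norm_mul, Complex.norm_real, Complex.norm_real, Real.norm_of_nonneg h0,
    Real.norm_of_nonneg (by linarith)]
  nlinarith⟩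

lemma continuous_lin : Continuous fun q : Disc × Disc × ℝ => lin q.1 q.2.1 q.2.2 := by
  unfold lin; fun_prop

lemma lin_zero (z w : Disc) : lin z w 0 = z := by apply Subtype.ext; simp [lin]
lemma lin_one (z w : Disc) : lin z w 1 = w := by apply Subtype.ext; simp [lin]

/-- distance to the nearest integer -/
def nu (θ : ℝ) : ℝ := ‖(θ : UnitAddCircle)‖

lemma continuous_nu : Continuous nu := continuous_norm.comp (AddCircle.continuous_mk' 1)
lemma nu_eq (θ : ℝ) : nu θ = |θ - round θ| := UnitAddCircle.norm_eq
lemma nu_neg (θ : ℝ) : nu (-θ) = nu θ := by unfold nu; rw [AddCircle.coe_neg, norm_neg]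
lemma nu_add_int (θ : ℝ) (m : ℤ) : nu (θ + m) = nu θ := by
  rw [nu_eq, nu_eq, round_add_intCast]; congr 1; push_cast; ring
lemma nu_int (m : ℤ) : nu m = 0 := by rw [nu_eq]; simp
lemma round_of_abs {x : ℝ} {m : ℤ} (h : |x - m| < 1 / 2) : round x = m := by
  rw [round_eq, Int.floor_eq_iff]; rw [abs_lt] at h; constructor <;> linarith

/-- target vertex for a boundary edge -/
def tgt (a : ℤ) : ℤ := if a % 4 < 2 then a else a + 1

/-- the movement -/
def moveF (g : ℕ) (s r θ τ : ℝ) : MG g :=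
  if r < 1 - s then Quot.mk _ (lin (polD (4 * g) r θ) (polD (4 * g) 1 0) τ)
  else if s < r * nu θ then pol g ((1 - cl τ) * r + cl τ) ((1 - cl τ) * θ + cl τ * tgt ⌊θ⌋)
  else pol g ((1 - cl τ) * r + cl τ) ((1 - cl τ) * θ + cl τ * round θ)

lemma compat_nu {g : ℕ} : Compat g (fun r θ => r * nu θ) := by
  refine ⟨by intros; simp, ?_, ?_⟩
  · intro r _ _
    have := nu_int (4 * g)
    push_cast at this
    rw [this]
    have := nu_int 0
    push_cast at this
    rw [this]
  · intro j hj ρ hρ t t0 t1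
    have h1 := nu_add_int t (4 * j + ρ)
    have h2 := nu_add_int (-t) (4 * j + ρ + 3)
    rw [nu_neg] at h2
    push_cast at h1 h2
    rw [show (4 * (j:ℝ) + ρ + t) = t + (4 * j + ρ) by ring, show (4 * (j:ℝ) + ρ + 3 - t) = -t + (4 * j + ρ + 3) by ring,
      h1, h2]

lemma compat_move {g : ℕ} (hg : 0 < g) {s : ℝ} (s0 : 0 < s) (s1 : s < 1 / 4) : Compat g (moveF g s) := by
  refine ⟨?_, ?_, ?_⟩
  · intro θ _ _
    funext τ
    unfold moveF
    rw [if_pos (by linarith), if_pos (by linarith), polD_zero _ θ 0]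
  · intro r hr0 hr1
    funext τ
    have n4 := nu_int (4 * g)
    have n0 := nu_int 0
    push_cast at n4 n0
    unfold moveF
    rw [n4, n0]
    have e : polD (4 * g) r (4 * g) = polD (4 * g) r 0 := by
      have := polD_add (4 * g) (by omega) r 0 1
      rw [← this]; congr 1; push_cast; ring
    rw [e]
    split_ifs with h1 h2
    · rfl
    · exfalso; linarith
    · have e1 : round (4 * (g:ℝ)) = 4 * g := by
        have := round_intCast (α := ℝ) (4 * g); push_cast at this; exact this
      rw [e1]
      have : ((1 - cl τ) * (4 * g : ℝ) + cl τ * ((4 * g : ℤ) : ℝ)) = 4 * g := by push_cast; ring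
      rw [this, pol_per hg]
      simp
  · intro j hj ρ hρ t t0 t1
    funext τ
    have c0 := cl_nonneg τ
    have c1 := cl_le_one τ
    have h1 := nu_add_int t (4 * j + ρ)
    have h2 := nu_add_int (-t) (4 * j + ρ + 3)
    rw [nu_neg] at h2
    push_cast at h1 h2
    unfold moveF
    have hns : ¬ ((1:ℝ) < 1 - s) := by linarith
    simp only [if_neg hns]
    have n1 : nu (4 * (j:ℝ) + ρ + t) = nu t := by rw [← h1]; congr 1; ring
    have n2 : nu (4 * (j:ℝ) + ρ + 3 - t) = nu t := by rw [← h2]; congr 1; ring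
    rw [n1, n2, one_mul]
    have er : (1 - cl τ) * 1 + cl τ = 1 := by ring
    rw [er]
    split_ifs with h
    · have tn : ∀ m : ℤ, t ≠ m := by rintro m rfl; rw [nu_int] at h; linarith
      have t0' : 0 < t := lt_of_le_of_ne t0 (by have := tn 0; push_cast at this; exact this.symm)
      have t1' : t < 1 := lt_of_le_of_ne t1 (by have := tn 1; push_cast at this; exact this)
      have f1 : ⌊(4 * (j:ℝ) + ρ + t)⌋ = 4 * j + ρ := by
        rw [Int.floor_eq_iff]; push_cast; constructor <;> linarith
      have f2 : ⌊(4 * (j:ℝ) + ρ + 3 - t)⌋ = 4 * j + ρ + 2 := by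
        rw [Int.floor_eq_iff]; push_cast; constructor <;> linarith
      rw [f1, f2]
      have g1 : tgt (4 * j + ρ) = 4 * j + ρ := by unfold tgt; rw [if_pos (by omega)]
      have g2 : tgt (4 * j + ρ + 2) = 4 * j + ρ + 3 := by unfold tgt; rw [if_neg (by omega)]; ring
      rw [g1, g2]
      have := pol_glue (g := g) hj hρ (t := (1 - cl τ) * t) (mul_nonneg (by linarith) t0) (by nlinarith)
      convert this using 2 <;> push_cast <;> ring
    · push Not at h
      rw [nu_eq] at h
      obtain hr | hr : round t = 0 ∨ round t = 1 := by
        have ha := abs_le.1 h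
        have a1 : ((round t : ℤ) : ℝ) < 2 := by linarith
        have a2 : (-1 : ℝ) < ((round t : ℤ) : ℝ) := by linarith
        have a1' : round t < 2 := by exact_mod_cast a1
        have a2' : -1 < round t := by exact_mod_cast a2
        omega
      all_goals
        rw [hr] at h
        push_cast at h
        have ha := abs_le.1 h
      · have g1 : round (4 * (j:ℝ) + ρ + t) = 4 * j + ρ := by
          apply round_of_abs; push_cast; rw [abs_lt]; constructor <;> linarith
        have g2 : round (4 * (j:ℝ) + ρ + 3 - t) = 4 * j + ρ + 3 := by
          apply round_of_abs; push_cast; rw [abs_lt]; constructor <;> linarith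
        rw [g1, g2]
        have := pol_glue (g := g) hj hρ (t := (1 - cl τ) * t) (mul_nonneg (by linarith) t0) (by nlinarith)
        convert this using 2 <;> push_cast <;> ring
      · have g1 : round (4 * (j:ℝ) + ρ + t) = 4 * j + ρ + 1 := by
          apply round_of_abs; push_cast; rw [abs_lt]; constructor <;> linarith
        have g2 : round (4 * (j:ℝ) + ρ + 3 - t) = 4 * j + ρ + 2 := by
          apply round_of_abs; push_cast; rw [abs_lt]; constructor <;> linarith
        rw [g1, g2]
        have := pol_glue (g := g) hj hρ (t := (1 - cl τ) * t + cl τ) (by nlinarith) (by nlinarith)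
        convert this using 2 <;> push_cast <;> ring

theorem upper_2n {n g : ℕ} (hg : 0 < g) : catLE (SP n (MG g)) (n * 2) := by
  obtain ⟨R, hRc, hR⟩ := exists_rad hg
  obtain ⟨N, hNc, hN⟩ := exists_clift hg (f := fun r θ => r * nu θ) compat_nu
    (continuous_fst.mul (continuous_nu.comp continuous_snd))
  set s : Fin (n * 2 + 1) → ℝ := fun j => ((j:ℝ) + 1) / (4 * (n * 2 + 2)) with hs
  have s0 : ∀ j, 0 < s j := fun j => by positivity
  have s1 : ∀ j, s j < 1 / 4 := fun j => by
    have : (j:ℝ) + 1 ≤ n * 2 + 1 := by exact_mod_cast j.2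
    rw [hs]; simp only
    rw [div_lt_div_iff₀ (by positivity) (by positivity)]; nlinarith
  have sinj : ∀ i j, s i = s j → i = j := by
    intro i j h
    rw [hs] at h; simp only at h
    have := (div_left_inj' (by positivity)).1 h
    apply Fin.ext
    have : (i:ℝ) = j := by linarith
    exact_mod_cast this
  have hm := fun j => exists_lift hg (compat_move hg (s0 j) (s1 j))
  choose F hF using hm
  refine catLE_pointwise (vx g) (fun j => {y | R y < 1 - s j} ∪ ({y | 1 - s j < R y} ∩ {y | N y ≠ s j})) ?_ ?_
    (fun j p => F j p.1 p.2) ?_ ?_ ?_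
  · intro j
    exact (isOpen_lt hRc continuous_const).union ((isOpen_lt continuous_const hRc).inter
      (isOpen_ne.preimage hNc))
  · intro y
    classical
    have : Nat.card Bool = 2 := by simp
    refine le_of_le_of_eq ?_ this
    have key : ∀ j, y ∉ ({y | R y < 1 - s j} ∪ ({y | 1 - s j < R y} ∩ {y | N y ≠ s j})) →
        s j ≠ 1 - R y → s j = N y := by
      intro j hj hne
      simp only [Set.mem_union, Set.mem_inter_iff, Set.mem_ofPred_eq, not_or, not_and, not_lt, not_not] at hj
      exact (hj.2 (lt_of_le_of_ne hj.1 (by intro h; apply hne; linarith))).symm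
    refine Nat.card_le_card_of_injective (fun j => decide (s j.1 = 1 - R y)) ?_
    rintro ⟨i, hi⟩ ⟨j, hj⟩ h
    simp only [decide_eq_decide] at h
    apply Subtype.ext
    apply sinj
    by_cases h' : s i = 1 - R y
    · rw [h', h.1 h']
    · rw [key i hi h', key j hj (fun hh => h' (h.2 hh))]
  · intro j y hy t _ _
    apply contAt_pol hg
    intro r θ r0 r1 θ0 θ1 e
    rw [← e] at hy
    simp only [Set.mem_union, Set.mem_inter_iff, Set.mem_ofPred_eq] at hy
    rw [hR _ _ r0 r1 θ0 θ1, hN _ _ r0 r1 θ0 θ1] at hy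
    have cN : Continuous fun q : ℝ × ℝ × ℝ => q.1 * nu q.2.1 := by
      have := continuous_nu
      fun_prop
    rcases hy with hy | ⟨hy, hy2⟩
    · refine ⟨fun q => Quot.mk _ (lin (polD (4 * g) q.1 q.2.1) (polD (4 * g) 1 0) q.2.2), ?_, ?_⟩
      · refine Continuous.continuousAt ?_
        refine continuous_quot_mk.comp (continuous_lin.comp
          (((continuous_polD (4 * g)).comp (continuous_fst.prodMk (continuous_fst.comp continuous_snd))).prodMk
            (continuous_const.prodMk (continuous_snd.comp continuous_snd))))
      · have : ∀ᶠ q : ℝ × ℝ × ℝ in 𝓝 (r, θ, t), q.1 < 1 - s j :=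
          continuous_fst.continuousAt.eventually_lt continuousAt_const hy
        filter_upwards [this] with q hq a b c d
        rw [hF _ _ _ a b c d, moveF, if_pos hq]
    · rcases lt_or_gt_of_ne hy2 with h | h
      · refine ⟨fun q => pol g ((1 - cl q.2.2) * q.1 + cl q.2.2) ((1 - cl q.2.2) * q.2.1 + cl q.2.2 * round θ), ?_, ?_⟩
        · refine Continuous.continuousAt ?_
          exact (continuous_pol g).comp (by fun_prop : Continuous fun q : ℝ × ℝ × ℝ =>
            ((1 - cl q.2.2) * q.1 + cl q.2.2, (1 - cl q.2.2) * q.2.1 + cl q.2.2 * round θ))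
        · have h1 : ∀ᶠ q : ℝ × ℝ × ℝ in 𝓝 (r, θ, t), 1 - s j < q.1 :=
            continuousAt_const.eventually_lt continuous_fst.continuousAt hy
          have h2 : ∀ᶠ q : ℝ × ℝ × ℝ in 𝓝 (r, θ, t), q.1 * nu q.2.1 < s j :=
            cN.continuousAt.eventually_lt continuousAt_const h
          have h3 : ∀ᶠ q : ℝ × ℝ × ℝ in 𝓝 (r, θ, t), |q.2.1 - round θ| < 1 / 2 := by
            refine ContinuousAt.eventually_lt (Continuous.continuousAt (by fun_prop)) continuousAt_const ?_
            simp only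
            rw [← nu_eq]
            have := s1 j
            have hn : 0 ≤ nu θ := norm_nonneg _
            nlinarith
          filter_upwards [h1, h2, h3] with q h1 h2 h3 a b c d
          rw [hF _ _ _ a b c d, moveF, if_neg (by linarith), if_neg (by linarith), round_of_abs h3]
      · refine ⟨fun q => pol g ((1 - cl q.2.2) * q.1 + cl q.2.2) ((1 - cl q.2.2) * q.2.1 + cl q.2.2 * tgt ⌊θ⌋), ?_, ?_⟩
        · refine Continuous.continuousAt ?_
          exact (continuous_pol g).comp (by fun_prop : Continuous fun q : ℝ × ℝ × ℝ =>
            ((1 - cl q.2.2) * q.1 + cl q.2.2, (1 - cl q.2.2) * q.2.1 + cl q.2.2 * tgt ⌊θ⌋))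
        · have h1 : ∀ᶠ q : ℝ × ℝ × ℝ in 𝓝 (r, θ, t), 1 - s j < q.1 :=
            continuousAt_const.eventually_lt continuous_fst.continuousAt hy
          have h2 : ∀ᶠ q : ℝ × ℝ × ℝ in 𝓝 (r, θ, t), s j < q.1 * nu q.2.1 :=
            continuousAt_const.eventually_lt cN.continuousAt h
          have h3 : ∀ᶠ q : ℝ × ℝ × ℝ in 𝓝 (r, θ, t), (⌊θ⌋ : ℝ) < q.2.1 := by
            refine ContinuousAt.eventually_lt continuousAt_const (Continuous.continuousAt (by fun_prop)) ?_
            refine lt_of_le_of_ne (Int.floor_le θ) ?_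
            intro h'
            change (⌊θ⌋ : ℝ) = θ at h'
            rw [← h', nu_int] at h
            have := s0 j
            linarith
          have h4 : ∀ᶠ q : ℝ × ℝ × ℝ in 𝓝 (r, θ, t), q.2.1 < (⌊θ⌋ : ℝ) + 1 := by
            refine ContinuousAt.eventually_lt (Continuous.continuousAt (by fun_prop)) continuousAt_const ?_
            exact Int.lt_floor_add_one θ
          filter_upwards [h1, h2, h3, h4] with q h1 h2 h3 h4 a b c d
          rw [hF _ _ _ a b c d, moveF, if_neg (by linarith), if_pos h2, Int.floor_eq_iff.2 ⟨h3.le, h4⟩]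
  · intro j y _
    obtain ⟨r, θ, r0, r1, θ0, θ1, rfl⟩ := pol_surj hg y
    simp only
    rw [hF _ _ _ r0 r1 θ0 θ1.le, moveF]
    simp only [cl_zero, lin_zero]
    split_ifs <;> simp [pol]
  · intro j y _
    obtain ⟨r, θ, r0, r1, θ0, θ1, rfl⟩ := pol_surj hg y
    simp only
    rw [hF _ _ _ r0 r1 θ0 θ1.le, moveF]
    simp only [cl_one, lin_one]
    split_ifs
    · rfl
    · simp [pol_int hg]
    · simp [pol_int hg]

end SPcat
end

open scoped unitInterval Topology
open MeasureTheory
noncomputable section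
namespace SPcat

/-! ## Divisors on the circle -/

lemma tmn_cons {Y : Type*} {m : ℕ} (a : Y) (f : Fin m → Y) :
    tmn (m + 1) (Fin.cons a f) = {a} + tmn m f := by
  have h : ∀ {n : ℕ} (f : Fin n → Y), tmn n f = (List.ofFn f : Multiset Y) := by
    intro n f; unfold tmn; simp
  rw [h, h, List.ofFn_cons]; rfl

lemma tmn_succ {Y : Type*} {m : ℕ} (f : Fin (m + 1) → Y) :
    tmn (m + 1) f = {f 0} + tmn m (fun i => f i.succ) := by
  rw [← tmn_cons]; congr 1; exact (Fin.cons_self_tail f).symm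

lemma tmn_last {Y : Type*} {m : ℕ} (f : Fin (m + 1) → Y) :
    tmn (m + 1) f = {f (Fin.last m)} + tmn m (fun i => f i.castSucc) := by
  have h : ∀ {n : ℕ} (f : Fin n → Y), tmn n f = (List.ofFn f : Multiset Y) := by
    intro n f; unfold tmn; simp
  rw [h, h, List.ofFn_succ', List.concat_eq_append, ← Multiset.coe_add, add_comm]; rfl

/-- ordered tuples of numbers in `[0,1]` -/
def Dl (m : ℕ) : Set (Fin (m + 1) → ℝ) := {s | Monotone s ∧ ∀ i, 0 ≤ s i ∧ s i ≤ 1}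

lemma isCompact_Dl (m : ℕ) : IsCompact (Dl m) := by
  have h : IsCompact (Set.pi Set.univ fun _ : Fin (m + 1) => Set.Icc (0:ℝ) 1) :=
    isCompact_univ_pi fun _ => isCompact_Icc
  refine h.of_isClosed_subset ?_ ?_
  · have : Dl m = (⋂ i, ⋂ j, ⋂ _ : i ≤ j, {s : Fin (m + 1) → ℝ | s i ≤ s j}) ∩
        ⋂ i, ({s | 0 ≤ s i} ∩ {s | s i ≤ 1}) := by
      ext s; simp [Dl, Monotone]
    rw [this]
    refine IsClosed.inter (isClosed_iInter fun i => isClosed_iInter fun j => isClosed_iInter fun _ =>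
      isClosed_le (continuous_apply i) (continuous_apply j)) (isClosed_iInter fun i =>
      (isClosed_le continuous_const (continuous_apply i)).inter (isClosed_le (continuous_apply i) continuous_const))
  · intro s hs i _; exact hs.2 i

abbrev Ci := UnitAddCircle

/-- the divisor of a tuple -/
def dv {m : ℕ} (s : Fin (m + 1) → ℝ) : Multiset Ci := tmn (m + 1) (fun i => (s i : Ci))

/-- the homotopy on tuples -/
def mvt {m : ℕ} (t : ℝ) (s : Fin (m + 1) → ℝ) (i : Fin (m + 1)) : ℝ :=
  (1 - t) * s i + t * cl ((∑ k, s k) - (m - i))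

lemma coe_int_Ci (k : ℤ) : ((k : ℝ) : Ci) = 0 := (AddCircle.coe_eq_zero_iff 1).2 ⟨k, by simp⟩

lemma coe_one_Ci : ((1 : ℝ) : Ci) = 0 := AddCircle.coe_period 1

lemma flip_dv {m : ℕ} {s : Fin (m + 1) → ℝ} (hs : s ∈ Dl m) (h1 : s (Fin.last m) = 1) :
    ∃ s' ∈ Dl m, dv s' = dv s ∧ (∀ t, dv (mvt t s') = dv (mvt t s)) ∧ ∑ i, s' i = ∑ i, s i - 1 := by
  set s' : Fin (m + 1) → ℝ := Fin.cons 0 (fun i => s i.castSucc) with hs'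
  have hsum : ∑ i, s' i = ∑ i, s i - 1 := by
    rw [Fin.sum_univ_succ, Fin.sum_univ_castSucc, h1]; simp [hs']
  have hS : 1 ≤ ∑ i, s i := by
    rw [← h1]; exact Finset.single_le_sum (fun i _ => (hs.2 i).1) (Finset.mem_univ _)
  have hS2 : ∑ i, s i ≤ m + 1 := by
    refine (Finset.sum_le_sum fun i _ => (hs.2 i).2).trans ?_
    simp
  refine ⟨s', ⟨?_, ?_⟩, ?_, ?_, hsum⟩
  · intro i j hij
    induction i using Fin.cases with
    | zero =>
      induction j using Fin.cases with
      | zero => exact le_rfl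
      | succ j => simpa [hs'] using (hs.2 j.castSucc).1
    | succ i =>
      induction j using Fin.cases with
      | zero => exact absurd hij (by simp)
      | succ j => simpa [hs'] using hs.1 (Fin.castSucc_le_castSucc_iff.2 (Fin.succ_le_succ_iff.1 hij))
  · intro i
    refine Fin.cases ?_ (fun i => ?_) i
    · simp [hs']
    · simpa [hs'] using hs.2 i.castSucc
  · rw [dv, dv, tmn_succ, tmn_last, h1]; simp [hs', coe_one_Ci]
  · intro t
    rw [dv, dv, tmn_succ, tmn_last]
    congr 1
    · have e1 : mvt t s' 0 = 0 := by
        unfold mvt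
        rw [hsum, cl_of_nonpos (by simp; linarith)]; simp [hs']
      have e2 : mvt t s (Fin.last m) = 1 := by
        unfold mvt
        rw [cl_of_one_le (by simp; linarith), h1]; ring
      rw [e1, e2, coe_one_Ci]; simp
    · congr 1
      funext i
      unfold mvt
      rw [hsum]
      congr 3
      · simp; ring

lemma norm_dv {m : ℕ} (k : ℕ) : ∀ s ∈ Dl m, ∑ i, s i ≤ k → 
    ∃ s' ∈ Dl m, dv s' = dv s ∧ (∀ t, dv (mvt t s') = dv (mvt t s)) ∧ ∀ i, s' i < 1 := by
  induction k with
  | zero =>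
    intro s hs h
    refine ⟨s, hs, rfl, fun _ => rfl, fun i => ?_⟩
    have : s i ≤ ∑ i, s i := Finset.single_le_sum (fun i _ => (hs.2 i).1) (Finset.mem_univ _)
    push_cast at h; linarith
  | succ k ih =>
    intro s hs h
    by_cases h1 : s (Fin.last m) = 1
    · obtain ⟨s', a, b, c, d⟩ := flip_dv hs h1
      obtain ⟨s'', a', b', c', d'⟩ := ih s' a (by rw [d]; push_cast at h; linarith)
      exact ⟨s'', a', b'.trans b, fun t => (c' t).trans (c t), d'⟩
    · refine ⟨s, hs, rfl, fun _ => rfl, fun i => ?_⟩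
      exact (hs.1 (Fin.le_last i)).trans_lt (lt_of_le_of_ne (hs.2 _).2 h1)

lemma coe_inj_Ico {a b : ℝ} (ha : 0 ≤ a) (ha1 : a < 1) (hb : 0 ≤ b) (hb1 : b < 1) (h : (a : Ci) = b) : a = b :=
  (AddCircle.coe_eq_coe_iff_of_mem_Ico (p := 1) (a := 0) (by simpa using ⟨ha, ha1⟩) (by simpa using ⟨hb, hb1⟩)).1 h

lemma dv_inj {m : ℕ} {s s' : Fin (m + 1) → ℝ} (hs : s ∈ Dl m) (hs' : s' ∈ Dl m) (h1 : ∀ i, s i < 1)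
    (h1' : ∀ i, s' i < 1) (h : dv s = dv s') : s = s' := by
  obtain ⟨e, he⟩ := tmn_eq h
  have h2 : s ∘ e = s' := by
    funext i
    exact coe_inj_Ico (hs.2 _).1 (h1 _) (hs'.2 _).1 (h1' _) (congrFun he i)
  have := @Tuple.unique_monotone _ _ _ s e (Equiv.refl _) (by rw [h2]; exact hs'.1) (by simpa using hs.1)
  rw [← h2, this]; rfl

lemma mv_wd {m : ℕ} {s s' : Fin (m + 1) → ℝ} (hs : s ∈ Dl m) (hs' : s' ∈ Dl m) (h : dv s = dv s') (t : ℝ) :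
    dv (mvt t s) = dv (mvt t s') := by
  obtain ⟨k, hk⟩ := exists_nat_ge (∑ i, s i)
  obtain ⟨k', hk'⟩ := exists_nat_ge (∑ i, s' i)
  obtain ⟨u, a, b, c, d⟩ := norm_dv k s hs hk
  obtain ⟨u', a', b', c', d'⟩ := norm_dv k' s' hs' hk'
  rw [← c, ← c', dv_inj a a' d d' (by rw [b, b', h])]

lemma mv_end (m : ℕ) : ∀ x : ℝ, 0 ≤ x → x ≤ m + 1 →
    tmn (m + 1) (fun i => ((cl (x - (m - (i : Fin (m+1)))) : ℝ) : Ci)) = {(x : Ci)} + m • {0} := by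
  induction m with
  | zero =>
    intro x h0 h1
    rw [tmn_succ]
    have : cl x = x := cl_of_mem h0 (by simpa using h1)
    simp [tmn, this]
  | succ m ih =>
    intro x h0 h1
    rw [tmn_succ]
    push_cast at h1
    by_cases hx : x ≤ m + 1
    · have := ih x h0 hx
      rw [succ_nsmul, ← add_assoc, ← this, add_comm]
      congr 1
      · congr 1; funext i; congr 2; push_cast [Fin.val_succ]; ring
      · rw [cl_of_nonpos (by simp; linarith)]; simp
    · push Not at hx
      congr 1
      · rw [cl_of_mem (by simp; linarith) (by simp; linarith)]
        congr 1
        have e : (x - (((m + 1 : ℕ) : ℝ) - ((0 : Fin (m + 1 + 1)) : ℕ)) : ℝ) = x + (((-(m + 1) : ℤ)) : ℝ) := by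
          push_cast; simp; ring
        rw [e, AddCircle.coe_add, coe_int_Ci, add_zero]
      · have : (fun i : Fin (m + 1) => ((cl (x - ((m + 1 : ℕ) - (i.succ : Fin (m + 2)))) : ℝ) : Ci)) = fun _ => 0 := by
          funext i
          rw [cl_of_one_le ?_, coe_one_Ci]
          push_cast [Fin.val_succ]
          have : (0:ℝ) ≤ (i : ℕ) := by positivity
          linarith
        rw [this]; simp [tmn, Multiset.nsmul_singleton]

lemma mv_count {m : ℕ} {s : Fin (m + 1) → ℝ} (hs : s ∈ Dl m) {t : ℝ}  :
    cnt {0} (dv s) ≤ cnt {0} (dv (mvt t s)) := by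
  rw [dv, dv, cnt_tmn, cnt_tmn]
  refine Nat.card_le_card_of_injective (fun i : {i // (s i : Ci) ∈ ({0} : Set Ci)} => ⟨i.1, ?_⟩) ?_
  · obtain ⟨i, hi⟩ := i
    simp only [Set.mem_singleton_iff] at hi ⊢
    by_cases h1 : s i < 1
    · have h0 : s i = 0 := coe_inj_Ico (hs.2 i).1 h1 le_rfl zero_lt_one (by simpa using hi)
      have : ∑ k, s k ≤ m - i := by
        calc ∑ k, s k ≤ ∑ k, if i < k then (1:ℝ) else 0 := by
              refine Finset.sum_le_sum fun k _ => ?_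
              split_ifs with h
              · exact (hs.2 k).2
              · rw [← h0]; exact hs.1 (not_lt.1 h)
          _ = m - i := by
              rw [Finset.sum_ite, Finset.sum_const_zero, add_zero, Finset.sum_const, nsmul_one,
                Finset.filter_lt_eq_Ioi, Fin.card_Ioi]
              have := i.2
              rw [show m + 1 - 1 - (i:ℕ) = m - i by omega, Nat.cast_sub (by omega)]
      unfold mvt
      rw [h0, cl_of_nonpos (by linarith)]; simp
    · have h1 : s i = 1 := le_antisymm (hs.2 i).2 (not_lt.1 h1)
      have : m + 1 - i ≤ ∑ k, s k := by
        calc (m + 1 - i : ℝ) = ∑ k, if i ≤ k then (1:ℝ) else 0 := by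
              rw [Finset.sum_ite, Finset.sum_const_zero, add_zero, Finset.sum_const, nsmul_one,
                Finset.filter_le_eq_Ici, Fin.card_Ici]
              have := i.2
              rw [Nat.cast_sub (by omega)]; push_cast; ring
          _ ≤ ∑ k, s k := by
              refine Finset.sum_le_sum fun k _ => ?_
              split_ifs with h
              · rw [← h1]; exact hs.1 h
              · exact (hs.2 k).1
      unfold mvt
      rw [h1, cl_of_one_le (by linarith), ← coe_one_Ci]; congr 1; ring
  · rintro ⟨i, hi⟩ ⟨j, hj⟩ h
    simpa using h

lemma dv_surj {m : ℕ} {D : Multiset Ci} (h : Multiset.card D = m + 1) : ∃ s ∈ Dl m, dv s = D := by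
  obtain ⟨f, rfl⟩ := tmn_surj' D h
  have h1 : ∀ i, ∃ x : ℝ, 0 ≤ x ∧ x ≤ 1 ∧ (x : Ci) = f i := by
    intro i
    have := (AddCircle.equivIco (1:ℝ) 0 (f i)).2
    exact ⟨(AddCircle.equivIco (1:ℝ) 0 (f i)).1, this.1, by simpa using this.2.le,
      (AddCircle.equivIco (1:ℝ) 0).symm_apply_apply (f i)⟩
  choose x x0 x1 hx using h1
  refine ⟨x ∘ Tuple.sort x, ⟨Tuple.monotone_sort x, fun i => ⟨x0 _, x1 _⟩⟩, ?_⟩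
  have : (fun i => ((x ∘ Tuple.sort x) i : Ci)) = f ∘ Tuple.sort x := by
    funext i; exact hx _
  rw [dv, this, tmn_perm]

/-- divisors on the circle can be concentrated at one point -/
theorem circleHom (m : ℕ) : HomC (0 : Ci) (fun D : {D : Multiset Ci // Multiset.card D = m + 1} => cnt {0} D.1)
    (fun D => D.1) (fun D => {D.1.sum} + m • {0}) := by
  have : CompactSpace (Dl m) := isCompact_iff_compactSpace.1 (isCompact_Dl m)
  set q : Dl m → {D : Multiset Ci // Multiset.card D = m + 1} := fun s => ⟨dv s.1, card_tmn _⟩ with hq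
  have cdv : Continuous (dv (m := m)) := by
    unfold dv
    refine (continuous_tmn _).comp (continuous_pi fun i => ?_)
    exact (AddCircle.continuous_mk' 1).comp (continuous_apply i)
  have qc : Continuous q := Continuous.subtype_mk (cdv.comp continuous_subtype_val) _
  have qs : Function.Surjective q := by
    rintro ⟨D, hD⟩
    obtain ⟨s, hs, rfl⟩ := dv_surj hD
    exact ⟨⟨s, hs⟩, rfl⟩
  have hp : IsProperMap q := qc.isProperMap
  have hp2 : Topology.IsQuotientMap (Prod.map q (id : ℝ → ℝ)) := by
    have := hp.prodMap (isProperMap_id (X := ℝ))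
    exact this.isClosedMap.isQuotientMap this.continuous (qs.prodMap Function.surjective_id)
  choose r hr using qs
  have hH : ∀ (s : Dl m) t, dv (mvt t (r (q s)).1) = dv (mvt t s.1) := by
    intro s t
    exact mv_wd (r (q s)).2 s.2 (congrArg Subtype.val (hr (q s))) t
  have hrD : ∀ D, dv (r D).1 = D.1 := fun D => congrArg Subtype.val (hr D)
  refine ⟨fun D t => dv (mvt t (r D).1), ?_, ?_, ?_, ?_⟩
  · rw [hp2.continuous_iff]
    have : ((fun p : {D : Multiset Ci // Multiset.card D = m + 1} × ℝ => dv (mvt p.2 (r p.1).1)) ∘ Prod.map q id) =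
        fun p : Dl m × ℝ => dv (mvt p.2 p.1.1) := by
      funext p; exact hH p.1 p.2
    rw [this]
    refine cdv.comp (continuous_pi fun i => ?_)
    have hap : ∀ k, Continuous fun p : Dl m × ℝ => p.1.1 k := fun k =>
      (continuous_apply k).comp (continuous_subtype_val.comp continuous_fst)
    unfold mvt
    have hsm : Continuous fun p : Dl m × ℝ => ∑ k, p.1.1 k := continuous_finsetSum _ fun k _ => hap k
    exact ((continuous_const.sub continuous_snd).mul (hap i)).add
      (continuous_snd.mul (continuous_cl.comp (hsm.sub continuous_const)))
  · intro D
    simp only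
    rw [← hrD D]; congr 1; funext i; simp [mvt]
  · intro D
    simp only
    set s := (r D).1 with hs
    have h0 : 0 ≤ ∑ i, s i := Finset.sum_nonneg fun i _ => ((r D).2.2 i).1
    have h1 : ∑ i, s i ≤ m + 1 := by
      refine (Finset.sum_le_sum fun i _ => ((r D).2.2 i).2).trans ?_
      simp
    have := mv_end m _ h0 h1
    rw [← hrD D]
    have e : (dv s).sum = ((∑ i, s i : ℝ) : Ci) := by
      unfold dv tmn
      have h := map_sum (QuotientAddGroup.mk' (AddSubgroup.zmultiples (1:ℝ))) s Finset.univ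
      exact h.symm
    rw [← hs, e, ← this]
    unfold dv
    congr 1; funext i; simp [mvt]
  · intro D t _ _
    simp only
    conv_lhs => rw [← hrD D]
    exact mv_count (r D).2

end SPcat
end

open scoped unitInterval Topology
open MeasureTheory
noncomputable section
namespace SPcat

/-! ## Lifting functions to the surface -/

def rp (g : ℕ) (y : MG g) : ℝ × ℝ := by
  classical
  exact if h : ∃ p : ℝ × ℝ, 0 ≤ p.1 ∧ p.1 ≤ 1 ∧ 0 ≤ p.2 ∧ p.2 ≤ 4 * (g:ℝ) ∧ pol g p.1 p.2 = y then h.choose else 0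

lemma rp_spec {g : ℕ} (hg : 0 < g) (y : MG g) : 0 ≤ (rp g y).1 ∧ (rp g y).1 ≤ 1 ∧ 0 ≤ (rp g y).2 ∧
    (rp g y).2 ≤ 4 * (g:ℝ) ∧ pol g (rp g y).1 (rp g y).2 = y := by
  have h : ∃ p : ℝ × ℝ, 0 ≤ p.1 ∧ p.1 ≤ 1 ∧ 0 ≤ p.2 ∧ p.2 ≤ 4 * (g:ℝ) ∧ pol g p.1 p.2 = y := by
    obtain ⟨r, θ, a, b, c, d, e⟩ := pol_surj hg y
    exact ⟨(r, θ), a, b, c, d.le, e⟩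
  unfold rp
  rw [dif_pos h]
  exact h.choose_spec

/-- the function on the surface given by a function in polar coordinates -/
def lft {Z : Type*} (g : ℕ) (f : ℝ → ℝ → Z) (y : MG g) : Z := f (rp g y).1 (rp g y).2

lemma lft_pol {Z : Type*} {g : ℕ} (hg : 0 < g) {f : ℝ → ℝ → Z} (hf : Compat g f) {r θ : ℝ} (r0 : 0 ≤ r)
    (r1 : r ≤ 1) (θ0 : 0 ≤ θ) (θ1 : θ ≤ 4 * (g:ℝ)) : lft g f (pol g r θ) = f r θ := by
  obtain ⟨F, hF⟩ := exists_lift hg hf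
  obtain ⟨a, b, c, d, e⟩ := rp_spec hg (pol g r θ)
  rw [lft, ← hF _ _ a b c d, e, hF _ _ r0 r1 θ0 θ1]

lemma continuous_lft {Z : Type*} [TopologicalSpace Z] {g : ℕ} (hg : 0 < g) {f : ℝ → ℝ → Z} (hf : Compat g f)
    (hc : Continuous fun p : ℝ × ℝ => f p.1 p.2) : Continuous (lft g f) := by
  obtain ⟨F, hFc, hF⟩ := exists_clift hg hf hc
  have : lft g f = F := by
    funext y
    obtain ⟨a, b, c, d, e⟩ := rp_spec hg y
    rw [lft, ← hF _ _ a b c d, e]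
  rw [this]; exact hFc

lemma continuous_lft2 {Z : Type*} [TopologicalSpace Z] {g : ℕ} (hg : 0 < g) {f : ℝ → ℝ → ℝ → Z} (hf : Compat g f)
    (hc : Continuous fun p : (ℝ × ℝ) × ℝ => f p.1.1 p.1.2 p.2) :
    Continuous fun p : MG g × ℝ => lft g f p.1 p.2 := by
  refine continuous_of_pol2 hg ?_
  have : (fun q : PK g × ℝ => lft g f (pol g q.1.1 q.1.2) q.2) = fun q : PK g × ℝ => f q.1.1 q.1.2 q.2 := by
    funext q; rw [lft_pol hg hf q.1.1.2.1 q.1.1.2.2 q.1.2.2.1 q.1.2.2.2]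
  simp only
  rw [this]
  exact hc.comp (by fun_prop : Continuous fun q : PK g × ℝ => (((q.1.1:ℝ), (q.1.2:ℝ)), q.2))

/-- functions of the radius and of a trapezoid -/
def tl {Z : Type*} (g k ς : ℕ) (ψ : ℝ → ℝ → Z) : MG g → Z := lft g fun r θ => ψ r (tz (4 * (k:ℝ) + (ς:ℝ)) θ)

lemma compat_tl {Z : Type*} {g k ς : ℕ} (hk : k < g) (hς : ς < 2) {ψ : ℝ → ℝ → Z}
    (h0 : ∀ x, ψ 0 x = ψ 0 0) (h1 : ψ 1 0 = ψ 1 1) : Compat g fun r θ => ψ r (tz (4 * (k:ℝ) + (ς:ℝ)) θ) := by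
  have kg : (k:ℝ) + 1 ≤ g := by exact_mod_cast hk
  have q0 : (0:ℝ) ≤ ς := by positivity
  have q1 : (ς:ℝ) ≤ 1 := by exact_mod_cast Nat.lt_succ_iff.1 hς
  have k0 : (0:ℝ) ≤ k := by positivity
  refine ⟨fun θ _ _ => by rw [h0, ← h0 (tz _ 0)], fun r _ _ => by rw [tz_right (by linarith), tz_left (by linarith)], ?_⟩
  intro j hj ρ hρ t t0 t1
  rcases tz_glue (k := k) (j := j) hρ hς t0 t1 with h | ⟨-, ⟨h, h'⟩ | ⟨h, h'⟩⟩
  · rw [h]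
  · rw [h, h', h1]
  · rw [h, h', h1]

lemma tl_pol {Z : Type*} {g k ς : ℕ} (hk : k < g) (hς : ς < 2) {ψ : ℝ → ℝ → Z}
    (h0 : ∀ x, ψ 0 x = ψ 0 0) (h1 : ψ 1 0 = ψ 1 1) {r θ : ℝ} (r0 : 0 ≤ r)
    (r1 : r ≤ 1) (θ0 : 0 ≤ θ) (θ1 : θ ≤ 4 * (g:ℝ)) :
    tl g k ς ψ (pol g r θ) = ψ r (tz (4 * (k:ℝ) + (ς:ℝ)) θ) :=
  lft_pol (by omega) (compat_tl hk hς h0 h1) r0 r1 θ0 θ1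

lemma continuous_tl {Z : Type*} [TopologicalSpace Z] {g k ς : ℕ} (hk : k < g) (hς : ς < 2) {ψ : ℝ → ℝ → Z}
    (h0 : ∀ x, ψ 0 x = ψ 0 0) (h1 : ψ 1 0 = ψ 1 1) (hc : Continuous fun p : ℝ × ℝ => ψ p.1 p.2) :
    Continuous (tl g k ς ψ) := by
  refine continuous_lft (by omega) (compat_tl hk hς h0 h1) ?_
  exact hc.comp (by fun_prop : Continuous fun p : ℝ × ℝ => (p.1, tz (4 * (k:ℝ) + (ς:ℝ)) p.2))

/-- flattening -/
def Phi (y : ℝ) : ℝ := cl ((100 * y - 1) / 98)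
lemma continuous_Phi : Continuous Phi := by unfold Phi; fun_prop
lemma Phi_zero : Phi 0 = 0 := cl_of_nonpos (by norm_num)
lemma Phi_one : Phi 1 = 1 := cl_of_one_le (by norm_num)

def psN (r x : ℝ) : ℝ := min (r * x) (1 - r * x)
def psF (r x : ℝ) : Ci := (Phi (r * x) : ℝ)
def psA (r x : ℝ) : Ci := (cl (200 * r) * x : ℝ)
def psE (r x : ℝ) : ℝ := cl (200 * r) * x - Phi (r * x)

def Nn (g k ς : ℕ) : MG g → ℝ := tl g k ς psN
def Fc (g k ς : ℕ) : MG g → Ci := tl g k ς psF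
def Ac (g k ς : ℕ) : MG g → Ci := tl g k ς psA
def Ec (g k ς : ℕ) : MG g → ℝ := tl g k ς psE

section
variable {g k ς : ℕ}

lemma psN0 (x : ℝ) : psN 0 x = psN 0 0 := by simp [psN]
lemma psF0 (x : ℝ) : psF 0 x = psF 0 0 := by simp [psF]
lemma psA0 (x : ℝ) : psA 0 x = psA 0 0 := by simp [psA]
lemma psE0 (x : ℝ) : psE 0 x = psE 0 0 := by simp [psE]
lemma psN1 : psN 1 0 = psN 1 1 := by simp [psN]
lemma psF1 : psF 1 0 = psF 1 1 := by simp [psF, Phi_zero, Phi_one, coe_one_Ci]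
lemma psA1 : psA 1 0 = psA 1 1 := by simp [psA, cl_of_one_le, coe_one_Ci]
lemma psE1 : psE 1 0 = psE 1 1 := by simp [psE, cl_of_one_le, Phi_zero, Phi_one]

lemma continuous_Nn (hk : k < g) (hς : ς < 2) : Continuous (Nn g k ς) := continuous_tl hk hς psN0 psN1 (by unfold psN; fun_prop)
lemma continuous_Fc (hk : k < g) (hς : ς < 2) : Continuous (Fc g k ς) := continuous_tl hk hς psF0 psF1 (by
  have := continuous_Phi
  exact (AddCircle.continuous_mk' 1).comp (by fun_prop : Continuous fun p : ℝ × ℝ => Phi (p.1 * p.2)))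
lemma continuous_Ac (hk : k < g) (hς : ς < 2) : Continuous (Ac g k ς) := continuous_tl hk hς psA0 psA1 (by
  exact (AddCircle.continuous_mk' 1).comp (by fun_prop : Continuous fun p : ℝ × ℝ => cl (200 * p.1) * p.2))
lemma continuous_Ec (hk : k < g) (hς : ς < 2) : Continuous (Ec g k ς) := continuous_tl hk hς psE0 psE1 (by
  have := continuous_Phi
  unfold psE; fun_prop)

variable {r θ : ℝ}

lemma Nn_pol (hk : k < g) (hς : ς < 2) (r0 : 0 ≤ r) (r1 : r ≤ 1) (θ0 : 0 ≤ θ) (θ1 : θ ≤ 4 * (g:ℝ)) :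
     Nn g k ς (pol g r θ) = psN r (tz (4 * (k:ℝ) + (ς:ℝ)) θ) := tl_pol hk hς psN0 psN1 r0 r1 θ0 θ1
lemma Fc_pol (hk : k < g) (hς : ς < 2) (r0 : 0 ≤ r) (r1 : r ≤ 1) (θ0 : 0 ≤ θ) (θ1 : θ ≤ 4 * (g:ℝ)) :
     Fc g k ς (pol g r θ) = psF r (tz (4 * (k:ℝ) + (ς:ℝ)) θ) := tl_pol hk hς psF0 psF1 r0 r1 θ0 θ1
lemma Ac_pol (hk : k < g) (hς : ς < 2) (r0 : 0 ≤ r) (r1 : r ≤ 1) (θ0 : 0 ≤ θ) (θ1 : θ ≤ 4 * (g:ℝ)) :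
     Ac g k ς (pol g r θ) = psA r (tz (4 * (k:ℝ) + (ς:ℝ)) θ) := tl_pol hk hς psA0 psA1 r0 r1 θ0 θ1
lemma Ec_pol (hk : k < g) (hς : ς < 2) (r0 : 0 ≤ r) (r1 : r ≤ 1) (θ0 : 0 ≤ θ) (θ1 : θ ≤ 4 * (g:ℝ)) :
     Ec g k ς (pol g r θ) = psE r (tz (4 * (k:ℝ) + (ς:ℝ)) θ) := tl_pol hk hς psE0 psE1 r0 r1 θ0 θ1
end

lemma Ac_eq {g k ς : ℕ} (hk : k < g) (hς : ς < 2) (y : MG g) : Ac g k ς y = Fc g k ς y + (Ec g k ς y : ℝ) := by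
  obtain ⟨r, θ, r0, r1, θ0, θ1, rfl⟩ := pol_surj (by omega) y
  rw [Ac_pol hk hς r0 r1 θ0 θ1.le, Fc_pol hk hς r0 r1 θ0 θ1.le, Ec_pol hk hς r0 r1 θ0 θ1.le, psA, psF, psE,
    ← AddCircle.coe_add]
  congr 1; ring

/-- pushing to the boundary -/
def fE (g : ℕ) (r θ t : ℝ) : MG g := pol g ((1 - t) * r + t * cl (200 * r)) θ
def Em (g : ℕ) (y : MG g) (t : ℝ) : MG g := lft g (fE g) y t

lemma compat_fE {g : ℕ} (hg : 0 < g) : Compat g (fE g) := by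
  refine ⟨?_, ?_, ?_⟩
  · intro θ _ _; funext t; simp only [fE, mul_zero, cl_zero, add_zero]; exact pol_zero _ _ _
  · intro r _ _; funext t; simp only [fE]; exact pol_per hg _
  · intro j hj ρ hρ t t0 t1; funext u
    have : (1 - u) * 1 + u * cl (200 * 1) = 1 := by rw [cl_of_one_le (by norm_num)]; ring
    simp only [fE, this]
    exact pol_glue hj hρ t0 t1

lemma continuous_Em {g : ℕ} (hg : 0 < g) : Continuous fun p : MG g × ℝ => Em g p.1 p.2 := by
  refine continuous_lft2 hg (compat_fE hg) ?_
  exact (continuous_pol g).comp (by fun_prop : Continuous fun p : (ℝ × ℝ) × ℝ =>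
    ((1 - p.2) * p.1.1 + p.2 * cl (200 * p.1.1), p.1.2))

lemma Em_zero {g : ℕ} (hg : 0 < g) (y : MG g) : Em g y 0 = y := by
  obtain ⟨r, θ, r0, r1, θ0, θ1, rfl⟩ := pol_surj hg y
  rw [Em, lft_pol hg (compat_fE hg) r0 r1 θ0 θ1.le, fE]; simp

lemma Em_one {g : ℕ} (hg : 0 < g) {r θ : ℝ} (r0 : 0 ≤ r) (r1 : r ≤ 1) (θ0 : 0 ≤ θ) (θ1 : θ ≤ 4 * (g:ℝ)) :
    Em g (pol g r θ) 1 = pol g (cl (200 * r)) θ := by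
  rw [Em, lft_pol hg (compat_fE hg) r0 r1 θ0 θ1, fE]; simp

/-- loops -/
def lpc {M : Type*} (γ : ℝ → M) : Ci → M := AddCircle.liftIco 1 0 γ

lemma continuous_lpc {M : Type*} [TopologicalSpace M] {γ : ℝ → M} (hc : Continuous γ) (h : γ 0 = γ 1) :
    Continuous (lpc γ) := AddCircle.liftIco_zero_continuous h hc.continuousOn

lemma lpc_coe {M : Type*} {γ : ℝ → M} (h : γ 0 = γ 1) {u : ℝ} (u0 : 0 ≤ u) (u1 : u ≤ 1) : lpc γ (u : Ci) = γ u := by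
  rcases u1.lt_or_eq with h' | rfl
  · exact AddCircle.liftIco_zero_coe_apply ⟨u0, h'⟩
  · rw [coe_one_Ci, ← h]
    have := AddCircle.liftIco_zero_coe_apply (p := (1:ℝ)) (f := γ) (x := 0) ⟨le_rfl, zero_lt_one⟩
    simpa [lpc] using this

lemma lpc_zero {M : Type*} {γ : ℝ → M} (h : γ 0 = γ 1) : lpc γ 0 = γ 0 := by
  have := lpc_coe h le_rfl zero_le_one
  simpa using this

/-! ## Multiset lemmas -/

lemma ms_split {Y C Z : Type*} (D : Multiset Y) (E : Y → Z) (v : Z) (A0 A1 : Y → C) (a b : C → Z)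
    (h : ∀ y ∈ D, ({E y} : Multiset Z) + {v} = {a (A0 y)} + {b (A1 y)}) :
    D.map E + Multiset.card D • {v} = (D.map A0).map a + (D.map A1).map b := by
  induction D using Multiset.induction_on with
  | empty => simp
  | cons y D ih =>
    have h1 := h y (Multiset.mem_cons_self y D)
    have h2 := ih fun z hz => h z (Multiset.mem_cons_of_mem hz)
    rw [← Multiset.singleton_add]
    simp only [Multiset.map_add, Multiset.map_singleton, Multiset.card_add, Multiset.card_singleton, add_comm 1, succ_nsmul]
    calc {E y} + D.map E + (Multiset.card D • {v} + {v}) = ({E y} + {v}) + (D.map E + Multiset.card D • {v}) := by abel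
      _ = _ := by rw [h1, h2]; abel

lemma cnt_split {Y C : Type*} (D : Multiset Y) (o : C) (A0 A1 : Y → C) (h : ∀ y ∈ D, A0 y = o ∨ A1 y = o) :
    Multiset.card D ≤ cnt {o} (D.map A0) + cnt {o} (D.map A1) := by
  induction D using Multiset.induction_on with
  | empty => simp
  | cons y D ih =>
    have h1 := h y (Multiset.mem_cons_self y D)
    have h2 := ih fun z hz => h z (Multiset.mem_cons_of_mem hz)
    rw [← Multiset.singleton_add]
    simp only [Multiset.map_add, Multiset.map_singleton, Multiset.card_add, Multiset.card_singleton, cnt_add]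
    have h3 : 1 ≤ cnt {o} {A0 y} + cnt {o} {A1 y} := by
      have hh : ∀ c : C, c = o → 0 < cnt {o} ({c} : Multiset C) := fun c hc => cnt_pos.2 ⟨c, by simp, hc⟩
      rcases h1 with h1 | h1
      · have := hh _ h1; omega
      · have := hh _ h1; omega
    omega

/-! ## Contracting loops along lifts -/

section
variable {X M : Type*} [TopologicalSpace X] [TopologicalSpace M]

lemma contract1 {v : M} {α : Ci → M} (hα : Continuous α) (h0 : α 0 = v) {z : X → Ci} {L : X → ℝ}
    (hL : Continuous L) (hz : ∀ x, (L x : Ci) = z x) :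
    HomC v (fun _ => 0) (fun x => {α (z x)}) (fun _ => {v}) := by
  refine ⟨fun x t => {α (((1 - t) * L x : ℝ) : Ci)}, ?_, ?_, ?_, fun _ _ _ _ => Nat.zero_le _⟩
  · refine continuous_single.comp (hα.comp ((AddCircle.continuous_mk' 1).comp ?_))
    fun_prop
  · intro x; simp [hz]
  · intro x; simp [h0]

lemma contract2 {v : M} {α β : Ci → M} (hα : Continuous α) (hβ : Continuous β) (h0 : α 0 = v) (h0' : β 0 = v)
    {z z' : X → Ci} {L L' : X → ℝ} (hL : Continuous L) (hL' : Continuous L') (hz : ∀ x, (L x : Ci) = z x)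
    (hz' : ∀ x, (L' x : Ci) = z' x) (hz'c : Continuous z') (hone : ∀ x, z' x = 0 ∨ L x = 1) :
    HomC v (fun _ => 1) (fun x => {α (z x)} + {β (z' x)}) (fun _ => {v} + {v}) := by
  have c1 : ∀ y : M, y = v → 1 ≤ cnt {v} ({y} : Multiset M) := fun c hc => cnt_pos.2 ⟨c, by simp, hc⟩
  refine HomC.trans (f1 := fun x => {v} + {β (z' x)}) ?_ ?_
  · refine ⟨fun x t => {α (((1 - t) * L x + t : ℝ) : Ci)} + {β (z' x)}, ?_, ?_, ?_, ?_⟩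
    · refine Continuous.add (continuous_single.comp (hα.comp ((AddCircle.continuous_mk' 1).comp ?_)))
        (continuous_single.comp (hβ.comp (hz'c.comp continuous_fst)))
      fun_prop
    · intro x; simp [hz]
    · intro x; simp [h0, coe_one_Ci]
    · intro x t _ _
      rw [cnt_add]
      change 1 ≤ _ + _
      rcases hone x with h | h
      · have := c1 (β (z' x)) (by rw [h, h0']); omega
      · have : ((1 - t) * L x + t : ℝ) = 1 := by rw [h]; ring
        rw [this]
        have := c1 (α ((1 : ℝ) : Ci)) (by rw [coe_one_Ci, h0]); omega
  · have h := (contract1 hβ h0' hL' hz').add_const (E := fun _ => ({v} : Multiset M)) continuous_const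
    refine (h.mono (fun x => ?_)).congr (fun x => add_comm _ _) (fun x => add_comm _ _)
    have := c1 v rfl
    change 1 ≤ 0 + _
    omega

lemma exists_lift_Ci {z : X → Ci} (hz : Continuous z) (a : ℝ) (h : ∀ x, z x ≠ (a : Ci)) :
    ∃ L : X → ℝ, Continuous L ∧ (∀ x, (L x : Ci) = z x) ∧ ∀ x, a ≤ L x ∧ L x < a + 1 := by
  refine ⟨fun x => (AddCircle.equivIco 1 a (z x)).1, ?_, ?_, ?_⟩
  · rw [continuous_iff_continuousAt]
    intro x
    exact continuous_subtype_val.continuousAt.comp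
      ((AddCircle.continuousAt_equivIco 1 a (h x)).comp hz.continuousAt)
  · intro x; exact (AddCircle.equivIco 1 a).symm_apply_apply (z x)
  · intro x; exact (AddCircle.equivIco 1 a (z x)).2

end

end SPcat
end

open scoped unitInterval Topology
open MeasureTheory
noncomputable section
namespace SPcat

/-- the two loops of a handle -/
def lpa (g k ς : ℕ) : Ci → MG g := lpc fun u => pol g 1 (4 * (k:ℝ) + (ς:ℝ) + u)

lemma lpa_aux {g : ℕ} (hg : 0 < g) (k ς : ℕ) : (fun u : ℝ => pol g 1 (4 * (k:ℝ) + (ς:ℝ) + u)) 0 =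
    (fun u : ℝ => pol g 1 (4 * (k:ℝ) + (ς:ℝ) + u)) 1 := by
  have h1 := pol_int hg (4 * k + ς)
  have h2 := pol_int hg (4 * k + ς + 1)
  push_cast at h1 h2
  simp only [add_zero]
  rw [h1, h2]

lemma continuous_lpa {g : ℕ} (hg : 0 < g) (k ς : ℕ) : Continuous (lpa g k ς) := by
  refine continuous_lpc ?_ (lpa_aux hg k ς)
  exact (continuous_pol g).comp (by fun_prop : Continuous fun u : ℝ => ((1:ℝ), 4 * (k:ℝ) + (ς:ℝ) + u))

lemma lpa_coe {g : ℕ} (hg : 0 < g) (k ς : ℕ) {u : ℝ} (u0 : 0 ≤ u) (u1 : u ≤ 1) :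
    lpa g k ς (u : Ci) = pol g 1 (4 * (k:ℝ) + (ς:ℝ) + u) := lpc_coe (lpa_aux hg k ς) u0 u1

lemma lpa_zero {g : ℕ} (hg : 0 < g) (k ς : ℕ) : lpa g k ς 0 = vx g := by
  have h1 := pol_int hg (4 * k + ς)
  push_cast at h1
  rw [lpa, lpc_zero (lpa_aux hg k ς)]
  simp only [add_zero]
  rw [h1]

lemma P_spec {g k : ℕ} (hk : k < g) {y : MG g} (hy : 1 / 200 < Nn g k 0 y ∨ 1 / 200 < Nn g k 1 y) :
    (({Em g y 1} : Multiset (MG g)) + {vx g} = {lpa g k 0 (Ac g k 0 y)} + {lpa g k 1 (Ac g k 1 y)}) ∧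
    (Ac g k 0 y = 0 ∨ Ac g k 1 y = 0) ∧
    (Ac g k 1 y = 0 ∨ Fc g k 0 y = 0 ∨ ∃ u : ℝ, 0 ≤ u ∧ u ≤ 1 ∧ Fc g k 0 y = u ∧ Ec g k 0 y = 1 - u) ∧
    (Ac g k 0 y = 0 ∨ Fc g k 1 y = 0 ∨ ∃ u : ℝ, 0 ≤ u ∧ u ≤ 1 ∧ Fc g k 1 y = u ∧ Ec g k 1 y = 1 - u) := by
  have hg : 0 < g := by omega
  have kg : (k:ℝ) + 1 ≤ g := by exact_mod_cast hk
  have k0 : (0:ℝ) ≤ k := by positivity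
  obtain ⟨r, θ, r0, r1, θ0, θ1, rfl⟩ := pol_surj hg y
  have h02 : (0:ℕ) < 2 := by norm_num
  have h12 : (1:ℕ) < 2 := by norm_num
  rw [Nn_pol hk h02 r0 r1 θ0 θ1.le, Nn_pol hk h12 r0 r1 θ0 θ1.le] at hy
  rw [Ac_pol hk h02 r0 r1 θ0 θ1.le, Ac_pol hk h12 r0 r1 θ0 θ1.le, Fc_pol hk h02 r0 r1 θ0 θ1.le,
    Fc_pol hk h12 r0 r1 θ0 θ1.le, Ec_pol hk h02 r0 r1 θ0 θ1.le, Ec_pol hk h12 r0 r1 θ0 θ1.le,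
    Em_one hg r0 r1 θ0 θ1.le]
  have key : ∀ c : ℝ, 1 / 200 < psN r (tz c θ) → 1 / 200 < r ∧ c < θ ∧ θ < c + 3 := by
    intro c hc
    have h1 : 1 / 200 < r * tz c θ := lt_of_lt_of_le hc (min_le_left _ _)
    have := tz_le_one c θ
    have := tz_nonneg c θ
    refine ⟨by nlinarith, ?_, ?_⟩
    · by_contra h; rw [tz_left (by linarith)] at h1; norm_num at h1
    · by_contra h; rw [tz_right (by linarith)] at h1; norm_num at h1
  have hr : 1 / 200 < r ∧ 4 * (k:ℝ) < θ ∧ θ < 4 * (k:ℝ) + 4 := by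
    rcases hy with hy | hy <;> obtain ⟨a, b, c⟩ := key _ hy <;> push_cast at b c <;>
      exact ⟨a, by linarith, by linarith⟩
  obtain ⟨hr, hθ, hθ'⟩ := hr
  have hcl : cl (200 * r) = 1 := cl_of_one_le (by linarith)
  have A1 : psA r 1 = 0 := by simp [psA, hcl, coe_one_Ci]
  have A0 : psA r 0 = 0 := by simp [psA]
  have F0 : psF r 0 = 0 := by simp [psF, Phi_zero]
  have E1 : ∃ u : ℝ, 0 ≤ u ∧ u ≤ 1 ∧ psF r 1 = u ∧ psE r 1 = 1 - u :=
    ⟨Phi (r * 1), cl_nonneg _, cl_le_one _, rfl, by rw [psE, hcl]; ring⟩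
  have AA : ∀ x, psA r x = (x : ℝ) := fun x => by rw [psA, hcl, one_mul]
  rw [hcl]
  push_cast
  rcases le_total θ (4 * (k:ℝ) + 1) with h1 | h1
  · have t0 : tz (4 * (k:ℝ) + 0) θ = θ - 4 * k := by
      rw [tz_up (by linarith) (by linarith)]; ring
    have t1 : tz (4 * (k:ℝ) + 1) θ = 0 := tz_left (by linarith)
    rw [t0, t1, A0]
    refine ⟨?_, Or.inr rfl, Or.inl rfl, Or.inr (Or.inl F0)⟩
    rw [AA, lpa_coe hg _ _ (by linarith) (by linarith), lpa_zero hg]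
    congr 3; push_cast; ring
  rcases le_total θ (4 * (k:ℝ) + 2) with h2 | h2
  · have t0 : tz (4 * (k:ℝ) + 0) θ = 1 := by
      rw [tz_mid (by linarith) (by linarith)]
    have t1 : tz (4 * (k:ℝ) + 1) θ = θ - 4 * k - 1 := by
      rw [tz_up (by linarith) (by linarith)]; ring
    rw [t0, t1, A1]
    refine ⟨?_, Or.inl rfl, Or.inr (Or.inr E1), Or.inl rfl⟩
    rw [AA, lpa_coe hg _ _ (by linarith) (by linarith), lpa_zero hg, add_comm]
    congr 3; push_cast; ring
  rcases le_total θ (4 * (k:ℝ) + 3) with h3 | h3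
  · have t0 : tz (4 * (k:ℝ) + 0) θ = 4 * k + 3 - θ := by
      rw [tz_down (by linarith) (by linarith)]; ring
    have t1 : tz (4 * (k:ℝ) + 1) θ = 1 := by
      rw [tz_mid (by linarith) (by linarith)]
    rw [t0, t1, A1]
    refine ⟨?_, Or.inr rfl, Or.inl rfl, Or.inr (Or.inr E1)⟩
    rw [AA, lpa_coe hg _ _ (by linarith) (by linarith), lpa_zero hg]
    have := pol_glue (t := 4 * k + 3 - θ) hk h02 (by linarith) (by linarith)
    rw [this]
    congr 3; push_cast; ring
  · have t0 : tz (4 * (k:ℝ) + 0) θ = 0 := tz_right (by linarith)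
    have t1 : tz (4 * (k:ℝ) + 1) θ = 4 * k + 4 - θ := by
      rw [tz_down (by linarith) (by linarith)]; ring
    rw [t0, t1, A0]
    refine ⟨?_, Or.inl rfl, Or.inr (Or.inl F0), Or.inl rfl⟩
    rw [AA, lpa_coe hg _ _ (by linarith) (by linarith), lpa_zero hg]
    have := pol_glue (t := 4 * k + 4 - θ) hk h12 (by linarith) (by linarith)
    rw [this, add_comm]
    congr 3; push_cast; ring

lemma coe_msum (D : Multiset ℝ) : ((D.sum : ℝ) : Ci) = (D.map fun x : ℝ => (x : Ci)).sum := by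
  induction D using Multiset.induction_on with
  | empty => simp
  | cons y D ih => simp [ih]

section
variable {X : Type*} [TopologicalSpace X]

/-- nullity condition on the sums of the angular coordinate -/
def okc (e : Bool) (z : Ci) : Prop := if e then z ≠ 0 else ‖z‖ < 1 / 2

lemma exists_L {g k ς : ℕ} (hk : k < g) (hς : ς < 2) {A : X → Multiset (MG g)} (hA : Continuous A) (e : Bool)
    (h : ∀ x, okc e ((A x).map (Fc g k ς)).sum) :
    ∃ L : X → ℝ, Continuous L ∧ (∀ x, (L x : Ci) = ((A x).map (Ac g k ς)).sum) ∧
      (e = true → ∀ x, ∃ l : ℝ, 0 ≤ l ∧ l < 1 ∧ (l : Ci) = ((A x).map (Fc g k ς)).sum ∧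
        L x = l + ((A x).map (Ec g k ς)).sum) := by
  have cF : Continuous fun x => ((A x).map (Fc g k ς)).sum := continuous_msum (continuous_Fc hk hς) hA
  have cE : Continuous fun x => ((A x).map (Ec g k ς)).sum := continuous_msum (continuous_Ec hk hς) hA
  have hsum : ∀ D : Multiset (MG g), (D.map (Ac g k ς)).sum = (D.map (Fc g k ς)).sum + ((D.map (Ec g k ς)).sum : ℝ) := by
    intro D
    rw [coe_msum, Multiset.map_map, ← Multiset.sum_map_add]
    congr 1
    exact Multiset.map_congr rfl fun y _ => Ac_eq hk hς y
  cases e with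
  | true =>
    obtain ⟨l, hl, hl', hl''⟩ := exists_lift_Ci cF 0 (fun x => by simpa [okc] using h x)
    refine ⟨fun x => l x + ((A x).map (Ec g k ς)).sum, hl.add cE, fun x => ?_, fun _ x =>
      ⟨l x, (hl'' x).1, by linarith [(hl'' x).2], hl' x, rfl⟩⟩
    rw [AddCircle.coe_add, hl', hsum]
  | false =>
    obtain ⟨l, hl, hl', hl''⟩ := exists_lift_Ci cF (-(1/2)) (fun x hx => by
      have := h x
      simp only [okc, Bool.false_eq_true, if_false, hx] at this
      rw [AddCircle.coe_neg, norm_neg] at this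
      have h2 := AddCircle.norm_half_period_eq (p := (1:ℝ))
      rw [h2] at this
      norm_num at this)
    refine ⟨fun x => l x + ((A x).map (Ec g k ς)).sum, hl.add cE, fun x => ?_, fun h => by simp at h⟩
    rw [AddCircle.coe_add, hl', hsum]

theorem handle {g k c : ℕ} (hk : k < g) {A : X → Multiset (MG g)} (hA : Continuous A)
    (hcard : ∀ x, Multiset.card (A x) = c)
    (hP : ∀ x, ∀ y ∈ A x, 1 / 200 < Nn g k 0 y ∨ 1 / 200 < Nn g k 1 y) (e0 e1 : Bool)
    (h0 : ∀ x, okc e0 ((A x).map (Fc g k 0)).sum) (h1 : ∀ x, okc e1 ((A x).map (Fc g k 1)).sum)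
    (hc : 2 ≤ c ∨ (c = 1 ∧ (e0 = true ∨ e1 = true))) :
    HomC (vx g) (fun _ => 0) A (fun _ => c • {vx g}) := by
  have hg : 0 < g := by omega
  have := compactMG hg
  have := t2MG hg
  have h02 : (0:ℕ) < 2 := by norm_num
  have h12 : (1:ℕ) < 2 := by norm_num
  obtain ⟨L0, cL0, hL0, hL0'⟩ := exists_L hk h02 hA e0 h0
  obtain ⟨L1, cL1, hL1, hL1'⟩ := exists_L hk h12 hA e1 h1
  have ca := continuous_lpa hg k 0
  have cb := continuous_lpa hg k 1
  have za := lpa_zero hg k 0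
  have zb := lpa_zero hg k 1
  obtain ⟨m, rfl⟩ : ∃ m, c = m + 1 := ⟨c - 1, by omega⟩
  have s1 : HomC (vx g) (fun _ => 0) A (fun x => (A x).map fun y => Em g y 1) := by
    have := HomC.pointwise (w := vx g) (h := fun p : MG g × ℝ => Em g p.1 p.2) hA
      (fun x y _ t _ _ => (continuous_Em hg).continuousAt)
    refine this.congr (fun x => ?_) fun x => rfl
    simp only [Em_zero hg, Multiset.map_id']
  refine s1.trans (HomC.cancel (n := m + 1) (m := m + 1) (b := fun _ => m + 1) (by simpa using hcard)
    (fun _ => le_rfl) ?_)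
  have cB : ∀ ς : ℕ, ς < 2 → Continuous fun x => (⟨(A x).map (Ac g k ς), by simp [hcard]⟩ :
      {D : Multiset Ci // Multiset.card D = m + 1}) := fun ς hς =>
    Continuous.subtype_mk (continuous_mmap (continuous_Ac hk hς) hA) _
  have q0 := ((circleHom m).comp (cB 0 h02)).map ca
  have q1 := ((circleHom m).comp (cB 1 h12)).map cb
  rw [za] at q0
  rw [zb] at q1
  have s2 := (q0.add q1).mono (b' := fun _ => m + 1) (fun x => by
    have := cnt_split (A x) (0:Ci) (Ac g k 0) (Ac g k 1) fun y hy => (P_spec hk (hP x y hy)).2.1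
    rw [hcard] at this
    exact this)
  have s3 := s2.congr (f0' := fun x => ((A x).map fun y => Em g y 1) + (m+1) • {vx g})
    (f1' := fun x => {lpa g k 0 ((A x).map (Ac g k 0)).sum} + {lpa g k 1 ((A x).map (Ac g k 1)).sum} + (2*m) • {vx g})
    (fun x => by
      rw [← ms_split (A x) (fun y => Em g y 1) (vx g) (Ac g k 0) (Ac g k 1) _ _
        fun y hy => (P_spec hk (hP x y hy)).1, hcard])
    (fun x => by
      simp only [Multiset.map_add, Multiset.map_singleton, Multiset.map_nsmul, za, zb, two_mul, add_nsmul]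
      abel)
  refine s3.trans ?_
  have ccc : Continuous fun _ : X => ((2 * m) • ({vx g} : Multiset (MG g))) := continuous_const
  have fin : ({vx g} : Multiset (MG g)) + {vx g} + (2 * m) • {vx g} = (m + 1) • {vx g} + (m + 1) • {vx g} := by
    simp only [two_mul, add_nsmul, one_nsmul]; abel
  rcases hc with hc | ⟨hc, he⟩
  · have := ((contract1 ca za cL0 hL0).add (contract1 cb zb cL1 hL1)).add_const ccc
    refine (this.mono fun x => ?_).congr (fun x => rfl) (fun x => fin)
    rw [cnt_nsmul]
    change m + 1 ≤ 0 + 0 + 2 * m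
    omega
  · obtain rfl : m = 0 := by omega
    have c0 : Continuous fun x => ((A x).map (Ac g k 0)).sum := continuous_msum (continuous_Ac hk h02) hA
    have c1 : Continuous fun x => ((A x).map (Ac g k 1)).sum := continuous_msum (continuous_Ac hk h12) hA
    rcases he with he | he
    · have := (contract2 ca cb za zb cL0 cL1 hL0 hL1 c1 (fun x => by
        obtain ⟨y, hy⟩ := Multiset.card_eq_one.1 (hcard x)
        obtain ⟨l, l0, l1, hl, hl'⟩ := hL0' he x
        have h0x := h0 x
        obtain ⟨-, -, h, -⟩ := P_spec hk (hP x y (by simp [hy]))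
        simp only [hy, Multiset.map_singleton, Multiset.sum_singleton, okc, he, if_true] at hl hl' h0x ⊢
        rcases h with h | h | ⟨u, u0, u1, hu, hu'⟩
        · exact Or.inl h
        · exact absurd h h0x
        · right
          have u1' : u < 1 := lt_of_le_of_ne u1 (by rintro rfl; rw [hu, coe_one_Ci] at h0x; exact h0x rfl)
          have : l = u := coe_inj_Ico l0 l1 u0 u1' (hl.trans hu)
          rw [hl', hu', this]; ring)).add_const ccc
      refine (this.mono fun x => ?_).congr (fun x => rfl) (fun x => fin)
      change 0 + 1 ≤ 1 + _
      omega
    · have := (contract2 cb ca zb za cL1 cL0 hL1 hL0 c0 (fun x => by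
        obtain ⟨y, hy⟩ := Multiset.card_eq_one.1 (hcard x)
        obtain ⟨l, l0, l1, hl, hl'⟩ := hL1' he x
        have h0x := h1 x
        obtain ⟨-, -, -, h⟩ := P_spec hk (hP x y (by simp [hy]))
        simp only [hy, Multiset.map_singleton, Multiset.sum_singleton, okc, he, if_true] at hl hl' h0x ⊢
        rcases h with h | h | ⟨u, u0, u1, hu, hu'⟩
        · exact Or.inl h
        · exact absurd h h0x
        · right
          have u1' : u < 1 := lt_of_le_of_ne u1 (by rintro rfl; rw [hu, coe_one_Ci] at h0x; exact h0x rfl)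
          have : l = u := coe_inj_Ico l0 l1 u0 u1' (hl.trans hu)
          rw [hl', hu', this]; ring)).add_const ccc
      refine (this.mono fun x => ?_).congr (fun x => by rw [add_comm ({lpa g k 1 _})]) (fun x => fin)
      change 0 + 1 ≤ 1 + _
      omega

end

end SPcat
end

open scoped unitInterval Topology
open MeasureTheory
noncomputable section
namespace SPcat

def NN (g k : ℕ) (y : MG g) : ℝ := max (Nn g k 0 y) (Nn g k 1 y)

lemma continuous_NN {g k : ℕ} (hk : k < g) : Continuous (NN g k) :=
  (continuous_Nn hk (by norm_num)).max (continuous_Nn hk (by norm_num))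

lemma Nn_le_NN {g k ς : ℕ} (hς : ς < 2) (y : MG g) : Nn g k ς y ≤ NN g k y := by
  interval_cases ς
  · exact le_max_left _ _
  · exact le_max_right _ _

lemma Fc_of_Nn {g k ς : ℕ} (hk : k < g) (hς : ς < 2) {y : MG g} (h : Nn g k ς y ≤ 1 / 100) : Fc g k ς y = 0 := by
  obtain ⟨r, θ, r0, r1, θ0, θ1, rfl⟩ := pol_surj (by omega) y
  rw [Nn_pol hk hς r0 r1 θ0 θ1.le, psN] at h
  rw [Fc_pol hk hς r0 r1 θ0 θ1.le, psF]
  rcases min_le_iff.1 h with h | h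
  · rw [Phi, cl_of_nonpos (by linarith)]; simp
  · rw [Phi, cl_of_one_le (by linarith), coe_one_Ci]

lemma Nn_of_Fc {g k ς : ℕ} (hk : k < g) (hς : ς < 2) {y : MG g} (h : ‖Fc g k ς y‖ < 1 / 100) : Nn g k ς y < 1 / 50 := by
  obtain ⟨r, θ, r0, r1, θ0, θ1, rfl⟩ := pol_surj (by omega) y
  rw [Nn_pol hk hς r0 r1 θ0 θ1.le, psN]
  rw [Fc_pol hk hς r0 r1 θ0 θ1.le, psF] at h
  by_contra hcon
  push Not at hcon
  obtain ⟨h1, h2⟩ := le_min_iff.1 hcon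
  set x := r * tz (4 * (k:ℝ) + (ς:ℝ)) θ
  rw [Phi, cl_of_mem (by linarith) (by linarith)] at h
  rw [UnitAddCircle.norm_eq] at h
  obtain ⟨h3, h4⟩ := abs_lt.1 h
  set u := (100 * x - 1) / 98 with hu
  have h5 : (round u : ℝ) < 1 := by rw [hu] at h3 ⊢; linarith
  have h6 : (0:ℝ) < round u := by rw [hu] at h4 ⊢; linarith
  have h7 : round u < 1 := by exact_mod_cast h5
  have h8 : 0 < round u := by exact_mod_cast h6
  omega

lemma NN_vx {g k : ℕ} (hk : k < g) : NN g k (vx g) = 0 := by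
  have kg : (k:ℝ) + 1 ≤ g := by exact_mod_cast hk
  rw [NN, vx, Nn_pol hk (by norm_num) zero_le_one le_rfl le_rfl (by positivity),
    Nn_pol hk (by norm_num) zero_le_one le_rfl le_rfl (by positivity),
    tz_left (by push_cast; positivity), tz_left (by push_cast; positivity)]
  simp [psN]

lemma NN_disj {g k l : ℕ} (hk : k < g) (hl : l < g) {y : MG g} (h : 0 < NN g k y) (h' : 0 < NN g l y) : k = l := by
  obtain ⟨r, θ, r0, r1, θ0, θ1, rfl⟩ := pol_surj (by omega) y
  have key : ∀ i, i < g → 0 < NN g i (pol g r θ) → 4 * (i:ℝ) < θ ∧ θ < 4 * (i:ℝ) + 4 := by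
    intro i hi h
    rw [NN, Nn_pol hi (by norm_num) r0 r1 θ0 θ1.le, Nn_pol hi (by norm_num) r0 r1 θ0 θ1.le] at h
    have key : ∀ c : ℝ, 0 < psN r (tz c θ) → c < θ ∧ θ < c + 3 := by
      intro c hc
      have h1 : 0 < r * tz c θ := lt_of_lt_of_le hc (min_le_left _ _)
      refine ⟨?_, ?_⟩
      · by_contra h; rw [tz_left (by linarith)] at h1; norm_num at h1
      · by_contra h; rw [tz_right (by linarith)] at h1; norm_num at h1
    rcases lt_max_iff.1 h with h | h <;> obtain ⟨a, b⟩ := key _ h <;> push_cast at a b <;>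
      exact ⟨by linarith, by linarith⟩
  obtain ⟨a, b⟩ := key k hk h
  obtain ⟨a', b'⟩ := key l hl h'
  have h1 : (k:ℝ) < l + 1 := by linarith
  have h2 : (l:ℝ) < k + 1 := by linarith
  have h1 : k < l + 1 := by exact_mod_cast h1
  have h2 : l < k + 1 := by exact_mod_cast h2
  omega

/-! ## Filtering -/
open Classical in
def filt {Y : Type*} (V : Set Y) (D : Multiset Y) : Multiset Y := D.filter (· ∈ V)


section
variable {Y : Type*}

lemma card_filt (V : Set Y) (D : Multiset Y) : Multiset.card (filt V D) = cnt V D := by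
  classical
  unfold filt cnt
  rw [Multiset.countP_eq_card_filter]

lemma mem_filt {V : Set Y} {D : Multiset Y} {y : Y} : y ∈ filt V D ↔ y ∈ D ∧ y ∈ V := by
  classical
  unfold filt; exact Multiset.mem_filter

open Classical in
lemma filt_cons (V : Set Y) (y : Y) (D : Multiset Y) :
    filt V (y ::ₘ D) = (if y ∈ V then {y} else 0) + filt V D := by
  unfold filt; exact Multiset.filter_cons ..

lemma filt_zero (V : Set Y) : filt V 0 = 0 := by
  classical
  unfold filt; exact Multiset.filter_zero _

open Classical in
lemma filt_sum (V : Set Y) (D : Multiset Y) : filt V D = (D.map fun y => if y ∈ V then {y} else 0).sum := by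
  induction D using Multiset.induction_on with
  | empty => simp [filt_zero]
  | cons y D ih => rw [filt_cons, ih]; simp

lemma sum_filt {M : Type*} [AddCommMonoid M] (V : Set Y) (f : Y → M) (h : ∀ y, y ∉ V → f y = 0) (D : Multiset Y) :
    ((filt V D).map f).sum = (D.map f).sum := by
  classical
  induction D using Multiset.induction_on with
  | empty => simp [filt_zero]
  | cons y D ih =>
    rw [filt_cons]
    split_ifs with hy
    · simp [ih]
    · simp [ih, h y hy]

lemma filt_decomp (s : Finset ℕ) (V : ℕ → Set Y) (hV : ∀ k ∈ s, ∀ l ∈ s, ∀ y, y ∈ V k → y ∈ V l → k = l)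
    (D : Multiset Y) : D = filt {y | ∀ k ∈ s, y ∉ V k} D + ∑ k ∈ s, filt (V k) D := by
  classical
  induction D using Multiset.induction_on with
  | empty => simp [filt_zero]
  | cons y D ih =>
    simp only [filt_cons, Finset.sum_add_distrib]
    have : ({y} : Multiset Y) = (if y ∈ {y | ∀ k ∈ s, y ∉ V k} then {y} else 0) + ∑ k ∈ s, if y ∈ V k then {y} else 0 := by
      by_cases h : ∃ k ∈ s, y ∈ V k
      · obtain ⟨k, hk, hy⟩ := h
        rw [if_neg (by simp only [Set.mem_ofPred_eq]; push Not; exact ⟨k, hk, hy⟩), Finset.sum_eq_single k, if_pos hy, zero_add]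
        · intro l hl hlk
          rw [if_neg]
          intro hy'
          exact hlk (hV l hl k hk y hy' hy)
        · intro h; exact absurd hk h
      · push Not at h
        rw [if_pos (by exact h), Finset.sum_eq_zero, add_zero]
        intro k hk
        rw [if_neg (h k hk)]
    rw [← Multiset.singleton_add]
    calc {y} + D = {y} + (filt {y | ∀ k ∈ s, y ∉ V k} D + ∑ k ∈ s, filt (V k) D) := by rw [← ih]
      _ = ((if y ∈ {y | ∀ k ∈ s, y ∉ V k} then {y} else 0) + ∑ k ∈ s, if y ∈ V k then {y} else 0) +
          (filt {y | ∀ k ∈ s, y ∉ V k} D + ∑ k ∈ s, filt (V k) D) := by rw [← this]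
      _ = _ := by rw [add_add_add_comm]; congr!

lemma cnt_squeeze {V V' : Set Y} (hVV : V ⊆ V') {D : Multiset Y} {c : ℕ} (h : c ≤ cnt V D) (h' : cnt V' D ≤ c) :
    ∀ y ∈ D, y ∈ V' → y ∈ V := by
  classical
  intro y hy hy'
  have h1 : filt V D ≤ filt V' D := by
    unfold filt; exact Multiset.monotone_filter_right D fun _ hx => hVV hx
  have h2 := Multiset.eq_of_le_of_card_le h1 (by rw [card_filt, card_filt]; omega)
  have h3 : y ∈ filt V' D := mem_filt.2 ⟨hy, hy'⟩
  rw [← h2] at h3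
  exact (mem_filt.1 h3).2

lemma continuous_filt {X : Type*} [TopologicalSpace X] [TopologicalSpace Y] {V V' : Set Y} (hV : IsOpen V)
    (hV' : IsClosed V') (hVV : V ⊆ V') {q : X → Multiset Y} (hq : Continuous q)
    (h : ∀ x, ∀ y ∈ q x, y ∈ V' → y ∈ V) : Continuous fun x => filt V (q x) := by
  classical
  simp only [filt_sum]
  rw [continuous_iff_continuousAt]
  intro x
  refine ContinuousAt.msum (T := Unit) (e := fun p => if p.1 ∈ V then {p.1} else 0) (s := fun _ => ())
    hq.continuousAt continuousAt_const fun y hy => ?_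
  by_cases hyV : y ∈ V
  · have : (fun p : Y × Unit => ({p.1} : Multiset Y)) =ᶠ[𝓝 (y, ())] fun p => if p.1 ∈ V then {p.1} else 0 := by
      filter_upwards [(hV.preimage continuous_fst).mem_nhds (show (y, ()) ∈ Prod.fst ⁻¹' V from hyV)] with p hp
      rw [if_pos (show p.1 ∈ V from hp)]
    exact ContinuousAt.congr (continuous_single.comp continuous_fst).continuousAt this
  · have hy2 : y ∈ V'ᶜ := fun h' => hyV (h x y hy h')
    have : (fun p : Y × Unit => (0 : Multiset Y)) =ᶠ[𝓝 (y, ())] fun p => if p.1 ∈ V then {p.1} else 0 := by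
      filter_upwards [(hV'.isOpen_compl.preimage continuous_fst).mem_nhds (show (y, ()) ∈ Prod.fst ⁻¹' V'ᶜ from hy2)] with p hp
      rw [if_neg fun h => hp (hVV h)]
    exact ContinuousAt.congr continuousAt_const this

end

end SPcat
end

open scoped unitInterval Topology
open MeasureTheory
noncomputable section
namespace SPcat

def SF (g k ς : ℕ) (D : Multiset (MG g)) : Ci := (D.map (Fc g k ς)).sum
def Vo (g k : ℕ) (s : ℝ) : Set (MG g) := {y | s < NN g k y}
def Vc (g k : ℕ) (s : ℝ) : Set (MG g) := {y | s ≤ NN g k y}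
def okn (e : Bool) (s : ℝ) (z : Ci) : Prop := if e then s < ‖z‖ else ‖z‖ < s
def actv (o : ℕ × Bool × Bool) : Prop := 2 ≤ o.1 ∨ (o.1 = 1 ∧ (o.2.1 = true ∨ o.2.2 = true))

def Wk (g k : ℕ) (s : ℝ) : Option (ℕ × Bool × Bool) → Set (Multiset (MG g))
  | none => {D | cnt (Vc g k s) D ≤ 1 ∧ ‖SF g k 0 D‖ < s ∧ ‖SF g k 1 D‖ < s}
  | some o => {D | actv o ∧ o.1 ≤ cnt (Vo g k s) D ∧ cnt (Vc g k s) D ≤ o.1 ∧ okn o.2.1 s (SF g k 0 D) ∧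
      okn o.2.2 s (SF g k 1 D)}

lemma Vo_sub (g k : ℕ) (s : ℝ) : Vo g k s ⊆ Vc g k s := fun y h => le_of_lt (show s < NN g k y from h)

section
variable {g k : ℕ}

lemma isOpen_Vo (hk : k < g) (s : ℝ) : IsOpen (Vo g k s) := isOpen_lt continuous_const (continuous_NN hk)
lemma isClosed_Vc (hk : k < g) (s : ℝ) : IsClosed (Vc g k s) := isClosed_le continuous_const (continuous_NN hk)
lemma continuous_SF (hk : k < g) {ς : ℕ} (hς : ς < 2) : Continuous (SF g k ς) :=
  continuous_msum (continuous_Fc hk hς) continuous_id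

lemma isOpen_Wk (hk : k < g) (s : ℝ) (o : Option (ℕ × Bool × Bool)) : IsOpen (Wk g k s o) := by
  have c0 := (continuous_SF hk (ς := 0) (by norm_num)).norm
  have c1 := (continuous_SF hk (ς := 1) (by norm_num)).norm
  have cc := fun m => cnt_closed (isClosed_Vc hk s) m
  have co := fun m => cnt_open (isOpen_Vo hk s) m
  have hn : ∀ (ς : ℕ) (e : Bool), ς < 2 → IsOpen {D : Multiset (MG g) | okn e s (SF g k ς D)} := by
    intro ς e hς
    have c0 := (continuous_SF hk (ς := ς) hς).norm
    cases e with
    | true => simpa [okn] using isOpen_lt continuous_const c0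
    | false => simpa [okn] using isOpen_lt c0 continuous_const
  cases o with
  | none => exact (cc 1).inter ((isOpen_lt c0 continuous_const).inter (isOpen_lt c1 continuous_const))
  | some o =>
    exact isOpen_const.inter ((co _).inter ((cc _).inter ((hn 0 _ (by norm_num)).inter (hn 1 _ (by norm_num)))))

lemma disj_Wk {s : ℝ} {o o' : Option (ℕ × Bool × Bool)} {D : Multiset (MG g)} (h : D ∈ Wk g k s o)
    (h' : D ∈ Wk g k s o') : o = o' := by
  have hm := cnt_mono (Vo_sub g k s) D
  have key : ∀ o o' : ℕ × Bool × Bool, D ∈ Wk g k s (some o) → D ∈ Wk g k s (some o') → o = o' := by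
    rintro ⟨c, e, f⟩ ⟨c', e', f'⟩ ⟨-, h1, h2, h3, h4⟩ ⟨-, h1', h2', h3', h4'⟩
    simp only at h1 h2 h1' h2'
    have hok : ∀ (e e' : Bool) (z : Ci), okn e s z → okn e' s z → e = e' := by
      intro e e' z a b
      cases e <;> cases e' <;> simp only [okn, if_true, if_false, Bool.false_eq_true] at a b <;>
        first | rfl | (exfalso; linarith)
    simp only [Prod.mk.injEq]
    exact ⟨by omega, hok _ _ _ h3 h3', hok _ _ _ h4 h4'⟩
  have key2 : ∀ o : ℕ × Bool × Bool, D ∈ Wk g k s (some o) → D ∈ Wk g k s none → False := by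
    rintro ⟨c, e, f⟩ ⟨h0, h1, h2, h3, h4⟩ ⟨h1', h2', h3'⟩
    rcases h0 with h0 | ⟨h0, h5 | h5⟩
    · simp only at h0 h1; omega
    · simp only at h5; subst h5; simp only [okn, if_true] at h3; linarith
    · simp only at h5; subst h5; simp only [okn, if_true] at h4; linarith
  cases o with
  | none =>
    cases o' with
    | none => rfl
    | some o' => exact (key2 _ h' h).elim
  | some o =>
    cases o' with
    | none => exact (key2 _ h h').elim
    | some o' => rw [key _ _ h h']

lemma SF_pos (hk : k < g) {ς : ℕ} (hς : ς < 2) {s : ℝ} (s1 : s < 1 / 100) {D : Multiset (MG g)} (h : SF g k ς D ≠ 0) :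
    0 < cnt (Vo g k s) D := by
  rw [cnt_pos]
  by_contra hcon
  push Not at hcon
  refine h (Multiset.sum_eq_zero fun z hz => ?_)
  obtain ⟨y, hy, rfl⟩ := Multiset.mem_map.1 hz
  refine Fc_of_Nn hk hς ?_
  have h1 : ¬ s < NN g k y := hcon y hy
  have := Nn_le_NN (k := k) hς y
  linarith

open Classical in
def wo (g k : ℕ) (s : ℝ) (D : Multiset (MG g)) : ℕ := (cnt (Vo g k s) D - 1) +
  (if s < ‖SF g k 0 D‖ then 1 else 0) + (if s < ‖SF g k 1 D‖ then 1 else 0)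
open Classical in
def wc (g k : ℕ) (s : ℝ) (D : Multiset (MG g)) : ℕ := (cnt (Vc g k s) D - 1) +
  (if s ≤ ‖SF g k 0 D‖ then 1 else 0) + (if s ≤ ‖SF g k 1 D‖ then 1 else 0)

lemma ite_mono {p q : Prop} [Decidable p] [Decidable q] (h : p → q) : (if p then 1 else 0 : ℕ) ≤ if q then 1 else 0 := by
  split_ifs with h1 h2 h2
  · exact le_rfl
  · exact (h2 (h h1)).elim
  · exact zero_le_one
  · exact le_rfl

lemma wo_le_wc (s : ℝ) (D : Multiset (MG g)) : wo g k s D ≤ wc g k s D := by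
  classical
  unfold wo wc
  have := cnt_mono (Vo_sub g k s) D
  gcongr ?_ + ?_ + ?_
  · omega
  · exact ite_mono le_of_lt
  · exact ite_mono le_of_lt

lemma wc_le_wo {s s' : ℝ} (h : s' < s) (D : Multiset (MG g)) : wc g k s D ≤ wo g k s' D := by
  classical
  unfold wo wc
  have : cnt (Vc g k s) D ≤ cnt (Vo g k s') D := cnt_mono (fun y hy => lt_of_lt_of_le h hy) D
  gcongr ?_ + ?_ + ?_
  · omega
  · exact ite_mono fun h' => lt_of_lt_of_le h h'
  · exact ite_mono fun h' => lt_of_lt_of_le h h'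

lemma ne_zero_of {s : ℝ} (s0 : 0 < s) {z : Ci} (h : s ≤ ‖z‖) : z ≠ 0 := by
  rintro rfl; rw [norm_zero] at h; linarith

lemma wc_le (hk : k < g) {s : ℝ} (s0 : 0 < s) (s1 : s < 1 / 100) (D : Multiset (MG g)) :
    wc g k s D ≤ cnt (Vc g k s) D + 1 := by
  classical
  unfold wc
  have := cnt_mono (Vo_sub g k s) D
  by_cases h : s ≤ ‖SF g k 0 D‖ ∨ s ≤ ‖SF g k 1 D‖
  · have : 0 < cnt (Vo g k s) D := by
      rcases h with h | h
      · exact SF_pos hk (by norm_num) s1 (ne_zero_of s0 h)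
      · exact SF_pos hk (by norm_num) s1 (ne_zero_of s0 h)
    split_ifs <;> omega
  · push Not at h
    rw [if_neg (not_le.2 h.1), if_neg (not_le.2 h.2)]
    omega

lemma cover_Wk (hk : k < g) {s : ℝ} (s0 : 0 < s) (s1 : s < 1 / 100) {D : Multiset (MG g)} (h : wo g k s D = wc g k s D) :
    ∃ o, D ∈ Wk g k s o := by
  classical
  have hm := cnt_mono (Vo_sub g k s) D
  have i0 : (if s < ‖SF g k 0 D‖ then 1 else 0 : ℕ) ≤ if s ≤ ‖SF g k 0 D‖ then 1 else 0 := ite_mono le_of_lt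
  have i1 : (if s < ‖SF g k 1 D‖ then 1 else 0 : ℕ) ≤ if s ≤ ‖SF g k 1 D‖ then 1 else 0 := ite_mono le_of_lt
  unfold wo wc at h
  have e0 : (if s < ‖SF g k 0 D‖ then 1 else 0 : ℕ) = if s ≤ ‖SF g k 0 D‖ then 1 else 0 := by omega
  have e1 : (if s < ‖SF g k 1 D‖ then 1 else 0 : ℕ) = if s ≤ ‖SF g k 1 D‖ then 1 else 0 := by omega
  have ec : cnt (Vo g k s) D - 1 = cnt (Vc g k s) D - 1 := by omega
  have hok : ∀ z : Ci, (if s < ‖z‖ then 1 else 0 : ℕ) = (if s ≤ ‖z‖ then 1 else 0) → okn (decide (s < ‖z‖)) s z := by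
    intro z hz
    unfold okn
    by_cases hs : s < ‖z‖
    · simp [hs]
    · simp only [hs, decide_false, if_false, Bool.false_eq_true] at hz ⊢
      by_contra hcon
      rw [if_pos (not_lt.1 hcon)] at hz
      omega
  by_cases ha : 2 ≤ cnt (Vc g k s) D ∨ s < ‖SF g k 0 D‖ ∨ s < ‖SF g k 1 D‖
  · have hp : 2 ≤ cnt (Vc g k s) D ∨ 0 < cnt (Vo g k s) D := by
      rcases ha with ha | ha | ha
      · exact Or.inl ha
      · exact Or.inr (SF_pos hk (by norm_num) s1 (ne_zero_of s0 ha.le))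
      · exact Or.inr (SF_pos hk (by norm_num) s1 (ne_zero_of s0 ha.le))
    refine ⟨some (cnt (Vo g k s) D, decide (s < ‖SF g k 0 D‖), decide (s < ‖SF g k 1 D‖)), ?_, le_rfl, ?_,
      hok _ e0, hok _ e1⟩
    · by_cases h2 : 2 ≤ cnt (Vo g k s) D
      · exact Or.inl h2
      · refine Or.inr ⟨?_, ?_⟩
        · change cnt (Vo g k s) D = 1; omega
        · rcases ha with ha | ha
          · omega
          · simpa using ha
    · change cnt (Vc g k s) D ≤ cnt (Vo g k s) D
      omega
  · push Not at ha
    obtain ⟨a, b, c⟩ := ha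
    refine ⟨none, by omega, ?_, ?_⟩
    · have := hok _ e0
      simpa [okn, b] using this
    · have := hok _ e1
      simpa [okn, c] using this

lemma none_lt (hk : k < g) {s : ℝ} (s1 : s < 1 / 100) {D : Multiset (MG g)} (h : D ∈ Wk g k s none) {y : MG g}
    (hy : y ∈ D) : NN g k y < 1 / 50 := by
  by_contra hcon
  push Not at hcon
  obtain ⟨h1, h2, h3⟩ := h
  obtain ⟨E, rfl⟩ := Multiset.exists_cons_of_mem hy
  rw [← Multiset.singleton_add, cnt_add] at h1
  have h4 : 0 < cnt (Vc g k s) {y} := cnt_pos.2 ⟨y, by simp, by change s ≤ _; linarith⟩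
  have h5 : cnt (Vc g k s) E = 0 := by omega
  rw [cnt_eq_zero] at h5
  have key : ∀ ς : ℕ, ς < 2 → SF g k ς (y ::ₘ E) = Fc g k ς y := by
    intro ς hς
    rw [SF, Multiset.map_cons, Multiset.sum_cons]
    rw [Multiset.sum_eq_zero, add_zero]
    intro z hz
    obtain ⟨w, hw, rfl⟩ := Multiset.mem_map.1 hz
    have h6 : ¬ s ≤ NN g k w := h5 w hw
    have := Nn_le_NN (k := k) hς w
    exact Fc_of_Nn hk hς (by linarith)
  rw [key _ (by norm_num)] at h2 h3
  have a := Nn_of_Fc hk (by norm_num) (h2.trans s1)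
  have b := Nn_of_Fc hk (by norm_num) (h3.trans s1)
  exact absurd (max_lt a b) (not_lt.2 hcon)

end

lemma filt_congr {Y : Type*} {V V' : Set Y} {D : Multiset Y} (h : ∀ y ∈ D, (y ∈ V ↔ y ∈ V')) : filt V D = filt V' D := by
  classical
  unfold filt
  exact Multiset.filter_congr h

lemma sum_cnt_le {Y : Type*} (g : ℕ) (V : ℕ → Set Y) (hV : ∀ k < g, ∀ l < g, ∀ y, y ∈ V k → y ∈ V l → k = l)
    (D : Multiset Y) : ∑ k ∈ Finset.range g, cnt (V k) D ≤ Multiset.card D := by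
  have := congrArg Multiset.card (filt_decomp (Finset.range g) V (by simpa using hV) D)
  rw [Multiset.card_add, Multiset.card_sum] at this
  simp only [card_filt] at this
  omega

theorem stage1 {g n : ℕ} {X : Type*} [TopologicalSpace X] {q : X → Multiset (MG g)} (hq : Continuous q)
    (hn : ∀ x, Multiset.card (q x) = n) {s : ℝ} (s0 : 1 / 200 < s) (s1 : s < 1 / 100) (τ : ℕ → Option (ℕ × Bool × Bool))
    (hW : ∀ x, ∀ k < g, q x ∈ Wk g k s (τ k)) :
    ∃ q' : X → Multiset (MG g), HomC (vx g) (fun _ => 0) q q' ∧ (∀ x, Multiset.card (q' x) = n) ∧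
      ∀ x, ∀ y ∈ q' x, ∀ k < g, NN g k y < 1 / 50 := by
  classical
  set act := (Finset.range g).filter fun k => (τ k).isSome with hact
  set c : ℕ → ℕ := fun k => (τ k).elim 0 Prod.fst with hc
  have hk : ∀ k ∈ act, k < g := fun k hk => Finset.mem_range.1 (Finset.mem_filter.1 hk).1
  have hsome : ∀ k ∈ act, ∃ o, τ k = some o ∧ c k = o.1 := by
    intro k hk
    obtain ⟨o, ho⟩ := Option.isSome_iff_exists.1 (Finset.mem_filter.1 hk).2
    exact ⟨o, ho, by simp [hc, ho]⟩
  have hnone : ∀ k < g, k ∉ act → τ k = none := by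
    intro k hk h
    by_contra hcon
    exact h (Finset.mem_filter.2 ⟨Finset.mem_range.2 hk, Option.isSome_iff_ne_none.2 hcon⟩)
  have hcnt : ∀ k ∈ act, ∀ x, c k ≤ cnt (Vo g k s) (q x) ∧ cnt (Vc g k s) (q x) ≤ c k := by
    intro k hka x
    obtain ⟨o, ho, hco⟩ := hsome k hka
    have := hW x k (hk k hka)
    rw [ho] at this
    rw [hco]
    exact ⟨this.2.1, this.2.2.1⟩
  have hsq : ∀ k ∈ act, ∀ x, ∀ y ∈ q x, y ∈ Vc g k s → y ∈ Vo g k s := fun k hka x =>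
    cnt_squeeze (Vo_sub g k s) (hcnt k hka x).1 (hcnt k hka x).2
  have hcA : ∀ k ∈ act, Continuous fun x => filt (Vo g k s) (q x) := fun k hka =>
    continuous_filt (isOpen_Vo (hk k hka) s) (isClosed_Vc (hk k hka) s) (Vo_sub g k s) hq (hsq k hka)
  have hcardA : ∀ k ∈ act, ∀ x, Multiset.card (filt (Vo g k s) (q x)) = c k := by
    intro k hka x
    rw [card_filt]
    have := cnt_mono (Vo_sub g k s) (q x)
    have := hcnt k hka x
    omega
  have hA : ∀ k ∈ act, HomC (vx g) (fun _ => 0) (fun x => filt (Vo g k s) (q x)) (fun _ => c k • {vx g}) := by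
    intro k hka
    obtain ⟨o, ho, hco⟩ := hsome k hka
    have hw : ∀ x, q x ∈ Wk g k s (some o) := fun x => ho ▸ hW x k (hk k hka)
    have hsf : ∀ ς : ℕ, ς < 2 → ∀ x, ((filt (Vo g k s) (q x)).map (Fc g k ς)).sum = SF g k ς (q x) := by
      intro ς hς x
      refine sum_filt _ _ (fun y hy => Fc_of_Nn (hk k hka) hς ?_) _
      have h1 : ¬ s < NN g k y := hy
      have := Nn_le_NN (k := k) hς y
      linarith
    have hok : ∀ (e : Bool) (z : Ci), okn e s z → okc e z := by
      intro e z hz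
      cases e with
      | true =>
        simp only [okn, okc, if_true] at hz ⊢
        exact ne_zero_of (by linarith) hz.le
      | false =>
        simp only [okn, okc, if_false, Bool.false_eq_true] at hz ⊢
        linarith
    rcases isEmpty_or_nonempty X with hX | ⟨⟨x0⟩⟩
    · exact HomC.mk' (fun x _ => (IsEmpty.false x).elim) (fun x => (IsEmpty.false x).elim)
        (fun x => (IsEmpty.false x).elim) (fun x => (IsEmpty.false x).elim) (fun x => (IsEmpty.false x).elim)
    refine handle (hk k hka) (hcA k hka) (hcardA k hka) ?_ o.2.1 o.2.2 ?_ ?_ ?_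
    · intro x y hy
      have h1 : s < max _ _ := (mem_filt.1 hy).2
      exact lt_max_iff.1 (s0.trans h1)
    · intro x; rw [hsf 0 (by norm_num)]; exact hok _ _ (hw x).2.2.2.1
    · intro x; rw [hsf 1 (by norm_num)]; exact hok _ _ (hw x).2.2.2.2
    · rw [hco]; exact (hw x0).1
  have hdec := fun x => filt_decomp act (fun k => Vo g k s) (fun k hka l hl y h h' =>
    NN_disj (hk k hka) (hk l hl) (lt_trans (by linarith : (0:ℝ) < s) h) (lt_trans (by linarith : (0:ℝ) < s) h')) (q x)
  set B : X → Multiset (MG g) := fun x => filt {y | ∀ k ∈ act, y ∉ Vo g k s} (q x) with hB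
  have hBc : Continuous B := by
    have h1 : Continuous fun x => filt (⋂ k ∈ act, (Vc g k s)ᶜ) (q x) := by
      refine continuous_filt (V' := ⋂ k ∈ act, (Vo g k s)ᶜ) ?_ ?_ ?_ hq ?_
      · exact isOpen_biInter_finset fun k hka => (isClosed_Vc (hk k hka) s).isOpen_compl
      · exact isClosed_biInter fun k hka => (isOpen_Vo (hk k hka) s).isClosed_compl
      · exact Set.iInter₂_mono fun k _ => Set.compl_subset_compl.2 (Vo_sub g k s)
      · intro x y hy h
        rw [Set.mem_iInter₂] at h ⊢
        exact fun k hka h' => h k hka (hsq k hka x y hy h')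
    refine h1.congr fun x => ?_
    simp only [hB]
    refine filt_congr fun y hy => ?_
    simp only [Set.mem_iInter, Set.mem_compl_iff, Set.mem_ofPred_eq]
    exact forall₂_congr fun k hka => not_congr ⟨hsq k hka x y hy, fun h => Vo_sub g k s h⟩
  refine ⟨fun x => B x + ∑ k ∈ act, c k • {vx g}, ?_, ?_, ?_⟩
  · have := ((HomC.refl (v := vx g) (b := fun _ => 0) hBc fun _ => Nat.zero_le _).add (HomC.sum act hA)).mono
      (b' := fun _ => 0) (fun _ => Nat.zero_le _)
    exact this.congr (fun x => (hdec x).symm) fun x => rfl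
  · intro x
    have := congrArg Multiset.card (hdec x)
    rw [hn, Multiset.card_add, Multiset.card_sum, Finset.sum_congr rfl fun k hka => hcardA k hka x] at this
    rw [Multiset.card_add, Multiset.card_sum, this]
    simp [hB]
  · intro x y hy k hkg
    rcases Multiset.mem_add.1 hy with hy | hy
    · obtain ⟨hy1, hy2⟩ := mem_filt.1 hy
      by_cases hka : k ∈ act
      · have : ¬ s < NN g k y := hy2 k hka
        linarith
      · have := hW x k hkg
        rw [hnone k hkg hka] at this
        exact none_lt hkg s1 this hy1
    · obtain ⟨l, hl, hy⟩ := Multiset.mem_sum.1 hy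
      have := Multiset.mem_of_mem_nsmul hy
      rw [Multiset.mem_singleton.1 this, NN_vx hkg]
      norm_num

theorem cover_of_stage2 {g n : ℕ}
    (h2 : ∀ (X : Type) [TopologicalSpace X] (q : X → Multiset (MG g)), Continuous q → (∀ x, Multiset.card (q x) = n) →
      (∀ x, ∀ y ∈ q x, ∀ k < g, NN g k y < 1 / 50) → HomC (vx g) (fun _ => 0) q (fun _ => n • {vx g})) :
    catLE (SP n (MG g)) (n + g) := by
  classical
  set s : ℕ → ℝ := fun j => 1 / 200 + 1 / (200 * ((j:ℝ) + 2)) with hs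
  have s0 : ∀ j, 1 / 200 < s j := fun j => by
    have : 0 < 1 / (200 * ((j:ℝ) + 2)) := by positivity
    simp only [hs]; linarith
  have s1 : ∀ j, s j < 1 / 100 := fun j => by
    have : 1 / (200 * ((j:ℝ) + 2)) ≤ 1 / 400 :=
      one_div_le_one_div_of_le (by norm_num) (by have : (0:ℝ) ≤ j := by positivity
                                                 linarith)
    simp only [hs]; linarith
  have sd : ∀ j, s (j + 1) < s j := fun j => by
    simp only [hs]
    have : (0:ℝ) ≤ j := by positivity
    have : 1 / (200 * (((j + 1 : ℕ):ℝ) + 2)) < 1 / (200 * ((j:ℝ) + 2)) :=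
      one_div_lt_one_div_of_lt (by positivity) (by push_cast; linarith)
    linarith
  refine catLE_of (vx g) (fun j (τ : Fin g → Option (ℕ × Bool × Bool)) =>
    {D | Multiset.card D = n} ∩ ⋂ k : Fin g, Wk g k (s j) (τ k)) ?_ ?_ ?_ ?_
  · intro j τ
    exact (isOpen_card n).inter (isOpen_iInter_of_finite fun k => isOpen_Wk k.2 _ _)
  · intro j τ τ' D hD hD'
    funext k
    exact disj_Wk (Set.mem_iInter.1 hD.2 k) (Set.mem_iInter.1 hD'.2 k)
  · intro D hD
    by_contra hcon
    push Not at hcon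
    have hlt : ∀ j : ℕ, j < n + g + 1 →
        ∑ k ∈ Finset.range g, wo g k (s j) D < ∑ k ∈ Finset.range g, wc g k (s j) D := by
      intro j hj
      refine lt_of_le_of_ne (Finset.sum_le_sum fun k _ => wo_le_wc _ _) fun he => ?_
      have he' := (Finset.sum_eq_sum_iff_of_le fun k _ => wo_le_wc (s j) D).1 he
      have hex : ∀ k : Fin g, ∃ o, D ∈ Wk g k (s j) o := fun k =>
        cover_Wk k.2 (by linarith [s0 j]) (s1 j) (he' k (Finset.mem_range.2 k.2))
      choose τ hτ using hex
      exact hcon ⟨j, hj⟩ τ ⟨hD, Set.mem_iInter.2 hτ⟩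
    have hind : ∀ j : ℕ, j < n + g + 1 → j + 1 ≤ ∑ k ∈ Finset.range g, wc g k (s j) D := by
      intro j
      induction j with
      | zero => intro h; have := hlt 0 h; omega
      | succ j ih =>
        intro h
        have h1 := ih (by omega)
        have h2 := hlt (j + 1) h
        have h3 : ∑ k ∈ Finset.range g, wc g k (s j) D ≤ ∑ k ∈ Finset.range g, wo g k (s (j + 1)) D :=
          Finset.sum_le_sum fun k _ => wc_le_wo (sd j) D
        omega
    have h1 := hind (n + g) (by omega)
    have h3 : ∑ k ∈ Finset.range g, wc g k (s (n + g)) D ≤ ∑ k ∈ Finset.range g, (cnt (Vc g k (s (n + g))) D + 1) :=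
      Finset.sum_le_sum fun k hk => wc_le (Finset.mem_range.1 hk) (by linarith [s0 (n + g)]) (s1 _) D
    rw [Finset.sum_add_distrib] at h3
    have h4 := sum_cnt_le g (fun k => Vc g k (s (n + g))) (fun k hk l hl y h h' =>
      NN_disj hk hl (lt_of_lt_of_le (by linarith [s0 (n + g)]) h) (lt_of_lt_of_le (by linarith [s0 (n + g)]) h')) D
    simp at h3
    omega
  · intro j τ
    obtain ⟨q', h1, hn, h3⟩ := stage1 (n := n) (q := fun D : ({D | Multiset.card D = n} ∩ ⋂ k : Fin g, Wk g k (s j) (τ k) :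
        Set (Multiset (MG g))) => D.1) continuous_subtype_val (fun D => D.2.1) (s0 j) (s1 j)
      (fun k => if h : k < g then τ ⟨k, h⟩ else none) (fun D k hk => by
        simp only [hk, dif_pos]
        exact Set.mem_iInter.1 D.2.2 ⟨k, hk⟩)
    exact h1.trans (h2 _ q' h1.cont1 hn h3)

end SPcat
end

open scoped unitInterval Topology
open MeasureTheory
noncomputable section
namespace SPcat

lemma sum_one {ι M : Type*} [DecidableEq ι] [AddCommMonoid M] {s : Finset ι} {f : ι → M} {w : M} {j : ι} (hj : j ∈ s)
    (h : ∀ i ∈ s, i ≠ j → f i = w) : ∑ i ∈ s, f i = f j + (s.card - 1) • w := by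
  rw [← Finset.add_sum_erase s f hj, Finset.sum_congr rfl (fun i hi => h i (Finset.mem_of_mem_erase hi) (Finset.ne_of_mem_erase hi)),
    Finset.sum_const, Finset.card_erase_of_mem hj]

/-- the loop along the boundary through the first k handles -/
def lk (g k : ℕ) : Ci → MG g := lpc fun u => pol g 1 (4 * (k:ℝ) * u)

lemma lk_aux {g : ℕ} (hg : 0 < g) (k : ℕ) : (fun u : ℝ => pol g 1 (4 * (k:ℝ) * u)) 0 =
    (fun u : ℝ => pol g 1 (4 * (k:ℝ) * u)) 1 := by
  have h1 := pol_int hg (4 * k)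
  have h2 := pol_int hg 0
  push_cast at h1 h2
  simp only [mul_zero, mul_one]
  rw [h1, h2]

lemma continuous_lk {g : ℕ} (hg : 0 < g) (k : ℕ) : Continuous (lk g k) := by
  refine continuous_lpc ?_ (lk_aux hg k)
  exact (continuous_pol g).comp (by fun_prop : Continuous fun u : ℝ => ((1:ℝ), 4 * (k:ℝ) * u))

lemma lk_coe {g : ℕ} (hg : 0 < g) (k : ℕ) {u : ℝ} (u0 : 0 ≤ u) (u1 : u ≤ 1) :
    lk g k (u : Ci) = pol g 1 (4 * (k:ℝ) * u) := lpc_coe (lk_aux hg k) u0 u1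

lemma lk_zero {g : ℕ} (hg : 0 < g) (k : ℕ) : lk g k 0 = vx g := by
  rw [lk, lpc_zero (lk_aux hg k)]
  simp only [mul_zero]
  rfl

lemma bd_split {g j : ℕ} (hj : j < g) {θ : ℝ} (h0 : 4 * (j:ℝ) ≤ θ) (h4 : θ ≤ 4 * (j:ℝ) + 4) :
    ({pol g 1 (4 * (j:ℝ) + tz (4 * (j:ℝ)) θ)} : Multiset (MG g)) + {pol g 1 (4 * (j:ℝ) + 1 + tz (4 * (j:ℝ) + 1) θ)} =
      {pol g 1 θ} + {vx g} := by
  have hg : 0 < g := by omega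
  have v0 : pol g 1 (4 * (j:ℝ)) = vx g := by have := pol_int hg (4 * j); push_cast at this; exact this
  have v1 : pol g 1 (4 * (j:ℝ) + 1) = vx g := by have := pol_int hg (4 * j + 1); push_cast at this; exact this
  have v2 : pol g 1 (4 * (j:ℝ) + 1 + 1) = vx g := by have := pol_int hg (4 * j + 1 + 1); push_cast at this; exact this
  rcases le_total θ (4 * (j:ℝ) + 1) with h1 | h1
  · rw [tz_up (by linarith) (by linarith), tz_left (by linarith), add_zero, v1]
    congr 3; ring
  rcases le_total θ (4 * (j:ℝ) + 2) with h2 | h2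
  · rw [tz_mid (by linarith) (by linarith), tz_up (by linarith) (by linarith), v1, add_comm]
    congr 3; ring
  rcases le_total θ (4 * (j:ℝ) + 3) with h3 | h3
  · rw [tz_down (by linarith) (by linarith), tz_mid (by linarith) (by linarith), v2]
    have := pol_glue (ρ := 0) (t := 4 * j + 3 - θ) hj (by norm_num) (by linarith) (by linarith)
    push_cast at this
    rw [add_zero] at this
    rw [this]
    congr 3; ring
  · rw [tz_right (by linarith), tz_down (by linarith) (by linarith), add_zero, v0, add_comm]
    have := pol_glue (ρ := 1) (t := 4 * j + 4 - θ) hj (by norm_num) (by linarith) (by linarith)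
    push_cast at this
    have e : 4 * (j:ℝ) + 1 + 3 - θ = 4 * j + 4 - θ := by ring
    rw [e, this]
    congr 3; ring

lemma coe_Ci_surj (z : Ci) : ∃ u : ℝ, 0 ≤ u ∧ u < 1 ∧ (u : Ci) = z := by
  have h := (AddCircle.equivIco 1 0 z).2
  exact ⟨_, h.1, h.2.trans_eq (zero_add 1), (AddCircle.equivIco 1 0).symm_apply_apply z⟩

/-- the terms of the contraction of a boundary loop -/
def kt (g k j : ℕ) (z : Ci) (t : ℝ) : Multiset (MG g) :=
  {pol g 1 (4 * (j:ℝ) + (1 - t) * lpc (fun u : ℝ => tz (4 * (j:ℝ)) (4 * (k:ℝ) * u)) z)} +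
  {pol g 1 (4 * (j:ℝ) + 1 + (1 - t) * lpc (fun u : ℝ => tz (4 * (j:ℝ) + 1) (4 * (k:ℝ) * u)) z)}

lemma kt_aux {k : ℕ} (c : ℝ) (h0 : 0 ≤ c) (h3 : c + 3 ≤ 4 * k) :
    (fun u : ℝ => tz c (4 * (k:ℝ) * u)) 0 = (fun u : ℝ => tz c (4 * (k:ℝ) * u)) 1 := by
  simp only [mul_zero, mul_one]
  rw [tz_left h0, tz_right h3]

lemma kill {g k : ℕ} (hk0 : 0 < k) (hk : k < g) :
    HomC (vx g) (fun _ => 0) (fun z : Ci => {lk g k z} + {vx g}) (fun _ => {vx g} + {vx g}) := by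
  classical
  have hg : 0 < g := by omega
  have := compactMG hg
  have := t2MG hg
  have v0 : ∀ j : ℕ, pol g 1 (4 * (j:ℝ)) = vx g := fun j => by
    have := pol_int hg (4 * j); push_cast at this; exact this
  have v1 : ∀ j : ℕ, pol g 1 (4 * (j:ℝ) + 1) = vx g := fun j => by
    have := pol_int hg (4 * j + 1); push_cast at this; exact this
  have a0 : ∀ j : ℕ, j < k → (0:ℝ) ≤ 4 * (j:ℝ) ∧ 4 * (j:ℝ) + 4 ≤ 4 * k := fun j hj => by
    have : (j:ℝ) + 1 ≤ k := by exact_mod_cast hj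
    exact ⟨by positivity, by linarith⟩
  have kc : ∀ j : ℕ, j < k → ∀ u : ℝ, 0 ≤ u → u ≤ 1 → ∀ t : ℝ, kt g k j (u : Ci) t =
      {pol g 1 (4 * (j:ℝ) + (1 - t) * tz (4 * (j:ℝ)) (4 * (k:ℝ) * u))} +
      {pol g 1 (4 * (j:ℝ) + 1 + (1 - t) * tz (4 * (j:ℝ) + 1) (4 * (k:ℝ) * u))} := by
    intro j hj u u0 u1 t
    obtain ⟨h0, h1⟩ := a0 j hj
    rw [kt, lpc_coe (kt_aux _ h0 (by linarith)) u0 u1, lpc_coe (kt_aux _ (by linarith) (by linarith)) u0 u1]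
  have key : ∀ z : Ci, ∃ j < k, (∀ i < k, i ≠ j → ∀ t, kt g k i z t = {vx g} + {vx g}) ∧
      kt g k j z 0 = {lk g k z} + {vx g} := by
    intro z
    obtain ⟨u, u0, u1, rfl⟩ := coe_Ci_surj z
    have kp : (0:ℝ) < k := by exact_mod_cast hk0
    have h1 := Nat.floor_le (mul_nonneg kp.le u0)
    have h2 := Nat.lt_floor_add_one ((k:ℝ) * u)
    have hjk : ⌊(k:ℝ) * u⌋₊ < k := by
      have : (⌊(k:ℝ) * u⌋₊ : ℝ) < k := by nlinarith
      exact_mod_cast this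
    refine ⟨⌊(k:ℝ) * u⌋₊, hjk, ?_, ?_⟩
    · intro i hi hne t
      rw [kc i hi u u0 u1.le]
      have : tz (4 * (i:ℝ)) (4 * (k:ℝ) * u) = 0 ∧ tz (4 * (i:ℝ) + 1) (4 * (k:ℝ) * u) = 0 := by
        rcases lt_or_gt_of_ne hne with h | h
        · have : (i:ℝ) + 1 ≤ ⌊(k:ℝ) * u⌋₊ := by exact_mod_cast h
          exact ⟨tz_right (by linarith), tz_right (by linarith)⟩
        · have : (⌊(k:ℝ) * u⌋₊:ℝ) + 1 ≤ i := by exact_mod_cast h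
          exact ⟨tz_left (by linarith), tz_left (by linarith)⟩
      rw [this.1, this.2, mul_zero, add_zero, add_zero, v0, v1]
    · rw [kc _ hjk u u0 u1.le, sub_zero, one_mul, one_mul, bd_split (by omega) (by linarith) (by linarith),
        lk_coe hg k u0 u1.le]
  refine HomC.cancel (n := 2) (m := 2 * (k - 1)) (b := fun _ => 2 * (k - 1)) (fun _ => by simp) (fun _ => le_rfl) ?_
  have c2 : ∀ m : ℕ, m • (({vx g} : Multiset (MG g)) + {vx g}) = (2 * m) • {vx g} := by
    intro m
    rw [mul_comm, mul_smul, two_smul]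
  refine HomC.mk' (fun z t => ∑ j ∈ Finset.range k, kt g k j z t) ?_ ?_ ?_ ?_
  · intro z t _ _
    apply Continuous.continuousAt
    refine continuous_finsetSum _ fun j hj => ?_
    obtain ⟨h0, h1⟩ := a0 j (Finset.mem_range.1 hj)
    have hc : ∀ c : ℝ, Continuous fun u : ℝ => tz c (4 * (k:ℝ) * u) := fun c => by fun_prop
    have e0 := continuous_lpc (hc (4 * (j:ℝ))) (kt_aux _ h0 (by linarith))
    have e1 := continuous_lpc (hc (4 * (j:ℝ) + 1)) (kt_aux _ (by linarith) (by linarith))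
    have w0 : Continuous fun p : Ci × ℝ => ((1:ℝ), 4 * (j:ℝ) + (1 - p.2) * lpc (fun u : ℝ => tz (4 * (j:ℝ)) (4 * (k:ℝ) * u)) p.1) :=
      continuous_const.prodMk (continuous_const.add ((continuous_const.sub continuous_snd).mul (e0.comp continuous_fst)))
    have w1 : Continuous fun p : Ci × ℝ => ((1:ℝ), 4 * (j:ℝ) + 1 + (1 - p.2) * lpc (fun u : ℝ => tz (4 * (j:ℝ) + 1) (4 * (k:ℝ) * u)) p.1) :=
      continuous_const.prodMk (continuous_const.add ((continuous_const.sub continuous_snd).mul (e1.comp continuous_fst)))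
    exact (continuous_single.comp ((continuous_pol g).comp w0)).add (continuous_single.comp ((continuous_pol g).comp w1))
  · intro z
    obtain ⟨j, hj, h1, h2⟩ := key z
    rw [sum_one (Finset.mem_range.2 hj) (fun i hi hne => h1 i (Finset.mem_range.1 hi) hne 0), h2, Finset.card_range, c2]
  · intro z
    obtain ⟨j, hj, h1, h2⟩ := key z
    have : ∀ i ∈ Finset.range k, kt g k i z 1 = {vx g} + {vx g} := by
      intro i _
      rw [kt, sub_self, zero_mul, zero_mul, add_zero, add_zero, v0, v1]
    rw [Finset.sum_congr rfl this, Finset.sum_const, Finset.card_range, c2, ← two_smul ℕ ({vx g} : Multiset (MG g)), ← add_smul]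
    congr 1; omega
  · intro z t _ _
    obtain ⟨j, hj, h1, h2⟩ := key z
    rw [sum_one (Finset.mem_range.2 hj) (fun i hi hne => h1 i (Finset.mem_range.1 hi) hne t), cnt_add, Finset.card_range, c2, cnt_nsmul]
    omega

end SPcat
end

open scoped unitInterval Topology
open MeasureTheory
noncomputable section
namespace SPcat

/-- compatibility over an open subset of the surface -/
structure CompatS {Z : Type*} (g : ℕ) (S : Set (MG g)) (f : ℝ → ℝ → Z) : Prop where
  zero : ∀ θ, 0 ≤ θ → θ ≤ 4 * (g:ℝ) → f 0 θ = f 0 0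
  per : ∀ r, 0 ≤ r → r ≤ 1 → f r (4 * (g:ℝ)) = f r 0
  glue : ∀ θ θ', 0 ≤ θ → θ ≤ 4 * (g:ℝ) → 0 ≤ θ' → θ' ≤ 4 * (g:ℝ) → pol g 1 θ ∈ S → pol g 1 θ' ∈ S → f 1 θ = f 1 θ'

lemma lft_polS {Z : Type*} {g : ℕ} (hg : 0 < g) {S : Set (MG g)} {f : ℝ → ℝ → Z} (hf : CompatS g S f) {r θ : ℝ} (r0 : 0 ≤ r)
    (r1 : r ≤ 1) (θ0 : 0 ≤ θ) (θ1 : θ ≤ 4 * (g:ℝ)) (hS : pol g r θ ∈ S) : lft g f (pol g r θ) = f r θ := by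
  classical
  have hc : Compat g (fun r θ => if pol g r θ ∈ S then some (f r θ) else none) := by
    refine ⟨fun θ h0 h1 => ?_, fun r h0 h1 => ?_, fun j hj ρ hρ t h0 h1 => ?_⟩
    · simp only [pol_zero g θ 0, hf.zero θ h0 h1]
    · have : pol g r (4 * (g:ℝ)) = pol g r 0 := pol_per hg r
      simp only [this, hf.per r h0 h1]
    · have e := pol_glue hj hρ h0 h1
      have j1 : (j:ℝ) + 1 ≤ g := by exact_mod_cast hj
      have j0 : (0:ℝ) ≤ j := by positivity
      have ρ0 : (0:ℝ) ≤ ρ := by positivity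
      have ρ1 : (ρ:ℝ) ≤ 1 := by exact_mod_cast (by omega : ρ ≤ 1)
      simp only [← e]
      split_ifs with h
      · rw [hf.glue _ _ (by linarith) (by linarith) (by linarith) (by linarith) h (e ▸ h)]
      · rfl
  have h := lft_pol hg hc r0 r1 θ0 θ1
  obtain ⟨a, b, c, d, e⟩ := rp_spec hg (pol g r θ)
  simp only [lft, e, if_pos hS] at h
  exact Option.some.inj h

lemma contAt_lftS {Z : Type*} [TopologicalSpace Z] {g : ℕ} (hg : 0 < g) {S : Set (MG g)} (hS : IsOpen S) {f : ℝ → ℝ → ℝ → Z}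
    (hf : CompatS g S f) (hc : Continuous fun p : ℝ × ℝ × ℝ => f p.1 p.2.1 p.2.2) {y : MG g} (hy : y ∈ S) (t : ℝ) :
    ContinuousAt (fun p : MG g × ℝ => lft g f p.1 p.2) (y, t) := by
  refine contAt_pol hg fun r θ r0 r1 θ0 θ1 e => ⟨_, hc.continuousAt, ?_⟩
  have h1 : Continuous fun q : ℝ × ℝ × ℝ => pol g q.1 q.2.1 :=
    (continuous_pol g).comp (by fun_prop : Continuous fun q : ℝ × ℝ × ℝ => (q.1, q.2.1))
  have h2 : ∀ᶠ q in 𝓝 (r, θ, t), pol g q.1 q.2.1 ∈ S := h1.continuousAt.eventually_mem (by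
    simpa [e] using hS.mem_nhds hy)
  filter_upwards [h2] with q hq a b c d
  rw [lft_polS hg hf a b c d hq]

lemma contAt_lftS' {Z : Type*} [TopologicalSpace Z] {g : ℕ} (hg : 0 < g) {S : Set (MG g)} (hS : IsOpen S) {f : ℝ → ℝ → Z}
    (hf : CompatS g S f) (hc : Continuous fun p : ℝ × ℝ => f p.1 p.2) {y : MG g} (hy : y ∈ S) :
    ContinuousAt (lft g f) y := by
  have h := contAt_lftS (f := fun r θ (_:ℝ) => f r θ) hg hS ⟨fun θ a b => by rw [hf.zero θ a b], fun r a b => by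
    rw [hf.per r a b], fun θ θ' a b c d e e' => by rw [hf.glue θ θ' a b c d e e']⟩
    (hc.comp (by fun_prop : Continuous fun p : ℝ × ℝ × ℝ => (p.1, p.2.1))) hy 0
  exact ContinuousAt.comp (f := fun y : MG g => (y, (0:ℝ))) (x := y) h (by fun_prop)

/-- the residual set -/
def SS (g : ℕ) : Set (MG g) := {y | ∀ k < g, NN g k y < 1 / 50}

lemma isOpen_SS (g : ℕ) : IsOpen (SS g) := by
  have : SS g = ⋂ k : Fin g, {y | NN g k y < 1 / 50} := by
    ext y
    simp only [SS, Set.mem_ofPred_eq, Set.mem_iInter]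
    exact ⟨fun h k => h k k.2, fun h k hk => h ⟨k, hk⟩⟩
  rw [this]
  exact isOpen_iInter_of_finite fun k => isOpen_lt (continuous_NN k.2) continuous_const

/-- radial cut off -/
def chi (r : ℝ) : ℝ := cl (2 * r - 1 / 2)

@[fun_prop] lemma continuous_chi : Continuous chi := by unfold chi; exact continuous_cl.comp (by fun_prop)

lemma chi_zero : chi 0 = 0 := cl_of_nonpos (by norm_num)
lemma chi_one : chi 1 = 1 := cl_of_one_le (by norm_num)

lemma SS_spec {g : ℕ} {r θ : ℝ} (r0 : 0 ≤ r) (r1 : r ≤ 1) (θ0 : 0 ≤ θ) (θ1 : θ ≤ 4 * (g:ℝ)) (h : pol g r θ ∈ SS g) :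
    chi r = 0 ∨ (chi r = 1 ∧ ∃ m : ℕ, m ≤ 4 * g ∧ |θ - m| < 1 / 10) ∨ (∃ k : ℕ, k ≤ g ∧ |θ - 4 * (k:ℝ)| < 1 / 10) := by
  rcases le_or_gt r (1/4) with hr | hr
  · left; exact cl_of_nonpos (by linarith)
  right
  rcases θ1.lt_or_eq with θ1' | rfl
  swap
  · right; exact ⟨g, le_rfl, by simp⟩
  have f1 := Nat.floor_le (by positivity : 0 ≤ θ / 4)
  have f2 := Nat.lt_floor_add_one (θ / 4)
  have hk : ⌊θ / 4⌋₊ < g := by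
    have : (⌊θ / 4⌋₊ : ℝ) < g := by linarith
    exact_mod_cast this
  generalize ⌊θ / 4⌋₊ = k at f1 f2 hk
  have h0 := (Nn_le_NN (ς := 0) (by norm_num) _).trans_lt (h k hk)
  have h1 := (Nn_le_NN (ς := 1) (by norm_num) _).trans_lt (h k hk)
  rw [Nn_pol hk (by norm_num) r0 r1 θ0 θ1, psN, min_lt_iff] at h0 h1
  push_cast at h0 h1
  rw [add_zero] at h0
  have lo : ∀ x : ℝ, 0 ≤ x → r * x < 1 / 50 → x < 1 / 10 := fun x hx hx' => by nlinarith
  have hi : ∀ x : ℝ, 0 ≤ x → x ≤ 1 → 1 - r * x < 1 / 50 → 9 / 10 < x ∧ chi r = 1 := fun x hx hx1 hx' =>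
    ⟨by nlinarith, cl_of_one_le (by nlinarith)⟩
  rcases le_total θ (4 * (k:ℝ) + 1) with c1 | c1
  · rw [tz_up (by linarith) (by linarith)] at h0
    rcases h0 with h0 | h0
    · right
      have := lo _ (by linarith) h0
      exact ⟨k, hk.le, by rw [abs_lt]; constructor <;> linarith⟩
    · left
      obtain ⟨a, b⟩ := hi _ (by linarith) (by linarith) h0
      exact ⟨b, 4 * k + 1, by omega, by push_cast; rw [abs_lt]; constructor <;> linarith⟩
  rcases le_total θ (4 * (k:ℝ) + 2) with c2 | c2
  · rw [tz_mid (by linarith) (by linarith)] at h0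
    rw [tz_up (by linarith) (by linarith)] at h1
    rcases h0 with h0 | h0
    · exfalso; linarith
    · left
      refine ⟨(hi _ zero_le_one le_rfl h0).2, ?_⟩
      rcases h1 with h1 | h1
      · have := lo _ (by linarith) h1
        exact ⟨4 * k + 1, by omega, by push_cast; rw [abs_lt]; constructor <;> linarith⟩
      · obtain ⟨a, b⟩ := hi _ (by linarith) (by linarith) h1
        exact ⟨4 * k + 2, by omega, by push_cast; rw [abs_lt]; constructor <;> linarith⟩
  rcases le_total θ (4 * (k:ℝ) + 3) with c3 | c3
  · rw [tz_down (by linarith) (by linarith)] at h0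
    rw [tz_mid (by linarith) (by linarith)] at h1
    rcases h1 with h1 | h1
    · exfalso; linarith
    · left
      refine ⟨(hi _ zero_le_one le_rfl h1).2, ?_⟩
      rcases h0 with h0 | h0
      · have := lo _ (by linarith) h0
        exact ⟨4 * k + 3, by omega, by push_cast; rw [abs_lt]; constructor <;> linarith⟩
      · obtain ⟨a, b⟩ := hi _ (by linarith) (by linarith) h0
        exact ⟨4 * k + 2, by omega, by push_cast; rw [abs_lt]; constructor <;> linarith⟩
  · rw [tz_down (by linarith) (by linarith)] at h1
    rcases h1 with h1 | h1
    · right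
      have := lo _ (by linarith) h1
      exact ⟨k + 1, hk, by push_cast; rw [abs_lt]; constructor <;> linarith⟩
    · left
      obtain ⟨a, b⟩ := hi _ (by linarith) (by linarith) h1
      exact ⟨b, 4 * k + 3, by omega, by push_cast; rw [abs_lt]; constructor <;> linarith⟩

lemma SS_int {g : ℕ} {θ : ℝ} (θ0 : 0 ≤ θ) (θ1 : θ ≤ 4 * (g:ℝ)) (h : pol g 1 θ ∈ SS g) :
    ∃ m : ℕ, |θ - m| < 1 / 10 := by
  rcases SS_spec zero_le_one le_rfl θ0 θ1 h with h | ⟨_, m, _, h⟩ | ⟨k, _, h⟩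
  · rw [chi_one] at h; norm_num at h
  · exact ⟨m, h⟩
  · exact ⟨4 * k, by push_cast; exact h⟩

/-- bumps around the points 4k -/
def bk (k : ℕ) (θ : ℝ) : ℝ := cl (2 * (7 / 4 - |θ - 4 * (k:ℝ)|))

@[fun_prop] lemma continuous_bk (k : ℕ) : Continuous (bk k) := by unfold bk; exact continuous_cl.comp (by fun_prop)

lemma bk_nonneg (k : ℕ) (θ : ℝ) : 0 ≤ bk k θ := cl_nonneg _
lemma bk_le_one (k : ℕ) (θ : ℝ) : bk k θ ≤ 1 := cl_le_one _

lemma bk_far {k : ℕ} {θ : ℝ} (h : 7 / 4 ≤ |θ - 4 * (k:ℝ)|) : bk k θ = 0 := cl_of_nonpos (by linarith)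
lemma bk_near {k : ℕ} {θ : ℝ} (h : |θ - 4 * (k:ℝ)| ≤ 5 / 4) : bk k θ = 1 := cl_of_one_le (by linarith)

lemma bk_disj {k l : ℕ} (h : k ≠ l) {θ : ℝ} (hk : bk k θ ≠ 0) : bk l θ = 0 := by
  by_contra hl
  have h1 : |θ - 4 * (k:ℝ)| < 7 / 4 := by by_contra h; exact hk (bk_far (by linarith))
  have h2 : |θ - 4 * (l:ℝ)| < 7 / 4 := by by_contra h; exact hl (bk_far (by linarith))
  rw [abs_lt] at h1 h2
  rcases lt_or_gt_of_ne h with h | h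
  · have : (k:ℝ) + 1 ≤ l := by exact_mod_cast h
    linarith
  · have : (l:ℝ) + 1 ≤ k := by exact_mod_cast h
    linarith

lemma bk_int (k : ℕ) {θ : ℝ} {m : ℕ} (h : |θ - m| < 1 / 10) : bk k θ = 0 ∨ bk k θ = 1 := by
  rw [abs_lt] at h
  have h3 : |(m:ℤ) - 4 * k| ≤ 1 ∨ 2 ≤ |(m:ℤ) - 4 * k| := by omega
  rcases h3 with h3 | h3
  · right
    have h4 : |(m:ℝ) - 4 * k| ≤ 1 := by exact_mod_cast h3
    rw [abs_le] at h4
    apply bk_near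
    rw [abs_le]; constructor <;> linarith
  · left
    have h4 : 2 ≤ |(m:ℝ) - 4 * k| := by exact_mod_cast h3
    apply bk_far
    rw [le_abs] at h4 ⊢
    rcases h4 with h4 | h4
    · left; linarith
    · right; linarith

lemma bk_zero {k : ℕ} (hk : 0 < k) : bk k 0 = 0 := by
  have : (1:ℝ) ≤ k := by exact_mod_cast hk
  apply bk_far
  rw [le_abs]; right; linarith

lemma bk_end {g k : ℕ} (hk : k < g) : bk k (4 * (g:ℝ)) = 0 := by
  have : (k:ℝ) + 1 ≤ g := by exact_mod_cast hk
  apply bk_far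
  rw [le_abs]; left; linarith

/-- locally constant angle -/
def KK (g : ℕ) (θ : ℝ) : ℝ := ∑ k ∈ Finset.Ico 1 g, 4 * (k:ℝ) * bk k θ

@[fun_prop] lemma continuous_KK (g : ℕ) : Continuous (KK g) := by
  unfold KK
  exact continuous_finsetSum _ fun k _ => by fun_prop

lemma KK_zero (g : ℕ) : KK g 0 = 0 := by
  refine Finset.sum_eq_zero fun k hk => ?_
  rw [bk_zero (by simp at hk; omega), mul_zero]

lemma KK_end (g : ℕ) : KK g (4 * (g:ℝ)) = 0 := by
  refine Finset.sum_eq_zero fun k hk => ?_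
  rw [bk_end (by simp at hk; omega), mul_zero]

lemma KK_int (g : ℕ) {θ : ℝ} {m : ℕ} (h : |θ - m| < 1 / 10) : ∃ a : ℕ, KK g θ = a := by
  have : ∀ k : ℕ, ∃ a : ℕ, 4 * (k:ℝ) * bk k θ = a := by
    intro k
    rcases bk_int k h with h | h
    · exact ⟨0, by simp [h]⟩
    · exact ⟨4 * k, by simp [h]⟩
  choose a ha using this
  exact ⟨∑ k ∈ Finset.Ico 1 g, a k, by rw [KK, Finset.sum_congr rfl fun k _ => ha k]; push_cast; rfl⟩

/-- either all bumps vanish, or exactly one does not -/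
lemma bk_cases (g : ℕ) (θ : ℝ) : (∀ k ∈ Finset.Ico 1 g, bk k θ = 0) ∨
    ∃ j ∈ Finset.Ico 1 g, ∀ i ∈ Finset.Ico 1 g, i ≠ j → bk i θ = 0 := by
  by_cases h : ∀ k ∈ Finset.Ico 1 g, bk k θ = 0
  · exact Or.inl h
  · push Not at h
    obtain ⟨j, hj, hj'⟩ := h
    exact Or.inr ⟨j, hj, fun i _ hne => bk_disj hne.symm hj'⟩

lemma KK_one {g j : ℕ} {θ : ℝ} (hj : j ∈ Finset.Ico 1 g) (h : ∀ i ∈ Finset.Ico 1 g, i ≠ j → bk i θ = 0) :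
    KK g θ = 4 * (j:ℝ) * bk j θ := by
  classical
  rw [KK, sum_one (w := 0) hj (fun i hi hne => by rw [h i hi hne, mul_zero])]
  simp

end SPcat
end

open scoped unitInterval Topology
open MeasureTheory
noncomputable section
namespace SPcat

lemma cl_one_sub (x : ℝ) : cl (1 - x) = 1 - cl x := by
  rcases le_total x 0 with h | h
  · rw [cl_of_nonpos h, cl_of_one_le (by linarith), sub_zero]
  rcases le_total 1 x with h1 | h1
  · rw [cl_of_one_le h1, cl_of_nonpos (by linarith), sub_self]
  · rw [cl_of_mem h h1, cl_of_mem (by linarith) (by linarith)]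

/-- a staircase -/
def xi (g : ℕ) (θ : ℝ) : ℝ := ∑ i ∈ Finset.range (4 * g), cl ((θ - i - 1 / 10) / (8 / 10))

lemma continuous_xi (g : ℕ) : Continuous (xi g) := by
  unfold xi
  exact continuous_finsetSum _ fun i _ => by fun_prop

lemma xi_stair {g N : ℕ} (hN : N < 4 * g) {s : ℝ} (s0 : 0 ≤ s) (s1 : s ≤ 1) :
    xi g (N + s) = N + cl ((s - 1 / 10) / (8 / 10)) := by
  rw [xi, ← Finset.sum_subset (Finset.range_mono (show N + 1 ≤ 4 * g by omega)), Finset.sum_range_succ]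
  · congr 1
    · rw [Finset.sum_congr rfl (g := fun _ => (1:ℝ))]
      · simp
      · intro i hi
        have : (i:ℝ) + 1 ≤ N := by exact_mod_cast (Finset.mem_range.1 hi)
        apply cl_of_one_le
        rw [le_div_iff₀ (by norm_num)]
        linarith
    · congr 2; ring
  · intro i _ hi
    have : (N:ℝ) + 1 ≤ i := by
      simp only [Finset.mem_range, not_lt] at hi
      exact_mod_cast hi
    apply cl_of_nonpos
    apply div_nonpos_of_nonpos_of_nonneg _ (by norm_num)
    linarith

lemma xi_near {g m : ℕ} (hm : m ≤ 4 * g) {θ : ℝ} (h : |θ - m| < 1 / 10) : xi g θ = m := by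
  rw [abs_lt] at h
  rw [xi, ← Finset.sum_subset (Finset.range_mono hm)]
  · rw [Finset.sum_congr rfl (g := fun _ => (1:ℝ))]
    · simp
    · intro i hi
      have : (i:ℝ) + 1 ≤ m := by exact_mod_cast (Finset.mem_range.1 hi)
      apply cl_of_one_le
      rw [le_div_iff₀ (by norm_num)]
      linarith
  · intro i _ hi
    have : (m:ℝ) ≤ i := by
      simp only [Finset.mem_range, not_lt] at hi
      exact_mod_cast hi
    apply cl_of_nonpos
    apply div_nonpos_of_nonpos_of_nonneg _ (by norm_num)
    linarith

/-- first homotopy -/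
def f1 (g : ℕ) (r θ t : ℝ) : MG g := pol g ((1 - cl t) * r + cl t * chi r) ((1 - cl t) * θ + cl t * xi g θ)

lemma compat_f1 {g : ℕ} (hg : 0 < g) : Compat g (f1 g) := by
  refine ⟨fun θ h0 h1 => ?_, fun r h0 h1 => ?_, fun j hj ρ hρ s h0 h1 => ?_⟩
  · funext t
    rw [f1, f1, chi_zero, mul_zero, mul_zero, add_zero]
    exact pol_zero _ _ _
  · funext t
    have e1 : xi g (4 * (g:ℝ)) = 4 * g := by
      have := xi_near (g := g) (m := 4 * g) (θ := 4 * (g:ℝ)) le_rfl (by push_cast; simp)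
      rw [this]; push_cast; rfl
    have e0 : xi g 0 = 0 := by
      have := xi_near (g := g) (m := 0) (θ := 0) (by omega) (by push_cast; simp)
      rw [this]; push_cast; rfl
    rw [f1, f1, e1, e0, mul_zero, mul_zero, add_zero, ← pol_per hg]
    congr 1; ring
  · funext t
    have a0 := cl_nonneg t
    have a1 := cl_le_one t
    have ec : cl ((1 - s - 1 / 10) / (8 / 10)) = 1 - cl ((s - 1 / 10) / (8 / 10)) := by
      rw [← cl_one_sub]; congr 1; ring
    have c0 := cl_nonneg ((s - 1 / 10) / (8 / 10))
    have c1 := cl_le_one ((s - 1 / 10) / (8 / 10))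
    have e1 := xi_stair (g := g) (N := 4 * j + ρ) (by omega) h0 h1
    have e2 := xi_stair (g := g) (N := 4 * j + ρ + 2) (s := 1 - s) (by omega) (by linarith) (by linarith)
    rw [ec] at e2
    push_cast at e1 e2
    have q2 : 4 * (j:ℝ) + ρ + 3 - s = 4 * (j:ℝ) + ρ + 2 + (1 - s) := by ring
    rw [f1, f1, e1, q2, e2, chi_one, mul_one, mul_one, sub_add_cancel]
    have := pol_glue (t := (1 - cl t) * s + cl t * cl ((s - 1 / 10) / (8 / 10))) hj hρ (by nlinarith) (by nlinarith)
    convert this using 2 <;> ring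

lemma continuous_f1 (g : ℕ) : Continuous fun p : (ℝ × ℝ) × ℝ => f1 g p.1.1 p.1.2 p.2 := by
  unfold f1
  have h := continuous_xi g
  exact (continuous_pol g).comp (by fun_prop : Continuous fun p : (ℝ × ℝ) × ℝ =>
    ((1 - cl p.2) * p.1.1 + cl p.2 * chi p.1.1, (1 - cl p.2) * p.1.2 + cl p.2 * xi g p.1.2))

/-- second homotopy -/
def f2 (g : ℕ) (r θ t : ℝ) : MG g :=
  Quot.mk _ (lin (polD (4 * g) (chi r) (KK g θ)) (polD (4 * g) 1 (chi r * KK g θ)) t)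

lemma lin_self (z : Disc) (t : ℝ) : lin z z t = z := by
  apply Subtype.ext
  simp only [lin]
  push_cast
  ring

lemma compat_f2 {g : ℕ} (hg : 0 < g) : CompatS g (SS g) (f2 g) := by
  refine ⟨fun θ h0 h1 => ?_, fun r h0 h1 => ?_, fun θ θ' a b c d h h' => ?_⟩
  · funext t
    rw [f2, f2, chi_zero, zero_mul, zero_mul, polD_zero _ _ (KK g 0)]
  · funext t
    rw [f2, f2, KK_end, KK_zero]
  · have key : ∀ θ, 0 ≤ θ → θ ≤ 4 * (g:ℝ) → pol g 1 θ ∈ SS g → f2 g 1 θ = fun _ => vx g := by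
      intro θ a b h
      obtain ⟨m, hm⟩ := SS_int a b h
      obtain ⟨l, hl⟩ := KK_int g hm
      funext t
      rw [f2, chi_one, one_mul, lin_self, hl]
      exact pol_int hg l
    rw [key θ a b h, key θ' c d h']

lemma continuous_f2 (g : ℕ) : Continuous fun p : ℝ × ℝ × ℝ => f2 g p.1 p.2.1 p.2.2 := by
  unfold f2
  have h1 : Continuous fun p : ℝ × ℝ × ℝ => polD (4 * g) (chi p.1) (KK g p.2.1) :=
    (continuous_polD (4 * g)).comp (by fun_prop : Continuous fun p : ℝ × ℝ × ℝ => (chi p.1, KK g p.2.1))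
  have h2 : Continuous fun p : ℝ × ℝ × ℝ => polD (4 * g) 1 (chi p.1 * KK g p.2.1) :=
    (continuous_polD (4 * g)).comp (by fun_prop : Continuous fun p : ℝ × ℝ × ℝ => ((1:ℝ), chi p.1 * KK g p.2.1))
  exact continuous_quot_mk.comp (continuous_lin.comp (h1.prodMk (h2.prodMk (by fun_prop))))

/-- the projection to the boundary loops -/
def TT (g : ℕ) (y : MG g) : MG g := lft g (f2 g) y 1

lemma TT_eq (g : ℕ) (y : MG g) : TT g y = pol g 1 (chi (rp g y).1 * KK g (rp g y).2) := by
  rw [TT, lft, f2, lin_one]; rfl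

lemma f12 {g : ℕ} (hg : 0 < g) {y : MG g} (hy : y ∈ SS g) : lft g (f1 g) y 1 = lft g (f2 g) y 0 := by
  obtain ⟨a, b, c, d, e⟩ := rp_spec hg y
  rw [lft, lft, f1, f2, lin_zero]
  change _ = pol g _ _
  simp only [cl_one, sub_self, zero_mul, one_mul, zero_add]
  rw [← e] at hy
  generalize (rp g y).1 = r at *
  generalize (rp g y).2 = θ at *
  rcases SS_spec a b c d hy with h | ⟨h, m, hm, hθ⟩ | ⟨k, hk, hθ⟩
  · rw [h]; exact pol_zero _ _ _
  · obtain ⟨l, hl⟩ := KK_int g hθ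
    rw [h, xi_near hm hθ, hl]
    exact (pol_int hg m).trans (pol_int hg l).symm
  · have e1 : xi g θ = 4 * (k:ℝ) := by
      rw [xi_near (m := 4 * k) (by omega) (by push_cast; exact hθ)]; push_cast; rfl
    have hb : bk k θ = 1 := bk_near (by linarith)
    have hb' : ∀ i, i ≠ k → bk i θ = 0 := fun i hi => bk_disj hi.symm (by rw [hb]; exact one_ne_zero)
    by_cases hk' : k ∈ Finset.Ico 1 g
    · rw [KK_one hk' (fun i _ hi => hb' i hi), hb, mul_one, e1]
    · have : KK g θ = 0 := by
        refine Finset.sum_eq_zero fun i hi => ?_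
        rw [hb' i (fun h => hk' (h ▸ hi)), mul_zero]
      rw [this, e1]
      have hk2 : k = 0 ∨ k = g := by simp only [Finset.mem_Ico] at hk'; omega
      rcases hk2 with rfl | rfl
      · simp
      · exact pol_per hg _

/-- angular coordinates of the boundary loops -/
def CC (g k : ℕ) (y : MG g) : Ci := lft g (fun r θ => ((chi r * bk k θ : ℝ) : Ci)) y

lemma contAt_CC {g k : ℕ} (hk0 : 0 < k) (hk : k < g) {y : MG g} (hy : y ∈ SS g) : ContinuousAt (CC g k) y := by
  refine contAt_lftS' (by omega) (isOpen_SS g) ⟨fun θ h0 h1 => ?_, fun r h0 h1 => ?_, fun θ θ' a b c d h h' => ?_⟩ ?_ hy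
  · rw [chi_zero, zero_mul, zero_mul]
  · rw [bk_zero hk0, bk_end hk]
  · have key : ∀ θ, 0 ≤ θ → θ ≤ 4 * (g:ℝ) → pol g 1 θ ∈ SS g → ((chi 1 * bk k θ : ℝ) : Ci) = 0 := by
      intro θ a b h
      obtain ⟨m, hm⟩ := SS_int a b h
      rw [chi_one, one_mul]
      rcases bk_int k hm with h | h
      · rw [h]; simp
      · rw [h]; exact coe_one_Ci
    rw [key θ a b h, key θ' c d h']
  · exact (AddCircle.continuous_mk' 1).comp (by fun_prop : Continuous fun p : ℝ × ℝ => chi p.1 * bk k p.2)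

lemma TT_split {g : ℕ} (hg : 0 < g) (y : MG g) : ({TT g y} : Multiset (MG g)) + (g - 1) • {vx g} =
    {vx g} + ∑ k ∈ Finset.Ico 1 g, {lk g k (CC g k y)} := by
  classical
  have z : ∀ k, bk k (rp g y).2 = 0 → lk g k (CC g k y) = vx g := by
    intro k h
    rw [CC, lft, h, mul_zero, AddCircle.coe_zero, lk_zero hg]
  rcases bk_cases g (rp g y).2 with h | ⟨j, hj, h⟩
  · have : KK g (rp g y).2 = 0 := Finset.sum_eq_zero fun k hk => by rw [h k hk, mul_zero]
    rw [TT_eq, this, mul_zero, Finset.sum_congr rfl (fun k hk => by rw [z k (h k hk)]), Finset.sum_const, Nat.card_Ico]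
    rfl
  · have e : TT g y = lk g j (CC g j y) := by
      have c0 : 0 ≤ chi (rp g y).1 := cl_nonneg _
      have c1 : chi (rp g y).1 ≤ 1 := cl_le_one _
      have b0 := bk_nonneg j (rp g y).2
      have b1 := bk_le_one j (rp g y).2
      rw [TT_eq, KK_one hj h, CC, lft, lk_coe hg j (by positivity) (by nlinarith)]
      congr 1; ring
    rw [sum_one hj (fun i hi hne => by rw [z i (h i hi hne)]), e, Nat.card_Ico]
    have : g - 1 = (g - 1 - 1) + 1 := by simp at hj; omega
    rw [this, add_smul, one_smul]
    simp only [Nat.add_sub_cancel]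
    abel

lemma cnt_CC {g : ℕ} (D : Multiset (MG g)) : Multiset.card D * (g - 1) ≤
    Multiset.card D + ∑ k ∈ Finset.Ico 1 g, cnt {0} (D.map (CC g k)) := by
  classical
  induction D using Multiset.induction_on with
  | empty => simp
  | cons y D ih =>
    have e : ∀ k, cnt {0} ((y ::ₘ D).map (CC g k)) = cnt {0} ({CC g k y} : Multiset Ci) + cnt {0} (D.map (CC g k)) := by
      intro k
      rw [Multiset.map_cons, ← Multiset.singleton_add, cnt_add]
    simp only [e, Finset.sum_add_distrib, Multiset.card_cons]
    have z : ∀ k, bk k (rp g y).2 = 0 → cnt {0} ({CC g k y} : Multiset Ci) = 1 := by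
      intro k h
      rw [CC, lft, h, mul_zero, AddCircle.coe_zero]
      have := cnt_nsmul (0 : Ci) 1
      rwa [one_smul] at this
    have : g - 1 ≤ 1 + ∑ k ∈ Finset.Ico 1 g, cnt {0} ({CC g k y} : Multiset Ci) := by
      rcases bk_cases g (rp g y).2 with h | ⟨j, hj, h⟩
      · rw [Finset.sum_congr rfl (fun k hk => z k (h k hk)), Finset.sum_const, Nat.card_Ico]
        simp
      · rw [sum_one hj (fun i hi hne => z i (h i hi hne)), Nat.card_Ico, smul_eq_mul, mul_one]
        omega
    nlinarith

end SPcat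
end

open scoped unitInterval Topology
open MeasureTheory
noncomputable section
namespace SPcat

lemma kill_all {X : Type*} [TopologicalSpace X] {g : ℕ} (z : ℕ → X → Ci) (s : Finset ℕ)
    (hs : ∀ k ∈ s, 0 < k ∧ k < g) (hz : ∀ k ∈ s, Continuous (z k)) (c : ℕ) :
    HomC (vx g) (fun _ => 0) (fun x => ∑ k ∈ s, {lk g k (z k x)} + (c + 1) • {vx g})
      (fun _ => s.card • {vx g} + (c + 1) • {vx g}) := by
  classical
  induction s using Finset.induction_on with
  | empty => exact (HomC.refl (f := fun _ => (c + 1) • ({vx g} : Multiset (MG g))) continuous_const fun _ => Nat.zero_le _).congr (fun _ => by simp) (fun _ => by simp)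
  | insert i s hi ih =>
    obtain ⟨i0, ig⟩ := hs i (by simp)
    have cs : Continuous fun x => (∑ k ∈ s, {lk g k (z k x)} + c • {vx g} : Multiset (MG g)) := by
      refine (continuous_finsetSum _ fun k hk => ?_).add continuous_const
      exact continuous_single.comp ((continuous_lk (by omega) k).comp (hz k (by simp [hk])))
    have h1 := (((kill i0 ig).comp (hz i (by simp))).add_const cs).mono (b' := fun _ => 0) fun _ => Nat.zero_le _
    have h2 := ((ih (fun k hk => hs k (by simp [hk])) (fun k hk => hz k (by simp [hk]))).add_const
      (E := fun _ => {vx g}) continuous_const).mono (b' := fun _ => 0) fun _ => Nat.zero_le _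
    refine (h1.congr (fun x => ?_) (fun x => ?_)).trans (h2.congr (fun x => ?_) (fun x => ?_)) (f1 := fun x =>
      ∑ k ∈ s, {lk g k (z k x)} + (c + 1) • {vx g} + {vx g})
    · rw [Finset.sum_insert hi, add_smul, one_smul]; abel
    · rw [add_smul, one_smul]; abel
    · rfl
    · rw [Finset.card_insert_of_notMem hi, add_smul s.card, one_smul]; abel

lemma split_all {g : ℕ} (hg : 0 < g) (D : Multiset (MG g)) :
    D.map (TT g) + (Multiset.card D * (g - 1)) • {vx g} =
      Multiset.card D • {vx g} + ∑ k ∈ Finset.Ico 1 g, (D.map (CC g k)).map (lk g k) := by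
  induction D using Multiset.induction_on with
  | empty => simp
  | cons y D ih =>
    have h := TT_split hg y
    have e : ∀ k, ((y ::ₘ D).map (CC g k)).map (lk g k) = {lk g k (CC g k y)} + (D.map (CC g k)).map (lk g k) := by
      intro k
      rw [Multiset.map_cons, Multiset.map_cons, Multiset.singleton_add]
    simp only [e, Finset.sum_add_distrib]
    rw [Multiset.card_cons, Multiset.map_cons]
    rw [← Multiset.singleton_add, add_mul, one_mul, add_smul, add_smul, one_smul]
    calc _ = ({TT g y} + (g - 1) • {vx g}) + (D.map (TT g) + (Multiset.card D * (g - 1)) • {vx g}) := by abel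
      _ = _ := by rw [h, ih]; abel

theorem stage2 {g n : ℕ} (hg : 0 < g) (hn : g < n) (X : Type) [TopologicalSpace X] (q : X → Multiset (MG g))
    (hq : Continuous q) (hc : ∀ x, Multiset.card (q x) = n) (hS : ∀ x, ∀ y ∈ q x, ∀ k < g, NN g k y < 1 / 50) :
    HomC (vx g) (fun _ => 0) q (fun _ => n • {vx g}) := by
  have := compactMG hg
  have := t2MG hg
  have s1 : HomC (vx g) (fun _ => 0) q (fun x => (q x).map (TT g)) := by
    have a1 := HomC.pointwise (h := fun p : MG g × ℝ => lft g (SPcat.f1 g) p.1 p.2) (w := vx g) hq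
      (fun _ _ _ _ _ _ => (continuous_lft2 hg (compat_f1 hg) (continuous_f1 g)).continuousAt)
    have a2 := HomC.pointwise (h := fun p : MG g × ℝ => lft g (SPcat.f2 g) p.1 p.2) (w := vx g) hq
      (fun x y hy t _ _ => contAt_lftS hg (isOpen_SS g) (compat_f2 hg) (continuous_f2 g) (hS x y hy) t)
    refine (a1.congr (fun x => ?_) (fun x => ?_)).trans a2
    · rw [Multiset.map_congr rfl (g := id)]
      · simp
      · intro y _
        obtain ⟨_, _, _, _, e⟩ := rp_spec hg y
        simp only [lft, SPcat.f1, cl_zero, sub_zero, one_mul, zero_mul, add_zero, id]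
        exact e
    · exact Multiset.map_congr rfl fun y hy => f12 hg (hS x y hy)
  have cC : ∀ k ∈ Finset.Ico 1 g, Continuous fun x => (q x).map (CC g k) := by
    intro k hk
    obtain ⟨k0, k1⟩ := Finset.mem_Ico.1 hk
    rw [continuous_iff_continuousAt]
    intro x
    exact ContinuousAt.mmap (T := Unit) (e := fun p => CC g k p.1) (s := fun _ => ()) hq.continuousAt
      continuousAt_const fun y hy => ContinuousAt.comp (g := CC g k) (contAt_CC k0 k1 (hS x y hy)) continuousAt_fst
  have cZ : ∀ k ∈ Finset.Ico 1 g, Continuous fun x => ((q x).map (CC g k)).sum := by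
    intro k hk
    have := continuous_msum (e := fun z : Ci => z) continuous_id (cC k hk)
    simpa using this
  have s2 : HomC (vx g) (fun _ => 0) (fun x => (q x).map (TT g))
      (fun x => ∑ k ∈ Finset.Ico 1 g, {lk g k ((q x).map (CC g k)).sum} + (n - g + 1) • {vx g}) := by
    have loops : ∀ k ∈ Finset.Ico 1 g, HomC (vx g) (fun x => cnt {0} ((q x).map (CC g k)))
        (fun x => ((q x).map (CC g k)).map (lk g k))
        (fun x => {lk g k ((q x).map (CC g k)).sum} + (n - 1) • {vx g}) := by
      intro k hk
      have cB : Continuous fun x => (⟨(q x).map (CC g k), by rw [Multiset.card_map, hc]; omega⟩ :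
          {D : Multiset Ci // Multiset.card D = n - 1 + 1}) := Continuous.subtype_mk (cC k hk) _
      have h := ((circleHom (n - 1)).comp cB).map (continuous_lk hg k)
      rw [lk_zero hg] at h
      refine h.congr (fun x => rfl) (fun x => ?_)
      rw [Multiset.map_add, Multiset.map_singleton, Multiset.map_nsmul, Multiset.map_singleton, lk_zero hg]
    have h := (HomC.sum _ loops).add_const (E := fun _ => n • {vx g}) continuous_const
    refine HomC.cancel (n := n) (m := n * (g - 1)) (fun x => by rw [Multiset.card_map, hc]) (fun x => ?_)
      (h.congr (fun x => ?_) (fun x => ?_))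
    · have := cnt_CC (q x)
      rw [hc] at this
      rw [cnt_nsmul]
      omega
    · have := split_all hg (q x)
      rw [hc] at this
      rw [this, add_comm]
    · rw [Finset.sum_add_distrib, Finset.sum_const, Nat.card_Ico, add_assoc, add_assoc, ← mul_smul, ← add_smul, ← add_smul]
      congr 2
      obtain ⟨m, rfl⟩ : ∃ m, g = m + 1 := ⟨g - 1, by omega⟩
      obtain ⟨p, rfl⟩ : ∃ p, n = p + (m + 1) + 1 := ⟨n - (m + 1) - 1, by omega⟩
      have e1 : p + (m + 1) + 1 - (m + 1) + 1 = p + 2 := by omega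
      rw [e1]
      simp only [Nat.add_sub_cancel]
      ring
  have s3 := kill_all (fun k x => ((q x).map (CC g k)).sum) (Finset.Ico 1 g)
    (fun k hk => ⟨(Finset.mem_Ico.1 hk).1, (Finset.mem_Ico.1 hk).2⟩) cZ (n - g)
  refine (s1.trans (s2.trans s3)).congr (fun _ => rfl) (fun x => ?_)
  rw [Nat.card_Ico, ← add_smul]
  congr 1; omega

theorem upper_ng {g n : ℕ} (hg : 0 < g) (hn : g < n) : catLE (SP n (MG g)) (n + g) :=
  cover_of_stage2 fun X _ q hq hc hS => stage2 hg hn X q hq hc hS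

theorem LScat_eq {X : Type} [TopologicalSpace X] {r : ℕ} (h : catLE X r) (h' : ∀ s, catLE X s → r ≤ s) :
    LScat X = (r : ℕ∞) := by
  apply le_antisymm
  · exact sInf_le ⟨r, h, rfl⟩
  · refine le_sInf ?_
    rintro c ⟨s, hs, rfl⟩
    exact_mod_cast h' s hs

end SPcat

end

/-- For `n ≥ 1` and `g ≥ 0`, `cat(SPⁿ(M_g)) = 2n` if `n ≤ g`, and `n + g` if `n > g`. -/
theorem LScat_SP_orientableSurface (n g : ℕ) (hn : 1 ≤ n) :
    LScat (SP n (Mg g)) = (if n ≤ g then ((2 * n : ℕ) : ℕ∞) else ((n + g : ℕ) : ℕ∞)) := by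
  cases g with
  | zero =>
    rw [if_neg (by omega)]
    exact SPcat.LScat_eq (X := SP n SPcat.S2) SPcat.upper_S2 fun s hs => SPcat.lower_S2 hn hs
  | succ g =>
    split_ifs with h
    · refine SPcat.LScat_eq (X := SP n (SPcat.MG (g + 1))) ?_ fun s hs => ?_
      · rw [mul_comm]; exact SPcat.upper_2n (by omega)
      · have := SPcat.lower_MG hn (by omega) hs
        omega
    · refine SPcat.LScat_eq (X := SP n (SPcat.MG (g + 1))) (SPcat.upper_ng (by omega) (by omega)) fun s hs => ?_
      have := SPcat.lower_MG hn (by omega) hs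
      omega

end
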